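/- Let k > 2 be a fixed real number and q a large integer. Assume that every Dirichlet L-function L(s,χ) attached to a Dirichlet character χ mod q satisfies the Riemann Hypothesis. Then there is a constant C depending only on k such that for all real y with q^{1/2} < y ≤ q, one has S_k(q,y) := ∑_{χ ∈ X_q^*} |∑_{n ≤ y} χ(n)|^{2k} ≤ C · φ(q) · y^k · (log(2q/y))^{(k−1)²}. -/

import Mathlib

open Complex Real Finset

def dirichletRH {q : ℕ} [NeZero q] (χ : DirichletCharacter ℂ q) : Prop :=
  ∀ s : ℂ, 0 < s.re → s.re < 1 → DirichletCharacter.LFunction χ s = 0 → s.re = 1 / 2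

namespace Szabo
open MeasureTheory Filter Topology Set
set_option linter.unusedSectionVars false
set_option linter.unusedSimpArgs false
set_option linter.unusedVariables false

section charsum
variable {q : ℕ} [NeZero q]

lemma sum_range_q (χ : DirichletCharacter ℂ q) (h1 : χ ≠ 1) :
    ∑ n ∈ Finset.range q, χ (n : ZMod q) = 0 := by
  rw [← MulChar.sum_eq_zero_of_ne_one h1]
  obtain ⟨k, rfl⟩ : ∃ k, q = k + 1 := ⟨q - 1, by have := NeZero.pos q; omega⟩
  rw [Finset.sum_range]
  refine Fintype.sum_congr (α := Fin (k+1)) _ _ (fun a => ?_)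
  congr 1
  exact Fin.cast_val_eq_self a

lemma norm_sum_range_le (χ : DirichletCharacter ℂ q) (h1 : χ ≠ 1) (N : ℕ) :
    ‖∑ n ∈ Finset.range N, χ (n : ZMod q)‖ ≤ q := by
  induction N using Nat.strong_induction_on with
  | _ N ih =>
    rcases lt_or_ge N q with h | h
    · calc _ ≤ ∑ n ∈ Finset.range N, ‖χ (n : ZMod q)‖ := norm_sum_le _ _
        _ ≤ ∑ n ∈ Finset.range N, (1:ℝ) := sum_le_sum fun n _ => χ.norm_le_one _
        _ ≤ q := by simp; exact_mod_cast h.le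
    · obtain ⟨M, rfl⟩ := Nat.exists_eq_add_of_le h
      rw [Finset.sum_range_add, sum_range_q χ h1, zero_add]
      have := ih M (by have := NeZero.pos q; omega)
      simpa using this

lemma char_zero (χ : DirichletCharacter ℂ q) (h1 : χ ≠ 1) : χ ((0 : ℕ) : ZMod q) = 0 := by
  have hq : q ≠ 1 := by
    rintro rfl
    exact h1 (Subsingleton.elim _ _)
  have : Nontrivial (ZMod q) := by
    have : Fact (1 < q) := ⟨by have := NeZero.pos q; omega⟩
    infer_instance
  simp [MulChar.map_zero]

lemma norm_sum_Icc_le (χ : DirichletCharacter ℂ q) (h1 : χ ≠ 1) (N : ℕ) :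
    ‖∑ n ∈ Finset.Icc 1 N, χ (n : ZMod q)‖ ≤ q := by
  have := norm_sum_range_le χ h1 (N+1)
  rw [Finset.range_eq_Ico, Finset.sum_eq_sum_Ico_succ_bot (by omega), char_zero χ h1, zero_add] at this
  exact this

/-- the smoothed character sum -/
noncomputable def Mfun (χ : DirichletCharacter ℂ q) (u : ℝ) : ℂ :=
  ∑ n ∈ Finset.Icc 1 ⌊u⌋₊, χ (n : ZMod q) * ((u - n : ℝ) : ℂ)

lemma abel_aux (χ : DirichletCharacter ℂ q) (u : ℝ) (N : ℕ) :
    ∑ n ∈ Finset.Icc 1 N, χ (n : ZMod q) * ((u - n : ℝ) : ℂ)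
      = ∑ j ∈ Finset.range N, ∑ n ∈ Finset.Icc 1 j, χ (n : ZMod q)
        + (∑ n ∈ Finset.Icc 1 N, χ (n : ZMod q)) * ((u - N : ℝ) : ℂ) := by
  induction N with
  | zero => simp
  | succ N ih =>
    rw [Finset.sum_Icc_succ_top (by omega), ih, sum_range_succ,
      Finset.sum_Icc_succ_top (by omega)]
    push_cast
    ring

lemma norm_Mfun_le (χ : DirichletCharacter ℂ q) (h1 : χ ≠ 1) (u : ℝ) (hu : 0 ≤ u) :
    ‖Mfun χ u‖ ≤ q * u := by
  rw [Mfun, abel_aux]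
  have h2 : (⌊u⌋₊ : ℝ) ≤ u := Nat.floor_le hu
  calc _ ≤ ∑ j ∈ Finset.range ⌊u⌋₊, (q:ℝ) + q * (u - ⌊u⌋₊) := by
        refine (norm_add_le _ _).trans (add_le_add ((norm_sum_le _ _).trans
          (sum_le_sum fun j _ => norm_sum_Icc_le χ h1 j)) ?_)
        rw [norm_mul, Complex.norm_real, Real.norm_of_nonneg (by linarith)]
        gcongr
        exact norm_sum_Icc_le χ h1 _
    _ = q * u := by simp; ring

lemma Mfun_of_lt_one (χ : DirichletCharacter ℂ q) (u : ℝ) (hu : u < 1) : Mfun χ u = 0 := by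
  have : ⌊u⌋₊ = 0 := by rw [Nat.floor_eq_zero]; exact hu
  simp [Mfun, this]

lemma Mfun_eq_sum (χ : DirichletCharacter ℂ q) (u : ℝ) (hu : 0 ≤ u) (N : ℕ) (hN : ⌊u⌋₊ ≤ N) :
    Mfun χ u = ∑ n ∈ Finset.Icc 1 N, χ (n : ZMod q) * ((max (u - n) 0 : ℝ) : ℂ) := by
  rw [Mfun]
  rw [← Finset.sum_subset (Finset.Icc_subset_Icc_right hN)]
  · refine sum_congr rfl fun n hn => ?_
    have : (n:ℝ) ≤ u := by
      have := (Finset.mem_Icc.1 hn).2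
      exact (Nat.le_floor_iff hu).1 this
    rw [max_eq_left (by linarith)]
  · intro n hn hn2
    have : ⌊u⌋₊ < n := by
      simp only [Finset.mem_Icc] at hn hn2; omega
    have : u < n := (Nat.floor_lt hu).1 this
    rw [max_eq_right (by linarith)]; simp

lemma Mfun_hasSum (χ : DirichletCharacter ℂ q) (h1 : χ ≠ 1) (u : ℝ) (hu : 0 ≤ u) :
    HasSum (fun n : ℕ => χ (n : ZMod q) * ((max (u - n) 0 : ℝ) : ℂ)) (Mfun χ u) := by
  rw [Mfun_eq_sum χ u hu _ le_rfl]
  refine hasSum_sum_of_ne_finset_zero fun n hn => ?_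
  rcases Nat.eq_zero_or_pos n with rfl | hn0
  · rw [char_zero χ h1]; simp
  · have : ⌊u⌋₊ < n := by
      simp only [Finset.mem_Icc] at hn; omega
    have : u < n := (Nat.floor_lt hu).1 this
    rw [max_eq_right (by linarith)]; simp

lemma Mfun_continuousOn (χ : DirichletCharacter ℂ q) : ContinuousOn (Mfun χ) (Set.Ioi 0) := by
  intro u hu
  have hu : (0:ℝ) < u := hu
  apply ContinuousAt.continuousWithinAt
  have h : Mfun χ =ᶠ[𝓝 u] fun v => ∑ n ∈ Finset.Icc 1 ⌊u+1⌋₊, χ (n : ZMod q) * ((max (v - n) 0 : ℝ) : ℂ) := by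
    filter_upwards [Ioo_mem_nhds hu (lt_add_one u)] with v hv
    exact Mfun_eq_sum χ v hv.1.le _ (Nat.floor_mono hv.2.le)
  refine ContinuousAt.congr ?_ h.symm
  fun_prop

end charsum

lemma mellin_tri {n : ℝ} (hn : 0 < n) {s : ℂ} (hs : 0 < s.re) :
    IntegrableOn (fun u : ℝ => (u : ℂ) ^ (-s - 2) * ((max (u - n) 0 : ℝ) : ℂ)) (Set.Ioi 0) ∧
    ∫ u in Set.Ioi (0:ℝ), (u : ℂ) ^ (-s - 2) * ((max (u - n) 0 : ℝ) : ℂ) = (n:ℂ) ^ (-s) / (s * (s + 1)) := by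
  have e1 : ∀ u ∈ Set.Ioi n, (u : ℂ) ^ (-s - 2) * ((max (u - n) 0 : ℝ) : ℂ)
      = (u:ℂ) ^ (-s - 1) - n * (u:ℂ) ^ (-s - 2) := by
    intro u hu
    have hu : n < u := hu
    have hu0 : (u:ℂ) ≠ 0 := by exact_mod_cast (hn.trans hu).ne'
    rw [max_eq_left (by linarith), show -s - 1 = (-s - 2) + 1 by ring, Complex.cpow_add _ _ hu0]
    push_cast; rw [Complex.cpow_one]; ring
  have i1 : IntegrableOn (fun u : ℝ => (u:ℂ) ^ (-s - 1)) (Set.Ioi n) :=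
    integrableOn_Ioi_cpow_of_lt (by simp; linarith) hn
  have i2 : IntegrableOn (fun u : ℝ => (u:ℂ) ^ (-s - 2)) (Set.Ioi n) :=
    integrableOn_Ioi_cpow_of_lt (by simp; linarith) hn
  have e0 : ∀ u ∈ Set.Ioc 0 n, (u : ℂ) ^ (-s - 2) * ((max (u - n) 0 : ℝ) : ℂ) = 0 := by
    intro u hu
    rw [max_eq_right (by linarith [hu.2])]; simp
  have hU : Set.Ioi (0:ℝ) = Set.Ioc 0 n ∪ Set.Ioi n := (Set.Ioc_union_Ioi_eq_Ioi hn.le).symm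
  have j1 : IntegrableOn (fun u : ℝ => (u : ℂ) ^ (-s - 2) * ((max (u - n) 0 : ℝ) : ℂ)) (Set.Ioi n) :=
    IntegrableOn.congr_fun (i1.sub (i2.const_mul (n:ℂ))) (fun u hu => (e1 u hu).symm) measurableSet_Ioi
  have j0 : IntegrableOn (fun u : ℝ => (u : ℂ) ^ (-s - 2) * ((max (u - n) 0 : ℝ) : ℂ)) (Set.Ioc 0 n) :=
    IntegrableOn.congr_fun (integrableOn_zero) (fun u hu => (e0 u hu).symm) measurableSet_Ioc
  refine ⟨hU ▸ j0.union j1, ?_⟩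
  rw [hU, setIntegral_union (Set.Ioc_disjoint_Ioi le_rfl) measurableSet_Ioi j0 j1,
    setIntegral_congr_fun measurableSet_Ioc e0, setIntegral_congr_fun measurableSet_Ioi e1,
    integral_sub i1 (i2.const_mul _), integral_const_mul,
    integral_Ioi_cpow_of_lt (by simp; linarith) hn, integral_Ioi_cpow_of_lt (by simp; linarith) hn]
  have hn0 : (n:ℂ) ≠ 0 := by exact_mod_cast hn.ne'
  have hs0 : s ≠ 0 := by rintro rfl; simp at hs
  have hs1 : s + 1 ≠ 0 := by
    intro h; have := congrArg Complex.re h; simp at this; linarith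
  rw [show -s - 1 + 1 = -s by ring, show -s - 2 + 1 = -s + (-1) by ring, Complex.cpow_add _ _ hn0,
    Complex.cpow_neg_one]
  have hs2 : -s + -1 ≠ 0 := by
    intro h; apply hs1; linear_combination -h
  simp only [integral_zero, zero_add]
  field_simp
  ring

section mellin
variable {q : ℕ} [NeZero q]

lemma mellin_Mfun_of_one_lt (χ : DirichletCharacter ℂ q) (h1 : χ ≠ 1) {s : ℂ} (hs : 1 < s.re) :
    mellin (Mfun χ) (-s - 1) = DirichletCharacter.LFunction χ s / (s * (s + 1)) := by
  rw [DirichletCharacter.LFunction_eq_LSeries χ hs]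
  have hs0 : 0 < s.re := by linarith
  have hsum : Summable fun n : ℕ => ‖LSeries.term (fun n => χ (n : ZMod q)) s n‖ :=
    (DirichletCharacter.LSeriesSummable_of_one_lt_re χ hs).norm
  set F : ℕ → ℝ → ℂ := fun n u => (u : ℂ) ^ (-s - 2) * (χ (n : ZMod q) * ((max (u - n) 0 : ℝ) : ℂ)) with hF
  have hF' : ∀ n, F n = fun u : ℝ => χ (n : ZMod q) * ((u : ℂ) ^ (-s - 2) * ((max (u - n) 0 : ℝ) : ℂ)) := by
    intro n; ext u; simp only [hF]; ring
  have hFi : ∀ n, Integrable (F n) (volume.restrict (Set.Ioi 0)) := by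
    intro n
    rw [hF']
    rcases Nat.eq_zero_or_pos n with rfl | hn0
    · rw [char_zero χ h1]; simp
    · exact (mellin_tri (n := n) (by exact_mod_cast hn0) hs0).1.const_mul _
  have hval : ∀ n, ∫ u in Set.Ioi (0:ℝ), F n u = LSeries.term (fun n => χ (n : ZMod q)) s n / (s * (s+1)) := by
    intro n
    rw [hF']
    rcases Nat.eq_zero_or_pos n with rfl | hn0
    · rw [char_zero χ h1]; simp
    · rw [integral_const_mul, (mellin_tri (n := n) (by exact_mod_cast hn0) hs0).2,
        LSeries.term_of_ne_zero hn0.ne', Complex.cpow_neg]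
      push_cast
      field_simp
  have hnorm : ∀ n, ∫ u in Set.Ioi (0:ℝ), ‖F n u‖ =
      ‖LSeries.term (fun n => χ (n : ZMod q)) s n‖ * (1 / (s.re * (s.re + 1))) := by
    intro n
    rcases Nat.eq_zero_or_pos n with rfl | hn0
    · simp only [hF', char_zero χ h1]; simp
    · have hn : (0:ℝ) < n := by exact_mod_cast hn0
      have h3 := (mellin_tri (n := n) hn (s := (s.re:ℂ)) (by simpa using hs0)).2
      have h4 : ∀ u ∈ Set.Ioi (0:ℝ), ((‖F n u‖ : ℝ) : ℂ) = ‖χ (n : ZMod q)‖ * ((u : ℂ) ^ (-(s.re:ℂ) - 2) * ((max (u - n) 0 : ℝ) : ℂ)) := by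
        intro u hu
        have hu : (0:ℝ) < u := hu
        simp only [hF']
        rw [norm_mul, norm_mul, Complex.norm_cpow_eq_rpow_re_of_pos hu, Complex.norm_real,
          Real.norm_of_nonneg (le_max_right _ _)]
        push_cast
        rw [Complex.ofReal_cpow hu.le]
        simp
      have h5 : ((∫ u in Set.Ioi (0:ℝ), ‖F n u‖ : ℝ) : ℂ) = ((‖LSeries.term (fun n => χ (n : ZMod q)) s n‖ * (1 / (s.re * (s.re + 1))) : ℝ) : ℂ) := by
        rw [← integral_complex_ofReal, setIntegral_congr_fun measurableSet_Ioi h4, integral_const_mul, h3,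
          LSeries.term_of_ne_zero hn0.ne', norm_div, Complex.norm_natCast_cpow_of_pos hn0]
        push_cast
        rw [Complex.ofReal_cpow hn.le, Complex.cpow_neg]
        push_cast
        field_simp
      exact_mod_cast h5
  have hS := hasSum_integral_of_summable_integral_norm hFi (by
    simp only [hnorm]; exact hsum.mul_right _)
  have := hS.tsum_eq
  simp only [hval] at this
  rw [tsum_div_const] at this
  rw [LSeries, this, mellin]
  refine setIntegral_congr_fun measurableSet_Ioi fun u hu => ?_
  have hu : (0:ℝ) < u := hu
  simp only [hF, smul_eq_mul]
  rw [tsum_mul_left, (Mfun_hasSum χ h1 u hu.le).tsum_eq]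
  congr 2; ring

lemma Mfun_isBigO_top (χ : DirichletCharacter ℂ q) (h1 : χ ≠ 1) :
    Mfun χ =O[atTop] fun u : ℝ => u ^ (-(-1:ℝ)) := by
  refine Asymptotics.IsBigO.of_bound q ?_
  filter_upwards [eventually_gt_atTop 0] with u hu
  simpa [abs_of_pos hu] using norm_Mfun_le χ h1 u hu.le

lemma Mfun_isBigO_zero (χ : DirichletCharacter ℂ q) (b : ℝ) :
    Mfun χ =O[𝓝[>] 0] fun u : ℝ => u ^ (-b) := by
  refine Asymptotics.IsBigO.of_bound 1 ?_
  have : Set.Iio (1:ℝ) ∈ 𝓝[>] (0:ℝ) := mem_nhdsWithin_of_mem_nhds (Iio_mem_nhds one_pos)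
  filter_upwards [this] with u hu
  rw [Mfun_of_lt_one χ u hu, norm_zero]; positivity

lemma Mfun_locInt (χ : DirichletCharacter ℂ q) : LocallyIntegrableOn (Mfun χ) (Set.Ioi 0) :=
  (Mfun_continuousOn χ).locallyIntegrableOn measurableSet_Ioi

lemma mellinConvergent_Mfun (χ : DirichletCharacter ℂ q) (h1 : χ ≠ 1) {s : ℂ} (hs : 0 < s.re) :
    MellinConvergent (Mfun χ) (-s - 1) :=
  mellinConvergent_of_isBigO_rpow (Mfun_locInt χ) (Mfun_isBigO_top χ h1) (by simp; linarith)
    (Mfun_isBigO_zero χ (-s.re - 2)) (by simp)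

lemma mellin_Mfun (χ : DirichletCharacter ℂ q) (h1 : χ ≠ 1) {s : ℂ} (hs : 0 < s.re) :
    mellin (Mfun χ) (-s - 1) = DirichletCharacter.LFunction χ s / (s * (s + 1)) := by
  have hopen : IsOpen {z : ℂ | 0 < z.re} := isOpen_lt continuous_const Complex.continuous_re
  have hf : DifferentiableOn ℂ (fun s => mellin (Mfun χ) (-s - 1)) {z : ℂ | 0 < z.re} := by
    intro z hz
    have hz : 0 < z.re := hz
    have : DifferentiableAt ℂ (mellin (Mfun χ)) (-z - 1) :=
      mellin_differentiableAt_of_isBigO_rpow (Mfun_locInt χ) (Mfun_isBigO_top χ h1) (by simp; linarith)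
        (Mfun_isBigO_zero χ (-z.re - 2)) (by simp)
    exact (DifferentiableAt.comp (g := mellin (Mfun χ)) (f := fun s => -s - 1) z this (by fun_prop)).differentiableWithinAt
  have hg : DifferentiableOn ℂ (fun s => DirichletCharacter.LFunction χ s / (s * (s + 1))) {z : ℂ | 0 < z.re} := by
    have h3 := DirichletCharacter.differentiable_LFunction h1
    refine (h3.differentiableOn).div (by fun_prop) ?_
    intro z hz
    have hz : 0 < z.re := hz
    refine mul_ne_zero (by rintro rfl; simp at hz) ?_
    intro h; have := congrArg Complex.re h; simp at this; linarith
  have := (hf.analyticOnNhd hopen).eqOn_of_preconnected_of_eventuallyEq (hg.analyticOnNhd hopen)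
    (convex_halfSpace_re_gt 0).isPreconnected (z₀ := 2) (by simp) (by
      have : {z : ℂ | 1 < z.re} ∈ 𝓝 (2:ℂ) :=
        (isOpen_lt continuous_const Complex.continuous_re).mem_nhds (by simp)
      filter_upwards [this] with z hz
      exact mellin_Mfun_of_one_lt χ h1 hz)
  exact this hs

lemma norm_LFunction_le (χ : DirichletCharacter ℂ q) (h1 : χ ≠ 1) {s : ℂ} (hs : 0 < s.re) :
    ‖DirichletCharacter.LFunction χ s‖ ≤ q * ‖s‖ * ‖s + 1‖ / s.re := by
  have hs0 : s ≠ 0 := by rintro rfl; simp at hs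
  have hs1 : s + 1 ≠ 0 := by
    intro h; have := congrArg Complex.re h; simp at this; linarith
  have h := mellin_Mfun χ h1 hs
  rw [eq_div_iff (mul_ne_zero hs0 hs1)] at h
  rw [← h, norm_mul, norm_mul]
  have hb : ‖mellin (Mfun χ) (-s - 1)‖ ≤ ∫ u in Set.Ioi (1:ℝ), q * u ^ (-s.re - 1) := by
    rw [mellin]
    have hU : Set.Ioi (0:ℝ) = Set.Ioc 0 1 ∪ Set.Ioi 1 := (Set.Ioc_union_Ioi_eq_Ioi zero_le_one).symm
    have hc := mellinConvergent_Mfun χ h1 hs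
    rw [MellinConvergent] at hc
    rw [hU, setIntegral_union (Set.Ioc_disjoint_Ioi le_rfl) measurableSet_Ioi
      (hc.mono_set (hU ▸ Set.subset_union_left)) (hc.mono_set (hU ▸ Set.subset_union_right))]
    have : ∫ t in Set.Ioc (0:ℝ) 1, (t:ℂ) ^ (-s - 1 - 1) • Mfun χ t = 0 := by
      rw [integral_Ioc_eq_integral_Ioo]
      rw [setIntegral_congr_fun (g := fun _ => 0) measurableSet_Ioo]
      · simp
      · intro t ht; simp [Mfun_of_lt_one χ t ht.2]
    rw [this, zero_add]
    refine norm_integral_le_of_norm_le ((integrableOn_Ioi_rpow_of_lt (by linarith) one_pos).const_mul _) ?_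
    refine (ae_restrict_iff' measurableSet_Ioi).2 (Eventually.of_forall fun t ht => ?_)
    have ht0 : (0:ℝ) < t := lt_trans one_pos ht
    rw [norm_smul, Complex.norm_cpow_eq_rpow_re_of_pos ht0]
    calc _ ≤ t ^ (-s.re - 2) * (q * t) := by
          gcongr
          · exact ht.le
          · simp; linarith
          · exact norm_Mfun_le χ h1 t ht0.le
      _ = q * t ^ (-s.re - 1) := by
          rw [show -s.re - 1 = (-s.re - 2) + 1 by ring, rpow_add ht0, Real.rpow_one]; ring
  rw [integral_const_mul, integral_Ioi_rpow_of_lt (by linarith) one_pos] at hb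
  simp only [Real.one_rpow, sub_add_cancel] at hb
  calc _ ≤ (q * (-1 / -s.re)) * (‖s‖ * ‖s+1‖) := by gcongr
    _ = _ := by field_simp

end mellin

lemma log_bound {f : ℂ → ℂ} {c : ℂ} {r R M : ℝ} (hr : 0 ≤ r) (hrR : r < R) (hM : 1 < M)
    (hf : DifferentiableOn ℂ f (Metric.ball c R)) (h0 : ∀ z ∈ Metric.ball c R, f z ≠ 0)
    (hfM : ∀ z ∈ Metric.ball c R, ‖f z‖ ≤ M * ‖f c‖) {z : ℂ} (hz : ‖z - c‖ ≤ r) :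
    Real.exp (-(2 * R / (R - r) * Real.log M)) * ‖f c‖ ≤ ‖f z‖ ∧
    ‖deriv f z / f z‖ ≤ 8 * R / (R - r) ^ 2 * Real.log M := by
  have hR : 0 < R := by linarith
  have hlM : 0 < Real.log M := Real.log_pos hM
  have hopen : IsOpen (Metric.ball c R) := Metric.isOpen_ball
  obtain ⟨G, hG⟩ := (((hf.deriv hopen).div hf h0).isExactOn_ball : Complex.IsExactOn (fun z => deriv f z / f z) (Metric.ball c R))
  have hc : c ∈ Metric.ball c R := Metric.mem_ball_self hR
  have hfc : f c ≠ 0 := h0 c hc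
  -- f = f c * exp (G - G c)
  have key : ∀ w ∈ Metric.ball c R, f w = f c * Complex.exp (G w - G c) := by
    have hd : ∀ w ∈ Metric.ball c R, HasDerivAt (fun w => f w * Complex.exp (-(G w - G c))) 0 w := by
      intro w hw
      have h1 : HasDerivAt f (deriv f w) w := (hf.differentiableAt (hopen.mem_nhds hw)).hasDerivAt
      have h2 : HasDerivAt (fun w => Complex.exp (-(G w - G c))) (Complex.exp (-(G w - G c)) * (-(deriv f w / f w))) w :=
        (((hG w hw).sub_const (G c)).neg).cexp
      refine (h1.mul h2).congr_deriv ?_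
      have h3 := h0 w hw
      have h4 : f w * (Complex.exp (-(G w - G c)) * (-(deriv f w / f w))) = - (deriv f w * Complex.exp (-(G w - G c))) := by
        field_simp
      rw [h4]; ring
    intro w hw
    have : (fun w => f w * Complex.exp (-(G w - G c))) w = (fun w => f w * Complex.exp (-(G w - G c))) c := by
      refine (convex_ball c R).is_const_of_fderivWithin_eq_zero (𝕜 := ℂ)
        (fun x hx => (hd x hx).differentiableAt.differentiableWithinAt) ?_ hw hc
      intro x hx
      rw [fderivWithin_of_isOpen hopen hx]
      have := (hd x hx).hasFDerivAt.fderiv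
      rw [this]; ext; simp
    simp only [sub_self, neg_zero, Complex.exp_zero, mul_one] at this
    rw [← this, mul_assoc, ← Complex.exp_add]; simp
  set H : ℂ → ℂ := fun w => G (c + w) - G c with hH
  have hHd : DifferentiableOn ℂ H (Metric.ball 0 R) := by
    intro w hw
    have : c + w ∈ Metric.ball c R := by simpa using hw
    have h3 : DifferentiableAt ℂ G (c + w) := (hG _ this).differentiableAt
    exact ((h3.comp w (by fun_prop : DifferentiableAt ℂ (fun w => c + w) w)).sub_const _).differentiableWithinAt
  have hHre : Set.MapsTo H (Metric.ball 0 R) {z | z.re ≤ Real.log M} := by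
    intro w hw
    have hw' : c + w ∈ Metric.ball c R := by simpa using hw
    have h1 := hfM _ hw'
    rw [key _ hw', norm_mul, Complex.norm_exp, mul_comm] at h1
    have h2 := le_of_mul_le_mul_right h1 (norm_pos_iff.2 hfc)
    exact (Real.le_log_iff_exp_le (by linarith)).2 h2
  have hH0 : H 0 = 0 := by simp [hH]
  have hBC : ∀ w : ℂ, ‖w‖ < R → ‖H w‖ ≤ 2 * Real.log M * ‖w‖ / (R - ‖w‖) := fun w hw =>
    Complex.borelCaratheodory_zero hlM hHd hHre hR (by simpa using hw) hH0
  have hzb : z ∈ Metric.ball c R := by rw [Metric.mem_ball, dist_eq_norm]; linarith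
  have hBC' : ∀ w : ℂ, ∀ ρ, ‖w‖ ≤ ρ → ρ < R → ‖H w‖ ≤ 2 * R / (R - ρ) * Real.log M := by
    intro w ρ hw hρ
    refine (hBC w (by linarith)).trans ?_
    rw [div_mul_eq_mul_div]
    apply div_le_div₀ (by positivity) _ (by linarith) (by linarith)
    nlinarith [norm_nonneg w]
  constructor
  · have h1 := hBC' (z - c) r hz hrR
    rw [key z hzb, norm_mul, mul_comm, Complex.norm_exp]
    gcongr
    have h2 : G z - G c = H (z - c) := by simp [hH]
    rw [h2]
    have := Complex.abs_re_le_norm (H (z - c))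
    linarith [neg_abs_le (H (z-c)).re]
  · have hder : deriv H (z - c) = deriv f z / f z := by
      have h3 : HasDerivAt G (deriv f z / f z) (c + (z - c)) := by
        have := hG z hzb; simpa using this
      have h4 := (h3.comp_const_add c (z - c)).sub_const (G c)
      exact h4.deriv
    rw [← hder]
    have hd : 0 < (R - r) / 4 := by linarith
    have h5 : ‖deriv H (z - c)‖ ≤ (2 * R / (R - (R + r) / 2) * Real.log M) / ((R - r) / 2) := by
      refine Complex.norm_deriv_le_of_forall_mem_sphere_norm_le (by linarith) ?_ ?_
      · refine DifferentiableOn.diffContOnCl (hHd.mono ?_)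
        rw [closure_ball _ (by linarith)]
        intro w hw
        rw [Metric.mem_closedBall, dist_eq_norm] at hw
        rw [mem_ball_zero_iff]
        calc ‖w‖ = ‖(w - (z - c)) + (z - c)‖ := by ring_nf
          _ ≤ _ := norm_add_le _ _
          _ < R := by linarith
      · intro w hw
        rw [mem_sphere_iff_norm] at hw
        refine hBC' w _ ?_ (by linarith)
        calc ‖w‖ = ‖(w - (z - c)) + (z - c)‖ := by ring_nf
          _ ≤ _ := norm_add_le _ _
          _ ≤ _ := by linarith
    refine h5.trans (le_of_eq ?_)
    have : R - r ≠ 0 := by linarith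
    have h7 : R - (R + r) / 2 = (R - r) / 2 := by ring
    rw [h7]
    field_simp
    ring

section
variable {q : ℕ} [NeZero q]

lemma summable_tail : HasSum (fun n : ℕ => 1 / ((n:ℝ) + 2) ^ 2) (π ^ 2 / 6 - 1) := by
  have h := hasSum_zeta_two
  have := (hasSum_nat_add_iff' 2).2 h
  simpa [sum_range_succ] using this

lemma norm_L_sub_one_le (χ : DirichletCharacter ℂ q) {s : ℂ} (hs : 2 ≤ s.re) :
    ‖DirichletCharacter.LFunction χ s - 1‖ ≤ π ^ 2 / 6 - 1 := by
  have hs1 : 1 < s.re := by linarith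
  rw [DirichletCharacter.LFunction_eq_LSeries χ hs1]
  have hS := DirichletCharacter.LSeriesSummable_of_one_lt_re χ hs1
  have h1 : LSeries (fun n => χ (n : ZMod q)) s - 1 = ∑' n : ℕ, LSeries.term (fun n => χ (n : ZMod q)) s (n + 2) := by
    rw [LSeries, ← hS.sum_add_tsum_nat_add 2]
    simp [sum_range_succ, LSeries.term]
  rw [h1]
  refine tsum_of_norm_bounded summable_tail fun n => ?_
  rw [LSeries.term_of_ne_zero (by omega), norm_div, Complex.norm_natCast_cpow_of_pos (by omega)]
  refine div_le_div₀ zero_le_one (χ.norm_le_one _) (by positivity) ?_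
  push_cast
  rw [← rpow_natCast]
  exact rpow_le_rpow_of_exponent_le (by linarith [(Nat.cast_nonneg n : (0:ℝ) ≤ n)]) (by simpa using hs)

lemma pi_sq_lt : π ^ 2 / 6 < 1.7 := by
  nlinarith [Real.pi_lt_d2, Real.pi_pos]

lemma L_lower_two (χ : DirichletCharacter ℂ q) {s : ℂ} (hs : 2 ≤ s.re) :
    0.3 ≤ ‖DirichletCharacter.LFunction χ s‖ := by
  have h := norm_L_sub_one_le χ hs
  have h2 : ‖(1:ℂ)‖ ≤ ‖DirichletCharacter.LFunction χ s‖ + ‖DirichletCharacter.LFunction χ s - 1‖ := by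
    rw [norm_sub_rev]
    calc _ = ‖DirichletCharacter.LFunction χ s + (1 - DirichletCharacter.LFunction χ s)‖ := by ring_nf
      _ ≤ _ := norm_add_le _ _
  have := pi_sq_lt
  rw [norm_one] at h2
  linarith

lemma L_upper_two (χ : DirichletCharacter ℂ q) {s : ℂ} (hs : 2 ≤ s.re) :
    ‖DirichletCharacter.LFunction χ s‖ ≤ 2 := by
  have h := norm_L_sub_one_le χ hs
  have h2 := norm_add_le (DirichletCharacter.LFunction χ s - 1) 1
  have := pi_sq_lt
  rw [norm_one, sub_add_cancel] at h2
  linarith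

lemma L_ne_zero (χ : DirichletCharacter ℂ q) (h1 : χ ≠ 1) (hRH : dirichletRH χ) {s : ℂ} (hs : 1/2 < s.re) :
    DirichletCharacter.LFunction χ s ≠ 0 := by
  rcases lt_or_ge s.re 1 with h | h
  · intro h0
    have := hRH s (by linarith) h h0
    linarith
  · exact DirichletCharacter.LFunction_ne_zero_of_one_le_re χ (Or.inl h1) h

lemma L_log_bounds (χ : DirichletCharacter ℂ q) (h1 : χ ≠ 1) (hRH : dirichletRH χ) {ε : ℝ} (hε : 0 < ε)
    (hε1 : ε ≤ 1) : ∃ C : ℝ, 0 < C ∧ ∀ s : ℂ, 1/2 + ε ≤ s.re →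
      Real.exp (-(C * Real.log (2 + ‖s‖))) ≤ ‖DirichletCharacter.LFunction χ s‖ ∧
      ‖deriv (DirichletCharacter.LFunction χ) s / DirichletCharacter.LFunction χ s‖ ≤ C * Real.log (2 + ‖s‖) := by
  set L := DirichletCharacter.LFunction χ
  have hq : (1:ℝ) ≤ q := by exact_mod_cast NeZero.pos q
  set B : ℝ := Real.log (400 * q) / Real.log 2 + 2 with hB
  have hl2 : 0 < Real.log 2 := Real.log_pos (by norm_num)
  have hB0 : 0 < B := by
    have : 0 ≤ Real.log (400 * q) := Real.log_nonneg (by nlinarith)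
    positivity
  refine ⟨(3 / ε + 12 / ε ^ 2) * B + 2, by positivity, fun s hs => ?_⟩
  -- centre
  set c : ℂ := ((max 2 s.re : ℝ) : ℂ) + s.im * I with hc
  have hcre : c.re = max 2 s.re := by simp [hc]
  have hc2 : 2 ≤ c.re := by rw [hcre]; exact le_max_left _ _
  have hsc : ‖s - c‖ ≤ 3/2 - ε := by
    have : s - c = ((s.re - max 2 s.re : ℝ) : ℂ) := by
      apply Complex.ext <;> simp [hc]
    rw [this, Complex.norm_real, Real.norm_eq_abs, abs_le]
    rcases le_total 2 s.re with h | h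
    · rw [max_eq_right h]; constructor <;> linarith
    · rw [max_eq_left h]; constructor <;> linarith
  have hLc := L_lower_two χ hc2
  set M : ℝ := 400 * q * (2 + ‖s‖) ^ 2 with hM
  have hs0 := norm_nonneg s
  have hM1 : 1 < M := by
    rw [hM]; nlinarith [mul_nonneg (by linarith : (0:ℝ) ≤ q) (by positivity : 0 ≤ (2 + ‖s‖)^2)]
  have hre : ∀ z ∈ Metric.ball c (3/2), 1/2 < z.re := by
    intro z hz
    rw [Metric.mem_ball, dist_eq_norm] at hz
    have := Complex.abs_re_le_norm (z - c)
    rw [Complex.sub_re] at this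
    have := neg_abs_le (z.re - c.re)
    linarith
  have hlog : Real.log M ≤ B * Real.log (2 + ‖s‖) := by
    rw [hM, Real.log_mul (by positivity) (by positivity), Real.log_pow, hB, add_mul]
    have : Real.log 2 ≤ Real.log (2 + ‖s‖) := Real.log_le_log (by norm_num) (by linarith)
    have h400 : 0 ≤ Real.log (400 * q) := Real.log_nonneg (by nlinarith)
    have : Real.log (400 * q) ≤ Real.log (400 * q) / Real.log 2 * Real.log (2 + ‖s‖) := by
      rw [div_mul_eq_mul_div, le_div_iff₀ hl2]
      gcongr
    push_cast
    linarith
  have hlog0 : 0 < Real.log (2 + ‖s‖) := Real.log_pos (by linarith)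
  obtain ⟨k1, k2⟩ := log_bound (f := L) (c := c) (r := 3/2 - ε) (R := 3/2) (M := M)
    (by linarith) (by linarith) hM1 (DirichletCharacter.differentiable_LFunction h1).differentiableOn
    (fun z hz => L_ne_zero χ h1 hRH (hre z hz)) (by
      intro z hz
      have hz2 := hre z hz
      refine (norm_LFunction_le χ h1 (by linarith : 0 < z.re)).trans ?_
      rw [Metric.mem_ball, dist_eq_norm] at hz
      have hzs : ‖z‖ ≤ ‖s‖ + 3 := by
        calc ‖z‖ = ‖(z - c) + ((c - s) + s)‖ := by ring_nf
          _ ≤ ‖z - c‖ + (‖c - s‖ + ‖s‖) := (norm_add_le _ _).trans (by gcongr; exact norm_add_le _ _)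
          _ ≤ _ := by rw [norm_sub_rev c s]; linarith
      have hzs1 : ‖z + 1‖ ≤ ‖s‖ + 4 := (norm_add_le _ _).trans (by rw [norm_one]; linarith)
      calc (q:ℝ) * ‖z‖ * ‖z + 1‖ / z.re ≤ (q * (‖s‖ + 3) * (‖s‖ + 4)) / (1/2) := by
            apply div_le_div₀ (by positivity) (by gcongr) (by norm_num) hz2.le
        _ ≤ M * 0.3 := by
            rw [hM]; nlinarith [mul_nonneg (by linarith : (0:ℝ) ≤ q) (by positivity : 0 ≤ ‖s‖), mul_nonneg (by linarith : (0:ℝ) ≤ q) (by positivity : 0 ≤ ‖s‖^2)]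
        _ ≤ _ := by gcongr) hsc
  have e1 : (3/2 - (3/2 - ε) : ℝ) = ε := by ring
  rw [e1] at k1 k2
  constructor
  · refine le_trans ?_ k1
    have h03 : Real.exp (-2 * Real.log (2 + ‖s‖)) ≤ ‖L c‖ := by
      refine le_trans ?_ hLc
      rw [mul_comm, Real.exp_mul, Real.exp_log (by linarith), Real.rpow_neg (by linarith)]
      rw [show (2:ℝ) = ((2:ℕ):ℝ) by norm_num, rpow_natCast, inv_le_comm₀ (by positivity) (by norm_num)]
      push_cast
      nlinarith
    calc _ ≤ Real.exp (-(2 * (3/2) / ε * Real.log M)) * Real.exp (-2 * Real.log (2 + ‖s‖)) := by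
          rw [← Real.exp_add]
          apply Real.exp_le_exp.2
          have : 2 * (3/2) / ε * Real.log M ≤ 3 / ε * (B * Real.log (2 + ‖s‖)) := by
            have : (2 * (3/2) / ε : ℝ) = 3 / ε := by ring
            rw [this]; gcongr
          have : 0 ≤ 12 / ε ^ 2 * B * Real.log (2 + ‖s‖) := by positivity
          nlinarith
      _ ≤ _ := by gcongr
  · refine k2.trans ?_
    have : 8 * (3/2) / ε ^ 2 * Real.log M ≤ 12 / ε ^ 2 * (B * Real.log (2 + ‖s‖)) := by
      have : (8 * (3/2) / ε ^ 2 : ℝ) = 12 / ε ^ 2 := by ring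
      rw [this]; gcongr
    have : 0 ≤ 3 / ε * B * Real.log (2 + ‖s‖) := by positivity
    nlinarith

end

lemma harm_lower (J n : ℕ) (hJ : 1 ≤ J) (hn : J ≤ n) :
    Real.log (n + 1) - Real.log J ≤ ∑ j ∈ Finset.Ico J (n+1), (1:ℝ) / j := by
  induction n, hn using Nat.le_induction with
  | base =>
    rw [Nat.Ico_succ_singleton, Finset.sum_singleton]
    have h : (0:ℝ) < J := by exact_mod_cast hJ
    rw [← Real.log_div (by positivity) (by positivity)]
    refine (Real.log_le_sub_one_of_pos (by positivity)).trans (le_of_eq ?_)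
    field_simp; ring
  | succ n hn ih =>
    rw [Finset.sum_Ico_succ_top (by omega)]
    have h : (0:ℝ) < (n:ℝ) + 1 := by positivity
    have h2 : Real.log (((n:ℝ) + 1 + 1) / (n+1)) ≤ 1 / ((n:ℝ)+1) := by
      refine (Real.log_le_sub_one_of_pos (by positivity)).trans (le_of_eq ?_)
      field_simp; ring
    rw [Real.log_div (by positivity) (by positivity)] at h2
    push_cast
    linarith

lemma factor_lower (z : ℂ) (hz : 0 < z.re) (η : ℝ) (h0 : 0 ≤ η) (h1 : η ≤ 1) (j : ℕ) (hj : 1 ≤ j) :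
    ‖z + j‖ * Real.exp (η * (1 / j - (‖z‖ + 1) * ((j:ℝ)^2)⁻¹)) ≤ ‖z + η + j‖ := by
  set w : ℂ := z + j with hw
  have hj0 : (1:ℝ) ≤ j := by exact_mod_cast hj
  have hwre : (j:ℝ) ≤ w.re := by simp [hw]; exact hz.le
  have hwn : (j:ℝ) ≤ ‖w‖ := hwre.trans (Complex.re_le_norm w)
  have hwpos : 0 < ‖w‖ := by linarith
  have hw0 : w ≠ 0 := norm_pos_iff.1 hwpos
  have hj0' : (j:ℂ) ≠ 0 := by exact_mod_cast (by omega : j ≠ 0)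
  set A : ℝ := (w⁻¹).re with hA
  have hAeq : A = w.re / ‖w‖^2 := by rw [hA, Complex.inv_re, Complex.normSq_eq_norm_sq]
  have hA0 : 0 ≤ A := by rw [hAeq]; apply div_nonneg (by linarith) (by positivity)
  have hA1 : A ≤ 1 / j := by
    calc A ≤ ‖w⁻¹‖ := Complex.re_le_norm _
      _ = 1 / ‖w‖ := by rw [norm_inv, one_div]
      _ ≤ 1 / j := by gcongr
  have ha : 1 / j - ‖z‖ * ((j:ℝ)^2)⁻¹ ≤ A := by
    have e : (j:ℂ)⁻¹ - w⁻¹ = z / (j * w) := by rw [hw] at hw0 ⊢; field_simp; ring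
    have h2 : ‖(j:ℂ)⁻¹ - w⁻¹‖ ≤ ‖z‖ * ((j:ℝ)^2)⁻¹ := by
      rw [e, norm_div, norm_mul, Complex.norm_natCast, div_eq_mul_inv]
      gcongr
      nlinarith
    have h3 := (Complex.re_le_norm _).trans h2
    rw [Complex.sub_re, ← hA] at h3
    have : ((j:ℂ)⁻¹).re = 1 / j := by
      rw [← Complex.ofReal_natCast, ← Complex.ofReal_inv, Complex.ofReal_re, one_div]
    linarith
  have hexp : Real.exp (2 * (η * A) - 2 * (η * A)^2) ≤ 1 + 2 * (η * A) := by
    have hv : 0 ≤ η * A := by positivity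
    rw [← Real.le_log_iff_exp_le (by linarith)]
    refine le_trans ?_ (Real.le_log_one_add_of_nonneg (by linarith : 0 ≤ 2 * (η * A)))
    rw [le_div_iff₀ (by linarith)]
    nlinarith [pow_nonneg hv 3]
  have hsq : (‖w‖ * Real.exp (η * (1 / j - (‖z‖ + 1) * ((j:ℝ)^2)⁻¹)))^2 ≤ ‖w + η‖^2 := by
    have e1 : ‖w + η‖^2 = ‖w‖^2 + 2 * η * w.re + η^2 := by
      rw [← Complex.normSq_eq_norm_sq, ← Complex.normSq_eq_norm_sq, Complex.normSq_apply, Complex.normSq_apply]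
      simp; ring
    have e2 : w.re = A * ‖w‖^2 := by rw [hAeq]; field_simp
    rw [mul_pow, ← Real.exp_nat_mul, e1, e2]
    have h5 : (η * A)^2 ≤ η * ((j:ℝ)^2)⁻¹ := by
      have : A^2 ≤ ((j:ℝ)^2)⁻¹ := by
        rw [← inv_pow]; rw [one_div] at hA1; gcongr
      rw [mul_pow]
      exact mul_le_mul (by nlinarith) this (by positivity) h0
    have h6 : Real.exp ((2:ℕ) * (η * (1 / j - (‖z‖ + 1) * ((j:ℝ)^2)⁻¹))) ≤ 1 + 2 * (η * A) := by
      refine le_trans (Real.exp_le_exp.2 ?_) hexp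
      push_cast
      have := mul_le_mul_of_nonneg_left ha h0
      nlinarith
    have := mul_le_mul_of_nonneg_left h6 (by positivity : 0 ≤ ‖w‖^2)
    nlinarith [sq_nonneg η]
  have := abs_le_of_sq_le_sq hsq (norm_nonneg _)
  rw [show z + η + j = w + η by rw [hw]; ring]
  exact (abs_le.1 this).2

lemma Gamma_ratio_upper (z : ℂ) (hz : 0 < z.re) (η : ℝ) (h0 : 0 ≤ η) (h1 : η ≤ 1) :
    ‖Complex.Gamma (z + η)‖ ≤ Real.exp (η * (Real.log (2 + ‖z‖) + 2)) * ‖Complex.Gamma z‖ := by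
  have t1 := (Complex.GammaSeq_tendsto_Gamma (z + η)).norm
  have t2 := ((Complex.GammaSeq_tendsto_Gamma z).norm).const_mul (Real.exp (η * (Real.log (2 + ‖z‖) + 2)))
  refine le_of_tendsto_of_tendsto t1 t2 ?_
  set k := ⌈‖z‖⌉₊ with hk
  have hk1 : ‖z‖ ≤ k := Nat.le_ceil _
  have hk2 : (k:ℝ) < ‖z‖ + 1 := Nat.ceil_lt_add_one (norm_nonneg z)
  filter_upwards [eventually_ge_atTop (k+1)] with n hn
  have hn0 : 0 < n := by omega
  have hnR : (0:ℝ) < n := by exact_mod_cast hn0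
  have hne : ∀ (w : ℂ), 0 < w.re → ∀ j : ℕ, 0 < ‖w + j‖ := by
    intro w hw j
    rw [norm_pos_iff]; intro h
    have := congrArg Complex.re h
    simp at this
    linarith [(Nat.cast_nonneg j : (0:ℝ) ≤ j)]
  have hzη : 0 < (z + η).re := by simp; linarith
  have key : (n:ℝ)^η * ∏ j ∈ Finset.range (n+1), ‖z + j‖ ≤
      Real.exp (η * (Real.log (2 + ‖z‖) + 2)) * ∏ j ∈ Finset.range (n+1), ‖z + η + j‖ := by
    rw [← Finset.prod_range_mul_prod_Ico _ (by omega : k+1 ≤ n+1), ← Finset.prod_range_mul_prod_Ico _ (by omega : k+1 ≤ n+1)]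
    have p1 : ∏ j ∈ Finset.range (k+1), ‖z + j‖ ≤ ∏ j ∈ Finset.range (k+1), ‖z + η + j‖ := by
      refine Finset.prod_le_prod (fun j _ => norm_nonneg _) fun j _ => ?_
      refine abs_le_of_sq_le_sq ?_ (norm_nonneg _) |> abs_le.1 |>.2
      rw [← Complex.normSq_eq_norm_sq, ← Complex.normSq_eq_norm_sq, Complex.normSq_apply, Complex.normSq_apply]
      simp
      nlinarith [(Nat.cast_nonneg j : (0:ℝ) ≤ j), mul_nonneg h0 hz.le, mul_nonneg h0 (Nat.cast_nonneg j : (0:ℝ) ≤ j)]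
    have p2 : (∏ j ∈ Finset.Ico (k+1) (n+1), ‖z + j‖) * Real.exp (η * (Real.log n - Real.log (2 + ‖z‖) - 2)) ≤ ∏ j ∈ Finset.Ico (k+1) (n+1), ‖z + η + j‖ := by
      refine le_trans ?_ (Finset.prod_le_prod (fun j _ => by positivity) fun j hj => factor_lower z hz η h0 h1 j (by have := (Finset.mem_Ico.1 hj).1; omega))
      rw [Finset.prod_mul_distrib, ← Real.exp_sum, ← mul_sum, Finset.sum_sub_distrib, ← mul_sum]
      have a1 := harm_lower (k+1) n (by omega) hn
      have a2 : ∑ j ∈ Finset.Ico (k+1) (n+1), ((j:ℝ)^2)⁻¹ ≤ 2 / ((k:ℝ)+1) := by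
        have : Finset.Ico (k+1) (n+1) = Finset.Ioo k (n+1) := by ext; simp
        rw [this]; exact sum_Ioo_inv_sq_le k (n+1)
      have a3 : (‖z‖+1) * ∑ j ∈ Finset.Ico (k+1) (n+1), ((j:ℝ)^2)⁻¹ ≤ 2 := by
        calc _ ≤ ((k:ℝ)+1) * (2 / ((k:ℝ)+1)) := by gcongr
          _ = 2 := by field_simp
      have a4 : Real.log n ≤ Real.log (n+1) := Real.log_le_log hnR (by linarith)
      have a5 : Real.log ((k+1 : ℕ):ℝ) ≤ Real.log (2 + ‖z‖) := Real.log_le_log (by positivity) (by push_cast; linarith)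
      have a6 : Real.log n - Real.log (2 + ‖z‖) - 2 ≤ ∑ j ∈ Finset.Ico (k+1) (n+1), (1:ℝ) / j - (‖z‖+1) * ∑ j ∈ Finset.Ico (k+1) (n+1), ((j:ℝ)^2)⁻¹ := by linarith
      exact mul_le_mul_of_nonneg_left (Real.exp_le_exp.2 (mul_le_mul_of_nonneg_left a6 h0)) (by positivity)
    have e : (n:ℝ)^η = Real.exp (η * (Real.log (2 + ‖z‖) + 2)) * Real.exp (η * (Real.log n - Real.log (2 + ‖z‖) - 2)) := by
      rw [← Real.exp_add, Real.rpow_def_of_pos hnR]; congr 1; ring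
    rw [e]
    calc _ = Real.exp (η * (Real.log (2 + ‖z‖) + 2)) * ((∏ j ∈ Finset.range (k+1), ‖z + j‖) * ((∏ j ∈ Finset.Ico (k+1) (n+1), ‖z + j‖) * Real.exp (η * (Real.log n - Real.log (2 + ‖z‖) - 2)))) := by ring
      _ ≤ _ := by
        apply mul_le_mul_of_nonneg_left _ (by positivity)
        exact mul_le_mul p1 p2 (by positivity) (by positivity)
  have P1 : 0 < ∏ j ∈ Finset.range (n+1), ‖z + j‖ := Finset.prod_pos fun j _ => hne z hz j
  have P2 : 0 < ∏ j ∈ Finset.range (n+1), ‖z + η + j‖ := Finset.prod_pos fun j _ => hne _ hzη j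
  simp only [Complex.GammaSeq, norm_div, norm_mul, norm_prod, Complex.norm_natCast_cpow_of_pos hn0, Complex.norm_natCast]
  rw [div_le_iff₀ P2, mul_div_assoc', div_mul_eq_mul_div, le_div_iff₀ P1]
  have : ((n:ℝ)^(z + η).re) = (n:ℝ)^z.re * (n:ℝ)^η := by
    rw [← rpow_add hnR]; simp
  rw [this]
  have := mul_le_mul_of_nonneg_left key (by positivity : 0 ≤ (n:ℝ)^z.re * (Nat.factorial n : ℝ))
  linarith

/-- crude bound for the inverse ratio -/
lemma Gamma_ratio_lower (η x0 : ℝ) (h0 : 0 < η) (hx0 : 0 < x0) : ∃ C : ℝ, 0 < C ∧ ∀ z : ℂ, x0 ≤ z.re →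
    ‖Complex.Gamma z‖ ≤ C * ‖Complex.Gamma (z + η)‖ := by
  set B : ℝ := ∫ x : ℝ in (0:ℝ)..1, ‖(x : ℂ) ^ ((x0:ℂ) - 1) * (1 - (x : ℂ)) ^ ((η:ℂ) - 1)‖ with hB
  have hG : 0 < ‖Complex.Gamma η‖ := by
    rw [norm_pos_iff]; exact Complex.Gamma_ne_zero_of_re_pos (by simpa using h0)
  have hB0 : 0 ≤ B := intervalIntegral.integral_nonneg zero_le_one fun x _ => norm_nonneg _
  refine ⟨(B + 1) / ‖Complex.Gamma η‖, by positivity, fun z hz => ?_⟩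
  have h := Complex.Gamma_mul_Gamma_eq_betaIntegral (s := z) (t := η) (by linarith) (by simpa using h0)
  have hb : ‖Complex.betaIntegral z η‖ ≤ B := by
    rw [Complex.betaIntegral, hB]
    refine intervalIntegral.norm_integral_le_of_norm_le zero_le_one ?_ ?_
    · have hne : ∀ᵐ x : ℝ, x ≠ 1 := by simp [ae_iff]
      filter_upwards [hne] with x hx1 hx
      rw [norm_mul, norm_mul]
      gcongr ?_ * _
      rw [Complex.norm_cpow_eq_rpow_re_of_pos hx.1, Complex.norm_cpow_eq_rpow_re_of_pos hx.1]
      exact Real.rpow_le_rpow_of_exponent_ge hx.1 hx.2 (by simp; linarith)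
    · exact (Complex.betaIntegral_convergent (by simpa using hx0) (by simpa using h0)).norm
  have h2 := congrArg norm h
  rw [norm_mul, norm_mul] at h2
  rw [div_mul_eq_mul_div, le_div_iff₀ hG, h2, mul_comm]
  gcongr
  linarith

/-- Gamma ratio for `Gammaℝ`. -/
lemma GammaR_ratio_upper (w : ℂ) (hw : 0 < w.re) (η : ℝ) (h0 : 0 ≤ η) (h1 : η ≤ 1) :
    ‖Complex.Gammaℝ (w + η)‖ ≤ Real.exp (η * (Real.log (2 + ‖w‖) + 2)) * ‖Complex.Gammaℝ w‖ := by
  rw [Complex.Gammaℝ_def, Complex.Gammaℝ_def, norm_mul, norm_mul,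
    Complex.norm_cpow_eq_rpow_re_of_pos Real.pi_pos, Complex.norm_cpow_eq_rpow_re_of_pos Real.pi_pos]
  have h := Gamma_ratio_upper (w/2) (by simp; linarith) (η/2) (by linarith) (by linarith)
  have e : (w + η) / 2 = w/2 + ((η/2 : ℝ):ℂ) := by push_cast; ring
  rw [e]
  have hl : Real.log (2 + ‖w/2‖) ≤ Real.log (2 + ‖w‖) := by
    apply Real.log_le_log (by positivity)
    have : ‖w/2‖ = ‖w‖/2 := by simp
    rw [this]; linarith [norm_nonneg w]
  have hl0 : 0 ≤ Real.log (2 + ‖w‖) := Real.log_nonneg (by linarith [norm_nonneg w])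
  have h3 : Real.exp (η / 2 * (Real.log (2 + ‖w/2‖) + 2)) ≤ Real.exp (η * (Real.log (2 + ‖w‖) + 2)) := by
    apply Real.exp_le_exp.2; nlinarith
  have h4 : π ^ (-(w + η) / 2).re ≤ π ^ (-w/2).re := by
    apply rpow_le_rpow_of_exponent_le (by linarith [Real.pi_gt_three])
    simp; linarith
  calc _ ≤ π ^ (-w/2).re * (Real.exp (η * (Real.log (2 + ‖w‖) + 2)) * ‖Complex.Gamma (w/2)‖) := by
        gcongr
        exact h.trans (by gcongr)
    _ = _ := by ring

lemma GammaR_ratio_lower (η x0 : ℝ) (h0 : 0 < η) (hx0 : 0 < x0) : ∃ C : ℝ, 0 < C ∧ ∀ z : ℂ, x0 ≤ z.re →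
    ‖Complex.Gammaℝ z‖ ≤ C * ‖Complex.Gammaℝ (z + η)‖ := by
  obtain ⟨C, hC, h⟩ := Gamma_ratio_lower (η/2) (x0/2) (by linarith) (by linarith)
  refine ⟨C * π ^ (η/2), by positivity, fun z hz => ?_⟩
  rw [Complex.Gammaℝ_def, Complex.Gammaℝ_def, norm_mul, norm_mul,
    Complex.norm_cpow_eq_rpow_re_of_pos Real.pi_pos, Complex.norm_cpow_eq_rpow_re_of_pos Real.pi_pos]
  have h2 := h (z/2) (by simp; linarith)
  have e : (z + η) / 2 = z/2 + ((η/2 : ℝ):ℂ) := by push_cast; ring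
  have e2 : π ^ (-z/2).re = π ^ (η/2) * π ^ (-(z + η) / 2).re := by
    rw [← rpow_add Real.pi_pos]; congr 1; simp; ring
  rw [e, e2]
  have := mul_le_mul_of_nonneg_left h2 (by positivity : 0 ≤ π ^ (η/2) * π ^ (-(z + η) / 2).re)
  linarith

section
open scoped ComplexConjugate
variable {q : ℕ} [NeZero q]

lemma L_conj (χ : DirichletCharacter ℂ q) (h1 : χ ≠ 1) (s : ℂ) :
    DirichletCharacter.LFunction χ⁻¹ (conj s) = conj (DirichletCharacter.LFunction χ s) := by
  have h1' : χ⁻¹ ≠ 1 := by simpa using h1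
  have d1 := DirichletCharacter.differentiable_LFunction h1
  have d2 := DirichletCharacter.differentiable_LFunction h1'
  have d3 : Differentiable ℂ (fun s => conj (DirichletCharacter.LFunction χ (conj s))) := by
    intro z
    have := (d1 (conj z)).conj_conj
    simpa [Function.comp_def] using this
  have key : (DirichletCharacter.LFunction χ⁻¹) = (fun s => conj (DirichletCharacter.LFunction χ (conj s))) := by
    refine AnalyticOnNhd.eq_of_eventuallyEq (z₀ := 2) (fun z _ => d2.analyticAt z) (fun z _ => d3.analyticAt z) ?_
    have ho : IsOpen {z : ℂ | 1 < z.re} := isOpen_lt continuous_const Complex.continuous_re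
    filter_upwards [ho.mem_nhds (by simp : (2:ℂ) ∈ {z : ℂ | 1 < z.re})] with z hz
    have hz : 1 < z.re := hz
    rw [DirichletCharacter.LFunction_eq_LSeries _ hz, DirichletCharacter.LFunction_eq_LSeries _ (by simpa using hz)]
    rw [LSeries, LSeries, Complex.conj_tsum]
    congr 1; ext n
    rcases eq_or_ne n 0 with rfl | hn
    · simp
    rw [LSeries.term_of_ne_zero hn, LSeries.term_of_ne_zero hn, map_div₀]
    congr 1
    · rw [← MulChar.star_apply']; rfl
    · have := Complex.cpow_conj (n:ℂ) z ?_
      · rw [this]; simp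
      · rw [Complex.natCast_arg]; exact Real.pi_pos.ne
  have := congrFun key (conj s)
  simpa using this

lemma gammaFactor_form (χ : DirichletCharacter ℂ q) : ∃ a : ℝ, (a = 0 ∨ a = 1) ∧
    ∀ s, DirichletCharacter.gammaFactor χ s = Complex.Gammaℝ (s + a) ∧
    DirichletCharacter.gammaFactor χ⁻¹ s = Complex.Gammaℝ (s + a) := by
  have hinv : χ⁻¹ (-1) = conj (χ (-1)) := by rw [← MulChar.star_apply']; rfl
  rcases χ.even_or_odd with h | h
  · refine ⟨0, Or.inl rfl, fun s => ?_⟩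
    have h' : (χ⁻¹).Even := by rw [DirichletCharacter.Even, hinv, h]; simp
    rw [h.gammaFactor_def, h'.gammaFactor_def]; simp
  · refine ⟨1, Or.inr rfl, fun s => ?_⟩
    have h' : (χ⁻¹).Odd := by rw [DirichletCharacter.Odd, hinv, h]; simp
    rw [h.gammaFactor_def, h'.gammaFactor_def]; simp

lemma GammaR_conj_norm (s : ℂ) : ‖Complex.Gammaℝ (conj s)‖ = ‖Complex.Gammaℝ s‖ := by
  rw [Complex.Gammaℝ_def, Complex.Gammaℝ_def, norm_mul, norm_mul,
    Complex.norm_cpow_eq_rpow_re_of_pos Real.pi_pos, Complex.norm_cpow_eq_rpow_re_of_pos Real.pi_pos]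
  have : (conj s : ℂ) / 2 = conj (s / 2) := by rw [map_div₀, map_ofNat]
  rw [this, Complex.Gamma_conj, Complex.norm_conj]
  simp

/-- Symmetric form of the functional equation, in absolute value. -/
lemma FE_norm (χ : DirichletCharacter ℂ q) (h1 : χ ≠ 1) (hp : χ.IsPrimitive) (hRH : dirichletRH χ) :
    ∃ a : ℝ, (a = 0 ∨ a = 1) ∧ ∀ s : ℂ, 0 < s.re → s.re < 1 →
      ‖DirichletCharacter.LFunction χ (1 - conj s)‖ * ‖Complex.Gammaℝ (1 - conj s + a)‖ =
      (q:ℝ) ^ (s.re - 1/2) * (‖DirichletCharacter.LFunction χ s‖ * ‖Complex.Gammaℝ (s + a)‖) := by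
  obtain ⟨a, ha, hg⟩ := gammaFactor_form χ
  refine ⟨a, ha, ?_⟩
  have ha0 : 0 ≤ a := by rcases ha with rfl | rfl <;> norm_num
  have hq1 : q ≠ 1 := by rintro rfl; exact h1 (Subsingleton.elim _ _)
  have hq0 : 0 < q := NeZero.pos q
  have hG0 : ∀ s : ℂ, 0 < s.re → Complex.Gammaℝ (s + a) ≠ 0 := by
    intro s hs
    apply Complex.Gammaℝ_ne_zero_of_re_pos
    simp; linarith
  have hp' : (χ⁻¹).IsPrimitive := by
    rw [DirichletCharacter.IsPrimitive] at hp ⊢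
    refine Eq.trans ?_ hp
    have e : ∀ d, (χ⁻¹).FactorsThrough d ↔ χ.FactorsThrough d := by
      intro d
      have : ∀ ψ : DirichletCharacter ℂ q, ψ.FactorsThrough d → (ψ⁻¹).FactorsThrough d := by
        rintro ψ ⟨hd, ψ0, h⟩
        exact ⟨hd, ψ0⁻¹, by rw [h, map_inv]⟩
      exact ⟨fun h => by simpa using this _ h, this _⟩
    simp only [DirichletCharacter.conductor, DirichletCharacter.conductorSet, e]
  have c1 : ∀ s : ℂ, 0 < s.re → ‖DirichletCharacter.completedLFunction χ s‖ = ‖DirichletCharacter.LFunction χ s‖ * ‖Complex.Gammaℝ (s + a)‖ := by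
    intro s hs
    rw [DirichletCharacter.LFunction_eq_completed_div_gammaFactor χ s (Or.inr hq1), (hg s).1, ← norm_mul,
      div_mul_cancel₀ _ (hG0 s hs)]
  have c2 : ∀ s : ℂ, 0 < s.re → ‖DirichletCharacter.completedLFunction χ⁻¹ (conj s)‖ = ‖DirichletCharacter.LFunction χ s‖ * ‖Complex.Gammaℝ (s + a)‖ := by
    intro s hs
    have e : ‖DirichletCharacter.LFunction χ s‖ = ‖DirichletCharacter.LFunction χ⁻¹ (conj s)‖ := by
      rw [L_conj χ h1, Complex.norm_conj]
    have e2 : conj (s + a) = conj s + a := by simp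
    rw [e, DirichletCharacter.LFunction_eq_completed_div_gammaFactor χ⁻¹ (conj s) (Or.inr hq1), (hg (conj s)).2,
      ← GammaR_conj_norm (s + a), e2, ← norm_mul, div_mul_cancel₀ _ (hG0 _ (by simpa using hs))]
  have hFE : ∀ s, ‖DirichletCharacter.completedLFunction χ (1 - s)‖ = (q:ℝ) ^ (s.re - 1/2) * ‖DirichletCharacter.rootNumber χ‖ * ‖DirichletCharacter.completedLFunction χ⁻¹ s‖ := by
    intro s
    rw [hp.completedLFunction_one_sub, norm_mul, norm_mul, Complex.norm_natCast_cpow_of_pos hq0]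
    congr 3; simp
  have hFE' : ∀ s, ‖DirichletCharacter.completedLFunction χ⁻¹ (1 - s)‖ = (q:ℝ) ^ (s.re - 1/2) * ‖DirichletCharacter.rootNumber χ⁻¹‖ * ‖DirichletCharacter.completedLFunction χ s‖ := by
    intro s
    rw [hp'.completedLFunction_one_sub, norm_mul, norm_mul, Complex.norm_natCast_cpow_of_pos hq0, inv_inv]
    congr 3; simp
  have hqR : (0:ℝ) < q := by exact_mod_cast hq0
  have hW : ‖DirichletCharacter.rootNumber χ‖ = 1 := by
    have s34 : (conj ((3/4:ℝ):ℂ)) = ((3/4:ℝ):ℂ) := Complex.conj_ofReal _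
    have s14 : (conj ((1/4:ℝ):ℂ)) = ((1/4:ℝ):ℂ) := Complex.conj_ofReal _
    have e34 : (1:ℂ) - ((3/4:ℝ):ℂ) = ((1/4:ℝ):ℂ) := by push_cast; norm_num
    have e14 : (1:ℂ) - ((1/4:ℝ):ℂ) = ((3/4:ℝ):ℂ) := by push_cast; norm_num
    have f1 := hFE ((3/4:ℝ):ℂ)
    have f2 := hFE' ((3/4:ℝ):ℂ)
    have f3 := hFE' ((1/4:ℝ):ℂ)
    have g1 := c1 ((3/4:ℝ):ℂ) (by norm_num)
    have g2 := c2 ((3/4:ℝ):ℂ) (by norm_num)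
    have g3 := c1 ((1/4:ℝ):ℂ) (by norm_num)
    have g4 := c2 ((1/4:ℝ):ℂ) (by norm_num)
    rw [s34, ← g1] at g2
    rw [s14, ← g3] at g4
    rw [e34, g2, Complex.ofReal_re] at f1
    rw [e34, g4, Complex.ofReal_re] at f2
    rw [e14, g2, Complex.ofReal_re] at f3
    have hne : ‖DirichletCharacter.completedLFunction χ ((3/4:ℝ):ℂ)‖ ≠ 0 := by
      rw [g1]
      apply mul_ne_zero
      · rw [norm_ne_zero_iff]; apply L_ne_zero χ h1 hRH; norm_num
      · rw [norm_ne_zero_iff]; apply hG0; norm_num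
    set b := ‖DirichletCharacter.completedLFunction χ ((3/4:ℝ):ℂ)‖
    set d := ‖DirichletCharacter.completedLFunction χ ((1/4:ℝ):ℂ)‖
    set c := (q:ℝ) ^ ((3/4:ℝ) - 1/2)
    have hc : (q:ℝ) ^ ((1/4:ℝ) - 1/2) = c⁻¹ := by
      rw [← Real.rpow_neg hqR.le]; norm_num
    have hc0 : c ≠ 0 := (Real.rpow_pos_of_pos hqR _).ne'
    rw [hc] at f3
    set W := ‖DirichletCharacter.rootNumber χ‖
    set W' := ‖DirichletCharacter.rootNumber χ⁻¹‖
    have hWW : W = W' := by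
      have : c * W * b = c * W' * b := by rw [← f1, ← f2]
      exact mul_left_cancel₀ hc0 (mul_right_cancel₀ hne this)
    rw [f1, ← hWW] at f3
    have : b * 1 = b * (W * W) := by
      rw [mul_one]; nth_rewrite 1 [f3]; field_simp
    have := mul_left_cancel₀ hne this
    have hW0 : 0 ≤ W := norm_nonneg _
    nlinarith
  intro s hs0 hs1
  have h := hFE (conj s)
  rw [hW, c2 s hs0, c1 _ (by simp; linarith)] at h
  simpa using h

/-- Main monotonicity inequality. -/
lemma L_mono (χ : DirichletCharacter ℂ q) (h1 : χ ≠ 1) (hp : χ.IsPrimitive) (hRH : dirichletRH χ)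
    {η : ℝ} (h0 : 0 < η) (hη : η ≤ 1/2) {s : ℂ} (hs : 1/2 - η/2 ≤ s.re) :
    ‖DirichletCharacter.LFunction χ s‖ ≤ Real.exp (η * (Real.log q / 2 + Real.log (2 + ‖s‖) + 3)) *
      ‖DirichletCharacter.LFunction χ (s + η)‖ := by
  obtain ⟨a, ha, hFE⟩ := FE_norm χ h1 hp hRH
  have ha0 : 0 ≤ a := by rcases ha with rfl | rfl <;> norm_num
  have ha1 : a ≤ 1 := by rcases ha with rfl | rfl <;> norm_num
  have hqR : (1:ℝ) ≤ q := by exact_mod_cast NeZero.pos q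
  set L := DirichletCharacter.LFunction χ with hL
  set c : ℝ := 1/2 - η/2 with hc
  have hc4 : 1/4 ≤ c := by rw [hc]; linarith
  have dL : Differentiable ℂ L := DirichletCharacter.differentiable_LFunction h1
  have hL0 : ∀ z : ℂ, 1/2 < z.re → L z ≠ 0 := fun z hz => L_ne_zero χ h1 hRH hz
  have hG0 : ∀ z : ℂ, 0 < z.re → Complex.Gammaℝ (z + a) ≠ 0 := by
    intro s hs
    apply Complex.Gammaℝ_ne_zero_of_re_pos
    simp; linarith
  have dG : ∀ z : ℂ, 0 < z.re → DifferentiableAt ℂ (fun z => Complex.Gammaℝ (z + a)) z := by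
    intro z hz
    have h := differentiable_Gammaℝ_inv (z + a)
    have h2 : DifferentiableAt ℂ (fun z => ((Complex.Gammaℝ (z + a))⁻¹)⁻¹) z := by
      refine DifferentiableAt.inv ?_ (inv_ne_zero (hG0 z hz))
      exact h.comp (f := fun z => z + (a:ℂ)) z (by fun_prop)
    simpa using h2
  obtain ⟨K, hK, hKr⟩ := GammaR_ratio_lower η (1/4) h0 (by norm_num)
  obtain ⟨B, hB, hBl⟩ := L_log_bounds χ h1 hRH (ε := η/2) (by linarith) (by linarith)
  set Q : ℝ := (q:ℝ) ^ (-(η/2)) with hQ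
  have hQ0 : 0 < Q := Real.rpow_pos_of_pos (by linarith) _
  set h : ℂ → ℂ := fun z => Q * (L (z + c) * Complex.Gammaℝ (z + c + a)) / (L (z + c + η) * Complex.Gammaℝ (z + c + η + a)) with hh
  have hn : ∀ z, ‖h z‖ = Q * (‖L (z + c)‖ * ‖Complex.Gammaℝ (z + c + a)‖) / (‖L (z + c + η)‖ * ‖Complex.Gammaℝ (z + c + η + a)‖) := by
    intro z
    simp only [hh, norm_div, norm_mul, Complex.norm_real, Real.norm_eq_abs, abs_of_pos hQ0]
  have hd : ∀ z : ℂ, 0 ≤ z.re → DifferentiableAt ℂ h z := by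
    intro z hz
    have e1 : 0 < (z + c).re := by simp; linarith
    have e2 : 1/2 < (z + c + η).re := by simp; linarith
    apply DifferentiableAt.div
    · apply DifferentiableAt.const_mul
      apply DifferentiableAt.mul
      · exact (dL _).comp (f := fun z => z + (c:ℂ)) z (by fun_prop)
      · exact (dG _ e1).comp (f := fun z => z + (c:ℂ)) z (by fun_prop)
    · apply DifferentiableAt.mul
      · exact (dL _).comp (f := fun z => z + (c:ℂ) + (η:ℂ)) z (by fun_prop)
      · exact (dG _ (by linarith)).comp (f := fun z => z + (c:ℂ) + (η:ℂ)) z (by fun_prop)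
    · exact mul_ne_zero (hL0 _ e2) (hG0 _ (by linarith))
  have hbd : ∀ z : ℂ, 0 ≤ z.re → ‖h z‖ ≤ Q * K * (‖L (z + c)‖ / ‖L (z + c + η)‖) := by
    intro z hz
    have e1 : 0 < (z + c).re := by simp; linarith
    have e2 : 1/2 < (z + c + η).re := by simp; linarith
    have k := hKr (z + c + a) (by simp; linarith)
    rw [hn]
    have p1 : 0 < ‖L (z + c + η)‖ := norm_pos_iff.2 (hL0 _ e2)
    have p2 : 0 < ‖Complex.Gammaℝ (z + c + η + a)‖ := norm_pos_iff.2 (hG0 _ (by linarith))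
    rw [show z + c + a + η = z + c + η + a by ring] at k
    calc _ ≤ Q * (‖L (z + c)‖ * (K * ‖Complex.Gammaℝ (z + c + η + a)‖)) / (‖L (z + c + η)‖ * ‖Complex.Gammaℝ (z + c + η + a)‖) := by gcongr
      _ = _ := by field_simp
  have hPL : ∀ z : ℂ, 0 ≤ z.re → ‖h z‖ ≤ 1 := by
    intro z hz
    refine PhragmenLindelof.right_half_plane_of_bounded_on_real ?_ ?_ ?_ ?_ hz
    · apply DifferentiableOn.diffContOnCl
      intro z hz
      have : 0 ≤ z.re := by
        have h3 := Complex.closure_setOfPred_lt_re 0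
        rw [h3] at hz; exact hz
      exact (hd z this).differentiableWithinAt
    · refine ⟨1, by norm_num, 3 + B, ?_⟩
      refine Asymptotics.IsBigO.of_bound (Q * K * (q * 4) * Real.exp (4 + 3 * B)) ?_
      rw [eventually_inf_principal]
      refine Eventually.of_forall fun z hz => ?_
      have hz : 0 < z.re := hz
      refine (hbd z hz.le).trans ?_
      have e1 : 1/4 ≤ (z + c).re := by simp; linarith
      have u := norm_LFunction_le χ h1 (s := z + c) (by linarith)
      have l := (hBl (z + c + η) (by simp; linarith)).1
      have cc : ‖(c:ℂ)‖ ≤ 1 := by rw [Complex.norm_real, Real.norm_eq_abs, abs_of_pos (by linarith)]; linarith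
      have ch : ‖(η:ℂ)‖ ≤ 1 := by rw [Complex.norm_real, Real.norm_eq_abs, abs_of_pos (by linarith)]; linarith
      have n1 : ‖z + c‖ ≤ ‖z‖ + 1 := (norm_add_le _ _).trans (by linarith)
      have n2 : ‖z + c + 1‖ ≤ ‖z‖ + 2 := (norm_add_le _ _).trans (by simp; linarith)
      have n3 : ‖z + c + η‖ ≤ ‖z‖ + 2 := (norm_add_le _ _).trans (by linarith)
      have u2 : ‖L (z + c)‖ ≤ (q * 4) * Real.exp (3 + 2 * ‖z‖) := by
        refine u.trans ?_
        rw [div_le_iff₀ (by linarith)]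
        have x1 : ‖z‖ + 1 ≤ Real.exp ‖z‖ := Real.add_one_le_exp _
        have x2 : ‖z‖ + 2 ≤ Real.exp (‖z‖ + 1) := by linarith [Real.add_one_le_exp (‖z‖ + 1)]
        have x3 : ‖z + c‖ * ‖z + c + 1‖ ≤ Real.exp (3 + 2 * ‖z‖) := by
          calc _ ≤ Real.exp ‖z‖ * Real.exp (‖z‖ + 1) := by gcongr <;> linarith
            _ ≤ _ := by rw [← Real.exp_add]; apply Real.exp_le_exp.2; linarith
        have := mul_le_mul_of_nonneg_left x3 (by linarith : (0:ℝ) ≤ q)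
        have y : (q:ℝ) * 4 * Real.exp (3 + 2 * ‖z‖) * (1/4) ≤ (q:ℝ) * 4 * Real.exp (3 + 2 * ‖z‖) * (z + c).re :=
          mul_le_mul_of_nonneg_left e1 (by positivity)
        linarith
      have l2 : Real.exp (-(B * (‖z‖ + 3))) ≤ ‖L (z + c + η)‖ := by
        refine le_trans (Real.exp_le_exp.2 ?_) l
        have := Real.log_le_sub_one_of_pos (by positivity : 0 < 2 + ‖z + c + η‖)
        have : Real.log (2 + ‖z + c + η‖) ≤ ‖z‖ + 3 := by linarith
        nlinarith
      have l3 : ‖L (z + c)‖ / ‖L (z + c + η)‖ ≤ (q * 4) * Real.exp (4 + 3 * B) * Real.exp ((3 + B) * ‖z‖) := by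
        rw [div_le_iff₀ (lt_of_lt_of_le (Real.exp_pos _) l2)]
        calc _ ≤ (q * 4) * Real.exp (3 + 2 * ‖z‖) := u2
          _ ≤ (q * 4) * Real.exp (4 + 3 * B) * Real.exp ((3 + B) * ‖z‖) * Real.exp (-(B * (‖z‖ + 3))) := by
            rw [mul_assoc ((q:ℝ)*4), mul_assoc ((q:ℝ)*4), ← Real.exp_add, ← Real.exp_add]
            refine mul_le_mul_of_nonneg_left (Real.exp_le_exp.2 ?_) (by positivity)
            nlinarith [norm_nonneg z]
          _ ≤ _ := by gcongr
      rw [Real.norm_eq_abs, abs_of_pos (Real.exp_pos _), Real.rpow_one]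
      have := mul_le_mul_of_nonneg_left l3 (by positivity : 0 ≤ Q * K)
      linarith
    · refine ⟨Q * K * (2 / 0.3), ?_⟩
      rw [eventually_map]
      filter_upwards [eventually_ge_atTop 2] with x hx
      refine (hbd x (by simp; linarith)).trans ?_
      have a1 := L_upper_two χ (s := (x:ℂ) + c) (by simp; linarith)
      have a2 := L_lower_two χ (s := (x:ℂ) + c + η) (by simp; linarith)
      gcongr
    · intro y
      rw [hn]
      have f := hFE (y * I + c) (by simp; linarith) (by simp; linarith)
      have e : 1 - conj ((y:ℂ) * I + c) = y * I + c + η := by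
        rw [map_add, map_mul, Complex.conj_ofReal, Complex.conj_ofReal, Complex.conj_I, hc]; push_cast; ring
      rw [e] at f
      rw [f]
      have e2 : (((y:ℂ) * I + c).re - 1/2) = -(η/2) := by simp [hc]
      rw [e2]
      exact div_self_le_one _
  have k := hPL (s - c) (by simp; linarith)
  rw [hn, sub_add_cancel] at k
  have e2 : 1/2 < (s + η).re := by simp; linarith
  have p1 : 0 < ‖L (s + η)‖ := norm_pos_iff.2 (hL0 _ e2)
  have p2 : 0 < ‖Complex.Gammaℝ (s + η + a)‖ := norm_pos_iff.2 (hG0 _ (by linarith))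
  have p3 : 0 < ‖Complex.Gammaℝ (s + a)‖ := norm_pos_iff.2 (hG0 _ (by linarith))
  rw [div_le_one (by positivity)] at k
  have g := GammaR_ratio_upper (s + a) (by simp; linarith) η h0.le (by linarith)
  rw [show s + a + η = s + η + a by ring] at g
  have na : ‖s + a‖ ≤ ‖s‖ + 1 := (norm_add_le _ _).trans (by
    rw [Complex.norm_real, Real.norm_eq_abs, abs_of_nonneg ha0]; linarith)
  have lg : Real.log (2 + ‖s + a‖) ≤ Real.log (2 + ‖s‖) + 1 := by
    have : 2 + ‖s + a‖ ≤ (2 + ‖s‖) * Real.exp 1 := by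
      nlinarith [Real.add_one_le_exp (1:ℝ), norm_nonneg s]
    calc _ ≤ Real.log ((2 + ‖s‖) * Real.exp 1) := Real.log_le_log (by positivity) this
      _ = _ := by rw [Real.log_mul (by positivity) (by positivity), Real.log_exp]
  have g2 : ‖Complex.Gammaℝ (s + η + a)‖ ≤ Real.exp (η * (Real.log (2 + ‖s‖) + 3)) * ‖Complex.Gammaℝ (s + a)‖ := by
    refine g.trans (mul_le_mul_of_nonneg_right (Real.exp_le_exp.2 ?_) p3.le)
    exact mul_le_mul_of_nonneg_left (by linarith) h0.le
  have hQe : Q = Real.exp (-(η * (Real.log q / 2))) := by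
    rw [hQ, Real.rpow_def_of_pos (by linarith)]; congr 1; ring
  have k2 : Q * ‖L s‖ * ‖Complex.Gammaℝ (s + a)‖ ≤ (‖L (s + η)‖ * Real.exp (η * (Real.log (2 + ‖s‖) + 3))) * ‖Complex.Gammaℝ (s + a)‖ := by
    have := mul_le_mul_of_nonneg_left g2 p1.le
    linarith
  have k3 := le_of_mul_le_mul_right k2 p3
  have : Real.exp (η * (Real.log q / 2 + Real.log (2 + ‖s‖) + 3)) = Q⁻¹ * Real.exp (η * (Real.log (2 + ‖s‖) + 3)) := by
    rw [hQe, ← Real.exp_neg, neg_neg, ← Real.exp_add]; congr 1; ring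
  rw [this, mul_assoc, inv_mul_eq_div, le_div_iff₀ hQ0]
  linarith
end

open scoped ComplexConjugate FourierTransform

/-- `g` is a (cosine) Fourier transform of the even compactly supported function `h`. -/
def IsKer (h g : ℝ → ℝ) : Prop :=
  Continuous g ∧ (∃ C : ℝ, 0 < C ∧ ∀ v, |g v| ≤ C * (1 + v ^ 2)⁻¹) ∧
    ∀ ξ : ℝ, ∫ v : ℝ, (g v : ℂ) * Complex.exp (-(2 * π * v * ξ : ℝ) * I) = (h ξ : ℂ)

lemma ker_of (h : ℝ → ℝ) (hc : Continuous h) (he : ∀ x, h (-x) = h x) (hs : ∀ x, 1 ≤ |x| → h x = 0)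
    (C : ℝ) (hb : ∀ v : ℝ, v ≠ 0 → |∫ x in (0:ℝ)..1, h x * Real.cos (2 * π * v * x)| ≤ C / v ^ 2) :
    IsKer h (fun v => 2 * ∫ x in (0:ℝ)..1, h x * Real.cos (2 * π * v * x)) := by
  set g : ℝ → ℝ := fun v => 2 * ∫ x in (0:ℝ)..1, h x * Real.cos (2 * π * v * x) with hg
  have gc : Continuous g := by
    apply Continuous.mul continuous_const
    apply intervalIntegral.continuous_parametric_intervalIntegral_of_continuous'
    simp only [Function.uncurry_def]
    fun_prop
  have hcs : HasCompactSupport h := by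
    apply HasCompactSupport.of_support_subset_isCompact (isCompact_Icc (a := (-1:ℝ)) (b := 1))
    intro x hx
    by_contra hcon
    apply hx
    apply hs
    rw [Set.mem_Icc, ← abs_le] at hcon
    linarith
  set hC : ℝ → ℂ := fun x => (h x : ℂ) with hhC
  have hCc : Continuous hC := by fun_prop
  have hCi : Integrable hC := (hc.integrable_of_hasCompactSupport hcs).ofReal
  have hF : ∀ v, 𝓕 hC v = (g v : ℂ) := by
    intro v
    rw [Real.fourier_real_eq_integral_exp_smul]
    have cont : Continuous (fun x : ℝ => Complex.exp (↑(-2 * π * x * v) * Complex.I) • hC x) := by fun_prop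
    have hsup : Function.support (fun x : ℝ => Complex.exp (↑(-2 * π * x * v) * Complex.I) • hC x) ⊆ Set.Ioc (-1) 1 := by
      intro x hx
      by_contra hcon
      apply hx
      have : 1 ≤ |x| := by
        by_contra h2
        push Not at h2
        rw [abs_lt] at h2
        exact hcon ⟨h2.1, h2.2.le⟩
      simp [hhC, hs x this]
    rw [← intervalIntegral.integral_eq_integral_of_support_subset hsup]
    rw [← intervalIntegral.integral_add_adjacent_intervals (b := 0) (cont.intervalIntegrable _ _) (cont.intervalIntegrable _ _)]
    have e1 : ∫ x in (-1:ℝ)..0, Complex.exp (↑(-2 * π * x * v) * Complex.I) • hC x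
        = ∫ x in (0:ℝ)..1, Complex.exp (↑(2 * π * x * v) * Complex.I) • hC x := by
      have := intervalIntegral.integral_comp_neg (a := 0) (b := 1) (fun x : ℝ => Complex.exp (↑(-2 * π * x * v) * Complex.I) • hC x)
      rw [neg_zero] at this
      rw [← this]
      congr 1; ext x
      simp only [hhC, he]
      congr 3; push_cast; ring
    rw [e1, ← intervalIntegral.integral_add ((Continuous.intervalIntegrable (by fun_prop) _ _)) (cont.intervalIntegrable _ _)]
    rw [hg]
    simp only
    rw [Complex.ofReal_mul, ← intervalIntegral.integral_ofReal, ← intervalIntegral.integral_const_mul]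
    congr 1; ext x
    simp only [hhC, smul_eq_mul]
    push_cast
    rw [← add_mul]
    have := Complex.two_cos (2 * π * v * x)
    calc _ = (Complex.exp (2 * π * v * x * I) + Complex.exp (-(2 * π * v * x) * I)) * (h x : ℂ) := by
          congr 3 <;> ring
      _ = _ := by rw [← this]; ring
  set B : ℝ := ∫ x in (0:ℝ)..1, |h x| with hB
  have hB0 : 0 ≤ B := intervalIntegral.integral_nonneg zero_le_one fun x _ => abs_nonneg _
  have gB : ∀ v, |g v| ≤ 2 * B := by
    intro v
    rw [hg]; simp only
    rw [abs_mul, abs_of_pos (by norm_num : (0:ℝ) < 2)]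
    gcongr
    rw [← Real.norm_eq_abs]
    refine intervalIntegral.norm_integral_le_of_norm_le zero_le_one (ae_of_all _ fun x _ => ?_) (Continuous.intervalIntegrable (by fun_prop) _ _)
    rw [Real.norm_eq_abs, abs_mul]
    exact mul_le_of_le_one_right (abs_nonneg _) (Real.abs_cos_le_one _)
  have hgb : ∀ v, |g v| ≤ (4 * B + 4 * |C| + 1) * (1 + v ^ 2)⁻¹ := by
    intro v
    rw [← div_eq_mul_inv, le_div_iff₀ (by positivity)]
    rcases le_or_gt |v| 1 with hv | hv
    · have : v^2 ≤ 1 := by rw [← sq_abs]; nlinarith [abs_nonneg v]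
      nlinarith [gB v, abs_nonneg (g v), abs_nonneg C]
    · have hv0 : v ≠ 0 := by rintro rfl; simp at hv; linarith
      have hv2 : 1 < v^2 := by rw [← sq_abs]; nlinarith [abs_nonneg v]
      have := hb v hv0
      have h3 : |g v| ≤ 2 * (C / v^2) := by
        rw [hg]; simp only
        rw [abs_mul, abs_of_pos (by norm_num : (0:ℝ) < 2)]
        gcongr
      have h4 : |g v| * v^2 ≤ 2 * C := by
        calc _ ≤ 2 * (C / v^2) * v^2 := by gcongr
          _ = 2 * C := by field_simp
      nlinarith [abs_nonneg (g v), le_abs_self C]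
  have gi : Integrable g := by
    refine (integrable_inv_one_add_sq.const_mul (4 * B + 4 * |C| + 1)).mono' gc.aestronglyMeasurable (ae_of_all _ fun v => ?_)
    rw [Real.norm_eq_abs]; exact hgb v
  refine ⟨gc, ⟨_, by positivity, hgb⟩, fun ξ => ?_⟩
  have hFe : 𝓕 hC = fun v => (g v : ℂ) := funext hF
  have inv := congrFun (hCc.fourierInv_fourier_eq hCi (by rw [hFe]; exact gi.ofReal)) (-ξ)
  rw [Real.fourierInv_eq', hFe] at inv
  simp only [hhC, he] at inv
  rw [← inv]
  congr 1; ext v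
  rw [smul_eq_mul, mul_comm]
  congr 2
  simp only [RCLike.inner_apply, conj_trivial]
  push_cast; ring

lemma IsKer.integrable {h g : ℝ → ℝ} (H : IsKer h g) : Integrable g := by
  obtain ⟨gc, ⟨C, hC, hb⟩, _⟩ := H
  refine (integrable_inv_one_add_sq.const_mul C).mono' gc.aestronglyMeasurable (ae_of_all _ fun v => ?_)
  rw [Real.norm_eq_abs]; exact hb v

lemma IsKer.integral {h g : ℝ → ℝ} (H : IsKer h g) : ∫ v, g v = h 0 := by
  have := H.2.2 0
  simp only [mul_zero, Complex.ofReal_zero, neg_zero, zero_mul, Complex.exp_zero, mul_one] at this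
  rw [integral_complex_ofReal] at this
  exact_mod_cast this

def tri (x : ℝ) : ℝ := max (1 - |x|) 0
def tri2 (x : ℝ) : ℝ := (tri x) ^ 2

lemma tri_cont : Continuous tri := by unfold tri; fun_prop

lemma tri_int (a : ℝ) (ha : a ≠ 0) : ∫ x in (0:ℝ)..1, tri x * Real.cos (a * x) = (1 - Real.cos a) / a ^ 2 := by
  have e : ∫ x in (0:ℝ)..1, tri x * Real.cos (a * x) = ∫ x in (0:ℝ)..1, (1 - x) * Real.cos (a * x) := by
    apply intervalIntegral.integral_congr
    intro x hx
    rw [Set.uIcc_of_le zero_le_one] at hx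
    simp only [tri]
    rw [abs_of_nonneg hx.1, max_eq_left (by linarith [hx.2])]
  rw [e]
  rw [intervalIntegral.integral_eq_sub_of_hasDerivAt (f := fun x => (1 - x) * (Real.sin (a * x) / a) - Real.cos (a * x) / a ^ 2)]
  · simp; field_simp; ring
  · intro x _
    have hl : HasDerivAt (fun x : ℝ => a * x) a x := by simpa using (hasDerivAt_id x).const_mul a
    have h1 := ((hl.sin).div_const a)
    have h2 := ((hl.cos).div_const (a^2))
    have h3 := (((hasDerivAt_id x).const_sub 1).mul h1).sub h2
    refine h3.congr_deriv ?_
    simp; field_simp; ring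
  · exact Continuous.intervalIntegrable (by fun_prop) _ _

lemma tri2_int (a : ℝ) (ha : a ≠ 0) : ∫ x in (0:ℝ)..1, tri2 x * Real.cos (a * x) = 2 / a ^ 2 - 2 * Real.sin a / a ^ 3 := by
  have e : ∫ x in (0:ℝ)..1, tri2 x * Real.cos (a * x) = ∫ x in (0:ℝ)..1, (1 - x) ^ 2 * Real.cos (a * x) := by
    apply intervalIntegral.integral_congr
    intro x hx
    rw [Set.uIcc_of_le zero_le_one] at hx
    simp only [tri, tri2]
    rw [abs_of_nonneg hx.1, max_eq_left (by linarith [hx.2])]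
  rw [e]
  rw [intervalIntegral.integral_eq_sub_of_hasDerivAt (f := fun x => (1 - x) ^ 2 * (Real.sin (a * x) / a) - 2 * (1 - x) * (Real.cos (a * x) / a ^ 2) - 2 * (Real.sin (a * x) / a ^ 3))]
  · simp; field_simp; ring
  · intro x _
    have hl : HasDerivAt (fun x : ℝ => a * x) a x := by simpa using (hasDerivAt_id x).const_mul a
    have h1 := ((hl.sin).div_const a)
    have h2 := ((hl.cos).div_const (a^2))
    have h3 := ((hl.sin).div_const (a^3)).const_mul 2
    have h0 := ((hasDerivAt_id x).const_sub 1)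
    have h4 := (((h0.pow 2).mul h1).sub ((h0.const_mul 2).mul h2)).sub h3
    refine h4.congr_deriv ?_
    simp; field_simp; ring
  · exact Continuous.intervalIntegrable (by fun_prop) _ _

lemma tri_ker : ∃ g, IsKer tri g ∧ ∀ v, 0 ≤ g v := by
  have hpi := Real.pi_pos
  refine ⟨_, ker_of tri tri_cont (fun x => by simp [tri]) (fun x hx => by rw [tri, max_eq_right (by linarith)]) (2 / (2 * π)^2) ?_, ?_⟩
  · intro v hv
    have ha : 2 * π * v ≠ 0 := by positivity
    rw [tri_int _ ha, abs_div, abs_of_nonneg (sq_nonneg (2 * π * v)), abs_of_nonneg (by linarith [Real.cos_le_one (2 * π * v)])]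
    rw [div_div, ← mul_pow]
    gcongr
    linarith [Real.neg_one_le_cos (2 * π * v)]
  · intro v
    rcases eq_or_ne v 0 with rfl | hv
    · simp only [mul_zero, zero_mul, Real.cos_zero, mul_one]
      apply mul_nonneg (by norm_num)
      exact intervalIntegral.integral_nonneg zero_le_one fun x _ => le_max_right _ _
    · have ha : 2 * π * v ≠ 0 := by positivity
      rw [tri_int _ ha]
      have := Real.cos_le_one (2 * π * v)
      apply mul_nonneg (by norm_num) (div_nonneg (by linarith) (by positivity))

lemma tri2_ker : ∃ g, IsKer tri2 g := by
  have hpi := Real.pi_pos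
  refine ⟨_, ker_of tri2 (tri_cont.pow 2) (fun x => by simp [tri, tri2]) (fun x hx => by rw [tri2, tri, max_eq_right (by linarith)]; simp) (4 / (2 * π)^2) ?_⟩
  intro v hv
  have ha : 2 * π * v ≠ 0 := by positivity
  rw [tri2_int _ ha]
  set a := 2 * π * v with hadef
  have e : (4 / (2 * π)^2) / v^2 = 2 / a^2 + 2 / a^2 := by
    rw [div_div, ← mul_pow]; ring
  rw [e]
  have h1 : |2 * Real.sin a / a^3| ≤ 2 / a^2 := by
    rw [abs_div, abs_mul, abs_of_pos (by norm_num : (0:ℝ) < 2), abs_pow, ← sq_abs a]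
    have : 0 < |a| := abs_pos.2 ha
    have h2 := Real.abs_sin_le_abs (x := a)
    rw [div_le_div_iff₀ (by positivity) (by positivity)]
    have : |a|^2 * |Real.sin a| ≤ |a|^2 * |a| := by gcongr
    nlinarith
  calc _ ≤ |2 / a^2| + |2 * Real.sin a / a^3| := abs_sub _ _
    _ ≤ _ := by
      rw [abs_of_nonneg (by positivity : 0 ≤ 2 / a^2)]; linarith

lemma int_log (c : ℝ) (hc : 0 ≤ c) : Integrable (fun v : ℝ => (1 + v ^ 2)⁻¹ * Real.log (1 + c * |v|)) := by
  have hi : Integrable (fun v : ℝ => (1 + ‖v‖) ^ (-(3/2:ℝ))) := integrable_one_add_norm (by simp; norm_num)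
  refine (hi.const_mul (4 * (1 + c))).mono' ?_ (ae_of_all _ fun v => ?_)
  · apply Continuous.aestronglyMeasurable
    refine Continuous.mul (Continuous.inv₀ (by fun_prop) fun v => by positivity) (Continuous.log (by fun_prop) fun v => by positivity)
  · have hv := abs_nonneg v
    have h1 : (0:ℝ) < 1 + c * |v| := by positivity
    have hl0 : 0 ≤ Real.log (1 + c * |v|) := Real.log_nonneg (by nlinarith)
    rw [Real.norm_eq_abs, abs_of_nonneg (by positivity), Real.norm_eq_abs]
    have hl : Real.log (1 + c * |v|) ≤ 2 * (1 + c) * (1 + |v|) ^ (1/2:ℝ) := by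
      have e1 : Real.log (1 + c * |v|) ≤ Real.log ((1 + c)^2 * (1 + |v|)) := by
        apply Real.log_le_log h1; nlinarith [mul_nonneg hc hv, mul_nonneg (mul_nonneg hc hc) hv]
      have e2 : (1 + c)^2 * (1 + |v|) = ((1 + c) * (1 + |v|) ^ (1/2:ℝ))^2 := by
        rw [mul_pow, ← rpow_natCast ((1 + |v|) ^ (1/2:ℝ)), ← rpow_mul (by positivity)]; norm_num
      rw [e2, Real.log_pow] at e1
      have e3 := Real.log_le_sub_one_of_pos (by positivity : 0 < (1 + c) * (1 + |v|) ^ (1/2:ℝ))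
      push_cast at e1
      linarith
    have h2 : (1 + v^2)⁻¹ ≤ 2 * (1 + |v|) ^ (-(2:ℝ)) := by
      rw [Real.rpow_neg (by positivity), ← div_eq_mul_inv, inv_eq_one_div, div_le_div_iff₀ (by positivity) (by positivity)]
      norm_cast
      have := sq_abs v
      nlinarith [sq_nonneg (1 - |v|)]
    calc _ ≤ (2 * (1 + |v|) ^ (-(2:ℝ))) * (2 * (1 + c) * (1 + |v|) ^ (1/2:ℝ)) := by gcongr
      _ = 4 * (1 + c) * ((1 + |v|) ^ (-(2:ℝ)) * (1 + |v|) ^ (1/2:ℝ)) := by ring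
      _ = _ := by rw [← rpow_add (by positivity)]; norm_num

/-- Growth hypothesis. -/
def LogGrowth (F : ℂ → ℂ) : Prop :=
  ∀ ε : ℝ, 0 < ε → ε ≤ 1 → ∃ C : ℝ, 0 < C ∧ ∀ s : ℂ, 1/2 + ε ≤ s.re → ‖F s‖ ≤ C * Real.log (2 + ‖s‖)

lemma log_split (x y c v : ℝ) (hx : 0 ≤ x) (hc : 0 ≤ c) (hy : y ≤ x + c * |v|) (hy0 : 0 ≤ y) :
    Real.log (2 + y) ≤ Real.log (2 + x) + Real.log (1 + c * |v|) := by
  have hv := abs_nonneg v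
  rw [← Real.log_mul (by positivity) (by positivity)]
  apply Real.log_le_log (by positivity)
  nlinarith [mul_nonneg hc hv, mul_nonneg hx (mul_nonneg hc hv)]

lemma norm_shift (c v : ℝ) (hc : 0 ≤ c) : ‖((c * v : ℝ) : ℂ) * I‖ = c * |v| := by
  rw [norm_mul, Complex.norm_I, mul_one, Complex.norm_real, Real.norm_eq_abs, abs_mul, abs_of_nonneg hc]

lemma shift_growth {F : ℂ → ℂ} {h g : ℝ → ℝ} (H : IsKer h g) (hg : LogGrowth F) {ε : ℝ} (hε : 0 < ε) (hε1 : ε ≤ 1) :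
    ∃ C : ℝ, 0 < C ∧ ∀ c : ℝ, 0 ≤ c → ∀ s : ℂ, 1/2 + ε ≤ s.re → ∀ v : ℝ,
      ‖F (s + ((c * v : ℝ) : ℂ) * I)‖ ≤ C * (Real.log (2 + ‖s‖) + Real.log (1 + c * |v|)) ∧
      ‖(g v : ℂ) * F (s + ((c * v : ℝ) : ℂ) * I)‖ ≤ C * (1 + v^2)⁻¹ * (Real.log (2 + ‖s‖) + Real.log (1 + c * |v|)) := by
  obtain ⟨A, hA, hgA⟩ := H.2.1
  obtain ⟨C, hC, hF⟩ := hg ε hε hε1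
  refine ⟨A * C + C, by positivity, fun c hc s hs v => ?_⟩
  have hb : ‖F (s + ((c * v : ℝ) : ℂ) * I)‖ ≤ C * (Real.log (2 + ‖s‖) + Real.log (1 + c * |v|)) := by
    refine (hF _ (by simpa using hs)).trans ?_
    gcongr
    exact log_split _ _ _ _ (norm_nonneg _) hc ((norm_add_le _ _).trans (by rw [norm_shift c v hc])) (norm_nonneg _)
  have hl : 0 ≤ Real.log (2 + ‖s‖) + Real.log (1 + c * |v|) := by
    have h1 := Real.log_nonneg (by linarith [norm_nonneg s] : 1 ≤ 2 + ‖s‖)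
    have h2 := Real.log_nonneg (by nlinarith [mul_nonneg hc (abs_nonneg v)] : 1 ≤ 1 + c * |v|)
    linarith
  constructor
  · refine hb.trans ?_
    gcongr
    nlinarith
  · rw [norm_mul, Complex.norm_real, Real.norm_eq_abs]
    calc _ ≤ (A * (1 + v^2)⁻¹) * (C * (Real.log (2 + ‖s‖) + Real.log (1 + c * |v|))) := by
          gcongr; exact hgA v
      _ = (A * C) * (1 + v^2)⁻¹ * (Real.log (2 + ‖s‖) + Real.log (1 + c * |v|)) := by ring
      _ ≤ _ := by gcongr; linarith

lemma int_bound (C L c : ℝ) (hc : 0 ≤ c) : Integrable (fun v : ℝ => C * (1 + v^2)⁻¹ * (L + Real.log (1 + c * |v|))) := by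
  have := ((integrable_inv_one_add_sq.mul_const L).add (int_log c hc)).const_mul C
  refine this.congr (ae_of_all _ fun v => ?_)
  simp only [Pi.add_apply]; ring

lemma half_open : IsOpen {s : ℂ | 1/2 < s.re} := isOpen_lt continuous_const Complex.continuous_re

lemma half_preconn : IsPreconnected {s : ℂ | 1/2 < s.re} := (convex_halfSpace_re_gt (1/2)).isPreconnected

lemma ker_meas {F : ℂ → ℂ} {g : ℝ → ℝ} (gc : Continuous g) (hd : ContinuousOn F {s : ℂ | 1/2 < s.re}) (c : ℝ) {s : ℂ} (hs : 1/2 < s.re) :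
    Continuous (fun v : ℝ => (g v : ℂ) * F (s + ((c * v : ℝ) : ℂ) * I)) := by
  refine Continuous.mul (by fun_prop) ?_
  refine hd.comp_continuous (by fun_prop) fun v => ?_
  simpa using hs

lemma ker_integrable {F : ℂ → ℂ} {h g : ℝ → ℝ} (H : IsKer h g) (hg : LogGrowth F) (hd : ContinuousOn F {s : ℂ | 1/2 < s.re})
    (c : ℝ) (hc : 0 ≤ c) {s : ℂ} (hs : 1/2 < s.re) :
    Integrable (fun v : ℝ => (g v : ℂ) * F (s + ((c * v : ℝ) : ℂ) * I)) := by
  have hε : 0 < min (s.re - 1/2) 1 := lt_min (by linarith) one_pos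
  obtain ⟨C, hC, hb⟩ := shift_growth H hg hε (min_le_right _ _)
  refine (int_bound C (Real.log (2 + ‖s‖)) c hc).mono' (ker_meas H.1 hd c hs).aestronglyMeasurable (ae_of_all _ fun v => ?_)
  exact (hb c hc s (by linarith [min_le_left (s.re - 1/2) 1]) v).2

lemma ker_holo {F : ℂ → ℂ} {h g : ℝ → ℝ} (H : IsKer h g) (hg : LogGrowth F) (hd : DifferentiableOn ℂ F {s : ℂ | 1/2 < s.re})
    (c : ℝ) (hc : 0 ≤ c) :
    DifferentiableOn ℂ (fun s => ∫ v : ℝ, (g v : ℂ) * F (s + ((c * v : ℝ) : ℂ) * I)) {s : ℂ | 1/2 < s.re} := by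
  intro s0 hs0
  have hs0 : 1/2 < s0.re := hs0
  apply DifferentiableAt.differentiableWithinAt
  set ε : ℝ := min ((s0.re - 1/2)/3) 1 with hεd
  have hε : 0 < ε := lt_min (by linarith) one_pos
  have hε3 : 3 * ε ≤ s0.re - 1/2 := by have := min_le_left ((s0.re - 1/2)/3) 1; linarith
  obtain ⟨C, hC, hb⟩ := shift_growth H hg hε (min_le_right _ _)
  obtain ⟨A, hA, hgA⟩ := H.2.1
  have hdd : DifferentiableOn ℂ (deriv F) {s : ℂ | 1/2 < s.re} := hd.deriv half_open
  have hre : ∀ z ∈ Metric.ball s0 ε, 1/2 + 2 * ε ≤ z.re := by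
    intro z hz
    rw [Metric.mem_ball, dist_eq_norm] at hz
    have := (Complex.abs_re_le_norm (z - s0)).trans hz.le
    rw [Complex.sub_re, abs_le] at this
    linarith [this.1]
  refine (hasDerivAt_integral_of_dominated_loc_of_deriv_le (s := Metric.ball s0 ε) (Metric.ball_mem_nhds _ hε)
    (F' := fun s v => (g v : ℂ) * deriv F (s + ((c * v : ℝ) : ℂ) * I))
    (bound := fun v => (A * C / ε) * (1 + v^2)⁻¹ * (Real.log (2 + (‖s0‖ + 2)) + Real.log (1 + c * |v|))) ?_ ?_ ?_ ?_ ?_ ?_).2.differentiableAt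
  · filter_upwards [Metric.ball_mem_nhds s0 hε] with z hz
    exact (ker_meas H.1 hd.continuousOn c (by linarith [hre z hz])).aestronglyMeasurable
  · exact ker_integrable H hg hd.continuousOn c hc hs0
  · exact (ker_meas H.1 hdd.continuousOn c hs0).aestronglyMeasurable
  · refine ae_of_all _ fun v z hz => ?_
    have hzr := hre z hz
    have hzn : ‖z‖ ≤ ‖s0‖ + 1 := by
      rw [Metric.mem_ball, dist_eq_norm] at hz
      have : ‖z‖ ≤ ‖s0‖ + ‖z - s0‖ := by simpa using norm_add_le s0 (z - s0)
      linarith [min_le_right ((s0.re - 1/2)/3) 1]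
    set w := z + ((c * v : ℝ) : ℂ) * I with hw
    have hwre : w.re = z.re := by simp [hw]
    have hD : ‖deriv F w‖ ≤ C * (Real.log (2 + (‖s0‖ + 2)) + Real.log (1 + c * |v|)) / ε := by
      apply Complex.norm_deriv_le_of_forall_mem_sphere_norm_le hε
      · apply DifferentiableOn.diffContOnCl
        apply hd.mono
        rw [closure_ball _ hε.ne']
        intro x hx
        rw [Metric.mem_closedBall, dist_eq_norm] at hx
        have := (Complex.abs_re_le_norm (x - w)).trans hx
        rw [Complex.sub_re, abs_le] at this
        show 1/2 < x.re
        linarith [this.1]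
      · intro x hx
        rw [Metric.mem_sphere, dist_eq_norm] at hx
        have h1 := (Complex.abs_re_le_norm (x - w)).trans hx.le
        rw [Complex.sub_re, abs_le] at h1
        have h2 : x = (z + (x - w)) + ((c * v : ℝ) : ℂ) * I := by rw [hw]; ring
        have h3 := (hb c hc (z + (x - w)) (by rw [Complex.add_re, Complex.sub_re]; linarith [h1.1]) v).1
        rw [← h2] at h3
        refine h3.trans ?_
        have h4 : ‖z + (x - w)‖ ≤ ‖s0‖ + 2 := (norm_add_le _ _).trans (by linarith [min_le_right ((s0.re - 1/2)/3) 1])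
        have := Real.log_le_log (by positivity) (by linarith : 2 + ‖z + (x - w)‖ ≤ 2 + (‖s0‖ + 2))
        gcongr
    rw [norm_mul, Complex.norm_real, Real.norm_eq_abs]
    have h0 : 0 ≤ ‖deriv F w‖ := norm_nonneg _
    calc _ ≤ (A * (1 + v^2)⁻¹) * (C * (Real.log (2 + (‖s0‖ + 2)) + Real.log (1 + c * |v|)) / ε) := by
          gcongr; exact hgA v
      _ = _ := by ring
  · exact int_bound _ _ _ hc
  · refine ae_of_all _ fun v z hz => ?_
    apply HasDerivAt.const_mul
    have h1 : HasDerivAt F (deriv F (z + ((c * v : ℝ) : ℂ) * I)) (z + ((c * v : ℝ) : ℂ) * I) := by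
      apply DifferentiableAt.hasDerivAt
      refine (hd _ ?_).differentiableAt (half_open.mem_nhds ?_) <;>
      · show 1/2 < (z + ((c * v : ℝ) : ℂ) * I).re
        simp; linarith [hre z hz]
    exact h1.comp_add_const z _

/-- smoothed partial sum -/
noncomputable def smooth (a : ℕ → ℂ) (h : ℝ → ℝ) (r : ℝ) (s : ℂ) : ℂ :=
  ∑ n ∈ Finset.range (⌊Real.exp r⌋₊ + 1), LSeries.term a s n * (h (Real.log n / r) : ℂ)

lemma smooth_holo (a : ℕ → ℂ) (h : ℝ → ℝ) (r : ℝ) : Differentiable ℂ (smooth a h r) := by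
  unfold smooth
  apply Differentiable.fun_sum
  intro n _
  apply Differentiable.mul_const
  rcases eq_or_ne n 0 with rfl | hn
  · simp [LSeries.term_zero]
  · have : (fun s => LSeries.term a s n) = fun s => a n / (n:ℂ)^s := by
      ext s; rw [LSeries.term_of_ne_zero hn]
    rw [this]
    have hn' : (n:ℂ) ≠ 0 := by exact_mod_cast hn
    refine Differentiable.div (by fun_prop) ?_ fun s => by simp [Complex.cpow_eq_zero_iff, hn']
    exact differentiable_id.const_cpow (Or.inl hn')

lemma ker_repr {a : ℕ → ℂ} {F : ℂ → ℂ} {h g : ℝ → ℝ} (H : IsKer h g) (hsupp : ∀ x, 1 ≤ |x| → h x = 0)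
    (hsum : ∀ s : ℂ, 1 < s.re → LSeriesSummable a s) (hF : ∀ s : ℂ, 1 < s.re → LSeries a s = F s)
    (hg : LogGrowth F) (hd : DifferentiableOn ℂ F {s : ℂ | 1/2 < s.re}) {r : ℝ} (hr : 0 < r) {s : ℂ} (hs : 1/2 < s.re) :
    smooth a h r s = ∫ v : ℝ, (g v : ℂ) * F (s + ((2 * π / r * v : ℝ) : ℂ) * I) := by
  have hpi := Real.pi_pos
  have hc : 0 ≤ 2 * π / r := by positivity
  have an1 : AnalyticOnNhd ℂ (smooth a h r) {s : ℂ | 1/2 < s.re} := (smooth_holo a h r).differentiableOn.analyticOnNhd half_open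
  have an2 := (ker_holo H hg hd (2 * π / r) hc).analyticOnNhd half_open
  refine an1.eqOn_of_preconnected_of_eventuallyEq an2 half_preconn (z₀ := 2) (by norm_num) ?_ hs
  have ho : IsOpen {z : ℂ | 1 < z.re} := isOpen_lt continuous_const Complex.continuous_re
  filter_upwards [ho.mem_nhds (by simp : (2:ℂ) ∈ {z : ℂ | 1 < z.re})] with z hz
  have hz : 1 < z.re := hz
  set c := 2 * π / r with hcdef
  have hterm : ∀ (n : ℕ) (v : ℝ), LSeries.term a (z + ((c * v : ℝ) : ℂ) * I) n = LSeries.term a z n * Complex.exp (-(2 * π * v * (Real.log n / r) : ℝ) * I) := by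
    intro n v
    rcases eq_or_ne n 0 with rfl | hn
    · simp
    rw [LSeries.term_of_ne_zero hn, LSeries.term_of_ne_zero hn]
    have hn' : (n:ℂ) ≠ 0 := by exact_mod_cast hn
    rw [Complex.cpow_add _ _ hn', ← div_div, div_eq_mul_inv (a n / (n:ℂ)^z), ← Complex.cpow_neg]
    congr 1
    rw [Complex.cpow_def_of_ne_zero hn', ← Complex.natCast_log]
    congr 1
    rw [hcdef]; push_cast; field_simp
  have key := hasSum_integral_of_summable_integral_norm (μ := volume) (F := fun (n : ℕ) (v : ℝ) => (g v : ℂ) * LSeries.term a (z + ((c * v : ℝ) : ℂ) * I) n) ?_ ?_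
  · have e1 : ∀ v : ℝ, ∑' n, (g v : ℂ) * LSeries.term a (z + ((c * v : ℝ) : ℂ) * I) n = (g v : ℂ) * F (z + ((c * v : ℝ) : ℂ) * I) := by
      intro v
      rw [tsum_mul_left, ← hF _ (by simpa using hz)]; rfl
    simp only [e1] at key
    have e2 : ∀ n : ℕ, ∫ v : ℝ, (g v : ℂ) * LSeries.term a (z + ((c * v : ℝ) : ℂ) * I) n = LSeries.term a z n * (h (Real.log n / r) : ℂ) := by
      intro n
      rw [← H.2.2, ← integral_const_mul]
      congr 1; ext v
      rw [hterm]; ring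
    simp only [e2] at key
    rw [← key.tsum_eq, smooth]
    symm
    apply tsum_eq_sum
    intro n hn
    rw [hsupp, Complex.ofReal_zero, mul_zero]
    rw [Finset.mem_range, not_lt, Nat.succ_le_iff, Nat.floor_lt (Real.exp_pos _).le] at hn
    have h1 : r < Real.log n := by
      rw [Real.lt_log_iff_exp_lt ((Real.exp_pos _).trans hn)]; exact hn
    rw [abs_of_nonneg (div_nonneg (hr.le.trans h1.le) hr.le), le_div_iff₀ hr]; linarith
  · intro n
    simp only [hterm]
    have : Integrable (fun v : ℝ => (LSeries.term a z n) * ((g v : ℂ) * Complex.exp (-(2 * π * v * (Real.log n / r) : ℝ) * I))) := by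
      apply Integrable.const_mul
      refine (H.integrable.norm).mono' ?_ (ae_of_all _ fun v => ?_)
      · have := H.1
        exact Continuous.aestronglyMeasurable (by fun_prop)
      · rw [norm_mul, ← Complex.ofReal_neg, Complex.norm_exp_ofReal_mul_I, mul_one, Complex.norm_real]
    refine this.congr (ae_of_all _ fun v => ?_)
    simp only; ring
  · have e : ∀ n : ℕ, ∫ v : ℝ, ‖(g v : ℂ) * LSeries.term a (z + ((c * v : ℝ) : ℂ) * I) n‖ = ‖LSeries.term a z n‖ * ∫ v, ‖g v‖ := by
      intro n
      rw [← integral_const_mul]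
      congr 1; ext v
      rw [hterm, norm_mul, norm_mul, ← Complex.ofReal_neg, Complex.norm_exp_ofReal_mul_I, mul_one, Complex.norm_real, mul_comm]
    simp only [e]
    exact ((hsum z hz).norm).mul_right _

lemma ker_lim {F : ℂ → ℂ} {h g : ℝ → ℝ} (H : IsKer h g)
    (hg : LogGrowth F) (hd : DifferentiableOn ℂ F {s : ℂ | 1/2 < s.re}) {s : ℂ} (hs : 1/2 < s.re) :
    Tendsto (fun r : ℝ => ∫ v : ℝ, (g v : ℂ) * F (s + ((2 * π / r * v : ℝ) : ℂ) * I)) atTop (𝓝 (h 0 * F s)) := by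
  have hpi := Real.pi_pos
  have hε : 0 < min (s.re - 1/2) 1 := lt_min (by linarith) one_pos
  obtain ⟨C, hC, hb⟩ := shift_growth H hg hε (min_le_right _ _)
  have e : (h 0 : ℂ) * F s = ∫ v : ℝ, (g v : ℂ) * F s := by
    rw [integral_mul_const, integral_complex_ofReal, H.integral]
  rw [e]
  refine tendsto_integral_filter_of_dominated_convergence (fun v => C * (1 + v^2)⁻¹ * (Real.log (2 + ‖s‖) + Real.log (1 + (2 * π) * |v|))) ?_ ?_ (int_bound _ _ _ (by positivity)) ?_
  · exact Eventually.of_forall fun r => (ker_meas H.1 hd.continuousOn _ hs).aestronglyMeasurable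
  · filter_upwards [eventually_ge_atTop 1] with r hr
    refine ae_of_all _ fun v => ?_
    refine ((hb (2 * π / r) (by positivity) s (by linarith [min_le_left (s.re - 1/2) 1]) v).2).trans ?_
    have : 2 * π / r ≤ 2 * π := div_le_self (by positivity) hr
    gcongr
  · refine ae_of_all _ fun v => ?_
    apply Tendsto.const_mul
    have hcF : ContinuousAt F s := ((hd s hs).differentiableAt (half_open.mem_nhds hs)).continuousAt
    refine hcF.tendsto.comp ?_
    have : Tendsto (fun r : ℝ => 2 * π / r * v) atTop (𝓝 0) := by
      have := (tendsto_const_nhds (x := 2 * π) (f := (atTop : Filter ℝ))).div_atTop tendsto_id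
      simpa using this.mul_const v
    have h2 := ((Complex.continuous_ofReal.tendsto 0).comp this).mul_const I
    have h3 := h2.const_add s
    simpa using h3

section
variable {q : ℕ} [NeZero q]

noncomputable def ld (χ : DirichletCharacter ℂ q) (s : ℂ) : ℂ :=
  deriv (DirichletCharacter.LFunction χ) s / DirichletCharacter.LFunction χ s

lemma lognorm_deriv (χ : DirichletCharacter ℂ q) (h1 : χ ≠ 1) (hRH : dirichletRH χ) {s : ℂ} {t0 : ℝ}
    (hs : 1/2 < s.re + t0) :
    HasDerivAt (fun t : ℝ => Real.log ‖DirichletCharacter.LFunction χ (s + t)‖) (ld χ (s + t0)).re t0 := by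
  have hne : DirichletCharacter.LFunction χ (s + t0) ≠ 0 := L_ne_zero χ h1 hRH (by simpa using hs)
  have hd := DirichletCharacter.differentiable_LFunction h1
  have h0 : HasDerivAt (fun t : ℝ => DirichletCharacter.LFunction χ (s + t) / DirichletCharacter.LFunction χ (s + t0)) (ld χ (s + t0)) t0 := by
    have h2 : HasDerivAt (fun t : ℝ => s + (t : ℂ)) 1 t0 := by
      simpa using (Complex.ofRealCLM.hasDerivAt (x := t0)).const_add s
    have := ((hd (s + t0)).hasDerivAt.comp t0 h2).div_const (DirichletCharacter.LFunction χ (s + t0))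
    simpa [ld] using this
  have h2 : HasDerivAt (fun t : ℝ => Complex.log (DirichletCharacter.LFunction χ (s + t) / DirichletCharacter.LFunction χ (s + t0))) (ld χ (s + t0)) t0 := by
    have := h0.clog_real (by simp [div_self hne])
    simpa [div_self hne] using this
  have h3 : HasDerivAt (fun t : ℝ => (Complex.log (DirichletCharacter.LFunction χ (s + t) / DirichletCharacter.LFunction χ (s + t0))).re
     + Real.log ‖DirichletCharacter.LFunction χ (s + t0)‖) (ld χ (s + t0)).re t0 :=
    (Complex.reCLM.hasFDerivAt.comp_hasDerivAt t0 h2).add_const _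
  refine h3.congr_of_eventuallyEq ?_
  have : ∀ᶠ t : ℝ in 𝓝 t0, 1/2 < s.re + t := by
    have : Continuous fun t : ℝ => s.re + t := by fun_prop
    exact this.continuousAt.eventually (lt_mem_nhds hs)
  filter_upwards [this] with t ht
  have hn2 : DirichletCharacter.LFunction χ (s + t) ≠ 0 := L_ne_zero χ h1 hRH (by simpa using ht)
  rw [Complex.log_re, norm_div, Real.log_div (norm_ne_zero_iff.2 hn2) (norm_ne_zero_iff.2 hne)]; ring

lemma ld_re_ge (χ : DirichletCharacter ℂ q) (h1 : χ ≠ 1) (hp : χ.IsPrimitive) (hRH : dirichletRH χ) {s : ℂ}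
    (hs : 1/2 < s.re) : -(ld χ s).re ≤ Real.log q / 2 + Real.log (2 + ‖s‖) + 3 := by
  have h := lognorm_deriv χ h1 hRH (s := s) (t0 := 0) (by simpa using hs)
  have h2 := h.tendsto_slope_zero_right
  simp only [ofReal_zero, add_zero, zero_add] at h2
  rw [neg_le]
  refine ge_of_tendsto h2 ?_
  have : Set.Ioo (0:ℝ) (1/2) ∈ 𝓝[>] (0:ℝ) := Ioo_mem_nhdsGT (by norm_num)
  filter_upwards [this] with η hη
  have hm := L_mono χ h1 hp hRH hη.1 hη.2.le (s := s) (by linarith [hη.1])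
  have hn : 0 < ‖DirichletCharacter.LFunction χ s‖ := norm_pos_iff.2 (L_ne_zero χ h1 hRH hs)
  have hn2 : 0 < ‖DirichletCharacter.LFunction χ (s + η)‖ := norm_pos_iff.2 (L_ne_zero χ h1 hRH (by simp; linarith [hη.1]))
  have h3 := Real.log_le_log hn hm
  rw [Real.log_mul (Real.exp_pos _).ne' hn2.ne', Real.log_exp] at h3
  rw [smul_eq_mul, inv_mul_eq_div, le_div_iff₀ hη.1]
  linarith

noncomputable def aL (χ : DirichletCharacter ℂ q) (n : ℕ) : ℂ := χ n * (ArithmeticFunction.vonMangoldt n : ℂ)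

noncomputable def al (χ : DirichletCharacter ℂ q) (n : ℕ) : ℂ :=
  χ n * ((ArithmeticFunction.vonMangoldt n / Real.log n : ℝ) : ℂ)

lemma aL_sum (χ : DirichletCharacter ℂ q) {s : ℂ} (hs : 1 < s.re) : LSeriesSummable (aL χ) s :=
  DirichletCharacter.LSeriesSummable_twist_vonMangoldt χ hs

lemma aL_eq (χ : DirichletCharacter ℂ q) {s : ℂ} (hs : 1 < s.re) : LSeries (aL χ) s = - ld χ s := by
  have := DirichletCharacter.LSeries_twist_vonMangoldt_eq χ hs
  rw [← DirichletCharacter.deriv_LFunction_eq_deriv_LSeries χ hs, ← DirichletCharacter.LFunction_eq_LSeries χ hs] at this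
  rw [ld, ← neg_div]
  exact this

lemma al_logMul (χ : DirichletCharacter ℂ q) : LSeries.logMul (al χ) = aL χ := by
  ext n
  rcases Nat.lt_or_ge n 2 with h | h
  · interval_cases n <;> simp [LSeries.logMul, al, aL]
  · have : Real.log n ≠ 0 := (Real.log_pos (by exact_mod_cast h)).ne'
    rw [LSeries.logMul, al, aL, Complex.natCast_log.symm]
    push_cast
    have h' : (Real.log n : ℂ) ≠ 0 := by exact_mod_cast this
    rw [Complex.natCast_log] at h'
    field_simp

lemma ld_growth (χ : DirichletCharacter ℂ q) (h1 : χ ≠ 1) (hRH : dirichletRH χ) : LogGrowth (ld χ) := by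
  intro ε h0 h2
  obtain ⟨C, hC, h⟩ := L_log_bounds χ h1 hRH h0 h2
  exact ⟨C, hC, fun s hs => (h s hs).2⟩

lemma ld_diff (χ : DirichletCharacter ℂ q) (h1 : χ ≠ 1) (hRH : dirichletRH χ) : DifferentiableOn ℂ (ld χ) {s : ℂ | 1/2 < s.re} := by
  have hd := DirichletCharacter.differentiable_LFunction h1
  refine DifferentiableOn.div ?_ hd.differentiableOn fun s hs => L_ne_zero χ h1 hRH hs
  exact hd.deriv.differentiableOn

lemma tri_supp (x : ℝ) (h : 1 ≤ |x|) : tri x = 0 := by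
  rw [tri]; exact max_eq_right (by linarith)

theorem boundA : ∃ C0 : ℝ, 0 < C0 ∧ ∀ (q : ℕ) [NeZero q] (χ : DirichletCharacter ℂ q), χ ≠ 1 → χ.IsPrimitive → dirichletRH χ →
    ∀ (r : ℝ), 1/2 ≤ r → ∀ s : ℂ, 1/2 < s.re →
    (smooth (aL χ) tri r s).re ≤ Real.log q / 2 + Real.log (2 + ‖s‖) + C0 := by
  obtain ⟨g, H, hg0⟩ := tri_ker
  obtain ⟨Cg, hCg, hgb⟩ := H.2.1
  set C1 := ∫ v : ℝ, Cg * ((1 + v ^ 2)⁻¹ * Real.log (1 + 4 * π * |v|)) with hC1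
  have hC1nn : 0 ≤ C1 := integral_nonneg fun v => by
    have : 0 ≤ Real.log (1 + 4 * π * |v|) := Real.log_nonneg (by linarith [show 0 ≤ 4 * π * |v| by positivity])
    positivity
  refine ⟨C1 + 3, by linarith, ?_⟩
  intro q _ χ h1 hp hRH r hr s hs
  have hr0 : 0 < r := by linarith
  set c := 2 * π / r with hc
  have hc0 : 0 ≤ c := by positivity
  have hc4 : c ≤ 4 * π := by
    rw [hc, div_le_iff₀ hr0]; nlinarith [Real.pi_pos]
  have hF : LogGrowth (fun s => - ld χ s) := by
    intro ε h0 h2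
    obtain ⟨C, hC, h⟩ := ld_growth χ h1 hRH ε h0 h2
    exact ⟨C, hC, fun s hs => by rw [norm_neg]; exact h s hs⟩
  have hD : DifferentiableOn ℂ (fun s => - ld χ s) {s : ℂ | 1/2 < s.re} := (ld_diff χ h1 hRH).neg
  rw [ker_repr H tri_supp (fun s hs => aL_sum χ hs) (fun s hs => aL_eq χ hs) hF hD hr0 hs]
  have hitg := ker_integrable H hF hD.continuousOn c hc0 hs
  rw [← Complex.reCLM_apply, ← ContinuousLinearMap.integral_comp_comm _ hitg]
  have hI : Integrable (fun v => g v * (Real.log q / 2 + Real.log (2 + ‖s‖) + 3) + Cg * ((1 + v ^ 2)⁻¹ * Real.log (1 + 4 * π * |v|))) :=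
    (H.integrable.mul_const _).add ((int_log _ (by positivity)).const_mul _)
  refine (integral_mono ((Complex.reCLM.integrable_comp hitg)) hI fun v => ?_).trans ?_
  · simp only [Complex.reCLM_apply, Complex.re_ofReal_mul]
    have h2 := ld_re_ge χ h1 hp hRH (s := s + ((c * v : ℝ) : ℂ) * I) (by simpa using hs)
    have h3 := log_split ‖s‖ ‖s + ((c * v : ℝ) : ℂ) * I‖ c v (norm_nonneg _) hc0 (by
      refine (norm_add_le _ _).trans ?_
      rw [norm_shift c v hc0]) (norm_nonneg _)
    have h4 : Real.log (1 + c * |v|) ≤ Real.log (1 + 4 * π * |v|) := by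
      apply Real.log_le_log (by positivity)
      have := mul_le_mul_of_nonneg_right hc4 (abs_nonneg v)
      linarith
    have h5 : 0 ≤ Real.log (1 + 4 * π * |v|) := Real.log_nonneg (by linarith [show 0 ≤ 4 * π * |v| by positivity])
    have h6 : g v ≤ Cg * (1 + v^2)⁻¹ := (le_abs_self _).trans (hgb v)
    calc g v * (-ld χ (s + ((c * v : ℝ) : ℂ) * I)).re
        ≤ g v * ((Real.log q / 2 + Real.log (2 + ‖s‖) + 3) + Real.log (1 + 4 * π * |v|)) := by
          apply mul_le_mul_of_nonneg_left _ (hg0 v)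
          rw [Complex.neg_re]; linarith
      _ ≤ _ := by
          rw [mul_add]
          have := mul_le_mul_of_nonneg_right h6 h5
          linarith
  · rw [integral_add (H.integrable.mul_const _) ((int_log _ (by positivity)).const_mul _), integral_mul_const, H.integral, ← hC1]
    have : tri 0 = 1 := by simp [tri]
    rw [this]; linarith
end

section
variable {q : ℕ} [NeZero q]

lemma al_norm_le (χ : DirichletCharacter ℂ q) (n : ℕ) : ‖al χ n‖ ≤ 1 := by
  rw [al, norm_mul]
  have h1 := χ.norm_le_one n
  have h2 : ‖((ArithmeticFunction.vonMangoldt n / Real.log n : ℝ) : ℂ)‖ ≤ 1 := by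
    rw [Complex.norm_real, Real.norm_eq_abs, abs_of_nonneg (div_nonneg ArithmeticFunction.vonMangoldt_nonneg (Real.log_natCast_nonneg n))]
    exact div_le_one_of_le₀ ArithmeticFunction.vonMangoldt_le_log (Real.log_natCast_nonneg n)
  exact mul_le_one₀ h1 (norm_nonneg _) h2

lemma al_sum (χ : DirichletCharacter ℂ q) {s : ℂ} (hs : 1 < s.re) : LSeriesSummable (al χ) s :=
  LSeriesSummable_of_bounded_of_one_lt_re (fun n _ => al_norm_le χ n) hs

lemma al_absc (χ : DirichletCharacter ℂ q) : LSeries.abscissaOfAbsConv (al χ) ≤ 1 :=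
  LSeries.abscissaOfAbsConv_le_of_forall_lt_LSeriesSummable fun y hy => al_sum χ (by simpa using hy)

lemma al_deriv (χ : DirichletCharacter ℂ q) {s : ℂ} (hs : 1 < s.re) : HasDerivAt (LSeries (al χ)) (ld χ s) s := by
  have h := LSeries_hasDerivAt (f := al χ) (s := s) (lt_of_le_of_lt (al_absc χ) (by exact_mod_cast hs))
  rw [al_logMul, aL_eq χ hs, neg_neg] at h
  exact h

lemma al_exp (χ : DirichletCharacter ℂ q) (h1 : χ ≠ 1) {s : ℂ} (hs : 1 < s.re) :
    Complex.exp (LSeries (al χ) s) = DirichletCharacter.LFunction χ s := by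
  have hd := DirichletCharacter.differentiable_LFunction h1
  have hne : ∀ s : ℂ, 1 < s.re → DirichletCharacter.LFunction χ s ≠ 0 := fun s hs =>
    DirichletCharacter.LFunction_ne_zero_of_one_le_re χ (Or.inl h1) hs.le
  set U : Set ℂ := {s | 1 < s.re} with hU
  have hUo : IsOpen U := isOpen_lt continuous_const Complex.continuous_re
  have hUc : IsPreconnected U := (convex_halfSpace_re_gt 1).isPreconnected
  set G : ℂ → ℂ := fun s => Complex.exp (LSeries (al χ) s) / DirichletCharacter.LFunction χ s with hG
  have hGd : ∀ s ∈ U, HasDerivAt G 0 s := by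
    intro s hs
    refine (((al_deriv χ hs).cexp).div (hd s).hasDerivAt (hne s hs)).congr_deriv ?_
    rw [ld]; field_simp [hne s hs]; ring
  obtain ⟨a, ha⟩ := hUo.exists_is_const_of_deriv_eq_zero hUc (fun s hs => (hGd s hs).differentiableAt.differentiableWithinAt)
    (fun s hs => (hGd s hs).deriv)
  have ht : Tendsto (fun x : ℝ => G x) atTop (𝓝 1) := by
    have t1 : Tendsto (fun x : ℝ => LSeries (al χ) x) atTop (𝓝 (al χ 1)) :=
      LSeries.tendsto_atTop (lt_of_le_of_lt (al_absc χ) (by exact EReal.coe_lt_top 1))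
    have t2 : Tendsto (fun x : ℝ => LSeries (fun n => χ (n : ZMod q)) x) atTop (𝓝 (χ ((1 : ℕ) : ZMod q))) :=
      LSeries.tendsto_atTop (by
        rw [DirichletCharacter.absicssaOfAbsConv_eq_one (NeZero.ne q)]; exact EReal.coe_lt_top 1)
    have t3 := (Complex.continuous_exp.continuousAt.tendsto.comp t1).div t2 (by simp)
    have : al χ 1 = 0 := by simp [al]
    simp only [this, Complex.exp_zero, Nat.cast_one, map_one, div_one] at t3
    refine t3.congr' ?_
    filter_upwards [eventually_gt_atTop 1] with x hx
    simp only [hG, Pi.div_apply, Function.comp]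
    rw [DirichletCharacter.LFunction_eq_LSeries χ (by simpa using hx)]
  have ha1 : a = 1 := by
    refine tendsto_nhds_unique (Tendsto.congr' ?_ tendsto_const_nhds) ht
    filter_upwards [eventually_gt_atTop 1] with x hx
    exact (ha x (by simpa [hU] using hx)).symm
  have := ha s hs
  rw [ha1, hG] at this
  exact (div_eq_one_iff_eq (hne s hs)).1 this

lemma al_re (χ : DirichletCharacter ℂ q) (h1 : χ ≠ 1) {s : ℂ} (hs : 1 < s.re) :
    (LSeries (al χ) s).re = Real.log ‖DirichletCharacter.LFunction χ s‖ := by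
  rw [← al_exp χ h1 hs, Complex.norm_exp, Real.log_exp]

lemma al_bdd (χ : DirichletCharacter ℂ q) : ∃ B : ℝ, 0 < B ∧ ∀ s : ℂ, 2 ≤ s.re → ‖LSeries (al χ) s‖ ≤ B := by
  refine ⟨(∑' n : ℕ, ‖LSeries.term (al χ) 2 n‖) + 1, by
    have : 0 ≤ ∑' n : ℕ, ‖LSeries.term (al χ) 2 n‖ := tsum_nonneg fun _ => norm_nonneg _
    linarith, fun s hs => ?_⟩
  have hS := (al_sum χ (s := 2) (by simp)).norm
  have := tsum_of_norm_bounded hS.hasSum (f := LSeries.term (al χ) s) (fun n => LSeries.norm_term_le_of_re_le_re (al χ) (by simpa using hs) n)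
  rw [LSeries]; linarith

/-- holomorphic logarithm -/
noncomputable def ell (χ : DirichletCharacter ℂ q) (s : ℂ) : ℂ :=
  LSeries (al χ) (s + 2) - ∫ u in (0:ℝ)..2, ld χ (s + u)

lemma ld_path_cont (χ : DirichletCharacter ℂ q) (h1 : χ ≠ 1) (hRH : dirichletRH χ) {s : ℂ} (hs : 1/2 < s.re) :
    ContinuousOn (fun u : ℝ => ld χ (s + u)) (Set.Icc 0 2) := by
  refine (ld_diff χ h1 hRH).continuousOn.comp (by fun_prop) fun u hu => ?_
  simp; linarith [hu.1]

lemma ld_path_int (χ : DirichletCharacter ℂ q) (h1 : χ ≠ 1) (hRH : dirichletRH χ) {s : ℂ} (hs : 1/2 < s.re) :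
    IntervalIntegrable (fun u : ℝ => ld χ (s + u)) volume 0 2 := by
  apply ContinuousOn.intervalIntegrable
  rw [Set.uIcc_of_le (by norm_num)]
  exact ld_path_cont χ h1 hRH hs

lemma ell_eq (χ : DirichletCharacter ℂ q) (h1 : χ ≠ 1) (hRH : dirichletRH χ) {s : ℂ} (hs : 1 < s.re) :
    LSeries (al χ) s = ell χ s := by
  have : ∫ u in (0:ℝ)..2, ld χ (s + u) = LSeries (al χ) (s + (2:ℝ)) - LSeries (al χ) (s + (0:ℝ)) := by
    refine intervalIntegral.integral_eq_sub_of_hasDerivAt (f := fun u : ℝ => LSeries (al χ) (s + u)) (fun u hu => ?_) (ld_path_int χ h1 hRH (by linarith))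
    rw [Set.uIcc_of_le (by norm_num)] at hu
    have h2 : HasDerivAt (fun t : ℝ => s + (t : ℂ)) 1 u := by
      simpa using (Complex.ofRealCLM.hasDerivAt (x := u)).const_add s
    have h3 : 1 < (s + (u:ℂ)).re := by simp; linarith [hu.1]
    have h4 := (al_deriv χ h3).comp u h2
    rw [mul_one] at h4
    exact h4
  rw [ell, this]; push_cast; ring_nf

lemma ell_re (χ : DirichletCharacter ℂ q) (h1 : χ ≠ 1) (hRH : dirichletRH χ) {s : ℂ} (hs : 1/2 < s.re) :
    (ell χ s).re = Real.log ‖DirichletCharacter.LFunction χ s‖ := by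
  have hitg := ld_path_int χ h1 hRH hs
  have h2 : (∫ u in (0:ℝ)..2, ld χ (s + u)).re = ∫ u in (0:ℝ)..2, (ld χ (s + u)).re := by
    rw [← Complex.reCLM_apply, ← ContinuousLinearMap.intervalIntegral_comp_comm _ hitg]
    rfl
  have h3 : ∫ u in (0:ℝ)..2, (ld χ (s + u)).re = Real.log ‖DirichletCharacter.LFunction χ (s + (2:ℝ))‖ - Real.log ‖DirichletCharacter.LFunction χ (s + (0:ℝ))‖ := by
    refine intervalIntegral.integral_eq_sub_of_hasDerivAt (f := fun u : ℝ => Real.log ‖DirichletCharacter.LFunction χ (s + u)‖) (fun u hu => ?_) ?_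
    · rw [Set.uIcc_of_le (by norm_num)] at hu
      exact lognorm_deriv χ h1 hRH (by linarith [hu.1])
    · apply ContinuousOn.intervalIntegrable
      rw [Set.uIcc_of_le (by norm_num)]
      exact Complex.continuous_re.comp_continuousOn (ld_path_cont χ h1 hRH hs)
  rw [ell, Complex.sub_re, h2, h3, al_re χ h1 (by simp; linarith)]
  push_cast; simp

lemma ell_growth (χ : DirichletCharacter ℂ q) (h1 : χ ≠ 1) (hRH : dirichletRH χ) : LogGrowth (ell χ) := by
  intro ε h0 h2
  obtain ⟨C, hC, h⟩ := ld_growth χ h1 hRH ε h0 h2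
  obtain ⟨B, hB, hb⟩ := al_bdd χ
  refine ⟨2 * B + 4 * C, by positivity, fun s hs => ?_⟩
  have hl : 1/2 ≤ Real.log (2 + ‖s‖) := by
    have : Real.log 2 ≤ Real.log (2 + ‖s‖) := Real.log_le_log (by norm_num) (by linarith [norm_nonneg s])
    linarith [Real.log_two_gt_d9]
  have h3 := hb (s + 2) (by simp; linarith)
  have h4 : ‖∫ u in (0:ℝ)..2, ld χ (s + u)‖ ≤ (2 * C * Real.log (2 + ‖s‖)) * |2 - 0| := by
    refine intervalIntegral.norm_integral_le_of_norm_le_const fun u hu => ?_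
    rw [Set.uIoc_of_le (by norm_num)] at hu
    refine (h _ (by simp; linarith [hu.1])).trans ?_
    have : Real.log (2 + ‖s + u‖) ≤ Real.log ((2 + ‖s‖)^2) := by
      apply Real.log_le_log (by positivity)
      have := norm_add_le s (u:ℂ)
      rw [Complex.norm_real, Real.norm_eq_abs, abs_of_pos hu.1] at this
      nlinarith [hu.2, norm_nonneg s]
    rw [Real.log_pow] at this
    push_cast at this
    nlinarith
  rw [ell]
  refine (norm_sub_le _ _).trans ?_
  norm_num at h4
  nlinarith

lemma ell_diff (χ : DirichletCharacter ℂ q) (h1 : χ ≠ 1) (hRH : dirichletRH χ) : DifferentiableOn ℂ (ell χ) {s : ℂ | 1/2 < s.re} := by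
  intro s hs
  have hs' : 1/2 < s.re := hs
  apply DifferentiableAt.differentiableWithinAt
  have hA : DifferentiableAt ℂ (fun s => LSeries (al χ) (s + 2)) s := by
    have h3 : 1 < (s + 2).re := by simp; linarith
    have h4 := (al_deriv χ h3).comp s ((hasDerivAt_id s).add_const (2:ℂ))
    exact h4.differentiableAt
  refine hA.sub ?_
  set ρ := (s.re - 1/2) / 2 with hρ
  have hρ0 : 0 < ρ := by rw [hρ]; linarith
  have hre : ∀ z ∈ Metric.closedBall s ρ, 1/2 < z.re := by
    intro z hz
    have := (Complex.abs_re_le_norm (z - s)).trans (mem_closedBall_iff_norm.1 hz)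
    rw [Complex.sub_re] at this
    have := (abs_le.1 this).1
    linarith
  have hd' : ContinuousOn (deriv (ld χ)) {s : ℂ | 1/2 < s.re} := ((ld_diff χ h1 hRH).deriv half_open).continuousOn
  have hcomp : IsCompact ((fun p : ℂ × ℝ => p.1 + (p.2 : ℂ)) '' (Metric.closedBall s ρ ×ˢ Set.Icc (0:ℝ) 2)) :=
    ((isCompact_closedBall s ρ).prod isCompact_Icc).image (by fun_prop)
  obtain ⟨B, hB⟩ := hcomp.exists_bound_of_continuousOn (f := deriv (ld χ)) (hd'.mono (by
    rintro _ ⟨⟨z, u⟩, ⟨hz, hu⟩, rfl⟩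
    have := hre z hz
    simp at hu ⊢; linarith [hu.1]))
  have := intervalIntegral.hasDerivAt_integral_of_dominated_loc_of_deriv_le (μ := volume) (a := 0) (b := 2)
    (F := fun (z : ℂ) (u : ℝ) => ld χ (z + u)) (F' := fun (z : ℂ) (u : ℝ) => deriv (ld χ) (z + u)) (x₀ := s) (s := Metric.ball s ρ)
    (bound := fun _ => B) (Metric.ball_mem_nhds s hρ0) ?_ (ld_path_int χ h1 hRH hs') ?_ ?_ (by simp) ?_
  · exact this.2.differentiableAt
  · filter_upwards [Metric.ball_mem_nhds s hρ0] with z hz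
    exact (ld_path_int χ h1 hRH (hre z (Metric.ball_subset_closedBall hz))).aestronglyMeasurable_restrict_uIoc
  · have : IntervalIntegrable (fun u : ℝ => deriv (ld χ) (s + u)) volume 0 2 := by
      apply ContinuousOn.intervalIntegrable
      rw [Set.uIcc_of_le (by norm_num)]
      refine hd'.comp (by fun_prop) fun u hu => ?_
      simp; linarith [hu.1]
    exact this.aestronglyMeasurable_restrict_uIoc
  · refine ae_of_all _ fun u hu z hz => hB _ ⟨(z, u), ⟨Metric.ball_subset_closedBall hz, ?_⟩, rfl⟩
    rw [Set.uIoc_of_le (by norm_num)] at hu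
    exact ⟨hu.1.le, hu.2⟩
  · refine ae_of_all _ fun u hu z hz => ?_
    rw [Set.uIoc_of_le (by norm_num)] at hu
    have hz' := hre z (Metric.ball_subset_closedBall hz)
    have : DifferentiableAt ℂ (ld χ) (z + u) := (ld_diff χ h1 hRH).differentiableAt (half_open.mem_nhds (by simp; linarith [hu.1]))
    have h5 := this.hasDerivAt.comp z ((hasDerivAt_id z).add_const (u:ℂ))
    rw [mul_one] at h5
    exact h5
end

lemma possq_deriv (y : ℝ) : HasDerivAt (fun y : ℝ => max y 0 ^ 2) (2 * max y 0) y := by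
  rcases lt_trichotomy y 0 with h | h | h
  · have : (fun y : ℝ => max y 0 ^ 2) =ᶠ[𝓝 y] fun _ => 0 := by
      filter_upwards [gt_mem_nhds h] with z hz
      rw [max_eq_right hz.le]; norm_num
    refine HasDerivAt.congr_of_eventuallyEq ?_ this
    rw [max_eq_right h.le, mul_zero]; exact hasDerivAt_const _ _
  · subst h
    rw [max_self, mul_zero]
    have : HasDerivAt (fun y : ℝ => y ^ 2) 0 0 := by simpa using hasDerivAt_pow 2 (0:ℝ)
    rw [hasDerivAt_iff_isLittleO] at this ⊢
    refine (Asymptotics.IsBigO.of_bound 1 (Eventually.of_forall fun y => ?_)).trans_isLittleO this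
    simp only [max_self, smul_zero, sub_zero, one_mul, ne_eq, OfNat.ofNat_ne_zero, not_false_eq_true, zero_pow, norm_pow]
    apply pow_le_pow_left₀ (norm_nonneg _)
    rw [Real.norm_eq_abs, Real.norm_eq_abs, abs_of_nonneg (le_max_right _ _)]
    exact max_le (le_abs_self _) (abs_nonneg _)
  · have : (fun y : ℝ => max y 0 ^ 2) =ᶠ[𝓝 y] fun y => y ^ 2 := by
      filter_upwards [lt_mem_nhds h] with z hz
      rw [max_eq_left hz.le]
    refine HasDerivAt.congr_of_eventuallyEq ?_ this
    rw [max_eq_left h.le]; simpa using hasDerivAt_pow 2 y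

lemma tri2_deriv {L r : ℝ} (hL : 0 ≤ L) (hr : 0 < r) :
    HasDerivAt (fun r : ℝ => tri2 (L / r)) (2 / r ^ 2 * (L * tri (L / r))) r := by
  have h1 : HasDerivAt (fun r : ℝ => 1 - L / r) (L / r ^ 2) r := by
    have := ((hasDerivAt_inv hr.ne').const_mul L).const_sub 1
    refine (this.congr_deriv ?_)
    field_simp
  have h2 := (possq_deriv (1 - L / r)).comp r h1
  have h3 : HasDerivAt (fun r : ℝ => tri2 (L / r)) (2 * max (1 - L / r) 0 * (L / r ^ 2)) r := by
    refine h2.congr_of_eventuallyEq ?_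
    filter_upwards [lt_mem_nhds hr] with z hz
    simp only [tri2, tri, Function.comp]
    rw [abs_of_nonneg (by positivity)]
  refine h3.congr_deriv ?_
  rw [tri, abs_of_nonneg (by positivity)]
  field_simp

lemma smooth_ext (a : ℕ → ℂ) (h : ℝ → ℝ) (hsupp : ∀ x, 1 ≤ |x| → h x = 0) {r : ℝ} (hr : 0 < r) (s : ℂ) {M : ℕ} (hM : ⌊Real.exp r⌋₊ + 1 ≤ M) :
    smooth a h r s = ∑ n ∈ Finset.range M, LSeries.term a s n * (h (Real.log n / r) : ℂ) := by
  rw [smooth]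
  refine Finset.sum_subset (Finset.range_subset_range.2 hM) fun n hn hn2 => ?_
  rw [Finset.mem_range, not_lt] at hn2
  have h3 : Real.exp r < n := (Nat.lt_floor_add_one _).trans_le (by exact_mod_cast hn2)
  have h4 : r < Real.log n := by rwa [Real.lt_log_iff_exp_lt (lt_trans (Real.exp_pos _) h3)]
  rw [hsupp _ (by rw [abs_of_pos (div_pos (by linarith) hr), le_div_iff₀ hr]; linarith)]
  simp

lemma tri2_supp (x : ℝ) (h : 1 ≤ |x|) : tri2 x = 0 := by
  rw [tri2, tri_supp x h]; norm_num

theorem boundB : ∃ C0 : ℝ, 0 < C0 ∧ ∀ (q : ℕ) [NeZero q] (χ : DirichletCharacter ℂ q), χ ≠ 1 → χ.IsPrimitive → dirichletRH χ →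
    ∀ (R : ℝ), 1/2 ≤ R → ∀ s : ℂ, 1/2 < s.re →
    Real.log ‖DirichletCharacter.LFunction χ s‖ ≤ (smooth (al χ) tri2 R s).re + (Real.log q + 2 * Real.log (2 + ‖s‖) + C0) / R := by
  obtain ⟨C0, hC0, hA⟩ := boundA
  obtain ⟨g, H⟩ := tri2_ker
  refine ⟨2 * C0, by linarith, ?_⟩
  intro q _ χ h1 hp hRH R hR s hs
  set K := Real.log q / 2 + Real.log (2 + ‖s‖) + C0 with hK
  have hKeq : Real.log q + 2 * Real.log (2 + ‖s‖) + 2 * C0 = 2 * K := by rw [hK]; ring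
  rw [hKeq]
  have hlim : Tendsto (fun r : ℝ => (smooth (al χ) tri2 r s).re) atTop (𝓝 (Real.log ‖DirichletCharacter.LFunction χ s‖)) := by
    have h2 := ker_lim H (ell_growth χ h1 hRH) (ell_diff χ h1 hRH) hs
    have h3 : Tendsto (fun r : ℝ => smooth (al χ) tri2 r s) atTop (𝓝 (ell χ s)) := by
      have h0 : tri2 0 = 1 := by simp [tri2, tri]
      rw [h0, ofReal_one, one_mul] at h2
      refine h2.congr' ?_
      filter_upwards [eventually_gt_atTop 0] with r hr
      exact (ker_repr H tri2_supp (fun s hs => al_sum χ hs) (fun s hs => ell_eq χ h1 hRH hs) (ell_growth χ h1 hRH) (ell_diff χ h1 hRH) hr hs).symm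
    rw [← ell_re χ h1 hRH hs]
    exact (Complex.continuous_re.tendsto _).comp h3
  have hmono : ∀ R', R ≤ R' → (smooth (al χ) tri2 R' s).re + 2 * K / R' ≤ (smooth (al χ) tri2 R s).re + 2 * K / R := by
    intro R' hRR
    set M := ⌊Real.exp R'⌋₊ + 1 with hM
    set p : ℝ → ℝ := fun r => ∑ n ∈ Finset.range M, (LSeries.term (al χ) s n).re * tri2 (Real.log n / r) with hpdef
    have hpe : ∀ r ∈ Set.Icc R R', (smooth (al χ) tri2 r s).re = p r := by
      intro r hr
      rw [smooth_ext (al χ) tri2 tri2_supp (by linarith [hr.1]) s (M := M) (by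
        rw [hM]; gcongr; exact hr.2), Complex.re_sum, hpdef]
      exact sum_congr rfl fun n _ => by rw [Complex.re_mul_ofReal]
    have hder : ∀ r ∈ Set.Icc R R', HasDerivAt p (2 / r ^ 2 * (smooth (aL χ) tri r s).re) r := by
      intro r hr
      have hr0 : 0 < r := by linarith [hr.1]
      have := HasDerivAt.fun_sum (u := Finset.range M) (A := fun n (r:ℝ) => (LSeries.term (al χ) s n).re * tri2 (Real.log n / r)) (x := r)
        (fun n hn => (tri2_deriv (Real.log_natCast_nonneg n) hr0).const_mul (LSeries.term (al χ) s n).re)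
      refine this.congr_deriv ?_
      rw [smooth_ext (aL χ) tri tri_supp hr0 s (M := M) (by
        rw [hM]; gcongr; exact hr.2), Complex.re_sum, mul_sum]
      refine sum_congr rfl fun n _ => ?_
      rw [Complex.re_mul_ofReal]
      have : LSeries.term (aL χ) s n = LSeries.term (al χ) s n * (Real.log n : ℂ) := by
        rw [← al_logMul]
        rcases eq_or_ne n 0 with rfl | hn
        · simp
        · rw [LSeries.term_of_ne_zero hn, LSeries.term_of_ne_zero hn, LSeries.logMul, Complex.natCast_log]; ring
      rw [this, Complex.re_mul_ofReal]; ring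
    have hder2 : ∀ r ∈ Set.Icc R R', HasDerivAt (fun r => p r + 2 * K / r) (2 / r ^ 2 * (smooth (aL χ) tri r s).re - 2 * K / r ^ 2) r := by
      intro r hr
      have hr0 : 0 < r := by linarith [hr.1]
      refine ((hder r hr).add ((hasDerivAt_inv hr0.ne').const_mul (2 * K))).congr_deriv ?_
      field_simp
      ring
    have hanti : AntitoneOn (fun r => p r + 2 * K / r) (Set.Icc R R') := by
      refine antitoneOn_of_deriv_nonpos (convex_Icc _ _) (fun r hr => (hder2 r hr).continuousAt.continuousWithinAt)
        (fun r hr => (hder2 r (interior_subset hr)).differentiableAt.differentiableWithinAt) fun r hr => ?_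
      have hr' := interior_subset hr
      have hr0 : 0 < r := by linarith [hr'.1]
      rw [(hder2 r hr').deriv]
      have := hA q χ h1 hp hRH r (by linarith [hr'.1]) s hs
      have h5 : 0 ≤ 2 / r ^ 2 * (K - (smooth (aL χ) tri r s).re) := mul_nonneg (by positivity) (by linarith)
      have h6 : 2 / r ^ 2 * (smooth (aL χ) tri r s).re - 2 * K / r ^ 2 = -(2 / r ^ 2 * (K - (smooth (aL χ) tri r s).re)) := by ring
      linarith
    have := hanti (Set.left_mem_Icc.2 hRR) (Set.right_mem_Icc.2 hRR) hRR
    simp only at this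
    rwa [← hpe R (Set.left_mem_Icc.2 hRR), ← hpe R' (Set.right_mem_Icc.2 hRR)] at this
  have hlim2 : Tendsto (fun r : ℝ => (smooth (al χ) tri2 r s).re + 2 * K / r) atTop (𝓝 (Real.log ‖DirichletCharacter.LFunction χ s‖)) := by
    simpa using hlim.add (tendsto_const_nhds.div_atTop tendsto_id (a := 2 * K))
  exact le_of_tendsto hlim2 (by filter_upwards [eventually_ge_atTop R] with r hr using hmono r hr)

/-- orthogonality: mean square over all characters -/
lemma orth {q : ℕ} [NeZero q] {ι : Type*} (S : Finset ι) (c : ι → ℂ) (v : ι → ZMod q) (hv : Set.InjOn v S) :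
    ∑ χ : DirichletCharacter ℂ q, ‖∑ m ∈ S, c m * χ (v m)‖ ^ 2 ≤ (Nat.totient q : ℝ) * ∑ m ∈ S, ‖c m‖ ^ 2 := by
  classical
  have key : ∀ a b : ZMod q, ∑ χ : DirichletCharacter ℂ q, χ a * conj (χ b) = if a = b ∧ IsUnit a then (Nat.totient q : ℂ) else 0 := by
    intro a b
    by_cases hb : IsUnit b
    · have h := DirichletCharacter.sum_char_inv_mul_char_eq ℂ hb a
      have h2 : ∀ χ : DirichletCharacter ℂ q, χ a * conj (χ b) = χ b⁻¹ * χ a := by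
        intro χ
        have h3 : χ b⁻¹ = (χ b)⁻¹ := by
          apply eq_inv_of_mul_eq_one_left
          rw [← map_mul, ZMod.inv_mul_of_unit b hb, map_one]
        rw [starRingEnd_apply, MulChar.star_apply', MulChar.inv_apply_eq_inv', h3, mul_comm]
      simp_rw [h2, h]
      by_cases hab : a = b
      · subst hab; simp [hb]
      · simp [hab, Ne.symm hab]
    · have : ∀ χ : DirichletCharacter ℂ q, χ a * conj (χ b) = 0 := fun χ => by
        rw [MulChar.map_nonunit χ hb]; simp
      simp_rw [this]
      rw [if_neg]
      · simp
      · rintro ⟨rfl, h⟩; exact hb h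
  have e1 : ((∑ χ : DirichletCharacter ℂ q, ‖∑ m ∈ S, c m * χ (v m)‖ ^ 2 : ℝ) : ℂ) =
      ((∑ m ∈ S, if IsUnit (v m) then (Nat.totient q : ℝ) * ‖c m‖ ^ 2 else 0 : ℝ) : ℂ) := by
    push_cast
    have : ∀ χ : DirichletCharacter ℂ q, ((‖∑ m ∈ S, c m * χ (v m)‖ : ℂ)) ^ 2 = ∑ m ∈ S, ∑ n ∈ S, c m * conj (c n) * (χ (v m) * conj (χ (v n))) := by
      intro χ
      rw [← Complex.mul_conj', map_sum, Finset.sum_mul_sum]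
      refine sum_congr rfl fun m _ => sum_congr rfl fun n _ => ?_
      rw [map_mul]; ring
    simp_rw [this]
    rw [sum_comm]
    refine sum_congr rfl fun m hm => ?_
    rw [sum_comm]
    simp_rw [← mul_sum, key]
    rw [Finset.sum_eq_single m]
    · simp only [true_and]
      split_ifs
      · rw [Complex.mul_conj']; push_cast; ring
      · simp
    · intro n hn hnm
      rw [if_neg, mul_zero]
      rintro ⟨h, _⟩
      exact hnm (hv hn hm h.symm)
    · intro h; exact absurd hm h
  have e2 := Complex.ofReal_injective e1
  rw [e2, mul_sum]
  refine sum_le_sum fun m _ => ?_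
  split_ifs
  · exact le_rfl
  · positivity

/-- Chernoff tail of exp -/
lemma exp_tail (x ρ : ℝ) (hx : 0 ≤ x) (hρ : 1 ≤ ρ) (n : ℕ) :
    Real.exp x - ∑ m ∈ Finset.range n, x ^ m / (m.factorial : ℝ) ≤ (ρ ^ n)⁻¹ * Real.exp (ρ * x) := by
  have hs : ∀ y : ℝ, HasSum (fun m : ℕ => y ^ m / (m.factorial : ℝ)) (Real.exp y) := fun y => by
    rw [Real.exp_eq_exp_ℝ]; exact NormedSpace.expSeries_div_hasSum_exp y
  have h1 := (hasSum_nat_add_iff' n).2 (hs x)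
  have h2 := ((hasSum_nat_add_iff' n).2 (hs (ρ * x))).mul_left ((ρ ^ n)⁻¹)
  have h3 := hasSum_le (fun m => ?_) h1 h2
  · refine h3.trans ?_
    apply mul_le_mul_of_nonneg_left _ (by positivity)
    rw [sub_le_self_iff]
    exact sum_nonneg fun m _ => by positivity
  · have hρ0 : 0 < ρ := by linarith
    have : (ρ ^ n)⁻¹ * ((ρ * x) ^ (m + n) / ((m + n).factorial : ℝ)) = ρ ^ m * (x ^ (m + n) / ((m + n).factorial : ℝ)) := by
      rw [mul_pow, pow_add ρ]; field_simp
    rw [this]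
    exact le_mul_of_one_le_left (by positivity) (one_le_pow₀ hρ)

/-- truncated exponential -/
noncomputable def EN (N : ℕ) (z : ℂ) : ℂ := ∑ m ∈ Finset.range (N + 1), z ^ m / (m.factorial : ℂ)

lemma EN_err (z : ℂ) (ρ : ℝ) (hρ : 1 ≤ ρ) (N : ℕ) : ‖Complex.exp z - EN N z‖ ≤ (ρ ^ (N+1))⁻¹ * Real.exp (ρ * ‖z‖) :=
  (Complex.norm_exp_sub_sum_le_exp_norm_sub_sum z (N+1)).trans (exp_tail ‖z‖ ρ (norm_nonneg z) hρ (N+1))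

lemma norm_exp_ge (z : ℂ) : Real.exp (-‖z‖) ≤ ‖Complex.exp z‖ := by
  rw [Complex.norm_exp]
  exact Real.exp_le_exp.2 ((abs_le.1 (Complex.abs_re_le_norm z)).1)

lemma exp_le_EN {z : ℂ} {T : ℝ} (hT : 1 ≤ T) (hz : ‖z‖ ≤ T / 2) {N : ℕ} (hN : 8 * T ≤ N) :
    ‖Complex.exp z‖ ≤ Real.exp (2 * Real.exp (-T)) * ‖EN N z‖ := by
  have h1 := EN_err z (Real.exp 2) (Real.one_le_exp (by norm_num)) N
  have he : Real.exp 2 ≤ 8 := by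
    have : Real.exp 2 = Real.exp 1 ^ 2 := by rw [← Real.exp_nat_mul]; norm_num
    rw [this]
    have := Real.exp_one_lt_d9
    nlinarith [Real.exp_pos 1]
  have h2 : ((Real.exp 2) ^ (N+1))⁻¹ * Real.exp (Real.exp 2 * ‖z‖) ≤ Real.exp (-T) * Real.exp (-‖z‖) := by
    rw [← Real.exp_nat_mul, ← Real.exp_neg, ← Real.exp_add, ← Real.exp_add]
    apply Real.exp_le_exp.2
    push_cast
    nlinarith [norm_nonneg z, mul_le_mul_of_nonneg_right he (norm_nonneg z)]
  have h3 : ‖Complex.exp z - EN N z‖ ≤ Real.exp (-T) * ‖Complex.exp z‖ :=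
    h1.trans (h2.trans (mul_le_mul_of_nonneg_left (norm_exp_ge z) (Real.exp_pos _).le))
  have h4 : ‖Complex.exp z‖ ≤ ‖Complex.exp z - EN N z‖ + ‖EN N z‖ := by
    have := norm_add_le (Complex.exp z - EN N z) (EN N z)
    rwa [sub_add_cancel] at this
  set t := Real.exp (-T) with ht
  have ht0 : 0 < t := Real.exp_pos _
  have ht1 : t ≤ 1/2 := by
    have : t ≤ Real.exp (-1) := Real.exp_le_exp.2 (by linarith)
    linarith [Real.exp_neg_one_lt_d9]
  have h5 : (1 - t) * ‖Complex.exp z‖ ≤ ‖EN N z‖ := by linarith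
  have h6 : 1 ≤ Real.exp (2 * t) * (1 - t) := by
    have := Real.add_one_le_exp (2 * t)
    nlinarith
  calc ‖Complex.exp z‖ = 1 * ‖Complex.exp z‖ := (one_mul _).symm
    _ ≤ (Real.exp (2 * t) * (1 - t)) * ‖Complex.exp z‖ := mul_le_mul_of_nonneg_right h6 (norm_nonneg _)
    _ = Real.exp (2 * t) * ((1 - t) * ‖Complex.exp z‖) := by ring
    _ ≤ _ := mul_le_mul_of_nonneg_left h5 (Real.exp_pos _).le

lemma EN_le_exp {z : ℂ} {W : ℝ} (hz : ‖z‖ ≤ W) {N : ℕ} (hN : 4 * W ≤ N) :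
    ‖EN N z‖ ≤ 2 * ‖Complex.exp z‖ := by
  have h1 := EN_err z (Real.exp 1) (Real.one_le_exp (by norm_num)) N
  have h2 : ((Real.exp 1) ^ (N+1))⁻¹ * Real.exp (Real.exp 1 * ‖z‖) ≤ Real.exp (-‖z‖) := by
    rw [← Real.exp_nat_mul, ← Real.exp_neg, ← Real.exp_add]
    apply Real.exp_le_exp.2
    push_cast
    nlinarith [norm_nonneg z, mul_le_mul_of_nonneg_right Real.exp_one_lt_d9.le (norm_nonneg z)]
  have h3 := h1.trans (h2.trans (norm_exp_ge z))
  have h4 : ‖EN N z‖ ≤ ‖Complex.exp z - EN N z‖ + ‖Complex.exp z‖ := by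
    have := norm_sub_le (Complex.exp z) (Complex.exp z - EN N z)
    rw [sub_sub_cancel] at this; linarith
  linarith

section
variable {σ : Type} [Fintype σ] [DecidableEq σ]

def Dom (f : MvPolynomial σ ℂ) (F : MvPolynomial σ ℝ) : Prop := ∀ m, ‖MvPolynomial.coeff m f‖ ≤ MvPolynomial.coeff m F

def CLe (F G : MvPolynomial σ ℝ) : Prop := ∀ m, MvPolynomial.coeff m F ≤ MvPolynomial.coeff m G

lemma Dom.trans {f : MvPolynomial σ ℂ} {F G : MvPolynomial σ ℝ} (h : Dom f F) (h2 : CLe F G) : Dom f G := fun m => (h m).trans (h2 m)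

lemma CLe.trans {E F G : MvPolynomial σ ℝ} (h : CLe E F) (h2 : CLe F G) : CLe E G := fun m => (h m).trans (h2 m)

lemma Dom.mul {f g : MvPolynomial σ ℂ} {F G : MvPolynomial σ ℝ} (h : Dom f F) (h2 : Dom g G) : Dom (f * g) (F * G) := by
  intro m
  rw [MvPolynomial.coeff_mul, MvPolynomial.coeff_mul]
  refine (norm_sum_le _ _).trans (sum_le_sum fun x _ => ?_)
  rw [norm_mul]
  exact mul_le_mul (h _) (h2 _) (norm_nonneg _) ((norm_nonneg _).trans (h _))

lemma Dom.one : Dom (1 : MvPolynomial σ ℂ) 1 := by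
  intro m
  rw [MvPolynomial.coeff_one, MvPolynomial.coeff_one]
  split_ifs <;> simp

lemma Dom.sum {ι : Type*} (S : Finset ι) {f : ι → MvPolynomial σ ℂ} {F : ι → MvPolynomial σ ℝ} (h : ∀ i ∈ S, Dom (f i) (F i)) :
    Dom (∑ i ∈ S, f i) (∑ i ∈ S, F i) := by
  intro m
  rw [MvPolynomial.coeff_sum, MvPolynomial.coeff_sum]
  exact (norm_sum_le _ _).trans (sum_le_sum fun i hi => h i hi m)

lemma Dom.pow {f : MvPolynomial σ ℂ} {F : MvPolynomial σ ℝ} (h : Dom f F) (n : ℕ) : Dom (f ^ n) (F ^ n) := by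
  induction n with
  | zero => simpa using Dom.one
  | succ n ih => rw [pow_succ, pow_succ]; exact ih.mul h

lemma Dom.C {c : ℂ} {r : ℝ} (h : ‖c‖ ≤ r) : Dom (MvPolynomial.C c : MvPolynomial σ ℂ) (MvPolynomial.C r) := by
  intro m
  rw [MvPolynomial.coeff_C, MvPolynomial.coeff_C]
  split_ifs
  · exact h
  · simp

lemma Dom.X (p : σ) : Dom (MvPolynomial.X p : MvPolynomial σ ℂ) (MvPolynomial.X p) := by
  intro m
  rw [MvPolynomial.coeff_X, MvPolynomial.coeff_X]
  split_ifs <;> simp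

noncomputable def EPc (N : ℕ) (f : MvPolynomial σ ℂ) : MvPolynomial σ ℂ := ∑ i ∈ Finset.range (N+1), MvPolynomial.C ((i.factorial : ℂ)⁻¹) * f ^ i
noncomputable def EPr (N : ℕ) (f : MvPolynomial σ ℝ) : MvPolynomial σ ℝ := ∑ i ∈ Finset.range (N+1), MvPolynomial.C ((i.factorial : ℝ)⁻¹) * f ^ i

lemma Dom.EP {f : MvPolynomial σ ℂ} {F : MvPolynomial σ ℝ} (h : Dom f F) (n : ℕ) : Dom (EPc n f) (EPr n F) :=
  Dom.sum _ fun i _ => (Dom.C (by simp)).mul (h.pow i)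

def NNeg (F : MvPolynomial σ ℝ) : Prop := ∀ m, 0 ≤ MvPolynomial.coeff m F

lemma Dom.nneg {f : MvPolynomial σ ℂ} {F : MvPolynomial σ ℝ} (h : Dom f F) : NNeg F := fun m => (norm_nonneg _).trans (h m)

lemma NNeg.dom {F : MvPolynomial σ ℝ} (h : NNeg F) : Dom (MvPolynomial.map Complex.ofRealHom F) F := by
  intro m
  rw [MvPolynomial.coeff_map]
  simp [abs_of_nonneg (h m)]

lemma NNeg.mul {F G : MvPolynomial σ ℝ} (h : NNeg F) (h2 : NNeg G) : NNeg (F * G) := (h.dom.mul h2.dom).nneg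
lemma NNeg.pow {F : MvPolynomial σ ℝ} (h : NNeg F) (n : ℕ) : NNeg (F ^ n) := (h.dom.pow n).nneg
lemma NNeg.C {r : ℝ} (h : 0 ≤ r) : NNeg (MvPolynomial.C r : MvPolynomial σ ℝ) := (Dom.C (c := (r:ℂ)) (by simp [abs_of_nonneg h])).nneg
lemma NNeg.add {F G : MvPolynomial σ ℝ} (h : NNeg F) (h2 : NNeg G) : NNeg (F + G) := fun m => by
  rw [MvPolynomial.coeff_add]; exact add_nonneg (h m) (h2 m)

lemma CLe.mul_right {F G H : MvPolynomial σ ℝ} (h : CLe F G) (hH : NNeg H) : CLe (F * H) (G * H) := by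
  intro m
  rw [MvPolynomial.coeff_mul, MvPolynomial.coeff_mul]
  exact sum_le_sum fun x _ => mul_le_mul_of_nonneg_right (h _) (hH _)

/-- `(a+b)^n / n!` expansion -/
lemma EPr_add (N : ℕ) (a b : MvPolynomial σ ℝ) :
    EPr N (a + b) = ∑ x ∈ (Finset.range (N+1) ×ˢ Finset.range (N+1)).filter (fun x => x.1 + x.2 ≤ N),
      (MvPolynomial.C ((x.1.factorial : ℝ)⁻¹) * a ^ x.1) * (MvPolynomial.C ((x.2.factorial : ℝ)⁻¹) * b ^ x.2) := by
  have h1 : ∀ i, MvPolynomial.C ((i.factorial : ℝ)⁻¹) * (a + b) ^ i = ∑ x ∈ Finset.HasAntidiagonal.antidiagonal i,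
      (MvPolynomial.C ((x.1.factorial : ℝ)⁻¹) * a ^ x.1) * (MvPolynomial.C ((x.2.factorial : ℝ)⁻¹) * b ^ x.2) := by
    intro i
    rw [Commute.add_pow' (Commute.all a b), mul_sum]
    refine sum_congr rfl fun x hx => ?_
    have hx' := Finset.HasAntidiagonal.mem_antidiagonal.1 hx
    have hc : ((i.factorial : ℝ)⁻¹) * (i.choose x.1 : ℝ) = ((x.1.factorial : ℝ)⁻¹) * ((x.2.factorial : ℝ)⁻¹) := by
      have := Nat.choose_mul_factorial_mul_factorial (n := i) (k := x.1) (by omega)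
      rw [show i - x.1 = x.2 by omega] at this
      have h2 : (i.choose x.1 : ℝ) * (x.1.factorial : ℝ) * (x.2.factorial : ℝ) = (i.factorial : ℝ) := by exact_mod_cast this
      have := Nat.factorial_ne_zero i
      have := Nat.factorial_ne_zero x.1
      have := Nat.factorial_ne_zero x.2
      field_simp
      linarith
    rw [nsmul_eq_mul, show ((i.choose x.1 : ℕ) : MvPolynomial σ ℝ) = MvPolynomial.C (i.choose x.1 : ℝ) by simp, ← mul_assoc, ← MvPolynomial.C_mul, hc, MvPolynomial.C_mul]
    ring
  rw [EPr]
  simp_rw [h1]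
  rw [Finset.sum_sigma']
  refine Finset.sum_bij' (fun x _ => x.2) (fun x _ => ⟨x.1 + x.2, x⟩) ?_ ?_ ?_ ?_ ?_
  · rintro ⟨i, x⟩ h
    simp at h ⊢; omega
  · intro x h
    simp at h ⊢; omega
  · rintro ⟨i, x⟩ h
    simp only [Finset.mem_sigma, Finset.HasAntidiagonal.mem_antidiagonal] at h
    obtain ⟨_, rfl⟩ := h; rfl
  · intro x h; rfl
  · intro x h; rfl

lemma CLe.sum_subset {ι : Type*} {S T : Finset ι} (h : S ⊆ T) {F : ι → MvPolynomial σ ℝ} (hF : ∀ i ∈ T, NNeg (F i)) :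
    CLe (∑ i ∈ S, F i) (∑ i ∈ T, F i) := by
  intro m
  rw [MvPolynomial.coeff_sum, MvPolynomial.coeff_sum]
  exact Finset.sum_le_sum_of_subset_of_nonneg h fun i hi _ => hF i hi m

lemma term_nneg {a : MvPolynomial σ ℝ} (ha : NNeg a) (i : ℕ) : NNeg (MvPolynomial.C ((i.factorial : ℝ)⁻¹) * a ^ i) :=
  (NNeg.C (by positivity)).mul (ha.pow i)

lemma EPr_nneg {a : MvPolynomial σ ℝ} (ha : NNeg a) (N : ℕ) : NNeg (EPr N a) := (ha.dom.EP N).nneg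

lemma EPr_mul_le {a b : MvPolynomial σ ℝ} (ha : NNeg a) (hb : NNeg b) (N M : ℕ) : CLe (EPr N a * EPr M b) (EPr (N+M) (a+b)) := by
  rw [EPr_add, EPr, EPr, Finset.sum_mul_sum, ← Finset.sum_product']
  refine CLe.sum_subset (fun x hx => ?_) fun x _ => (term_nneg ha _).mul (term_nneg hb _)
  simp at hx ⊢; omega

lemma EPr_mul_pow_le {a b : MvPolynomial σ ℝ} (ha : NNeg a) (hb : NNeg b) (N M : ℕ) :
    CLe (EPr N a * (MvPolynomial.C ((M.factorial : ℝ)⁻¹) * b ^ M)) (EPr (N+M) (a+b)) := by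
  have h1 : CLe (MvPolynomial.C ((M.factorial : ℝ)⁻¹) * b ^ M * EPr N a) (EPr M b * EPr N a) := by
    refine CLe.mul_right ?_ (EPr_nneg ha N)
    have := CLe.sum_subset (S := {M}) (T := Finset.range (M+1)) (by simp) (F := fun i => MvPolynomial.C ((i.factorial : ℝ)⁻¹) * b ^ i) (fun i _ => term_nneg hb i)
    rwa [Finset.sum_singleton] at this
  rw [mul_comm (EPr N a)]
  refine h1.trans ?_
  rw [mul_comm (EPr M b)]
  exact EPr_mul_le ha hb N M

lemma EPr_mono {a : MvPolynomial σ ℝ} (ha : NNeg a) {N M : ℕ} (h : N ≤ M) : CLe (EPr N a) (EPr M a) :=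
  CLe.sum_subset (Finset.range_subset_range.2 (by omega)) fun i _ => term_nneg ha i

lemma EPr_prod_le {J : ℕ} (a : ℕ → MvPolynomial σ ℝ) (ha : ∀ i, NNeg (a i)) (N : ℕ → ℕ) :
    CLe (∏ l ∈ Finset.range J, EPr (N l) (a l)) (EPr (∑ l ∈ Finset.range J, N l) (∑ l ∈ Finset.range J, a l)) := by
  induction J with
  | zero => intro m; simp [EPr]
  | succ J ih =>
    rw [Finset.prod_range_succ, sum_range_succ, sum_range_succ]
    refine (ih.mul_right (EPr_nneg (ha J) _)).trans (EPr_mul_le ?_ (ha J) _ _)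
    intro m
    rw [MvPolynomial.coeff_sum]; exact sum_nonneg fun i _ => ha i m

lemma Dom.prod {J : ℕ} {f : ℕ → MvPolynomial σ ℂ} {F : ℕ → MvPolynomial σ ℝ} (h : ∀ i, Dom (f i) (F i)) :
    Dom (∏ l ∈ Finset.range J, f l) (∏ l ∈ Finset.range J, F l) := by
  induction J with
  | zero => simpa using Dom.one
  | succ J ih => rw [Finset.prod_range_succ, Finset.prod_range_succ]; exact ih.mul (h J)

lemma eval_EPc (v : σ → ℂ) (N : ℕ) (f : MvPolynomial σ ℂ) : MvPolynomial.eval v (EPc N f) = EN N (MvPolynomial.eval v f) := by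
  rw [EPc, EN, map_sum]
  refine sum_congr rfl fun i _ => ?_
  simp [div_eq_inv_mul]

lemma map_EPr (N : ℕ) (f : MvPolynomial σ ℝ) : MvPolynomial.map Complex.ofRealHom (EPr N f) = EPc N (MvPolynomial.map Complex.ofRealHom f) := by
  rw [EPc, EPr, map_sum]
  refine sum_congr rfl fun i _ => ?_
  simp

/-! weights -/
noncomputable def wt (pr : σ → ℕ) (m : σ →₀ ℕ) : ℝ := ∑ p, (m p : ℝ) * Real.log (pr p)

lemma wt_add (pr : σ → ℕ) (m n : σ →₀ ℕ) : wt pr (m + n) = wt pr m + wt pr n := by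
  simp [wt, add_mul, sum_add_distrib]

def Wt (pr : σ → ℕ) (X : ℝ) (f : MvPolynomial σ ℂ) : Prop := ∀ m, MvPolynomial.coeff m f ≠ 0 → wt pr m ≤ X

lemma Wt.mul {pr : σ → ℕ} {X Y : ℝ} {f g : MvPolynomial σ ℂ} (hf : Wt pr X f) (hg : Wt pr Y g) : Wt pr (X + Y) (f * g) := by
  intro m hm
  rw [MvPolynomial.coeff_mul] at hm
  obtain ⟨x, hx, hne⟩ := Finset.exists_ne_zero_of_sum_ne_zero hm
  rw [← (Finset.HasAntidiagonal.mem_antidiagonal.1 hx : x.1 + x.2 = m), wt_add]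
  exact add_le_add (hf _ (left_ne_zero_of_mul hne)) (hg _ (right_ne_zero_of_mul hne))

lemma Wt.sum {ι : Type*} {pr : σ → ℕ} {X : ℝ} {S : Finset ι} {f : ι → MvPolynomial σ ℂ} (hf : ∀ i ∈ S, Wt pr X (f i)) : Wt pr X (∑ i ∈ S, f i) := by
  intro m hm
  rw [MvPolynomial.coeff_sum] at hm
  obtain ⟨i, hi, hne⟩ := Finset.exists_ne_zero_of_sum_ne_zero hm
  exact hf i hi m hne

lemma Wt.C {pr : σ → ℕ} (c : ℂ) : Wt pr 0 (MvPolynomial.C c : MvPolynomial σ ℂ) := by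
  intro m hm
  rw [MvPolynomial.coeff_C] at hm
  have : 0 = m := by by_contra h; simp [h] at hm
  subst this
  simp [wt]

lemma Wt.mono {pr : σ → ℕ} {X Y : ℝ} {f : MvPolynomial σ ℂ} (hf : Wt pr X f) (h : X ≤ Y) : Wt pr Y f := fun m hm => (hf m hm).trans h

lemma Wt.pow {pr : σ → ℕ} {X : ℝ} {f : MvPolynomial σ ℂ} (hf : Wt pr X f) (n : ℕ) : Wt pr (n * X) (f ^ n) := by
  induction n with
  | zero => simpa using Wt.C (pr := pr) (1:ℂ)
  | succ n ih => rw [pow_succ]; push_cast; rw [add_mul, one_mul]; exact ih.mul hf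

lemma Wt.EP {pr : σ → ℕ} {X : ℝ} (hX : 0 ≤ X) {f : MvPolynomial σ ℂ} (hf : Wt pr X f) (N : ℕ) : Wt pr (N * X) (EPc N f) := by
  refine Wt.sum fun i hi => ?_
  have := (Wt.C (pr := pr) ((i.factorial : ℂ)⁻¹)).mul (hf.pow i)
  refine this.mono ?_
  rw [zero_add]
  have : i ≤ N := by simp at hi; omega
  gcongr

lemma Wt.prod {pr : σ → ℕ} {J : ℕ} {X : ℕ → ℝ} {f : ℕ → MvPolynomial σ ℂ} (hf : ∀ i, Wt pr (X i) (f i)) :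
    Wt pr (∑ l ∈ Finset.range J, X l) (∏ l ∈ Finset.range J, f l) := by
  induction J with
  | zero => simpa using Wt.C (pr := pr) (1:ℂ)
  | succ J ih => rw [Finset.prod_range_succ, sum_range_succ]; exact ih.mul (hf J)

/-- product of prime powers -/
def nm (pr : σ → ℕ) (m : σ →₀ ℕ) : ℕ := ∏ p, pr p ^ m p

lemma nm_pos {pr : σ → ℕ} (hpr : ∀ p, (pr p).Prime) (m : σ →₀ ℕ) : 0 < nm pr m := Finset.prod_pos fun p _ => pow_pos (hpr p).pos _

lemma log_nm {pr : σ → ℕ} (hpr : ∀ p, (pr p).Prime) (m : σ →₀ ℕ) : Real.log (nm pr m) = wt pr m := by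
  rw [nm, wt, Nat.cast_prod, Real.log_prod (fun p _ => by
    have := (hpr p).pos
    positivity)]
  exact sum_congr rfl fun p _ => by rw [Nat.cast_pow, Real.log_pow]

lemma nm_fact {pr : σ → ℕ} (hpr : ∀ p, (pr p).Prime) (hinj : Function.Injective pr) (m : σ →₀ ℕ) (p : σ) : (nm pr m).factorization (pr p) = m p := by
  rw [nm, Nat.factorization_prod (fun p _ => pow_ne_zero _ (hpr p).ne_zero), Finsupp.finsetSum_apply, Finset.sum_eq_single p]
  · rw [(hpr p).factorization_pow]; simp
  · intro b _ hb
    rw [(hpr b).factorization_pow, Finsupp.single_apply, if_neg (fun h => hb (hinj h))]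
  · simp

lemma nm_inj {pr : σ → ℕ} (hpr : ∀ p, (pr p).Prime) (hinj : Function.Injective pr) : Function.Injective (nm pr) := by
  intro m n h
  ext p
  rw [← nm_fact hpr hinj m p, h, nm_fact hpr hinj]

lemma meansq {q : ℕ} [NeZero q] {pr : σ → ℕ} (hpr : ∀ p, (pr p).Prime) (hinj : Function.Injective pr) {X : ℝ} (hX : X < Real.log q)
    {f : MvPolynomial σ ℂ} {G : MvPolynomial σ ℝ} (hf : Wt pr X f) (hG : Dom f G) :
    ∑ χ : DirichletCharacter ℂ q, ‖MvPolynomial.eval (fun p => χ (pr p : ZMod q)) f‖ ^ 2 ≤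
      (Nat.totient q : ℝ) * ∑ m ∈ G.support, (MvPolynomial.coeff m G) ^ 2 := by
  have h1 : ∀ χ : DirichletCharacter ℂ q, MvPolynomial.eval (fun p => χ (pr p : ZMod q)) f = ∑ m ∈ f.support, MvPolynomial.coeff m f * χ ((nm pr m : ℕ) : ZMod q) := by
    intro χ
    rw [MvPolynomial.eval_eq']
    refine sum_congr rfl fun m _ => ?_
    rw [nm]; push_cast; rw [map_prod]; simp
  simp_rw [h1]
  have hlt : ∀ m ∈ f.support, nm pr m < q := by
    intro m hm
    have := hf m (MvPolynomial.mem_support_iff.1 hm)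
    rw [← log_nm hpr] at this
    have h3 := this.trans_lt hX
    have h4 := (Real.log_lt_log_iff (by exact_mod_cast nm_pos hpr m) (by exact_mod_cast NeZero.pos q)).1 h3
    exact_mod_cast h4
  refine (orth f.support _ (fun m => ((nm pr m : ℕ) : ZMod q)) ?_).trans ?_
  · intro m hm n hn h
    have h2 := (ZMod.natCast_eq_natCast_iff' _ _ _).1 h
    rw [Nat.mod_eq_of_lt (hlt m hm), Nat.mod_eq_of_lt (hlt n hn)] at h2
    exact nm_inj hpr hinj h2
  · apply mul_le_mul_of_nonneg_left _ (Nat.cast_nonneg _)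
    calc ∑ m ∈ f.support, ‖MvPolynomial.coeff m f‖ ^ 2 ≤ ∑ m ∈ f.support, (MvPolynomial.coeff m G) ^ 2 :=
          sum_le_sum fun m _ => pow_le_pow_left₀ (norm_nonneg _) (hG m) 2
      _ ≤ _ := by
          refine Finset.sum_le_sum_of_subset_of_nonneg (fun m hm => ?_) fun _ _ _ => sq_nonneg _
          rw [MvPolynomial.mem_support_iff] at hm ⊢
          exact fun h => hm (norm_le_zero_iff.1 (by rw [← h]; exact hG m))
end

section
variable {σ : Type} [Fintype σ] [DecidableEq σ]

noncomputable def zN (N : ℕ) : ℂ := Complex.exp (2 * Real.pi * Complex.I / N)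

lemma zN_norm (N : ℕ) : ‖zN N‖ = 1 := by
  rw [zN, show (2 * Real.pi * Complex.I / N : ℂ) = ((2 * Real.pi / N : ℝ) : ℂ) * Complex.I by push_cast; ring]
  exact Complex.norm_exp_ofReal_mul_I _

lemma zN_orth {N : ℕ} (hN : 0 < N) {a b : ℕ} (ha : a < N) (hb : b < N) :
    ∑ θ : Fin N, (zN N ^ (θ : ℕ)) ^ a * conj ((zN N ^ (θ : ℕ)) ^ b) = if a = b then (N : ℂ) else 0 := by
  have hprim : IsPrimitiveRoot (zN N) N := Complex.isPrimitiveRoot_exp N hN.ne'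
  have hcz : ∀ m : ℕ, conj (zN N ^ m) * zN N ^ m = 1 := by
    intro m
    rw [mul_comm, Complex.mul_conj, Complex.normSq_eq_norm_sq, norm_pow, zN_norm]; simp
  set z := zN N ^ a * conj (zN N ^ b) with hz
  have h1 : ∀ θ : Fin N, (zN N ^ (θ : ℕ)) ^ a * conj ((zN N ^ (θ : ℕ)) ^ b) = z ^ (θ : ℕ) := by
    intro θ
    rw [hz, mul_pow, ← map_pow, ← pow_mul, ← pow_mul, ← pow_mul, ← pow_mul, mul_comm a, mul_comm b]
  simp_rw [h1]
  rw [Fin.sum_univ_eq_sum_range (fun i => z ^ i) N]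
  split_ifs with h
  · have : z = 1 := by rw [hz, h, mul_comm]; exact hcz b
    simp [this]
  · have hz1 : z ≠ 1 := by
      intro h2
      apply h
      refine hprim.pow_inj ha hb ?_
      have : z * zN N ^ b = zN N ^ a := by rw [hz, mul_assoc, hcz, mul_one]
      rw [← this, h2, one_mul]
    have hzN : z ^ N = 1 := by
      rw [hz, mul_pow, ← map_pow, ← pow_mul, ← pow_mul, mul_comm a, mul_comm b, pow_mul, pow_mul, hprim.pow_eq_one]; simp
    have := mul_geom_sum z N
    rw [hzN, sub_self] at this
    exact (mul_eq_zero.1 this).resolve_left (sub_ne_zero.2 hz1)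

noncomputable def vN (N : ℕ) (x : σ → Fin N) (p : σ) : ℂ := zN N ^ (x p : ℕ)

lemma sum_pi_prod {N : ℕ} {R : Type*} [CommSemiring R] (f : σ → Fin N → R) : ∑ x : σ → Fin N, ∏ p, f p (x p) = ∏ p, ∑ θ : Fin N, f p θ := by
  rw [Finset.prod_univ_sum, Fintype.piFinset_univ]

lemma steinhaus (G : MvPolynomial σ ℝ) {N : ℕ} (hN : 0 < N) (hd : ∀ m ∈ G.support, ∀ p, m p < N) :
    ∑ x : σ → Fin N, ‖MvPolynomial.eval (vN N x) (MvPolynomial.map Complex.ofRealHom G)‖ ^ 2 =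
      (N : ℝ) ^ Fintype.card σ * ∑ m ∈ G.support, (MvPolynomial.coeff m G) ^ 2 := by
  have h1 : ∀ x : σ → Fin N, MvPolynomial.eval (vN N x) (MvPolynomial.map Complex.ofRealHom G) =
      ∑ m ∈ G.support, ((MvPolynomial.coeff m G : ℝ) : ℂ) * ∏ p, (zN N ^ (x p : ℕ)) ^ m p := by
    intro x
    rw [MvPolynomial.eval_map, MvPolynomial.eval₂_eq']
    rfl
  have key : ∀ x : σ → Fin N, ((‖MvPolynomial.eval (vN N x) (MvPolynomial.map Complex.ofRealHom G)‖ ^ 2 : ℝ) : ℂ) =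
      ∑ m ∈ G.support, ∑ n ∈ G.support, (((MvPolynomial.coeff m G : ℝ) : ℂ) * ((MvPolynomial.coeff n G : ℝ) : ℂ)) *
        ∏ p, ((zN N ^ (x p : ℕ)) ^ m p * conj ((zN N ^ (x p : ℕ)) ^ n p)) := by
    intro x
    rw [← Complex.normSq_eq_norm_sq, ← Complex.mul_conj, h1, map_sum, Finset.sum_mul_sum]
    refine sum_congr rfl fun m _ => sum_congr rfl fun n _ => ?_
    rw [map_mul, Complex.conj_ofReal, map_prod, Finset.prod_mul_distrib]; ring
  have : ((∑ x : σ → Fin N, ‖MvPolynomial.eval (vN N x) (MvPolynomial.map Complex.ofRealHom G)‖ ^ 2 : ℝ) : ℂ) =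
      (((N : ℝ) ^ Fintype.card σ * ∑ m ∈ G.support, (MvPolynomial.coeff m G) ^ 2 : ℝ) : ℂ) := by
    rw [Complex.ofReal_sum]
    simp_rw [key]
    rw [sum_comm]
    push_cast
    rw [mul_sum]
    refine sum_congr rfl fun m hm => ?_
    rw [sum_comm, Finset.sum_eq_single m]
    · rw [← mul_sum, sum_pi_prod (fun p θ => (zN N ^ (θ : ℕ)) ^ m p * conj ((zN N ^ (θ : ℕ)) ^ m p))]
      simp_rw [zN_orth hN (hd m hm _) (hd m hm _)]
      simp; ring
    · intro n hn hne
      rw [← mul_sum, sum_pi_prod (fun p θ => (zN N ^ (θ : ℕ)) ^ m p * conj ((zN N ^ (θ : ℕ)) ^ n p))]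
      simp_rw [zN_orth hN (hd m hm _) (hd n hn _)]
      obtain ⟨p, hp⟩ : ∃ p, m p ≠ n p := by
        by_contra hcon; push Not at hcon; exact hne (Finsupp.ext fun p => (hcon p).symm)
      rw [Finset.prod_eq_zero (Finset.mem_univ p) (by rw [if_neg hp]), mul_zero]
    · intro h; exact absurd hm h
  exact_mod_cast this

lemma main_ms {q : ℕ} [NeZero q] {pr : σ → ℕ} (hpr : ∀ p, (pr p).Prime) (hinj : Function.Injective pr) {X : ℝ} (hX : X < Real.log q)
    {f : MvPolynomial σ ℂ} {w : MvPolynomial σ ℝ} (hw : NNeg w) {c : ℝ} (hc : 0 ≤ c) {n0 : ℕ} (hf : Wt pr X f)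
    (hD : Dom f (MvPolynomial.C c * EPr n0 w)) {E : ℝ} {N0 : ℕ}
    (hE : ∀ N : ℕ, N0 ≤ N → 0 < N → ∑ x : σ → Fin N, Real.exp (2 * (MvPolynomial.eval (vN N x) (MvPolynomial.map Complex.ofRealHom w)).re) ≤ (N : ℝ) ^ Fintype.card σ * E) :
    ∑ χ : DirichletCharacter ℂ q, ‖MvPolynomial.eval (fun p => χ (pr p : ZMod q)) f‖ ^ 2 ≤
      (Nat.totient q : ℝ) * (4 * c ^ 2 * E) := by
  set S := ∑ m ∈ w.support, MvPolynomial.coeff m w with hS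
  set B := max n0 ⌈4 * S⌉₊ with hB
  set G := MvPolynomial.C c * EPr B w with hG
  have hDG : Dom f G := by
    refine hD.trans ?_
    rw [hG, mul_comm, mul_comm (MvPolynomial.C c)]
    exact (EPr_mono hw (le_max_left _ _)).mul_right (NNeg.C hc)
  refine (meansq hpr hinj hX hf hDG).trans ?_
  refine mul_le_mul_of_nonneg_left ?_ (by positivity)
  set N := N0 + G.totalDegree + 1 with hN
  have hN0 : 0 < N := by omega
  have hst := steinhaus G hN0 (fun m hm p => by
    have h1 : (m.sum fun _ e => e) ≤ G.totalDegree := MvPolynomial.le_totalDegree hm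
    have h2 : m p ≤ m.sum fun _ e => e := by
      rw [Finsupp.sum_fintype _ _ (fun _ => rfl)]
      exact Finset.single_le_sum (f := fun p => m p) (fun _ _ => Nat.zero_le _) (Finset.mem_univ p)
    omega)
  have hpos : (0:ℝ) < (N : ℝ) ^ Fintype.card σ := by positivity
  have hb : ∀ x : σ → Fin N, ‖MvPolynomial.eval (vN N x) (MvPolynomial.map Complex.ofRealHom G)‖ ^ 2 ≤
      4 * c ^ 2 * Real.exp (2 * (MvPolynomial.eval (vN N x) (MvPolynomial.map Complex.ofRealHom w)).re) := by
    intro x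
    set z := MvPolynomial.eval (vN N x) (MvPolynomial.map Complex.ofRealHom w) with hz
    have h1 : MvPolynomial.eval (vN N x) (MvPolynomial.map Complex.ofRealHom G) = c * EN B z := by
      rw [hG, map_mul, map_mul, map_EPr, eval_EPc, ← hz, MvPolynomial.map_C, MvPolynomial.eval_C]; rfl
    have hzS : ‖z‖ ≤ S := by
      rw [hz, MvPolynomial.eval_map, MvPolynomial.eval₂_eq']
      refine (norm_sum_le _ _).trans (sum_le_sum fun m _ => ?_)
      rw [norm_mul, norm_prod]
      simp only [norm_pow, vN, zN_norm, one_pow, Finset.prod_const_one, mul_one]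
      simp [abs_of_nonneg (hw m)]
    have h2 := EN_le_exp (N := B) hzS (by
      have := Nat.le_ceil (4 * S)
      have h3 : ((⌈4 * S⌉₊ : ℕ) : ℝ) ≤ B := by exact_mod_cast le_max_right _ _
      linarith)
    rw [h1, norm_mul, mul_pow]
    have h3 : ‖(c:ℂ)‖ ^ 2 = c ^ 2 := by simp
    rw [h3, Complex.norm_exp] at *
    have h4 : ‖EN B z‖ ^ 2 ≤ (2 * Real.exp z.re) ^ 2 := pow_le_pow_left₀ (norm_nonneg _) h2 2
    rw [show (2 * Real.exp z.re) ^ 2 = 4 * Real.exp (2 * z.re) by rw [mul_pow, ← Real.exp_nat_mul]; norm_num] at h4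
    nlinarith [sq_nonneg c]
  have h5 := sum_le_sum (s := (Finset.univ : Finset (σ → Fin N))) fun x _ => hb x
  rw [hst, ← mul_sum] at h5
  have h6 := hE N (by omega) hN0
  have h7 : 0 ≤ 4 * c ^ 2 := by positivity
  refine le_of_mul_le_mul_left ?_ hpos
  nlinarith [mul_le_mul_of_nonneg_left h6 h7]

lemma avg_prod (A : ℕ) (W : σ → ℕ → ℝ) {N : ℕ} (hN : 0 < N) {E : σ → ℝ}
    (h : ∀ p, ∑ θ : Fin N, Real.exp (2 * (∑ a ∈ Finset.Icc 1 A, (W p a : ℂ) * (zN N ^ (θ : ℕ)) ^ a).re) ≤ N * Real.exp (E p)) :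
    ∑ x : σ → Fin N, Real.exp (2 * (MvPolynomial.eval (vN N x) (MvPolynomial.map Complex.ofRealHom
      (∑ p, ∑ a ∈ Finset.Icc 1 A, MvPolynomial.C (W p a) * MvPolynomial.X p ^ a))).re) ≤ (N : ℝ) ^ Fintype.card σ * Real.exp (∑ p, E p) := by
  have h1 : ∀ x : σ → Fin N, Real.exp (2 * (MvPolynomial.eval (vN N x) (MvPolynomial.map Complex.ofRealHom
      (∑ p, ∑ a ∈ Finset.Icc 1 A, MvPolynomial.C (W p a) * MvPolynomial.X p ^ a))).re) =
      ∏ p, Real.exp (2 * (∑ a ∈ Finset.Icc 1 A, (W p a : ℂ) * (zN N ^ (x p : ℕ)) ^ a).re) := by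
    intro x
    rw [← Real.exp_sum, ← mul_sum, ← Complex.re_sum]
    simp [vN]
  simp_rw [h1]
  rw [sum_pi_prod (fun p θ => Real.exp (2 * (∑ a ∈ Finset.Icc 1 A, (W p a : ℂ) * (zN N ^ (θ : ℕ)) ^ a).re))]
  rw [Real.exp_sum, ← Finset.card_univ, ← Finset.prod_const, ← Finset.prod_mul_distrib]
  exact Finset.prod_le_prod (fun p _ => sum_nonneg fun _ _ => (Real.exp_pos _).le) fun p _ => h p
end

lemma mertens (X : ℕ) (hX : 1 ≤ X) : ∑ p ∈ Nat.primesLE X, Real.log p / p ≤ Real.log X + 2 := by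
  have hX0 : (0:ℝ) < X := by exact_mod_cast hX
  have h1 : ∑ n ∈ Finset.Ioc 0 X, ∑ p ∈ Nat.primesLE X with p ∣ n, Real.log p ≤ X * Real.log X := by
    have : ∀ n ∈ Finset.Ioc 0 X, ∑ p ∈ Nat.primesLE X with p ∣ n, Real.log p ≤ Real.log X := by
      intro n hn
      simp only [Finset.mem_Ioc] at hn
      have h2 : ∑ p ∈ Nat.primesLE X with p ∣ n, Real.log p ≤ ∑ d ∈ n.divisors, ArithmeticFunction.vonMangoldt d := by
        rw [← sum_congr rfl (fun p hp => ArithmeticFunction.vonMangoldt_apply_prime (Nat.prime_of_mem_primesLE (Finset.mem_filter.1 hp).1))]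
        refine Finset.sum_le_sum_of_subset_of_nonneg (fun p hp => ?_) fun _ _ _ => ArithmeticFunction.vonMangoldt_nonneg
        rw [Nat.mem_divisors]
        exact ⟨(Finset.mem_filter.1 hp).2, by omega⟩
      rw [ArithmeticFunction.vonMangoldt_sum] at h2
      have : (n:ℝ) ≤ X := by exact_mod_cast hn.2
      have hn0 : (0:ℝ) < n := by exact_mod_cast hn.1
      exact h2.trans (Real.log_le_log hn0 this)
    refine (sum_le_sum this).trans ?_
    simp
  have h2 : ∑ n ∈ Finset.Ioc 0 X, ∑ p ∈ Nat.primesLE X with p ∣ n, Real.log p = ∑ p ∈ Nat.primesLE X, ((X / p : ℕ) : ℝ) * Real.log p := by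
    simp_rw [Finset.sum_filter]
    rw [sum_comm]
    refine sum_congr rfl fun p hp => ?_
    rw [← Finset.sum_filter, Finset.sum_const, Nat.Ioc_filter_dvd_card_eq_div]; simp
  have h3 := Chebyshev.theta_le_log4_mul_x hX0.le
  rw [Chebyshev.theta_eq_sum_primesLE_log] at h3
  rw [h2] at h1
  have h4 : ∑ p ∈ Nat.primesLE X, (X * (Real.log p / p) - Real.log p) ≤ ∑ p ∈ Nat.primesLE X, ((X / p : ℕ) : ℝ) * Real.log p := by
    refine sum_le_sum fun p hp => ?_
    have hp2 := (Nat.prime_of_mem_primesLE hp).pos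
    have hp0 : (0:ℝ) < p := by exact_mod_cast hp2
    have h5 : (X:ℝ) / p < (X / p : ℕ) + 1 := by
      rw [div_lt_iff₀ hp0]
      have := Nat.lt_div_mul_add hp2 (a := X)
      have : (X:ℝ) < ((X / p * p + p : ℕ) : ℝ) := by exact_mod_cast this
      push_cast at this; linarith
    have h6 : 0 ≤ Real.log p := Real.log_natCast_nonneg p
    have : (X:ℝ) * (Real.log p / p) = (X / p) * Real.log p := by ring
    rw [this]; nlinarith
  rw [Finset.sum_sub_distrib, ← mul_sum] at h4
  have h7 : Real.log 4 ≤ 2 := by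
    rw [show (4:ℝ) = 2 ^ 2 by norm_num, Real.log_pow]
    have := Real.log_two_lt_d9
    push_cast; linarith
  have h8 : (X:ℝ) * ∑ p ∈ Nat.primesLE X, Real.log p / p ≤ X * (Real.log X + 2) := by nlinarith
  exact le_of_mul_le_mul_left h8 hX0

lemma exp_cubic {y : ℝ} (h : |y| ≤ 1) : Real.exp y ≤ 1 + y + y ^ 2 / 2 + |y| ^ 3 := by
  have := Real.exp_bound h (n := 3) (by norm_num)
  simp only [sum_range_succ, Finset.sum_range_zero, Nat.factorial] at this
  have h2 := (abs_le.1 this).2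
  norm_num at h2
  have : 0 ≤ |y| ^ 3 := by positivity
  nlinarith

lemma trig_mean (A : ℕ) (W : ℕ → ℝ) {N : ℕ} (hN : 2 * A < N) :
    ∑ θ : Fin N, 2 * (∑ a ∈ Finset.Icc 1 A, (W a : ℂ) * (zN N ^ (θ : ℕ)) ^ a).re = 0 := by
  have hN0 : 0 < N := by omega
  rw [← mul_sum, ← Complex.re_sum, sum_comm]
  have : ∀ a ∈ Finset.Icc 1 A, ∑ θ : Fin N, (W a : ℂ) * (zN N ^ (θ : ℕ)) ^ a = 0 := by
    intro a ha
    simp only [Finset.mem_Icc] at ha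
    have := zN_orth hN0 (a := a) (b := 0) (by omega) hN0
    simp only [pow_zero, map_one, mul_one] at this
    rw [← mul_sum, this, if_neg (by omega), mul_zero]
  rw [Finset.sum_eq_zero this]; simp

lemma trig_sq (A : ℕ) (W : ℕ → ℝ) {N : ℕ} (hN : 2 * A < N) :
    ∑ θ : Fin N, (2 * (∑ a ∈ Finset.Icc 1 A, (W a : ℂ) * (zN N ^ (θ : ℕ)) ^ a).re) ^ 2 = N * (2 * ∑ a ∈ Finset.Icc 1 A, W a ^ 2) := by
  have hN0 : 0 < N := by omega
  set F : Fin N → ℂ := fun θ => ∑ a ∈ Finset.Icc 1 A, (W a : ℂ) * (zN N ^ (θ : ℕ)) ^ a with hF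
  have hFF : ∑ θ, F θ * F θ = 0 := by
    simp only [hF]
    simp_rw [Finset.sum_mul_sum]
    rw [sum_comm]
    refine Finset.sum_eq_zero fun a ha => ?_
    rw [sum_comm]
    refine Finset.sum_eq_zero fun b hb => ?_
    simp only [Finset.mem_Icc] at ha hb
    have := zN_orth hN0 (a := a + b) (b := 0) (by omega) hN0
    simp only [pow_zero, map_one, mul_one] at this
    rw [if_neg (by omega)] at this
    rw [sum_congr rfl (fun (θ : Fin N) _ => show (W a : ℂ) * (zN N ^ (θ : ℕ)) ^ a * ((W b : ℂ) * (zN N ^ (θ : ℕ)) ^ b) = (W a * W b : ℂ) * (zN N ^ (θ : ℕ)) ^ (a + b) by rw [pow_add]; ring),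
      ← mul_sum, this, mul_zero]
  have hFc : ∑ θ, F θ * conj (F θ) = N * ∑ a ∈ Finset.Icc 1 A, (W a : ℂ) ^ 2 := by
    simp only [hF]
    simp_rw [map_sum, Finset.sum_mul_sum]
    rw [sum_comm, mul_sum]
    refine sum_congr rfl fun a ha => ?_
    rw [sum_comm, Finset.sum_eq_single a]
    · simp only [Finset.mem_Icc] at ha
      have := zN_orth hN0 (a := a) (b := a) (by omega) (by omega)
      rw [if_pos rfl] at this
      rw [sum_congr rfl (fun (θ : Fin N) _ => show (W a : ℂ) * (zN N ^ (θ : ℕ)) ^ a * conj ((W a : ℂ) * (zN N ^ (θ : ℕ)) ^ a) = (W a : ℂ) ^ 2 * ((zN N ^ (θ : ℕ)) ^ a * conj ((zN N ^ (θ : ℕ)) ^ a)) by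
        rw [map_mul, Complex.conj_ofReal]; ring), ← mul_sum, this, mul_comm]
    · intro b hb hne
      simp only [Finset.mem_Icc] at ha hb
      have := zN_orth hN0 (a := a) (b := b) (by omega) (by omega)
      rw [if_neg (Ne.symm hne)] at this
      rw [sum_congr rfl (fun (θ : Fin N) _ => show (W a : ℂ) * (zN N ^ (θ : ℕ)) ^ a * conj ((W b : ℂ) * (zN N ^ (θ : ℕ)) ^ b) = (W a * W b : ℂ) * ((zN N ^ (θ : ℕ)) ^ a * conj ((zN N ^ (θ : ℕ)) ^ b)) by
        rw [map_mul, Complex.conj_ofReal]; ring), ← mul_sum, this, mul_zero]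
    · intro h; exact absurd ha h
  have hpt : ∀ θ, (2 * (F θ).re) ^ 2 = 2 * (F θ * F θ).re + 2 * (F θ * conj (F θ)).re := by
    intro θ; simp [Complex.mul_re]; ring
  have h1 : ∑ θ, (2 * (F θ).re) ^ 2 = 2 * (∑ θ, F θ * F θ).re + 2 * (∑ θ, F θ * conj (F θ)).re := by
    simp_rw [hpt]
    rw [sum_add_distrib, ← mul_sum, ← mul_sum, Complex.re_sum, Complex.re_sum]
  rw [show (∑ θ : Fin N, (2 * (∑ a ∈ Finset.Icc 1 A, (W a : ℂ) * (zN N ^ (θ : ℕ)) ^ a).re) ^ 2) = ∑ θ, (2 * (F θ).re) ^ 2 from rfl, h1, hFF, hFc]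
  have : ((N:ℂ) * ∑ a ∈ Finset.Icc 1 A, (W a : ℂ) ^ 2) = ((N * ∑ a ∈ Finset.Icc 1 A, W a ^ 2 : ℝ) : ℂ) := by push_cast; rfl
  rw [this, Complex.ofReal_re]; simp; ring

lemma perprime (A : ℕ) (W : ℕ → ℝ) (hW : ∀ a, 0 ≤ W a) {N : ℕ} (hN : 2 * A < N) {u v : ℝ} (hu : 0 ≤ u) (hv : 0 ≤ v)
    (h : 2 * ∑ a ∈ Finset.Icc 1 A, W a ≤ u + v) :
    ∑ θ : Fin N, Real.exp (2 * (∑ a ∈ Finset.Icc 1 A, (W a : ℂ) * (zN N ^ (θ : ℕ)) ^ a).re) ≤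
      N * Real.exp (∑ a ∈ Finset.Icc 1 A, W a ^ 2 + 8 * (u ^ 3 + v ^ 2)) := by
  have hN0 : (0:ℝ) < N := by have : 0 < N := by omega
                             exact_mod_cast this
  set Y : Fin N → ℝ := fun θ => 2 * (∑ a ∈ Finset.Icc 1 A, (W a : ℂ) * (zN N ^ (θ : ℕ)) ^ a).re with hY
  have hYb : ∀ θ, |Y θ| ≤ u + v := by
    intro θ
    refine le_trans ?_ h
    simp only [hY]
    rw [abs_mul, abs_of_pos (by norm_num : (0:ℝ) < 2)]
    refine mul_le_mul_of_nonneg_left ((Complex.abs_re_le_norm _).trans ((norm_sum_le _ _).trans (sum_le_sum fun a _ => ?_))) (by norm_num)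
    rw [norm_mul, norm_pow, norm_pow, zN_norm]
    simp [abs_of_nonneg (hW a)]
  have hm : ∑ θ, Y θ = 0 := trig_mean A W hN
  have hs : ∑ θ, Y θ ^ 2 = N * (2 * ∑ a ∈ Finset.Icc 1 A, W a ^ 2) := trig_sq A W hN
  set S := ∑ a ∈ Finset.Icc 1 A, W a ^ 2 with hS
  have hS0 : 0 ≤ S := sum_nonneg fun _ _ => sq_nonneg _
  show ∑ θ, Real.exp (Y θ) ≤ _
  have hu3 : 0 ≤ u ^ 3 := by positivity
  by_cases huv : u + v ≤ 1
  · have h1 : ∀ θ, Real.exp (Y θ) ≤ 1 + Y θ + Y θ ^ 2 / 2 + (u + v) ^ 3 := fun θ =>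
      (exp_cubic ((hYb θ).trans huv)).trans (by gcongr; exact hYb θ)
    have h2 := sum_le_sum (s := Finset.univ) fun θ _ => h1 θ
    rw [sum_add_distrib, sum_add_distrib, sum_add_distrib, ← Finset.sum_div, hm, hs] at h2
    simp only [Finset.sum_const, Finset.card_univ, Fintype.card_fin, nsmul_eq_mul] at h2
    have h3 : (u + v) ^ 3 ≤ 8 * (u ^ 3 + v ^ 2) := by
      have : v ^ 3 ≤ v ^ 2 := by nlinarith [sq_nonneg v]
      nlinarith [mul_nonneg (add_nonneg hu hv) (sq_nonneg (u - v))]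
    have h4 := Real.add_one_le_exp (S + 8 * (u ^ 3 + v ^ 2))
    nlinarith
  · push Not at huv
    have h1 : ∀ θ, Real.exp (Y θ) ≤ Real.exp (S + 8 * (u ^ 3 + v ^ 2)) := by
      intro θ
      refine Real.exp_le_exp.2 ((le_abs_self _).trans ((hYb θ).trans ?_))
      rcases le_total u v with h2 | h2
      · have : 1 / 2 < v := by linarith
        nlinarith
      · have h3 : 1 / 2 < u := by linarith
        have : 0 ≤ v ^ 2 := sq_nonneg v
        have : 1 / 4 * u ≤ u ^ 3 := by nlinarith [mul_pos (show 0 < u by linarith) (show 0 < u - 1/2 by linarith)]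
        nlinarith
    refine (sum_le_sum fun θ _ => h1 θ).trans ?_
    simp

lemma geom_Icc {x : ℝ} (h0 : 0 ≤ x) (h1 : x < 1) (m A : ℕ) : ∑ a ∈ Finset.Icc m A, x ^ a ≤ x ^ m / (1 - x) := by
  have := geom_sum_Ico_le_of_lt_one (m := m) (n := A + 1) h0 h1
  rwa [show Finset.Ico m (A+1) = Finset.Icc m A by ext; simp [Nat.lt_succ_iff]] at this

set_option maxHeartbeats 800000 in
/-- local bound at one prime -/
lemma prime_local (A : ℕ) {K : ℝ} (hK : 0 ≤ K) {x l lam : ℝ} (hx : 0 ≤ x) (hx2 : x ^ 2 ≤ 1 / 2) (hl : 0 ≤ l) (hl1 : l ≤ 1) (hlam : 0 ≤ lam)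
    (b ρ c : ℕ → ℝ) (hb0 : ∀ a, 0 ≤ b a) (hb : ∀ a, 1 ≤ a → b a ≤ K / a * x ^ a) (hρ0 : ∀ a, 0 ≤ ρ a) (hρ1 : ∀ a, ρ a ≤ 1)
    (hc0 : ∀ a, 0 ≤ c a) (hc1 : ∀ a, c a ≤ 1) (hc : ∀ a, 1 ≤ a → c a ≤ 4 * a * l) {N : ℕ} (hN : 2 * A < N) :
    ∑ θ : Fin N, Real.exp (2 * (∑ a ∈ Finset.Icc 1 A, ((b a * (1/2 * ρ a + lam * c a) : ℝ) : ℂ) * (zN N ^ (θ : ℕ)) ^ a).re) ≤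
      N * Real.exp (1/4 * b 1 ^ 2 + 9000 * (K ^ 2 + K ^ 3) * (x ^ 3 + (lam + lam ^ 2) * (l * x ^ 2))) := by
  set W : ℕ → ℝ := fun a => b a * (1/2 * ρ a + lam * c a) with hW
  have hx1 : x ≤ 3 / 4 := by nlinarith
  have hWb : ∀ a, 1 ≤ a → W a ≤ K * (1/2 + 4 * lam * l) * x ^ a := by
    intro a ha
    have ha0 : (1:ℝ) ≤ a := by exact_mod_cast ha
    have h1 : 1/2 * ρ a + lam * c a ≤ a * (1/2 + 4 * lam * l) := by
      have := mul_le_mul_of_nonneg_left (hc a ha) hlam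
      have := hρ1 a
      nlinarith
    have h2 : 0 ≤ 1/2 * ρ a + lam * c a := add_nonneg (mul_nonneg (by norm_num) (hρ0 a)) (mul_nonneg hlam (hc0 a))
    have h3 : 0 ≤ K / a * x ^ a := by positivity
    calc W a ≤ (K / a * x ^ a) * (a * (1/2 + 4 * lam * l)) := mul_le_mul (hb a ha) h1 h2 h3
      _ = K * (1/2 + 4 * lam * l) * x ^ a := by field_simp
  have hW0 : ∀ a, 0 ≤ W a := fun a => mul_nonneg (hb0 a) (add_nonneg (mul_nonneg (by norm_num) (hρ0 a)) (mul_nonneg hlam (hc0 a)))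
  have hKl : 0 ≤ K * (1/2 + 4 * lam * l) := by positivity
  have hsum : 2 * ∑ a ∈ Finset.Icc 1 A, W a ≤ 4 * K * x + 32 * K * lam * l * x := by
    have h1 : ∑ a ∈ Finset.Icc 1 A, W a ≤ K * (1/2 + 4 * lam * l) * (x ^ 1 / (1 - x)) := by
      refine (sum_le_sum fun a ha => hWb a (Finset.mem_Icc.1 ha).1).trans ?_
      rw [← mul_sum]
      exact mul_le_mul_of_nonneg_left (geom_Icc hx (by linarith) 1 A) hKl
    have h2 : x ^ 1 / (1 - x) ≤ 4 * x := by
      rw [div_le_iff₀ (by linarith)]; nlinarith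
    have := mul_le_mul_of_nonneg_left h2 hKl
    nlinarith
  refine (perprime A W hW0 hN (u := 4 * K * x) (v := 32 * K * lam * l * x) (by positivity) (by positivity) hsum).trans ?_
  refine mul_le_mul_of_nonneg_left (Real.exp_le_exp.2 ?_) (Nat.cast_nonneg N)
  have hl2 : l ^ 2 ≤ l := by nlinarith
  have hlx : 0 ≤ l * x ^ 2 := by positivity
  have hx3 : 0 ≤ x ^ 3 := by positivity
  have hsq : ∑ a ∈ Finset.Icc 1 A, W a ^ 2 ≤ 1/4 * b 1 ^ 2 + 4 * K ^ 2 * (lam + lam ^ 2) * (l * x ^ 2) + K ^ 2 * (x ^ 3 + 64 * lam ^ 2 * (l * x ^ 2)) := by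
    have hb1 : b 1 ≤ K * x := by have := hb 1 le_rfl; simpa using this
    have h1 : W 1 ^ 2 ≤ 1/4 * b 1 ^ 2 + 4 * K ^ 2 * (lam + lam ^ 2) * (l * x ^ 2) := by
      have hc4 : c 1 ≤ 4 * l := by have := hc 1 le_rfl; simpa using this
      have e1 : (1/2 * ρ 1 + lam * c 1) ^ 2 ≤ 1/4 + 4 * (lam + lam ^ 2) * l := by
        have a1 : ρ 1 ^ 2 ≤ 1 := by nlinarith [hρ0 1, hρ1 1]
        have a2 : c 1 ^ 2 ≤ 4 * l := by nlinarith [hc0 1, hc1 1]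
        have a3 : ρ 1 * c 1 ≤ 4 * l := by nlinarith [hc0 1, hρ1 1]
        nlinarith [mul_le_mul_of_nonneg_left a3 hlam, mul_le_mul_of_nonneg_left a2 (sq_nonneg lam)]
      have e2 : b 1 ^ 2 ≤ K ^ 2 * x ^ 2 := by
        rw [← mul_pow]; exact pow_le_pow_left₀ (hb0 1) hb1 2
      have e3 : 0 ≤ 4 * (lam + lam ^ 2) * l := by positivity
      calc W 1 ^ 2 = b 1 ^ 2 * (1/2 * ρ 1 + lam * c 1) ^ 2 := by simp only [hW]; ring
        _ ≤ b 1 ^ 2 * (1/4 + 4 * (lam + lam ^ 2) * l) := mul_le_mul_of_nonneg_left e1 (sq_nonneg _)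
        _ ≤ _ := by nlinarith [mul_le_mul_of_nonneg_right e2 e3]
    have h2 : ∑ a ∈ Finset.Icc 2 A, W a ^ 2 ≤ K ^ 2 * (x ^ 3 + 64 * lam ^ 2 * (l * x ^ 2)) := by
      have e1 : ∑ a ∈ Finset.Icc 2 A, W a ^ 2 ≤ (K * (1/2 + 4 * lam * l)) ^ 2 * ((x^2) ^ 2 / (1 - x^2)) := by
        have : ∀ a ∈ Finset.Icc 2 A, W a ^ 2 ≤ (K * (1/2 + 4 * lam * l)) ^ 2 * (x^2) ^ a := by
          intro a ha
          have h3 := pow_le_pow_left₀ (hW0 a) (hWb a (by simp at ha; omega)) 2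
          have e9 : (K * (1/2 + 4 * lam * l) * x ^ a) ^ 2 = (K * (1/2 + 4 * lam * l)) ^ 2 * (x^2) ^ a := by
            rw [mul_pow _ (x ^ a), ← pow_mul x, mul_comm a, pow_mul]
          exact h3.trans e9.le
        refine (sum_le_sum this).trans ?_
        rw [← mul_sum]
        exact mul_le_mul_of_nonneg_left (geom_Icc (sq_nonneg x) (by linarith) 2 A) (sq_nonneg _)
      have e2 : (x^2) ^ 2 / (1 - x^2) ≤ 2 * x ^ 4 := by
        rw [div_le_iff₀ (by linarith)]; nlinarith [show 0 ≤ x^4 by positivity]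
      have e3 : (1/2 + 4 * lam * l) ^ 2 ≤ 1/2 + 32 * lam ^ 2 * l := by
        nlinarith [sq_nonneg (1/2 - 4 * lam * l), mul_le_mul_of_nonneg_left hl2 (sq_nonneg lam)]
      have e4 : x ^ 4 ≤ x ^ 3 := by nlinarith
      have e5 : x ^ 4 ≤ x ^ 2 := by nlinarith [sq_nonneg x]
      have e6 : 0 ≤ x ^ 4 := by positivity
      have e7 : 0 ≤ lam ^ 2 * l := by positivity
      calc _ ≤ (K * (1/2 + 4 * lam * l)) ^ 2 * ((x^2) ^ 2 / (1 - x^2)) := e1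
        _ ≤ (K * (1/2 + 4 * lam * l)) ^ 2 * (2 * x ^ 4) := mul_le_mul_of_nonneg_left e2 (sq_nonneg _)
        _ = K ^ 2 * ((1/2 + 4 * lam * l) ^ 2 * (2 * x ^ 4)) := by ring
        _ ≤ K ^ 2 * ((1/2 + 32 * lam ^ 2 * l) * (2 * x ^ 4)) := by gcongr
        _ ≤ _ := by
          refine mul_le_mul_of_nonneg_left ?_ (sq_nonneg K)
          nlinarith [mul_le_mul_of_nonneg_left e5 e7]
    rcases Nat.eq_zero_or_pos A with hA | hA
    · subst hA
      simp
      positivity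
    · rw [← Finset.insert_Icc_succ_left_eq_Icc hA, Finset.sum_insert (by simp)]
      have : Order.succ 1 = 2 := rfl
      rw [this]
      linarith
  have hK3 : 0 ≤ K ^ 3 := by positivity
  have hv2 : (32 * K * lam * l * x) ^ 2 ≤ 1024 * K ^ 2 * lam ^ 2 * (l * x ^ 2) := by
    have h9 := mul_le_mul_of_nonneg_left hl2 (show 0 ≤ 1024 * K ^ 2 * lam ^ 2 * x ^ 2 by positivity)
    calc _ = 1024 * K ^ 2 * lam ^ 2 * x ^ 2 * l ^ 2 := by ring
      _ ≤ _ := h9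
      _ = _ := by ring
  have hll : 0 ≤ lam * (l * x^2) := by positivity
  have hll2 : 0 ≤ lam ^ 2 * (l * x^2) := by positivity
  have m1 := mul_nonneg (sq_nonneg K) hll
  have m2 := mul_nonneg (sq_nonneg K) hll2
  have m3 := mul_nonneg (sq_nonneg K) hx3
  have m4 := mul_nonneg hK3 hll
  have m5 := mul_nonneg hK3 hll2
  have m6 := mul_nonneg hK3 hx3
  generalize ∑ a ∈ Finset.Icc 1 A, W a ^ 2 = S at hsq ⊢
  clear_value W
  linarith

abbrev sP (X : ℕ) : Type := {p : ℕ // p ∈ Nat.primesLE X}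

noncomputable def QP (X : ℕ) (b : ℕ → ℂ) (c : ℕ → ℝ) : MvPolynomial (sP X) ℂ :=
  ∑ p : sP X, ∑ a ∈ Finset.Icc 1 X, MvPolynomial.C (b (p.1 ^ a) * (c (p.1 ^ a) : ℂ)) * MvPolynomial.X p ^ a

noncomputable def QH (X : ℕ) (b : ℕ → ℂ) (c : ℕ → ℝ) : MvPolynomial (sP X) ℝ :=
  ∑ p : sP X, ∑ a ∈ Finset.Icc 1 X, MvPolynomial.C (‖b (p.1 ^ a)‖ * c (p.1 ^ a)) * MvPolynomial.X p ^ a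

lemma QP_dom (X : ℕ) (b : ℕ → ℂ) (c : ℕ → ℝ) (hc : ∀ n, 0 ≤ c n) : Dom (QP X b c) (QH X b c) := by
  refine Dom.sum _ fun p _ => Dom.sum _ fun a _ => (Dom.C ?_).mul ((Dom.X p).pow a)
  rw [norm_mul, Complex.norm_real, Real.norm_eq_abs, abs_of_nonneg (hc _)]

lemma QH_lin (X : ℕ) (b : ℕ → ℂ) (c d : ℕ → ℝ) (s t : ℝ) :
    MvPolynomial.C s * QH X b c + MvPolynomial.C t * QH X b d = QH X b (fun n => s * c n + t * d n) := by
  simp only [QH, mul_sum, ← sum_add_distrib]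
  refine sum_congr rfl fun p _ => sum_congr rfl fun a _ => ?_
  rw [← mul_assoc, ← mul_assoc, ← MvPolynomial.C_mul, ← MvPolynomial.C_mul, ← add_mul, ← MvPolynomial.C_add]
  congr 2; ring

lemma QH_sum {ι : Type*} (S : Finset ι) (X : ℕ) (b : ℕ → ℂ) (c : ι → ℕ → ℝ) :
    ∑ l ∈ S, QH X b (c l) = QH X b (fun n => ∑ l ∈ S, c l n) := by
  simp only [QH]
  rw [sum_comm]
  refine sum_congr rfl fun p _ => ?_
  rw [sum_comm]
  refine sum_congr rfl fun a _ => ?_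
  rw [← sum_mul, ← map_sum, mul_sum]

/-- eval of QP at a character -/
lemma QP_eval {q : ℕ} [NeZero q] (χ : DirichletCharacter ℂ q) (X : ℕ) (b : ℕ → ℂ) (c : ℕ → ℝ) (hbp : ∀ n, ¬ IsPrimePow n → b n = 0)
    (hc : ∀ n, X < n → c n = 0) :
    MvPolynomial.eval (fun p : sP X => χ ((p.1 : ℕ) : ZMod q)) (QP X b c) = ∑ n ∈ Finset.Icc 1 X, χ n * b n * (c n : ℂ) := by
  have h1 : MvPolynomial.eval (fun p : sP X => χ ((p.1 : ℕ) : ZMod q)) (QP X b c) =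
      ∑ p ∈ Nat.primesLE X, ∑ a ∈ Finset.Icc 1 X, χ ((p ^ a : ℕ) : ZMod q) * b (p ^ a) * (c (p ^ a) : ℂ) := by
    rw [← Finset.sum_coe_sort (Nat.primesLE X) (fun p => ∑ a ∈ Finset.Icc 1 X, χ ((p ^ a : ℕ) : ZMod q) * b (p ^ a) * (c (p ^ a) : ℂ)), QP, map_sum]
    refine sum_congr rfl fun p _ => ?_
    rw [map_sum]
    refine sum_congr rfl fun a _ => ?_
    simp; ring
  rw [h1, ← Finset.sum_product']
  have h2 : ∑ x ∈ Nat.primesLE X ×ˢ Finset.Icc 1 X, χ ((x.1 ^ x.2 : ℕ) : ZMod q) * b (x.1 ^ x.2) * (c (x.1 ^ x.2) : ℂ) =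
    ∑ x ∈ (Nat.primesLE X ×ˢ Finset.Icc 1 X).filter (fun x => x.1 ^ x.2 ≤ X), χ ((x.1 ^ x.2 : ℕ) : ZMod q) * b (x.1 ^ x.2) * (c (x.1 ^ x.2) : ℂ) := by
    rw [Finset.sum_filter_of_ne]
    intro x _ hne
    by_contra h
    exact hne (by rw [hc _ (by omega)]; simp)
  have h3 : ∑ n ∈ Finset.Icc 1 X, χ n * b n * (c n : ℂ) = ∑ n ∈ (Finset.Icc 1 X).filter IsPrimePow, χ n * b n * (c n : ℂ) := by
    rw [Finset.sum_filter_of_ne]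
    intro n _ hne
    by_contra h
    exact hne (by rw [hbp _ h]; simp)
  rw [h2, h3]
  refine Finset.sum_bij (fun x _ => x.1 ^ x.2) ?_ ?_ ?_ ?_
  · intro x hx
    simp only [Finset.mem_filter, Finset.mem_product, Nat.mem_primesLE, Finset.mem_Icc] at hx ⊢
    exact ⟨⟨Nat.one_le_pow _ _ hx.1.1.2.pos, hx.2⟩, hx.1.1.2.isPrimePow.pow (by omega)⟩
  · intro x hx y hy h
    simp only [Finset.mem_filter, Finset.mem_product, Nat.mem_primesLE, Finset.mem_Icc] at hx hy
    have := hx.1.1.2.pow_inj' hy.1.1.2 (by omega) (by omega) h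
    exact Prod.ext this.1 this.2
  · intro n hn
    simp only [Finset.mem_filter, Finset.mem_Icc] at hn
    obtain ⟨p, k, hp, hk, rfl⟩ := (isPrimePow_nat_iff n).1 hn.2
    refine ⟨(p, k), ?_, rfl⟩
    simp only [Finset.mem_filter, Finset.mem_product, Nat.mem_primesLE, Finset.mem_Icc]
    have h4 : k < p ^ k := Nat.lt_pow_self hp.one_lt
    have h5 : p ≤ p ^ k := Nat.le_self_pow (by omega) p
    exact ⟨⟨⟨h5.trans hn.1.2, hp⟩, hk, by omega⟩, hn.1.2⟩
  · intro x hx; rfl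

lemma QP_wt (X : ℕ) (b : ℕ → ℂ) (c : ℕ → ℝ) {Y : ℝ} (hY : 0 ≤ Y) (hc : ∀ n : ℕ, 1 ≤ n → Y ≤ Real.log n → c n = 0) :
    Wt (fun p : sP X => p.1) Y (QP X b c) := by
  refine Wt.sum fun p _ => Wt.sum fun a _ => ?_
  intro m hm
  rw [MvPolynomial.coeff_C_mul, MvPolynomial.coeff_X_pow] at hm
  have h1 := left_ne_zero_of_mul hm
  have h2 := right_ne_zero_of_mul hm
  have hm2 : Finsupp.single p a = m := by by_contra h; simp [h] at h2
  have hp := (Nat.prime_of_mem_primesLE p.2).pos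
  have h3 : Real.log ((p.1 ^ a : ℕ) : ℝ) < Y := by
    by_contra h
    push Not at h
    exact h1 (by rw [hc _ (Nat.one_le_pow _ _ hp) h]; simp)
  subst hm2
  rw [wt, Finset.sum_eq_single p]
  · rw [Nat.cast_pow, Real.log_pow] at h3
    simp only [Finsupp.single_eq_same]; exact h3.le
  · intro r _ hr
    simp [Finsupp.single_apply, Ne.symm hr]
  · simp

noncomputable def Z32 : ℝ := ∑' n : ℕ, (1 / Real.sqrt n) ^ 3

lemma Z32_summable : Summable (fun n : ℕ => (1 / Real.sqrt n) ^ 3) := by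
  have := Real.summable_one_div_nat_rpow (p := 3/2) |>.2 (by norm_num)
  refine this.congr fun n => ?_
  rw [div_pow, one_pow, Real.sqrt_eq_rpow, ← rpow_natCast, ← rpow_mul (Nat.cast_nonneg n)]; norm_num

/-- the exponential average for the dominating polynomial -/
lemma QH_avg {K : ℝ} (hK : 0 ≤ K) (b : ℕ → ℂ) (hb : ∀ p a : ℕ, p.Prime → 1 ≤ a → ‖b (p ^ a)‖ ≤ K / a * (1 / Real.sqrt p) ^ a)
    {R : ℝ} (hR : 1 / 2 ≤ R) {lam : ℝ} (hlam : 0 ≤ lam) (ρ c : ℕ → ℝ) (hρ0 : ∀ n, 0 ≤ ρ n) (hρ1 : ∀ n, ρ n ≤ 1) (hc0 : ∀ n, 0 ≤ c n) (hc1 : ∀ n, c n ≤ 1)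
    (hc : ∀ n : ℕ, 1 ≤ n → c n ≤ 4 * Real.log n / R) {X : ℕ} (hX : X = ⌊Real.exp R⌋₊) {N : ℕ} (hN : 2 * X < N) :
    ∑ x : sP X → Fin N, Real.exp (2 * (MvPolynomial.eval (vN N x) (MvPolynomial.map Complex.ofRealHom
      (QH X b (fun n => 1/2 * ρ n + lam * c n)))).re) ≤ (N : ℝ) ^ Fintype.card (sP X) *
        Real.exp (1/4 * ∑ p ∈ Nat.primesLE X, ‖b p‖ ^ 2 + 9000 * (K ^ 2 + K ^ 3) * (Z32 + 5 * (lam + lam ^ 2))) := by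
  have hR0 : 0 < R := by linarith
  have hX1 : 1 ≤ X := by rw [hX]; exact Nat.le_floor (by simpa using Real.one_le_exp hR0.le)
  have hXR : Real.log X ≤ R := by
    rw [← Real.log_exp R]
    refine Real.log_le_log (by exact_mod_cast hX1) ?_
    rw [hX]; exact Nat.floor_le (Real.exp_pos _).le
  set E : sP X → ℝ := fun p => 1/4 * ‖b p.1‖ ^ 2 + 9000 * (K ^ 2 + K ^ 3) * ((1 / Real.sqrt p.1) ^ 3 + (lam + lam ^ 2) * (Real.log p.1 / R * (1 / Real.sqrt p.1) ^ 2)) with hE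
  refine (avg_prod X (fun (p : sP X) a => ‖b (p.1 ^ a)‖ * (1/2 * ρ (p.1 ^ a) + lam * c (p.1 ^ a))) (by omega) (E := E) ?_).trans ?_
  · intro p
    have hpp := Nat.prime_of_mem_primesLE p.2
    have hp2 : (2:ℝ) ≤ p.1 := by exact_mod_cast hpp.two_le
    have h1 := prime_local X hK (x := 1 / Real.sqrt p.1) (l := Real.log p.1 / R) (lam := lam) (by positivity) (by
      rw [div_pow, one_pow, Real.sq_sqrt (by linarith)]
      exact one_div_le_one_div_of_le (by norm_num) hp2) (by have := Real.log_nonneg (show (1:ℝ) ≤ p.1 by linarith); positivity) (by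
      rw [div_le_one hR0]
      refine le_trans ?_ hXR
      refine Real.log_le_log (by linarith) ?_
      exact_mod_cast Nat.le_of_mem_primesLE p.2) hlam (fun a => ‖b (p.1 ^ a)‖) (fun a => ρ (p.1 ^ a)) (fun a => c (p.1 ^ a))
      (fun a => norm_nonneg _) (fun a ha => hb _ _ hpp ha) (fun a => hρ0 _) (fun a => hρ1 _) (fun a => hc0 _) (fun a => hc1 _) (fun a ha => by
        refine (hc _ (Nat.one_le_pow _ _ hpp.pos)).trans (le_of_eq ?_)
        rw [Nat.cast_pow, Real.log_pow]; ring) hN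
    simp only [pow_one] at h1
    exact h1
  · refine mul_le_mul_of_nonneg_left (Real.exp_le_exp.2 ?_) (by positivity)
    rw [Finset.sum_coe_sort (Nat.primesLE X) (fun p => 1/4 * ‖b p‖ ^ 2 + 9000 * (K ^ 2 + K ^ 3) * ((1 / Real.sqrt p) ^ 3 + (lam + lam ^ 2) * (Real.log p / R * (1 / Real.sqrt p) ^ 2)))]
    rw [sum_add_distrib, ← mul_sum, ← mul_sum, sum_add_distrib, ← mul_sum]
    have h1 : ∑ p ∈ Nat.primesLE X, (1 / Real.sqrt p) ^ 3 ≤ Z32 := Z32_summable.sum_le_tsum _ fun _ _ => by positivity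
    have h2 : ∑ p ∈ Nat.primesLE X, Real.log p / R * (1 / Real.sqrt p) ^ 2 ≤ 5 := by
      have h3 : ∑ p ∈ Nat.primesLE X, Real.log p / R * (1 / Real.sqrt p) ^ 2 = (∑ p ∈ Nat.primesLE X, Real.log p / p) / R := by
        rw [Finset.sum_div]
        refine sum_congr rfl fun p _ => ?_
        rw [div_pow, one_pow, Real.sq_sqrt (Nat.cast_nonneg p)]; ring
      rw [h3, div_le_iff₀ hR0]
      have := mertens X hX1
      linarith
    have : 0 ≤ K ^ 2 + K ^ 3 := by positivity
    have h4 : 0 ≤ lam + lam ^ 2 := by positivity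
    have := mul_le_mul_of_nonneg_left h2 h4
    have h6 := mul_le_mul_of_nonneg_left (show ∑ p ∈ Nat.primesLE X, (1 / Real.sqrt p) ^ 3 + (lam + lam ^ 2) * ∑ p ∈ Nat.primesLE X, Real.log p / R * (1 / Real.sqrt p) ^ 2 ≤ Z32 + 5 * (lam + lam ^ 2) by linarith) (show 0 ≤ 9000 * (K ^ 2 + K ^ 3) by positivity)
    linarith

section
noncomputable def Rl (l : ℕ) : ℝ := 2 ^ l * Real.log 2
noncomputable def rho (l n : ℕ) : ℝ := tri2 (Real.log n / Rl l)
noncomputable def cc (l n : ℕ) : ℝ := rho (l+1) n - rho l n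

lemma Rl_pos (l : ℕ) : 0 < Rl l := by have := Real.log_pos (show (1:ℝ) < 2 by norm_num); unfold Rl; positivity
lemma Rl_half (l : ℕ) : 1 / 2 ≤ Rl l := by
  have h1 : (1:ℝ) ≤ 2 ^ l := one_le_pow₀ (by norm_num)
  have := Real.log_two_gt_d9
  unfold Rl; nlinarith
lemma Rl_succ (l : ℕ) : Rl (l+1) = 2 * Rl l := by unfold Rl; rw [pow_succ]; ring
lemma Rl_mono {l m : ℕ} (h : l ≤ m) : Rl l ≤ Rl m := by
  have := Real.log_pos (show (1:ℝ) < 2 by norm_num)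
  unfold Rl
  exact mul_le_mul_of_nonneg_right (pow_le_pow_right₀ (by norm_num) h) this.le

lemma tri_nonneg (x : ℝ) : 0 ≤ tri x := le_max_right _ _
lemma tri_le_one (x : ℝ) : tri x ≤ 1 := max_le (by linarith [abs_nonneg x]) (by norm_num)
lemma tri_anti {x y : ℝ} (hx : 0 ≤ x) (h : x ≤ y) : tri y ≤ tri x := by
  unfold tri; rw [abs_of_nonneg hx, abs_of_nonneg (hx.trans h)]
  exact max_le_max (by linarith) le_rfl
lemma rho_nonneg (l n : ℕ) : 0 ≤ rho l n := sq_nonneg _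
lemma rho_le_one (l n : ℕ) : rho l n ≤ 1 := pow_le_one₀ (tri_nonneg _) (tri_le_one _)
lemma cc_nonneg (l n : ℕ) : 0 ≤ cc l n := by
  unfold cc rho tri2
  rw [sub_nonneg]
  have h0 : 0 ≤ Real.log n := Real.log_natCast_nonneg n
  refine pow_le_pow_left₀ (tri_nonneg _) (tri_anti (div_nonneg h0 (Rl_pos _).le) ?_) 2
  exact div_le_div_of_nonneg_left h0 (Rl_pos _) (Rl_mono (by omega))
lemma cc_le_one (l n : ℕ) : cc l n ≤ 1 := by
  have := rho_le_one (l+1) n; have := rho_nonneg l n; unfold cc; linarith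
lemma cc_le_log (l n : ℕ) : cc l n ≤ 4 * Real.log n / Rl (l+1) := by
  have h0 : 0 ≤ Real.log n := Real.log_natCast_nonneg n
  have h1 := rho_le_one (l+1) n
  have h2 : 1 - 2 * (Real.log n / Rl l) ≤ rho l n := by
    unfold rho tri2
    have h3 : 0 ≤ Real.log n / Rl l := div_nonneg h0 (Rl_pos _).le
    have : 1 - Real.log n / Rl l ≤ tri (Real.log n / Rl l) := by
      unfold tri; rw [abs_of_nonneg h3]; exact le_max_left _ _
    have := tri_nonneg (Real.log n / Rl l)
    rcases le_total (Real.log n / Rl l) 1 with h | h <;> nlinarith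
  rw [Rl_succ, show 4 * Real.log n / (2 * Rl l) = 2 * (Real.log n / Rl l) by ring]
  unfold cc; linarith
lemma rho_supp {l n : ℕ} (h : Rl l ≤ Real.log n) : rho l n = 0 := by
  refine tri2_supp _ ?_
  have h0 : 0 ≤ Real.log n := Real.log_natCast_nonneg n
  rw [abs_of_nonneg (div_nonneg h0 (Rl_pos _).le), one_le_div (Rl_pos _)]; exact h
lemma cc_supp {l n : ℕ} (h : Rl (l+1) ≤ Real.log n) : cc l n = 0 := by
  unfold cc; rw [rho_supp h, rho_supp ((Rl_mono (by omega)).trans h), sub_zero]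
lemma log_of_floor {R : ℝ} {n : ℕ} (h : ⌊Real.exp R⌋₊ < n) : R ≤ Real.log n := by
  rw [Nat.floor_lt (Real.exp_pos _).le] at h
  rw [Real.le_log_iff_exp_le ((Real.exp_pos _).trans h)]; exact h.le

noncomputable def Xl (l : ℕ) : ℕ := ⌊Real.exp (Rl l)⌋₊

lemma Xl_mono {l m : ℕ} (h : l ≤ m) : Xl l ≤ Xl m := Nat.floor_mono (Real.exp_le_exp.2 (Rl_mono h))

variable {q : ℕ} [NeZero q]

/-- level increments of the prime sum -/
noncomputable def Qc (b : ℕ → ℂ) (l : ℕ) (χ : DirichletCharacter ℂ q) : ℂ := ∑ n ∈ Finset.Icc 1 (Xl (l+1)), χ n * b n * (cc l n : ℂ)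

lemma QP_eval_cc (χ : DirichletCharacter ℂ q) {b : ℕ → ℂ} (hbp : ∀ n, ¬ IsPrimePow n → b n = 0) {l j : ℕ} (h : l ≤ j) :
    MvPolynomial.eval (fun p : sP (Xl (j+1)) => χ ((p.1 : ℕ) : ZMod q)) (QP (Xl (j+1)) b (cc l)) = Qc b l χ := by
  have hs : ∀ n, Xl (l+1) < n → cc l n = 0 := fun n hn => cc_supp (log_of_floor hn)
  have hX : Xl (l+1) ≤ Xl (j+1) := Xl_mono (by omega)
  rw [QP_eval χ _ b _ hbp (fun n hn => hs n (by omega)), Qc]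
  symm
  refine Finset.sum_subset (Finset.Icc_subset_Icc le_rfl hX) fun n hn hn2 => ?_
  rw [hs n (by simp at hn hn2; omega)]; simp

lemma sum_cc (j n : ℕ) : ∑ l ∈ Finset.range j, cc l n = rho j n - rho 0 n := Finset.sum_range_sub (fun l => rho l n) j

lemma Xl_le {j : ℕ} (h : Rl j ≤ Real.log q) : Xl j ≤ q := by
  have hq : (0:ℝ) < q := by exact_mod_cast Nat.pos_of_ne_zero (NeZero.ne q)
  have h2 : Real.exp (Rl j) ≤ q := by rw [← Real.exp_log hq]; exact Real.exp_le_exp.2 h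
  exact (Nat.floor_mono h2).trans (by simp)

lemma fact_sq_le (M : ℕ) : ((M.factorial : ℝ) / (Real.sqrt M) ^ M) ^ 2 ≤ (M : ℝ) ^ M := by
  rcases Nat.eq_zero_or_pos M with h | h
  · subst h; simp
  · have hM : (0:ℝ) < M := by exact_mod_cast h
    rw [div_pow, ← pow_mul, mul_comm M 2, pow_mul, Real.sq_sqrt hM.le, div_le_iff₀ (by positivity), ← sq]
    refine pow_le_pow_left₀ (by positivity) ?_ 2
    exact_mod_cast Nat.factorial_le_pow M

lemma termA {K : ℝ} (hK : 0 ≤ K) (b : ℕ → ℂ) (hbp : ∀ n, ¬ IsPrimePow n → b n = 0) (hb : ∀ p a : ℕ, p.Prime → 1 ≤ a → ‖b (p ^ a)‖ ≤ K / a * (1 / Real.sqrt p) ^ a)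
    (j M : ℕ) (N : ℕ → ℕ) (hR : Rl (j+1) ≤ Real.log q) (hw : ∑ l ∈ Finset.range j, (N l : ℝ) * Rl (l+1) + M * Rl (j+1) < Real.log q) :
    ∑ χ : DirichletCharacter ℂ q, (∏ l ∈ Finset.range j, ‖EN (N l) (Qc b l χ / 2)‖ ^ 2) * ‖Qc b j χ‖ ^ (2 * M) ≤
      (Nat.totient q : ℝ) * (4 * (M : ℝ) ^ M * Real.exp (1/4 * ∑ p ∈ Nat.primesLE q, ‖b p‖ ^ 2 + 9000 * (K ^ 2 + K ^ 3) * (Z32 + 10 * M))) := by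
  set X := Xl (j+1) with hX
  set lam := Real.sqrt M with hlam
  have hlam2 : lam ^ 2 = M := Real.sq_sqrt (Nat.cast_nonneg M)
  have hlam0 : 0 ≤ lam := Real.sqrt_nonneg _
  have hlamM : lam ≤ M := by
    rcases Nat.eq_zero_or_pos M with h | h
    · rw [hlam, h]; simp
    · have : (1:ℝ) ≤ M := by exact_mod_cast h
      nlinarith
  set f : MvPolynomial (sP X) ℂ := (∏ l ∈ Finset.range j, EPc (N l) (MvPolynomial.C (1/2) * QP X b (cc l))) * QP X b (cc j) ^ M with hf
  set c : ℝ := (M.factorial : ℝ) / lam ^ M with hc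
  have hcpow : c * ((M.factorial : ℝ)⁻¹ * lam ^ M) = 1 := by
    rw [hc]
    have h1 : (M.factorial : ℝ) ≠ 0 := by exact_mod_cast Nat.factorial_ne_zero M
    have h2 : lam ^ M ≠ 0 := by
      rcases Nat.eq_zero_or_pos M with h | h
      · rw [h]; simp
      · have : 0 < lam := Real.sqrt_pos.2 (by exact_mod_cast h)
        positivity
    field_simp
  have hQn : ∀ l, NNeg (QH X b (cc l)) := fun l => (QP_dom X b (cc l) (cc_nonneg l)).nneg
  set w : MvPolynomial (sP X) ℝ := QH X b (fun n => 1/2 * (∑ l ∈ Finset.range j, cc l n) + lam * cc j n) with hwd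
  have hw2 : w = (∑ l ∈ Finset.range j, MvPolynomial.C (1/2) * QH X b (cc l)) + MvPolynomial.C lam * QH X b (cc j) := by
    rw [← mul_sum, QH_sum, QH_lin]
  have hhalf : ∀ l, NNeg (MvPolynomial.C (1/2 : ℝ) * QH X b (cc l)) := fun l => (NNeg.C (by norm_num)).mul (hQn l)
  have hsumn : NNeg (∑ l ∈ Finset.range j, MvPolynomial.C (1/2 : ℝ) * QH X b (cc l)) :=
    (Dom.sum _ fun l _ => (hhalf l).dom).nneg
  have hlamn : NNeg (MvPolynomial.C lam * QH X b (cc j)) := (NNeg.C hlam0).mul (hQn j)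
  have hwn : NNeg w := by rw [hw2]; exact hsumn.add hlamn
  have hD : Dom f (MvPolynomial.C c * EPr (∑ l ∈ Finset.range j, N l + M) w) := by
    have h1 : Dom f ((∏ l ∈ Finset.range j, EPr (N l) (MvPolynomial.C (1/2) * QH X b (cc l))) * QH X b (cc j) ^ M) := by
      refine Dom.mul (Dom.prod fun l => Dom.EP ?_ _) (Dom.pow (QP_dom X b _ (cc_nonneg j)) M)
      exact (Dom.C (by norm_num)).mul (QP_dom X b _ (cc_nonneg l))
    refine h1.trans ?_
    have h2 : CLe ((∏ l ∈ Finset.range j, EPr (N l) (MvPolynomial.C (1/2) * QH X b (cc l))) * QH X b (cc j) ^ M)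
        (EPr (∑ l ∈ Finset.range j, N l) (∑ l ∈ Finset.range j, MvPolynomial.C (1/2) * QH X b (cc l)) * QH X b (cc j) ^ M) :=
      (EPr_prod_le _ hhalf N).mul_right ((hQn j).pow M)
    refine h2.trans ?_
    have h3 := (EPr_mul_pow_le hsumn hlamn (∑ l ∈ Finset.range j, N l) M).mul_right (NNeg.C (show 0 ≤ c by rw [hc]; positivity))
    rw [← hw2, mul_comm _ (MvPolynomial.C c), mul_comm _ (MvPolynomial.C c)] at h3
    have e : ∀ (A G : MvPolynomial (sP X) ℝ), A * G ^ M = MvPolynomial.C c * (A * (MvPolynomial.C (M.factorial : ℝ)⁻¹ * (MvPolynomial.C lam * G) ^ M)) := by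
      intro A G
      calc A * G ^ M = MvPolynomial.C (c * ((M.factorial : ℝ)⁻¹ * lam ^ M)) * (A * G ^ M) := by rw [hcpow, MvPolynomial.C_1, one_mul]
        _ = _ := by simp only [MvPolynomial.C_mul, MvPolynomial.C_pow, mul_pow]; ring
    rw [e]; exact h3
  have hWt : Wt (fun p : sP X => p.1) (∑ l ∈ Finset.range j, (N l : ℝ) * Rl (l+1) + M * Rl (j+1)) f := by
    refine Wt.mul (Wt.prod fun l => Wt.EP (Rl_pos _).le ?_ _) (Wt.pow ?_ M)
    · have := (Wt.C (pr := fun p : sP X => p.1) (1/2 : ℂ)).mul (QP_wt X b (cc l) (Rl_pos (l+1)).le (fun n _ h => cc_supp h))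
      rwa [zero_add] at this
    · exact QP_wt X b (cc j) (Rl_pos (j+1)).le (fun n _ h => cc_supp h)
  have hrs : ∀ n, ∑ l ∈ Finset.range j, cc l n ≤ 1 := fun n => by
    rw [sum_cc]; linarith [rho_le_one j n, rho_nonneg 0 n]
  have hmain := main_ms (q := q) (pr := fun p : sP X => p.1) (fun p => Nat.prime_of_mem_primesLE p.2) Subtype.val_injective hw hwn
    (c := c) (by rw [hc]; positivity) hWt hD (N0 := 2 * X + 1) (fun n hn hn0 => QH_avg hK b hb (Rl_half (j+1)) hlam0 (fun n => ∑ l ∈ Finset.range j, cc l n) (cc j)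
      (fun n => sum_nonneg fun l _ => cc_nonneg l n) hrs (cc_nonneg j) (cc_le_one j) (fun n _ => cc_le_log j n) (X := X) rfl (N := n) (by omega))
  refine le_trans (le_of_eq (sum_congr rfl fun χ _ => ?_)) (hmain.trans ?_)
  · rw [hf, map_mul, map_prod, map_pow, norm_mul, mul_pow, norm_prod, ← Finset.prod_pow, norm_pow, ← pow_mul, mul_comm M 2, QP_eval_cc χ hbp le_rfl]
    congr 1
    refine Finset.prod_congr rfl fun l hl => ?_
    rw [eval_EPc, map_mul, QP_eval_cc χ hbp (Finset.mem_range.1 hl).le, MvPolynomial.eval_C, div_eq_inv_mul, one_div]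
  · refine mul_le_mul_of_nonneg_left ?_ (Nat.cast_nonneg _)
    refine mul_le_mul (mul_le_mul_of_nonneg_left (fact_sq_le M) (by norm_num)) (Real.exp_le_exp.2 ?_) (Real.exp_pos _).le (by positivity)
    have h1 : ∑ p ∈ Nat.primesLE X, ‖b p‖ ^ 2 ≤ ∑ p ∈ Nat.primesLE q, ‖b p‖ ^ 2 := by
      refine Finset.sum_le_sum_of_subset_of_nonneg (fun p hp => ?_) fun _ _ _ => sq_nonneg _
      rw [Nat.mem_primesLE] at hp ⊢
      exact ⟨hp.1.trans (Xl_le hR), hp.2⟩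
    have h2 : 9000 * (K ^ 2 + K ^ 3) * (Z32 + 5 * (lam + lam ^ 2)) ≤ 9000 * (K ^ 2 + K ^ 3) * (Z32 + 10 * M) := by
      refine mul_le_mul_of_nonneg_left ?_ (by positivity)
      rw [hlam2]; linarith
    linarith
end

lemma rho_zero {n : ℕ} (hn : 2 ≤ n) : rho 0 n = 0 := by
  have h2 : Real.log 2 ≤ Real.log n := Real.log_le_log (by norm_num) (by exact_mod_cast hn)
  have h0 : (0:ℝ) < Real.log 2 := Real.log_pos (by norm_num)
  have : Rl 0 = Real.log 2 := by simp [Rl]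
  rw [rho, this]
  apply tri2_supp
  rw [abs_of_nonneg (by positivity), le_div_iff₀ h0]; linarith

lemma sum_Qc {q : ℕ} [NeZero q] {b : ℕ → ℂ} (hbp : ∀ n, ¬ IsPrimePow n → b n = 0) (χ : DirichletCharacter ℂ q) (j : ℕ) :
    ∑ l ∈ Finset.range j, Qc b l χ = ∑ n ∈ Finset.Icc 1 (Xl j), χ n * b n * (rho j n : ℂ) := by
  have h1 : ∀ l ∈ Finset.range j, Qc b l χ = ∑ n ∈ Finset.Icc 1 (Xl j), χ n * b n * (cc l n : ℂ) := by
    intro l hl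
    have hlj := Finset.mem_range.1 hl
    have hs : ∀ n, Xl (l+1) < n → cc l n = 0 := fun n hn => cc_supp (log_of_floor hn)
    have hX : Xl (l+1) ≤ Xl j := Xl_mono (by omega)
    rw [Qc]
    refine Finset.sum_subset (Finset.Icc_subset_Icc le_rfl hX) fun n hn hn2 => ?_
    rw [hs n (by simp at hn hn2; omega)]; simp
  rw [sum_congr rfl h1, sum_comm]
  refine sum_congr rfl fun n hn => ?_
  rw [← mul_sum]
  have h2 : (∑ l ∈ Finset.range j, (cc l n : ℂ)) = ((rho j n - rho 0 n : ℝ) : ℂ) := by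
    rw [← sum_cc]; push_cast; rfl
  rw [h2]
  rcases Nat.lt_or_ge n 2 with h | h
  · have : n = 1 := by simp at hn; omega
    rw [hbp n (by rw [this]; exact not_isPrimePow_one)]; simp
  · rw [rho_zero h]; simp

lemma exists_J {a : ℝ} (h : Real.log 2 ≤ a) : ∃ J, Rl J ≤ a ∧ a < 2 * Rl J := by
  have h0 : (0:ℝ) < Real.log 2 := Real.log_pos (by norm_num)
  have hex : ∃ j, a < Rl j := by
    obtain ⟨n, hn⟩ := pow_unbounded_of_one_lt (a / Real.log 2) (by norm_num : (1:ℝ) < 2)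
    exact ⟨n, by rw [Rl]; rwa [div_lt_iff₀ h0] at hn⟩
  classical
  have hf := Nat.find_spec hex
  have hp : Nat.find hex ≠ 0 := by
    intro h1; rw [h1] at hf; simp [Rl] at hf; linarith
  obtain ⟨m, hm⟩ := Nat.exists_eq_succ_of_ne_zero hp
  have := Nat.find_min hex (m := m) (by omega)
  refine ⟨m, not_lt.1 this, ?_⟩
  rw [hm] at hf
  rw [← Rl_succ]; exact hf

lemma geo1 (β : ℕ → ℝ) (h0 : ∀ l, 0 ≤ β l) (h : ∀ l, β (l+1) = 2 * β l) (j : ℕ) : ∑ l ∈ Finset.range j, β (l+1) ≤ 2 * β j := by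
  induction j with
  | zero => simpa using h0 0
  | succ n ih => rw [sum_range_succ, h n]; linarith

lemma geo2 (y : ℕ → ℝ) (h0 : ∀ l, 0 ≤ y l) (h : ∀ l, y l ≤ 6/7 * y (l+1)) (j : ℕ) : ∑ l ∈ Finset.range j, y (l+1) ≤ 7 * y j := by
  induction j with
  | zero => have := h0 0; simp; linarith
  | succ n ih => rw [sum_range_succ]; have := h n; linarith

lemma exp_neg_le_two {T : ℝ} (h : 0 < T) : Real.exp (-T) ≤ 2 / T ^ 2 := by
  have := Real.pow_div_factorial_le_exp T h.le 2
  rw [Real.exp_neg, inv_le_comm₀ (Real.exp_pos _) (by positivity)]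
  simp at this
  rw [inv_div]; exact this

lemma good_bound {j : ℕ} (Q : ℕ → ℂ) (T : ℕ → ℝ) (N : ℕ → ℕ) (hT : ∀ l < j, 1 ≤ T l) (hQ : ∀ l < j, ‖Q l‖ ≤ T l) (hN : ∀ l < j, 8 * T l ≤ N l) :
    Real.exp ((∑ l ∈ Finset.range j, Q l).re) ≤ Real.exp (4 * ∑ l ∈ Finset.range j, Real.exp (- T l)) * ∏ l ∈ Finset.range j, ‖EN (N l) (Q l / 2)‖ ^ 2 := by
  rw [Complex.re_sum, mul_sum, Real.exp_sum, Real.exp_sum, ← Finset.prod_mul_distrib]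
  refine Finset.prod_le_prod (fun _ _ => (Real.exp_pos _).le) fun l hl => ?_
  have hl := Finset.mem_range.1 hl
  have h := exp_le_EN (z := Q l / 2) (hT l hl) (by rw [norm_div]; simp; linarith [hQ l hl]) (hN l hl)
  have h2 := pow_le_pow_left₀ (norm_nonneg _) h 2
  rw [mul_pow, ← Real.exp_nat_mul, Complex.norm_exp, ← Real.exp_nat_mul] at h2
  convert h2 using 2
  · simp; ring
  · push_cast; ring_nf

lemma lvl {C1 D y : ℝ} (hC1 : 0 ≤ C1) (hD : 0 ≤ D) (hy : 0 < y) (hy0 : y ≤ Real.exp (-(8 * (2 * C1 + 1) + 5 * D + 5))) :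
    Real.exp (2 * C1 / y ^ 4) * (((⌊1 / (8 * y ^ 4)⌋₊ : ℝ) ^ ⌊1 / (8 * y ^ 4)⌋₊ * (y ^ 3) ^ (2 * ⌊1 / (8 * y ^ 4)⌋₊)) * Real.exp (10 * D * ⌊1 / (8 * y ^ 4)⌋₊)) ≤ y ^ 4 := by
  set M := ⌊1 / (8 * y ^ 4)⌋₊ with hM
  have hb : 0 < y ^ 4 := by positivity
  have hM1 : (M : ℝ) ≤ 1 / (8 * y ^ 4) := Nat.floor_le (by positivity)
  have hM2 : 1 / (8 * y ^ 4) < M + 1 := Nat.lt_floor_add_one _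
  have hy2 : y ≤ 1/4 := hy0.trans (by
    have : Real.exp (-(8 * (2 * C1 + 1) + 5 * D + 5)) ≤ Real.exp (-5) := Real.exp_le_exp.2 (by linarith)
    have h2 : Real.exp (-5) ≤ 1/4 := by
      have := exp_neg_le_two (T := 5) (by norm_num); linarith
    linarith)
  have hy4 : y ^ 4 ≤ 1/16 := by
    calc y ^ 4 ≤ (1/4) ^ 4 := pow_le_pow_left₀ hy.le hy2 4
      _ ≤ _ := by norm_num
  have hM3 : 1 / y ^ 4 ≤ 16 * M := by
    have e : 1 / (8 * y ^ 4) = 1 / 8 * (1 / y ^ 4) := by field_simp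
    have : 16 ≤ 1 / y ^ 4 := by rw [le_div_iff₀ hb]; linarith
    rw [e] at hM2; linarith
  have h1 : (M : ℝ) ^ M * (y ^ 3) ^ (2 * M) ≤ (y ^ 2) ^ M := by
    rw [pow_mul, ← mul_pow]
    refine pow_le_pow_left₀ (by positivity) ?_ M
    have : (M : ℝ) * y ^ 4 ≤ 1 := by
      calc (M : ℝ) * y ^ 4 ≤ 1 / (8 * y ^ 4) * y ^ 4 := mul_le_mul_of_nonneg_right hM1 hb.le
        _ = 1/8 := by field_simp
        _ ≤ 1 := by norm_num
    nlinarith [sq_nonneg y]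
  have h2 : (y ^ 2) ^ M ≤ Real.exp (-(16 * (2 * C1 + 1) + 10 * D) * M) := by
    have : y ^ 2 ≤ Real.exp (-(16 * (2 * C1 + 1) + 10 * D)) := by
      calc y ^ 2 ≤ Real.exp (-(8 * (2 * C1 + 1) + 5 * D + 5)) ^ 2 := pow_le_pow_left₀ hy.le hy0 2
        _ = Real.exp (2 * (-(8 * (2 * C1 + 1) + 5 * D + 5))) := by rw [← Real.exp_nat_mul]; norm_num
        _ ≤ _ := Real.exp_le_exp.2 (by linarith)
    calc _ ≤ Real.exp (-(16 * (2 * C1 + 1) + 10 * D)) ^ M := pow_le_pow_left₀ (by positivity) this M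
      _ = _ := by rw [← Real.exp_nat_mul]; ring_nf
  calc _ ≤ Real.exp (2 * C1 / y ^ 4) * (Real.exp (-(16 * (2 * C1 + 1) + 10 * D) * M) * Real.exp (10 * D * M)) :=
        mul_le_mul_of_nonneg_left (mul_le_mul_of_nonneg_right (h1.trans h2) (Real.exp_pos _).le) (Real.exp_pos _).le
    _ = Real.exp (2 * C1 * (1 / y ^ 4) - (2 * C1 + 1) * (16 * M)) := by rw [← Real.exp_add, ← Real.exp_add]; ring_nf
    _ ≤ Real.exp (-(1 / y ^ 4)) := by
        refine Real.exp_le_exp.2 ?_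
        have := mul_le_mul_of_nonneg_left hM3 (show 0 ≤ 2 * C1 + 1 by linarith)
        linarith
    _ ≤ y ^ 4 := by
        rw [Real.exp_neg, inv_le_comm₀ (Real.exp_pos _) hb]
        have := Real.add_one_le_exp (1 / y ^ 4)
        rw [← one_div]; linarith

theorem moment_abs (K C1 : ℝ) (hK : 0 ≤ K) (hC1 : 0 ≤ C1) : ∃ C : ℝ, 0 < C ∧ ∃ q0 : ℕ, ∀ (q : ℕ) [NeZero q], q0 ≤ q →
    ∀ (b : ℕ → ℂ) (hbp : ∀ n, ¬ IsPrimePow n → b n = 0) (hb : ∀ p a : ℕ, p.Prime → 1 ≤ a → ‖b (p ^ a)‖ ≤ K / a * (1 / Real.sqrt p) ^ a)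
    (S : Finset (DirichletCharacter ℂ q)) (V : DirichletCharacter ℂ q → ℝ),
    (∀ χ ∈ S, ∀ j : ℕ, V χ ≤ (∑ n ∈ Finset.Icc 1 (Xl j), χ n * b n * (rho j n : ℂ)).re + C1 * Real.log q / Rl j) →
    ∑ χ ∈ S, Real.exp (V χ) ≤ C * (Nat.totient q) * Real.exp (1/4 * ∑ p ∈ Nat.primesLE q, ‖b p‖ ^ 2) := by
  set D := 9000 * (K ^ 2 + K ^ 3) with hD
  have hD0 : 0 ≤ D := by positivity
  set y0 := Real.exp (-(8 * (2 * C1 + 1) + 5 * D + 5)) with hy0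
  have hy0p : 0 < y0 := Real.exp_pos _
  have hy0s : y0 ≤ 1 / 130 := by
    have h1 : y0 ≤ Real.exp (-13) := Real.exp_le_exp.2 (by linarith)
    have h2 : Real.exp (-13) ≤ 2 / 13 ^ 2 := exp_neg_le_two (T := 13) (by norm_num)
    have h3 : Real.exp (-13) = Real.exp (-6.5) ^ 2 := by rw [← Real.exp_nat_mul]; norm_num
    have h4 : Real.exp (-6.5) ≤ 2 / 6.5 ^ 2 := exp_neg_le_two (T := 6.5) (by norm_num)
    have h5 : Real.exp (-6.5) ^ 2 ≤ (2 / 6.5 ^ 2) ^ 2 := pow_le_pow_left₀ (Real.exp_pos _).le h4 2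
    have : ((2:ℝ) / 6.5 ^ 2) ^ 2 ≤ 1 / 130 := by norm_num
    linarith
  set c0 := y0 ^ 4 with hc0
  have hc0p : 0 < c0 := by positivity
  have hc0s : c0 ≤ 1 / 16 := by
    calc c0 ≤ (1/130) ^ 4 := pow_le_pow_left₀ hy0p.le hy0s 4
      _ ≤ _ := by norm_num
  refine ⟨4 * Real.exp 1 * Real.exp (D * Z32) * (Real.exp (2 * C1 / c0) + 1), by positivity, ⌈Real.exp (Real.log 2 / c0)⌉₊, ?_⟩
  intro q _ hq b hbp hb S V hV
  have hq1 : Real.exp (Real.log 2 / c0) ≤ q := (Nat.le_ceil _).trans (by exact_mod_cast hq)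
  have hqp : (0:ℝ) < q := (Real.exp_pos _).trans_le hq1
  set L := Real.log q with hL
  have hlog2 : (0:ℝ) < Real.log 2 := Real.log_pos (by norm_num)
  have hL1 : Real.log 2 / c0 ≤ L := by rw [hL, Real.le_log_iff_exp_le hqp]; exact hq1
  have hLp : 0 < L := lt_of_lt_of_le (by positivity) hL1
  obtain ⟨J, hJ1, hJ2⟩ := exists_J (a := c0 * L) (by rw [div_le_iff₀ hc0p] at hL1; linarith)
  set β : ℕ → ℝ := fun l => Rl l / L with hβ
  have hβp : ∀ l, 0 < β l := fun l => div_pos (Rl_pos l) hLp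
  have hβs : ∀ l, β (l+1) = 2 * β l := fun l => by simp only [hβ, Rl_succ]; ring
  have hβm : ∀ {l m}, l ≤ m → β l ≤ β m := fun h => div_le_div_of_nonneg_right (Rl_mono h) hLp.le
  have hβJ : β J ≤ c0 := by simp only [hβ]; rw [div_le_iff₀ hLp]; exact hJ1
  have hβJ2 : c0 ≤ 2 * β J := by
    have : β J * L = Rl J := by simp only [hβ]; field_simp
    by_contra hcon
    push Not at hcon
    have := mul_lt_mul_of_pos_right hcon hLp
    linarith
  set y : ℕ → ℝ := fun l => β l ^ (1/4 : ℝ) with hy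
  have hyp : ∀ l, 0 < y l := fun l => Real.rpow_pos_of_pos (hβp l) _
  have hy4 : ∀ l, y l ^ 4 = β l := fun l => by
    simp only [hy]; rw [← rpow_natCast, ← rpow_mul (hβp l).le]; norm_num
  have hyle : ∀ l ≤ J, y l ≤ y0 := fun l hl => by
    refine le_of_pow_le_pow_left₀ (n := 4) (by norm_num) hy0p.le ?_
    rw [hy4]; exact (hβm hl).trans hβJ
  have hys : ∀ l, y l ≤ 6/7 * y (l+1) := fun l => by
    refine le_of_pow_le_pow_left₀ (n := 4) (by norm_num) (by have := hyp (l+1); positivity) ?_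
    rw [mul_pow, hy4, hy4, hβs]; have := hβp l; norm_num; nlinarith
  set T : ℕ → ℝ := fun l => (y (l+1) ^ 3)⁻¹ with hT
  have hTp : ∀ l, 0 < T l := fun l => inv_pos.2 (pow_pos (hyp _) _)
  have hT1 : ∀ l < J, 1 ≤ T l := fun l hl => by
    simp only [hT]; refine (one_le_inv₀ (pow_pos (hyp _) _)).2 (pow_le_one₀ (hyp _).le ?_)
    linarith [hyle (l+1) hl]
  set N : ℕ → ℕ := fun l => ⌈8 * T l⌉₊ with hN
  have hN1 : ∀ l, 8 * T l ≤ N l := fun l => Nat.le_ceil _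
  have hN2 : ∀ l < J, (N l : ℝ) ≤ 9 * T l := fun l hl => by
    have := Nat.ceil_lt_add_one (a := 8 * T l) (by have := hTp l; positivity)
    have := hT1 l hl; simp only [hN]; linarith
  have hNw : ∀ j ≤ J, ∑ l ∈ Finset.range j, (N l : ℝ) * Rl (l+1) ≤ L / 2 := fun j hj => by
    calc ∑ l ∈ Finset.range j, (N l : ℝ) * Rl (l+1) ≤ ∑ l ∈ Finset.range j, 9 * L * y (l+1) := by
          refine sum_le_sum fun l hl => ?_
          have hl := Finset.mem_range.1 hl
          have e : Rl (l+1) = L * y (l+1) ^ 4 := by rw [hy4]; simp only [hβ]; field_simp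
          calc (N l : ℝ) * Rl (l+1) ≤ 9 * T l * Rl (l+1) := mul_le_mul_of_nonneg_right (hN2 l (by omega)) (Rl_pos _).le
            _ = 9 * L * y (l+1) := by
              rw [e]; simp only [hT]; have := (hyp (l+1)).ne'; field_simp
      _ = 9 * L * ∑ l ∈ Finset.range j, y (l+1) := by rw [mul_sum]
      _ ≤ 9 * L * (7 * y j) := mul_le_mul_of_nonneg_left (geo2 y (fun l => (hyp l).le) hys j) (by positivity)
      _ ≤ 9 * L * (7 * (1/130)) := mul_le_mul_of_nonneg_left (by linarith [hyle j hj]) (by positivity)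
      _ ≤ L / 2 := by linarith
  have hE : ∀ j ≤ J, Real.exp (4 * ∑ l ∈ Finset.range j, Real.exp (- T l)) ≤ Real.exp 1 := fun j hj => by
    refine Real.exp_le_exp.2 ?_
    have h1 : ∑ l ∈ Finset.range j, Real.exp (- T l) ≤ ∑ l ∈ Finset.range j, 2 * β (l+1) := by
      refine sum_le_sum fun l hl => (exp_neg_le_two (hTp l)).trans ?_
      have hl := Finset.mem_range.1 hl
      have h2 : y (l+1) ≤ 1 := by linarith [hyle (l+1) (by omega)]
      rw [← hy4]; simp only [hT]
      rw [inv_pow, div_inv_eq_mul, ← pow_mul]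
      exact mul_le_mul_of_nonneg_left (pow_le_pow_of_le_one (hyp _).le h2 (by norm_num)) (by norm_num)
    rw [← mul_sum] at h1
    have h2 := geo1 β (fun l => (hβp l).le) hβs j
    have h3 := hβm hj
    linarith
  set M : ℕ → ℕ := fun j => ⌊1 / (8 * y (j+1) ^ 4)⌋₊ with hM
  have hMb : ∀ j, (M j : ℝ) * Rl (j+1) ≤ L / 8 := fun j => by
    have e : Rl (j+1) = L * y (j+1) ^ 4 := by rw [hy4]; simp only [hβ]; field_simp
    have h1 : (M j : ℝ) ≤ 1 / (8 * y (j+1) ^ 4) := Nat.floor_le (by have := hyp (j+1); positivity)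
    calc (M j : ℝ) * Rl (j+1) ≤ 1 / (8 * y (j+1) ^ 4) * Rl (j+1) := mul_le_mul_of_nonneg_right h1 (Rl_pos _).le
      _ = L / 8 := by rw [e]; have := (hyp (j+1)).ne'; field_simp
  set P : DirichletCharacter ℂ q → ℕ → ℝ := fun χ j => ∏ l ∈ Finset.range j, ‖EN (N l) (Qc b l χ / 2)‖ ^ 2 with hP
  have hPn : ∀ χ j, 0 ≤ P χ j := fun χ j => Finset.prod_nonneg fun _ _ => sq_nonneg _
  have hV2 : ∀ χ ∈ S, ∀ j ≤ J, (∀ l < j, ‖Qc b l χ‖ ≤ T l) → Real.exp (V χ) ≤ Real.exp (2 * C1 / (2 * β j)) * (Real.exp 1 * P χ j) := by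
    intro χ hχ j hj hg
    have h1 := hV χ hχ j
    rw [← sum_Qc hbp] at h1
    have h2 := good_bound (fun l => Qc b l χ) T N (fun l hl => hT1 l (by omega)) hg (fun l _ => hN1 l)
    have e : C1 * L / Rl j = 2 * C1 / (2 * β j) := by simp only [hβ]; have := (Rl_pos j).ne'; field_simp
    rw [e] at h1
    calc Real.exp (V χ) ≤ Real.exp (2 * C1 / (2 * β j)) * Real.exp ((∑ l ∈ Finset.range j, Qc b l χ).re) := by
          rw [← Real.exp_add]; exact Real.exp_le_exp.2 (by linarith)
      _ ≤ _ := mul_le_mul_of_nonneg_left (h2.trans (mul_le_mul_of_nonneg_right (hE j hj) (hPn χ j))) (Real.exp_pos _).le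
  have hpt : ∀ χ ∈ S, Real.exp (V χ) ≤ Real.exp (2 * C1 / c0) * (Real.exp 1 * P χ J) +
      ∑ j ∈ Finset.range J, Real.exp (2 * C1 / y (j+1) ^ 4) * (Real.exp 1 * (P χ j * ‖Qc b j χ‖ ^ (2 * M j) * (y (j+1) ^ 3) ^ (2 * M j))) := by
    intro χ hχ
    have hnn : ∀ j ∈ Finset.range J, 0 ≤ Real.exp (2 * C1 / y (j+1) ^ 4) * (Real.exp 1 * (P χ j * ‖Qc b j χ‖ ^ (2 * M j) * (y (j+1) ^ 3) ^ (2 * M j))) := fun j _ => by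
      have := hPn χ j; have := hyp (j+1); positivity
    by_cases hbad : ∃ j, j < J ∧ T j < ‖Qc b j χ‖
    · classical
      obtain ⟨h1, h2⟩ := Nat.find_spec hbad
      set j := Nat.find hbad with hj
      have h3 : ∀ l < j, ‖Qc b l χ‖ ≤ T l := fun l hl => by
        have := Nat.find_min hbad hl
        push Not at this
        exact this (by omega)
      have h4 := hV2 χ hχ j h1.le h3
      have h5 : 1 ≤ ‖Qc b j χ‖ ^ (2 * M j) * (y (j+1) ^ 3) ^ (2 * M j) := by
        rw [← mul_pow]
        refine one_le_pow₀ ?_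
        have : T j * y (j+1) ^ 3 = 1 := by simp only [hT]; exact inv_mul_cancel₀ (pow_pos (hyp _) _).ne'
        rw [← this]
        exact mul_le_mul_of_nonneg_right h2.le (pow_pos (hyp _) _).le
      have h6 : Real.exp (V χ) ≤ Real.exp (2 * C1 / y (j+1) ^ 4) * (Real.exp 1 * (P χ j * ‖Qc b j χ‖ ^ (2 * M j) * (y (j+1) ^ 3) ^ (2 * M j))) := by
        rw [hy4, hβs]
        refine h4.trans (mul_le_mul_of_nonneg_left (mul_le_mul_of_nonneg_left ?_ (Real.exp_pos _).le) (Real.exp_pos _).le)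
        rw [mul_assoc]
        exact le_mul_of_one_le_right (hPn χ j) h5
      have h7 := Finset.single_le_sum hnn (Finset.mem_range.2 h1)
      have h8 : 0 ≤ Real.exp (2 * C1 / c0) * (Real.exp 1 * P χ J) := by have := hPn χ J; positivity
      exact h6.trans (h7.trans (by linarith))
    · push Not at hbad
      have h4 := hV2 χ hχ J le_rfl hbad
      have h5 : Real.exp (2 * C1 / (2 * β J)) ≤ Real.exp (2 * C1 / c0) := Real.exp_le_exp.2 (div_le_div_of_nonneg_left (by linarith) hc0p hβJ2)
      have h6 := sum_nonneg hnn
      have h7 := mul_le_mul_of_nonneg_right h5 (show 0 ≤ Real.exp 1 * P χ J by have := hPn χ J; positivity)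
      linarith
  set E4 := Real.exp (1/4 * ∑ p ∈ Nat.primesLE q, ‖b p‖ ^ 2) with hE4
  have hRl : ∀ j ≤ J, Rl (j+1) ≤ L := fun j hj => by
    have h1 := hβm hj
    have h2 : β (j+1) ≤ 1 := by rw [hβs]; linarith
    simp only [hβ] at h2; rwa [div_le_one hLp] at h2
  have hA : ∀ j ≤ J, ∀ M' : ℕ, (M' : ℝ) * Rl (j+1) ≤ L / 8 → ∑ χ ∈ S, P χ j * ‖Qc b j χ‖ ^ (2 * M') ≤
      (Nat.totient q : ℝ) * (4 * (M' : ℝ) ^ M' * (E4 * Real.exp (D * Z32) * Real.exp (10 * D * M'))) := fun j hj M' hM' => by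
    have h1 := termA hK b hbp hb j M' N (hRl j hj) (by have := hNw j hj; linarith)
    refine (Finset.sum_le_univ_sum_of_nonneg fun χ => mul_nonneg (hPn χ j) (by positivity)).trans (h1.trans (le_of_eq ?_))
    rw [hE4, ← Real.exp_add, ← Real.exp_add, ← hD]; ring_nf
  have hφ : (0:ℝ) ≤ Nat.totient q := Nat.cast_nonneg _
  set G := (Nat.totient q : ℝ) * (4 * Real.exp 1 * Real.exp (D * Z32)) * E4 with hG
  have hG0 : 0 ≤ G := by positivity
  have hfin : ∀ j ∈ Finset.range J, ∑ χ ∈ S, Real.exp (2 * C1 / y (j+1) ^ 4) * (Real.exp 1 * (P χ j * ‖Qc b j χ‖ ^ (2 * M j) * (y (j+1) ^ 3) ^ (2 * M j))) ≤ G * β (j+1) := fun j hj => by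
    have hj := Finset.mem_range.1 hj
    have h1 := hA j hj.le (M j) (hMb j)
    have h2 := lvl hC1 hD0 (hyp (j+1)) (hyle (j+1) hj)
    rw [hy4] at h2
    have e : ∑ χ ∈ S, Real.exp (2 * C1 / y (j+1) ^ 4) * (Real.exp 1 * (P χ j * ‖Qc b j χ‖ ^ (2 * M j) * (y (j+1) ^ 3) ^ (2 * M j)))
      = Real.exp (2 * C1 / y (j+1) ^ 4) * (Real.exp 1 * (y (j+1) ^ 3) ^ (2 * M j)) * ∑ χ ∈ S, P χ j * ‖Qc b j χ‖ ^ (2 * M j) := by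
      rw [mul_sum]; exact sum_congr rfl fun _ _ => by ring
    rw [e]
    have h3 : 0 ≤ Real.exp (2 * C1 / y (j+1) ^ 4) * (Real.exp 1 * (y (j+1) ^ 3) ^ (2 * M j)) := by have := hyp (j+1); positivity
    refine (mul_le_mul_of_nonneg_left h1 h3).trans ?_
    have h4 := mul_le_mul_of_nonneg_left h2 hG0
    refine le_trans (le_of_eq ?_) h4
    simp only [hM, hG, hy4]; ring
  calc ∑ χ ∈ S, Real.exp (V χ) ≤ ∑ χ ∈ S, (Real.exp (2 * C1 / c0) * (Real.exp 1 * P χ J) +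
      ∑ j ∈ Finset.range J, Real.exp (2 * C1 / y (j+1) ^ 4) * (Real.exp 1 * (P χ j * ‖Qc b j χ‖ ^ (2 * M j) * (y (j+1) ^ 3) ^ (2 * M j)))) := sum_le_sum hpt
    _ = Real.exp (2 * C1 / c0) * (Real.exp 1 * ∑ χ ∈ S, P χ J) + ∑ j ∈ Finset.range J, ∑ χ ∈ S, Real.exp (2 * C1 / y (j+1) ^ 4) * (Real.exp 1 * (P χ j * ‖Qc b j χ‖ ^ (2 * M j) * (y (j+1) ^ 3) ^ (2 * M j))) := by
        rw [sum_add_distrib, mul_sum, mul_sum, sum_comm (s := S)]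
    _ ≤ G * Real.exp (2 * C1 / c0) + G := by
        refine add_le_add ?_ ?_
        · have h1 := hA J le_rfl 0 (by simp; positivity)
          simp only [mul_zero, pow_zero, mul_one, Nat.cast_zero, Real.exp_zero] at h1
          have h2 := mul_le_mul_of_nonneg_left h1 (show 0 ≤ Real.exp (2 * C1 / c0) * Real.exp 1 by positivity)
          rw [mul_assoc] at h2
          refine h2.trans (le_of_eq ?_)
          rw [hG]; ring
        · refine (sum_le_sum hfin).trans ?_
          rw [← mul_sum]
          have h2 := geo1 β (fun l => (hβp l).le) hβs J
          exact mul_le_of_le_one_right hG0 (by linarith)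
    _ = _ := by rw [hG]; ring

/-- zeta values on the right of the critical strip -/
noncomputable def zz (δ Δ : ℝ) : ℂ := riemannZeta (1 + 2 * δ + Δ * I)
/-- prime sum constant -/
noncomputable def Bz : ℝ := ∑' p : Nat.Primes, (p : ℝ) ^ (-2 : ℝ)

lemma Bz_summable : Summable (fun p : Nat.Primes => (p : ℝ) ^ (-2 : ℝ)) := Nat.Primes.summable_rpow.2 (by norm_num)

lemma norm_prime_cpow (p : Nat.Primes) (s : ℂ) : ‖((p : ℕ) : ℂ) ^ (-s)‖ = (p : ℝ) ^ (-s.re) := by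
  rw [Complex.norm_natCast_cpow_of_pos p.2.pos]; simp

lemma prime_cpow_summable {s : ℂ} (hs : 1 < s.re) : Summable (fun p : Nat.Primes => ((p : ℕ) : ℂ) ^ (-s)) := by
  refine Summable.of_norm ?_
  simp_rw [norm_prime_cpow]
  exact Nat.Primes.summable_rpow.2 (by linarith)

lemma prime_sum_le {s : ℂ} (hs : 1 < s.re) : (∑' p : Nat.Primes, ((p : ℕ) : ℂ) ^ (-s)).re ≤ Real.log ‖riemannZeta s‖ + Bz := by
  have h1 : ∀ p : Nat.Primes, ‖-Complex.log (1 - ((p : ℕ) : ℂ) ^ (-s)) - ((p : ℕ) : ℂ) ^ (-s)‖ ≤ (p : ℝ) ^ (-2 : ℝ) := by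
    intro p
    have hp : (2:ℝ) ≤ (p : ℕ) := by exact_mod_cast p.2.two_le
    have hp1 : (1:ℝ) ≤ (p : ℕ) := by linarith
    have hn : ‖((p : ℕ) : ℂ) ^ (-s)‖ ≤ 1/2 := by
      rw [norm_prime_cpow]
      calc ((p : ℕ) : ℝ) ^ (-s.re) ≤ (p : ℝ) ^ (-1 : ℝ) := rpow_le_rpow_of_exponent_le hp1 (by linarith)
        _ = 1 / (p : ℝ) := by rw [Real.rpow_neg_one]; simp
        _ ≤ 1/2 := div_le_div_of_nonneg_left (by norm_num) (by norm_num) hp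
    have h := Complex.norm_log_one_sub_inv_sub_self_le (z := ((p : ℕ) : ℂ) ^ (-s)) (by linarith)
    have hre : 0 < (1 - ((p : ℕ) : ℂ) ^ (-s)).re := by
      have := Complex.re_le_norm (((p : ℕ) : ℂ) ^ (-s)); simp; linarith
    rw [Complex.log_inv _ (by
      intro h3
      have := Complex.arg_eq_pi_iff.1 h3
      linarith [this.1])] at h
    refine h.trans ?_
    have h5 : (1 - ‖((p : ℕ) : ℂ) ^ (-s)‖)⁻¹ ≤ 2 := by
      rw [inv_le_comm₀ (by linarith) (by norm_num)]; linarith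
    have h6 : ‖((p : ℕ) : ℂ) ^ (-s)‖ ^ 2 ≤ (p : ℝ) ^ (-2 : ℝ) := by
      rw [norm_prime_cpow, ← rpow_natCast, ← rpow_mul (by linarith)]
      exact rpow_le_rpow_of_exponent_le hp1 (by push_cast; linarith)
    nlinarith [sq_nonneg ‖((p : ℕ) : ℂ) ^ (-s)‖]
  have hs1 := prime_cpow_summable hs
  have hsd : Summable (fun p : Nat.Primes => -Complex.log (1 - ((p : ℕ) : ℂ) ^ (-s)) - ((p : ℕ) : ℂ) ^ (-s)) :=
    Summable.of_norm_bounded Bz_summable h1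
  have hsl : Summable (fun p : Nat.Primes => -Complex.log (1 - ((p : ℕ) : ℂ) ^ (-s))) := by
    have := hsd.add hs1; simpa using this
  have hE := riemannZeta_eulerProduct_exp_log hs
  have h2 : Real.log ‖riemannZeta s‖ = (∑' p : Nat.Primes, -Complex.log (1 - ((p : ℕ) : ℂ) ^ (-s))).re := by
    rw [← hE, Complex.norm_exp, Real.log_exp]
  rw [h2]
  have h3 : ‖∑' p : Nat.Primes, (-Complex.log (1 - ((p : ℕ) : ℂ) ^ (-s)) - ((p : ℕ) : ℂ) ^ (-s))‖ ≤ Bz :=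
    tsum_of_norm_bounded Bz_summable.hasSum h1
  rw [hsl.tsum_sub hs1] at h3
  have h4 := (Complex.abs_re_le_norm _).trans h3
  rw [Complex.sub_re] at h4
  linarith [(abs_le.1 h4).1]

lemma conj_nat_cpow (n : ℕ) (z : ℂ) : (starRingEnd ℂ) ((n : ℂ) ^ z) = (n : ℂ) ^ ((starRingEnd ℂ) z) := by
  rw [Complex.cpow_conj _ _ (by rw [Complex.natCast_arg]; exact Real.pi_pos.ne), Complex.conj_natCast]

lemma hs_le {α : Type} {f : α → ℝ} {c : ℝ} (h0 : ∀ x, 0 ≤ f x) (h : HasSum f c) (s : Finset α) : ∑ x ∈ s, f x ≤ c :=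
  sum_le_hasSum s (fun x _ => h0 x) h

lemma prime_quad {ι : Type} [Fintype ι] (a t : ι → ℝ) (ha : ∀ i, 0 ≤ a i) {δ : ℝ} (hδ : 0 < δ) (q : ℕ) :
    ∑ p ∈ Nat.primesLE q, ‖∑ i, (a i : ℂ) * (p : ℂ) ^ (-((1/2 + δ : ℝ) + t i * I : ℂ))‖ ^ 2 ≤
      ∑ i, ∑ k, a i * a k * (Real.log ‖zz δ (t i - t k)‖ + Bz) := by
  set s : ι → ι → ℂ := fun i k => 1 + 2 * δ + ((t i - t k : ℝ) : ℂ) * I with hs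
  have hsr : ∀ i k, 1 < (s i k).re := fun i k => by simp [hs]; linarith
  set f : ℕ → ℝ := fun p => ‖∑ i, (a i : ℂ) * (p : ℂ) ^ (-((1/2 + δ : ℝ) + t i * I : ℂ))‖ ^ 2 with hf
  have hfe : ∀ p : Nat.Primes, (f p : ℂ) = ∑ i, ∑ k, (a i * a k : ℂ) * ((p : ℕ) : ℂ) ^ (-(s i k)) := by
    intro p
    have hp0 : ((p : ℕ) : ℂ) ≠ 0 := by exact_mod_cast p.2.ne_zero
    simp only [hf]
    rw [← Complex.normSq_eq_norm_sq, Complex.normSq_eq_conj_mul_self, mul_comm, map_sum, Finset.sum_mul_sum]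
    refine sum_congr rfl fun i _ => sum_congr rfl fun k _ => ?_
    rw [map_mul, Complex.conj_ofReal]
    have : (starRingEnd ℂ) (((p : ℕ) : ℂ) ^ (-((1/2 + δ : ℝ) + t k * I : ℂ))) = ((p : ℕ) : ℂ) ^ (-((1/2 + δ : ℝ) - t k * I : ℂ)) := by
      rw [conj_nat_cpow]; congr 1
      simp only [map_neg, map_add, map_mul, Complex.conj_ofReal, Complex.conj_I]; ring
    rw [this]
    calc _ = (a i * a k : ℂ) * ((((p : ℕ) : ℂ) ^ (-((1/2 + δ : ℝ) + t i * I : ℂ))) * ((p : ℕ) : ℂ) ^ (-((1/2 + δ : ℝ) - t k * I : ℂ))) := by ring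
      _ = _ := by
        rw [← Complex.cpow_add _ _ hp0]; congr 2; simp only [hs]; push_cast; ring
  have hS : HasSum (fun p : Nat.Primes => (f p : ℂ)) (∑ i, ∑ k, (a i * a k : ℂ) * ∑' p : Nat.Primes, ((p : ℕ) : ℂ) ^ (-(s i k))) := by
    simp_rw [hfe]
    exact hasSum_sum fun i _ => hasSum_sum fun k _ => (prime_cpow_summable (hsr i k)).hasSum.mul_left _
  have hSr := Complex.hasSum_re hS
  simp only [Complex.ofReal_re] at hSr
  calc ∑ p ∈ Nat.primesLE q, f p = ∑ p ∈ (Nat.primesLE q).subtype Nat.Prime, f p := by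
        rw [Finset.sum_subtype_of_mem]; intro x hx; exact Nat.prime_of_mem_primesLE hx
    _ ≤ _ := hs_le (fun _ => sq_nonneg _) hSr _
    _ = ∑ i, ∑ k, a i * a k * (∑' p : Nat.Primes, ((p : ℕ) : ℂ) ^ (-(s i k))).re := by
        simp only [Complex.re_sum]
        refine sum_congr rfl fun i _ => sum_congr rfl fun k _ => ?_
        rw [← Complex.ofReal_mul, Complex.re_ofReal_mul]
    _ ≤ _ := sum_le_sum fun i _ => sum_le_sum fun k _ =>
        mul_le_mul_of_nonneg_left (prime_sum_le (hsr i k)) (mul_nonneg (ha i) (ha k))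

open Classical in
/-- primitive characters -/
noncomputable def prims (q : ℕ) [NeZero q] : Finset (DirichletCharacter ℂ q) := Finset.univ.filter (fun χ => χ.IsPrimitive)

lemma prims_mem {q : ℕ} [NeZero q] {χ : DirichletCharacter ℂ q} (h : χ ∈ prims q) : χ.IsPrimitive := by
  simpa [prims] using h

lemma prims_ne {q : ℕ} [NeZero q] (hq : 2 ≤ q) {χ : DirichletCharacter ℂ q} (h : χ.IsPrimitive) : χ ≠ 1 := by
  rintro rfl
  rw [DirichletCharacter.IsPrimitive, DirichletCharacter.conductor_one] at h
  omega

/-- prime power coefficients -/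
noncomputable def bC {ι : Type} [Fintype ι] (a t : ι → ℝ) (δ : ℝ) (n : ℕ) : ℂ :=
  ((ArithmeticFunction.vonMangoldt n / Real.log n : ℝ) : ℂ) * ∑ i, (a i : ℂ) * (n : ℂ) ^ (-((1/2 + δ : ℝ) + t i * I : ℂ))

lemma bC_pp {ι : Type} [Fintype ι] (a t : ι → ℝ) (δ : ℝ) (n : ℕ) (hn : ¬ IsPrimePow n) : bC a t δ n = 0 := by
  unfold bC; rw [ArithmeticFunction.vonMangoldt_eq_zero_iff.2 hn]; simp

lemma bC_le {ι : Type} [Fintype ι] (a t : ι → ℝ) (ha : ∀ i, 0 ≤ a i) {K : ℝ} (hK : ∑ i, a i ≤ K) {δ : ℝ} (hδ : 0 < δ) (p m : ℕ) (hp : p.Prime) (hm : 1 ≤ m) :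
    ‖bC a t δ (p ^ m)‖ ≤ K / m * (1 / Real.sqrt p) ^ m := by
  have hp1 : (1:ℝ) < p := by exact_mod_cast hp.one_lt
  have hlp := Real.log_pos hp1
  have hm0 : (0:ℝ) < m := by exact_mod_cast hm
  have h1 : ArithmeticFunction.vonMangoldt (p ^ m) / Real.log ((p ^ m : ℕ) : ℝ) = 1 / m := by
    rw [ArithmeticFunction.vonMangoldt_apply_pow (by omega), ArithmeticFunction.vonMangoldt_apply_prime hp, Nat.cast_pow, Real.log_pow]
    field_simp
  have h2 : ‖∑ i, (a i : ℂ) * ((p ^ m : ℕ) : ℂ) ^ (-((1/2 + δ : ℝ) + t i * I : ℂ))‖ ≤ K * (1 / Real.sqrt p) ^ m := by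
    refine (norm_sum_le _ _).trans ?_
    have h3 : ∀ i ∈ Finset.univ, ‖(a i : ℂ) * ((p ^ m : ℕ) : ℂ) ^ (-((1/2 + δ : ℝ) + t i * I : ℂ))‖ ≤ a i * (1 / Real.sqrt p) ^ m := by
      intro i _
      rw [norm_mul, Complex.norm_real, Real.norm_of_nonneg (ha i), Complex.norm_natCast_cpow_of_pos (pow_pos hp.pos m)]
      refine mul_le_mul_of_nonneg_left ?_ (ha i)
      have e : (1 / Real.sqrt p) ^ m = ((p ^ m : ℕ) : ℝ) ^ (-(1/2 : ℝ)) := by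
        rw [Nat.cast_pow, ← rpow_natCast, ← rpow_natCast, ← rpow_mul (by linarith), Real.sqrt_eq_rpow, one_div, ← Real.rpow_neg (by linarith), ← rpow_mul (by linarith)]
        ring_nf
      rw [e]
      refine rpow_le_rpow_of_exponent_le ?_ ?_
      · exact_mod_cast Nat.one_le_pow _ _ hp.pos
      · simp; linarith
    refine (sum_le_sum h3).trans ?_
    rw [← sum_mul]
    exact mul_le_mul_of_nonneg_right hK (by positivity)
  unfold bC
  rw [norm_mul, Complex.norm_real, h1, Real.norm_of_nonneg (by positivity)]
  calc _ ≤ 1 / (m : ℝ) * (K * (1 / Real.sqrt p) ^ m) := mul_le_mul_of_nonneg_left h2 (by positivity)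
    _ = _ := by ring

lemma sum_smooth {q : ℕ} [NeZero q] {ι : Type} [Fintype ι] (a t : ι → ℝ) (δ : ℝ) (χ : DirichletCharacter ℂ q) (j : ℕ) :
    ∑ i, (a i : ℂ) * smooth (al χ) tri2 (Rl j) ((1/2 + δ : ℝ) + t i * I) = ∑ n ∈ Finset.Icc 1 (Xl j), χ n * bC a t δ n * (rho j n : ℂ) := by
  have h1 : ∀ s, smooth (al χ) tri2 (Rl j) s = ∑ n ∈ Finset.Icc 1 (Xl j), al χ n * (n : ℂ) ^ (-s) * (rho j n : ℂ) := by
    intro s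
    rw [smooth, Finset.range_eq_Ico, Finset.sum_eq_sum_Ico_succ_bot (by omega)]
    simp only [LSeries.term_zero, zero_mul, zero_add]
    refine sum_congr (by ext n; simp [Xl]) fun n hn => ?_
    have : n ≠ 0 := by simp at hn; omega
    rw [LSeries.term_of_ne_zero this, Complex.cpow_neg, div_eq_mul_inv]; rfl
  simp_rw [h1, mul_sum]
  rw [sum_comm]
  refine sum_congr rfl fun n _ => ?_
  unfold bC al
  rw [mul_sum, mul_sum, sum_mul]
  exact sum_congr rfl fun i _ => by ring

lemma zz_pos {δ : ℝ} (hδ : 0 < δ) (Δ : ℝ) : 0 < ‖zz δ Δ‖ := by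
  rw [norm_pos_iff, zz]
  exact riemannZeta_ne_zero_of_one_le_re (by simp; linarith)

theorem momC (K : ℝ) (hK : 0 ≤ K) : ∃ C : ℝ, 0 < C ∧ ∃ q0 : ℕ, 2 ≤ q0 ∧ ∀ (q : ℕ) [NeZero q], q0 ≤ q →
    (∀ χ : DirichletCharacter ℂ q, dirichletRH χ) → ∀ (ι : Type) [Fintype ι] (a t : ι → ℝ), (∀ i, 0 ≤ a i) → ∑ i, a i ≤ K →
    (∀ i, |t i| ≤ (q : ℝ) ^ 2) → ∀ δ : ℝ, 0 < δ → δ ≤ 1/2 →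
    ∑ χ ∈ prims q, ∏ i, ‖DirichletCharacter.LFunction χ ((1/2 + δ : ℝ) + t i * I)‖ ^ (a i) ≤
      C * (Nat.totient q) * ∏ i, ∏ k, ‖zz δ (t i - t k)‖ ^ (a i * a k / 4) := by
  obtain ⟨C0, hC0, hB⟩ := boundB
  obtain ⟨C, hC, q0, hM⟩ := moment_abs K (K * (9 + 2 * C0)) hK (by positivity)
  have hBz : 0 ≤ Bz := tsum_nonneg fun p => by positivity
  refine ⟨C * Real.exp (K ^ 2 * Bz / 4), by positivity, q0 + 2, by omega, ?_⟩
  intro q _ hq hRH ι _ a t ha hsum ht δ hδ hδ2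
  set s : ι → ℂ := fun i => (1/2 + δ : ℝ) + t i * I with hs
  have hsr : ∀ i, 1/2 < (s i).re := fun i => by simp [hs]; linarith
  have hq2 : (2:ℝ) ≤ q := by exact_mod_cast (show 2 ≤ q by omega)
  have hL1 : 1/2 ≤ Real.log q := by
    have := Real.log_two_gt_d9
    have := Real.log_le_log (by norm_num) hq2
    linarith
  have hbd := hM q (by omega) (bC a t δ) (bC_pp a t δ) (fun p m hp hm => bC_le a t ha hsum hδ p m hp hm) (prims q)
    (fun χ => ∑ i, a i * Real.log ‖DirichletCharacter.LFunction χ (s i)‖) (by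
      intro χ hχ j
      rw [← sum_smooth, Complex.re_sum]
      have hterm : ∀ i ∈ Finset.univ, a i * Real.log ‖DirichletCharacter.LFunction χ (s i)‖ ≤
          ((a i : ℂ) * smooth (al χ) tri2 (Rl j) (s i)).re + a i * ((9 + 2 * C0) * Real.log q / Rl j) := by
        intro i _
        have h1 := hB q χ (prims_ne (by omega) (prims_mem hχ)) (prims_mem hχ) (hRH χ) (Rl j) (Rl_half j) (s i) (hsr i)
        have h2 : Real.log (2 + ‖s i‖) ≤ 4 * Real.log q := by
          rw [show (4:ℝ) * Real.log q = Real.log ((q:ℝ) ^ 4) by rw [Real.log_pow]; norm_num]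
          refine Real.log_le_log (by positivity) ?_
          have h3 : ‖s i‖ ≤ 1 + q ^ 2 := by
            simp only [hs]
            refine (norm_add_le _ _).trans (add_le_add ?_ ?_)
            · rw [Complex.norm_real, Real.norm_of_nonneg (by linarith)]; linarith
            · rw [norm_mul, Complex.norm_I, mul_one, Complex.norm_real]; exact ht i
          nlinarith [sq_nonneg ((q:ℝ) ^ 2 - 1), mul_self_nonneg ((q:ℝ)-2)]
        have h4 : (Real.log q + 2 * Real.log (2 + ‖s i‖) + C0) / Rl j ≤ (9 + 2 * C0) * Real.log q / Rl j := by
          refine div_le_div_of_nonneg_right ?_ (Rl_pos j).le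
          nlinarith
        rw [Complex.re_ofReal_mul, ← mul_add]
        exact mul_le_mul_of_nonneg_left (by linarith) (ha i)
      refine (sum_le_sum hterm).trans ?_
      rw [sum_add_distrib, ← sum_mul]
      refine add_le_add le_rfl ?_
      calc _ ≤ K * ((9 + 2 * C0) * Real.log q / Rl j) := mul_le_mul_of_nonneg_right hsum (div_nonneg (by nlinarith) (Rl_pos j).le)
        _ = _ := by ring)
  have hz : ∀ i k, ‖zz δ (t i - t k)‖ ^ (a i * a k / 4) = Real.exp (1/4 * (a i * a k * Real.log ‖zz δ (t i - t k)‖)) := fun i k => by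
    rw [Real.rpow_def_of_pos (zz_pos hδ _)]; congr 1; ring
  calc _ = ∑ χ ∈ prims q, Real.exp (∑ i, a i * Real.log ‖DirichletCharacter.LFunction χ (s i)‖) := by
        refine sum_congr rfl fun χ hχ => ?_
        rw [Real.exp_sum]
        refine Finset.prod_congr rfl fun i _ => ?_
        rw [Real.rpow_def_of_pos (norm_pos_iff.2 (L_ne_zero χ (prims_ne (by omega) (prims_mem hχ)) (hRH χ) (hsr i)))]
        rw [mul_comm]
    _ ≤ _ := hbd
    _ ≤ C * (Nat.totient q) * (Real.exp (K ^ 2 * Bz / 4) * ∏ i, ∏ k, ‖zz δ (t i - t k)‖ ^ (a i * a k / 4)) := by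
        refine mul_le_mul_of_nonneg_left ?_ (by positivity)
        simp_rw [hz, ← Real.exp_sum]
        rw [← Real.exp_add]
        refine Real.exp_le_exp.2 ?_
        have h1 : ∑ p ∈ Nat.primesLE q, ‖bC a t δ p‖ ^ 2 ≤ ∑ p ∈ Nat.primesLE q, ‖∑ i, (a i : ℂ) * (p : ℂ) ^ (-((1/2 + δ : ℝ) + t i * I : ℂ))‖ ^ 2 := by
          refine le_of_eq (sum_congr rfl fun p hp => ?_)
          have hp := Nat.prime_of_mem_primesLE hp
          have : Real.log p ≠ 0 := (Real.log_pos (by exact_mod_cast hp.one_lt)).ne'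
          rw [bC, ArithmeticFunction.vonMangoldt_apply_prime hp, div_self this]; simp
        have h2 := h1.trans (prime_quad a t ha hδ q)
        have h3 : ∑ i, ∑ k, a i * a k * (Real.log ‖zz δ (t i - t k)‖ + Bz) = ∑ i, ∑ k, a i * a k * Real.log ‖zz δ (t i - t k)‖ + (∑ i, a i) ^ 2 * Bz := by
          rw [sq, Finset.sum_mul_sum, sum_mul, ← sum_add_distrib]
          refine sum_congr rfl fun i _ => ?_
          rw [sum_mul, ← sum_add_distrib]
          exact sum_congr rfl fun k _ => by ring
        have h4 : (∑ i, a i) ^ 2 * Bz ≤ K ^ 2 * Bz := mul_le_mul_of_nonneg_right (pow_le_pow_left₀ (sum_nonneg fun i _ => ha i) hsum 2) hBz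
        simp_rw [← mul_sum]
        rw [h3] at h2
        linarith
    _ = _ := by ring

lemma zeta_step {s : ℂ} (hs : 1 < s.re) {n : ℕ} (hn : 1 ≤ n) :
    ‖(((n + 1 : ℕ) : ℝ) : ℂ) ^ (-s) - ((((n + 1 : ℕ) : ℝ) : ℂ) ^ (-s + 1) / (-s + 1) - ((n : ℝ) : ℂ) ^ (-s + 1) / (-s + 1))‖ ≤ ‖s‖ * ((n : ℝ) ^ 2)⁻¹ := by
  have hn0 : (1:ℝ) ≤ n := by exact_mod_cast hn
  have hs0 : -s ≠ 0 := fun h => by rw [neg_eq_zero.1 h] at hs; norm_num at hs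
  have hs1 : -s ≠ -1 := fun h => by rw [neg_inj.1 h] at hs; norm_num at hs
  have hcast : ((n + 1 : ℕ) : ℝ) = n + 1 := by push_cast; ring
  rw [hcast]
  have hd : ∀ x ∈ Set.Icc (n : ℝ) (n + 1), ‖(x : ℂ) ^ (-s) - ((n + 1 : ℝ) : ℂ) ^ (-s)‖ ≤ ‖s‖ * ((n : ℝ) ^ 2)⁻¹ := by
    intro x hx
    have h := (convex_Icc (n : ℝ) (n + 1)).norm_image_sub_le_of_norm_hasDerivWithin_le (f := fun y : ℝ => (y : ℂ) ^ (-s)) (f' := fun y : ℝ => (-s) * (y : ℂ) ^ (-s - 1)) (C := ‖s‖ * ((n : ℝ) ^ 2)⁻¹)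
      (fun y hy => (hasDerivAt_ofReal_cpow_const (by linarith [hy.1] : y ≠ 0) hs0).hasDerivWithinAt) (by
        intro y hy
        have hy0 : 0 < y := by linarith [hy.1]
        rw [norm_mul, norm_neg, Complex.norm_cpow_eq_rpow_re_of_pos hy0]
        refine mul_le_mul_of_nonneg_left ?_ (norm_nonneg _)
        calc y ^ (-s - 1).re ≤ y ^ (-2 : ℝ) := rpow_le_rpow_of_exponent_le (by linarith [hy.1]) (by simp; linarith)
          _ ≤ (n : ℝ) ^ (-2 : ℝ) := Real.rpow_le_rpow_of_nonpos (by linarith) hy.1 (by norm_num)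
          _ = _ := by rw [Real.rpow_neg (by linarith)]; norm_num)
      (show (n + 1 : ℝ) ∈ _ from ⟨by linarith, le_rfl⟩) hx
    refine h.trans ?_
    have : ‖x - (n + 1)‖ ≤ 1 := by rw [Real.norm_eq_abs, abs_le]; constructor <;> linarith [hx.1, hx.2]
    exact mul_le_of_le_one_right (by positivity) this
  have h := (convex_Icc (n : ℝ) (n + 1)).norm_image_sub_le_of_norm_hasDerivWithin_le (f := fun y : ℝ => (y : ℂ) ^ (-s + 1) / (-s + 1) - (y : ℂ) * ((n + 1 : ℝ) : ℂ) ^ (-s))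
      (f' := fun y : ℝ => (y : ℂ) ^ (-s) - 1 * ((n + 1 : ℝ) : ℂ) ^ (-s)) (C := ‖s‖ * ((n : ℝ) ^ 2)⁻¹)
      (fun y hy => ((hasDerivAt_ofReal_cpow_const' (by linarith [hy.1] : y ≠ 0) hs1).sub ((Complex.ofRealCLM.hasDerivAt (x := y)).mul_const _)).hasDerivWithinAt)
      (fun y hy => by rw [one_mul]; exact hd y hy)
      (show (n + 1 : ℝ) ∈ _ from ⟨by linarith, le_rfl⟩) (show (n : ℝ) ∈ _ from ⟨le_rfl, by linarith⟩)
  rw [show (n : ℝ) - (n + 1) = -1 by ring, norm_neg, norm_one, mul_one] at h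
  refine le_trans (le_of_eq ?_) h
  congr 1; push_cast; ring

lemma zeta_part {s : ℂ} (hs : 1 < s.re) {N : ℕ} (hN : 1 ≤ N) (M : ℕ) (hM : N ≤ M) :
    ‖∑ n ∈ Finset.Ico N M, (((n + 1 : ℕ) : ℝ) : ℂ) ^ (-s) - (((M : ℝ) : ℂ) ^ (-s + 1) / (-s + 1) - ((N : ℝ) : ℂ) ^ (-s + 1) / (-s + 1))‖ ≤
      ‖s‖ * ∑ n ∈ Finset.Ico N M, ((n : ℝ) ^ 2)⁻¹ := by
  induction M, hM using Nat.le_induction with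
  | base => simp
  | succ M hM ih =>
    rw [Finset.sum_Ico_succ_top hM, Finset.sum_Ico_succ_top hM, mul_add]
    have h := zeta_step hs (hN.trans hM)
    refine le_trans (le_of_eq ?_) ((norm_add_le _ _).trans (add_le_add ih h))
    congr 1; ring

lemma zeta_raw {s : ℂ} (hs : 1 < s.re) {N : ℕ} (hN : 1 ≤ N) : ‖riemannZeta s‖ ≤ 1 + Real.log N + 2 / ‖s - 1‖ + 2 * ‖s‖ / N := by
  have hsum : Summable (fun n : ℕ => (((n + 1 : ℕ) : ℝ) : ℂ) ^ (-s)) := by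
    have := (summable_nat_add_iff 1).2 (Complex.summable_one_div_nat_cpow.2 hs)
    refine this.congr fun n => ?_
    rw [Complex.cpow_neg, one_div]; push_cast; rfl
  have hz : HasSum (fun n : ℕ => (((n + 1 : ℕ) : ℝ) : ℂ) ^ (-s)) (riemannZeta s) := by
    rw [zeta_eq_tsum_one_div_nat_add_one_cpow hs]
    convert hsum.hasSum using 3 with n
    · rw [Complex.cpow_neg, one_div]; push_cast; rfl
  have ht := hz.tendsto_sum_nat.norm
  refine le_of_tendsto ht (eventually_atTop.2 ⟨N, fun M hM => ?_⟩)
  have hsp := Finset.sum_range_add_sum_Ico (fun n : ℕ => (((n + 1 : ℕ) : ℝ) : ℂ) ^ (-s)) hM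
  rw [← hsp]
  have h1 : ‖∑ n ∈ Finset.range N, (((n + 1 : ℕ) : ℝ) : ℂ) ^ (-s)‖ ≤ 1 + Real.log N := by
    refine (norm_sum_le _ _).trans ?_
    have hh := harmonic_le_one_add_log N
    refine le_trans ?_ hh
    rw [harmonic]; push_cast
    refine sum_le_sum fun n _ => ?_
    have : (0:ℝ) < (n:ℝ) + 1 := by positivity
    have h2 := Complex.norm_cpow_eq_rpow_re_of_pos this (-s)
    push_cast at h2
    rw [h2, ← Real.rpow_neg_one]
    exact rpow_le_rpow_of_exponent_le (by linarith [(Nat.cast_nonneg n : (0:ℝ) ≤ n)]) (by simp; linarith)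
  have hg : ∀ m : ℕ, 1 ≤ m → ‖((m : ℝ) : ℂ) ^ (-s + 1) / (-s + 1)‖ ≤ 1 / ‖s - 1‖ := by
    intro m hm
    have hm0 : (1:ℝ) ≤ m := by exact_mod_cast hm
    rw [norm_div, show -s + 1 = -(s - 1) by ring, norm_neg (s - 1), Complex.norm_cpow_eq_rpow_re_of_pos (by linarith)]
    refine div_le_div_of_nonneg_right ?_ (norm_nonneg _)
    exact Real.rpow_le_one_of_one_le_of_nonpos hm0 (by simp; linarith)
  have h3 := zeta_part hs hN M hM
  have h4 : ∑ n ∈ Finset.Ico N M, ((n : ℝ) ^ 2)⁻¹ ≤ 2 / N := by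
    have h5 := sum_Ioo_inv_sq_le (α := ℝ) (N - 1) M
    have e : Finset.Ioo (N - 1) M = Finset.Ico N M := by ext x; simp; omega
    rw [e] at h5
    have : ((N - 1 : ℕ) : ℝ) + 1 = N := by exact_mod_cast Nat.sub_add_cancel hN
    rwa [this] at h5
  have h5 := mul_le_mul_of_nonneg_left h4 (norm_nonneg s)
  have h6 := hg M (hN.trans hM)
  have h7 := hg N hN
  have h8 : ‖∑ n ∈ Finset.Ico N M, (((n + 1 : ℕ) : ℝ) : ℂ) ^ (-s)‖ ≤ 2 / ‖s - 1‖ + 2 * ‖s‖ / N := by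
    have := norm_le_norm_add_norm_sub' (∑ n ∈ Finset.Ico N M, (((n + 1 : ℕ) : ℝ) : ℂ) ^ (-s)) (((M : ℝ) : ℂ) ^ (-s + 1) / (-s + 1) - ((N : ℝ) : ℂ) ^ (-s + 1) / (-s + 1))
    have h9 := norm_sub_le (((M : ℝ) : ℂ) ^ (-s + 1) / (-s + 1)) (((N : ℝ) : ℂ) ^ (-s + 1) / (-s + 1))
    have e1 : 2 / ‖s - 1‖ = 1 / ‖s - 1‖ + 1 / ‖s - 1‖ := by ring
    have e2 : 2 * ‖s‖ / N = ‖s‖ * (2 / N) := by ring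
    linarith
  linarith [norm_add_le (∑ n ∈ Finset.range N, (((n + 1 : ℕ) : ℝ) : ℂ) ^ (-s)) (∑ n ∈ Finset.Ico N M, (((n + 1 : ℕ) : ℝ) : ℂ) ^ (-s))]

lemma zz_bound {δ : ℝ} (hδ : 0 < δ) (hδ2 : δ ≤ 1/2) (Δ : ℝ) : ‖zz δ Δ‖ ≤ 7 * (1 / (δ + |Δ|) + Real.log (2 + |Δ|)) := by
  set s : ℂ := 1 + 2 * δ + Δ * I with hs
  have hsr : s.re = 1 + 2 * δ := by simp [hs]
  have hn1 : 1 ≤ ‖s‖ := by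
    have := Complex.re_le_norm s; rw [hsr] at this; linarith
  have hn2 : ‖s‖ ≤ 2 + |Δ| := by
    have : ‖s‖ ≤ ‖((1 + 2 * δ : ℝ) : ℂ)‖ + ‖(Δ : ℂ) * I‖ := by rw [hs]; push_cast; exact norm_add_le _ _
    rw [Complex.norm_real, Real.norm_of_nonneg (by linarith), norm_mul, Complex.norm_I, mul_one, Complex.norm_real, Real.norm_eq_abs] at this
    linarith
  have hd0 : (δ + |Δ|) / 2 ≤ ‖s - 1‖ := by
    have h1 := Complex.abs_re_le_norm (s - 1)
    have h2 := Complex.abs_im_le_norm (s - 1)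
    have e1 : (s - 1).re = 2 * δ := by simp [hs]
    have e2 : (s - 1).im = Δ := by simp [hs]
    rw [e1, abs_of_pos (by linarith)] at h1
    rw [e2] at h2
    linarith
  have hp : 0 < δ + |Δ| := by have := abs_nonneg Δ; linarith
  set N := ⌈‖s‖⌉₊ with hN
  have hN1 : ‖s‖ ≤ N := Nat.le_ceil _
  have hN2 : (N : ℝ) < ‖s‖ + 1 := Nat.ceil_lt_add_one (norm_nonneg _)
  have hN3 : 1 ≤ N := by exact_mod_cast hn1.trans hN1
  have h := zeta_raw (s := s) (by rw [hsr]; linarith) hN3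
  have hN0 : (0:ℝ) < N := by exact_mod_cast hN3
  have h1 : Real.log N ≤ 2 * Real.log (2 + |Δ|) := by
    rw [show 2 * Real.log (2 + |Δ|) = Real.log ((2 + |Δ|) ^ 2) by rw [Real.log_pow]; norm_num]
    refine Real.log_le_log hN0 ?_
    nlinarith [abs_nonneg Δ]
  have h2 : 2 / ‖s - 1‖ ≤ 4 * (1 / (δ + |Δ|)) := by
    calc 2 / ‖s - 1‖ ≤ 2 / ((δ + |Δ|) / 2) := div_le_div_of_nonneg_left (by norm_num) (by positivity) hd0
      _ = _ := by field_simp; norm_num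
  have h3 : 2 * ‖s‖ / N ≤ 2 := by rw [div_le_iff₀ hN0]; linarith
  have h4 : (0.69 : ℝ) ≤ Real.log (2 + |Δ|) := by
    have := Real.log_two_gt_d9
    have := Real.log_le_log (by norm_num) (show (2:ℝ) ≤ 2 + |Δ| by linarith [abs_nonneg Δ])
    linarith
  have h5 : 0 < 1 / (δ + |Δ|) := by positivity
  rw [zz]; linarith

section
variable {q : ℕ} [NeZero q]

/-- `|L(1/2+δ+it)|` -/
noncomputable def Fv (χ : DirichletCharacter ℂ q) (δ t : ℝ) : ℝ :=
  ‖DirichletCharacter.LFunction χ ((1/2 + δ : ℝ) + t * I)‖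

lemma Fv_nonneg (χ : DirichletCharacter ℂ q) (δ t : ℝ) : 0 ≤ Fv χ δ t := norm_nonneg _

lemma Fv_cont (χ : DirichletCharacter ℂ q) (h1 : χ ≠ 1) (δ : ℝ) : Continuous (Fv χ δ) := by
  have h := (DirichletCharacter.differentiable_LFunction h1).continuous
  unfold Fv
  exact (h.comp (by fun_prop : Continuous fun t : ℝ => (((1/2 + δ : ℝ) : ℂ) + t * I))).norm

lemma norm_line_le {c t : ℝ} (h0 : 0 ≤ c) (h1 : c ≤ 1) : 2 + ‖((c:ℝ):ℂ) + t * I‖ ≤ 3 * (1 + |t|) := by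
  have := norm_add_le ((c:ℝ):ℂ) (t * I)
  rw [norm_mul, Complex.norm_I, mul_one, Complex.norm_real, Complex.norm_real, Real.norm_eq_abs, Real.norm_eq_abs, abs_of_nonneg h0] at this
  linarith [abs_nonneg t]

lemma norm_line_ge {c t : ℝ} (h0 : 1/4 ≤ c) : 1 + |t| ≤ 5 * ‖((c:ℝ):ℂ) + t * I‖ := by
  have a1 := Complex.abs_re_le_norm (((c:ℝ):ℂ) + t * I)
  have a2 := Complex.abs_im_le_norm (((c:ℝ):ℂ) + t * I)
  simp at a1 a2
  have := le_abs_self c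
  linarith

lemma growth : ∃ C : ℝ, 0 < C ∧ ∀ (q : ℕ) [NeZero q] (χ : DirichletCharacter ℂ q), χ ≠ 1 → χ.IsPrimitive → dirichletRH χ →
    ∀ δ : ℝ, 0 < δ → δ ≤ 1/2 → ∀ t : ℝ, Fv χ δ t ≤ C * (q:ℝ) ^ (1/16:ℝ) * (1 + |t|) ^ (1/8:ℝ) := by
  obtain ⟨C0, hC0, hB⟩ := boundB
  refine ⟨Real.exp (Real.exp 16 + 1 + C0 / 16) * 3 ^ (1/8:ℝ), by positivity, ?_⟩
  intro q _ χ h1 hp hRH δ hd hd2 t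
  have hq : (0:ℝ) < q := by exact_mod_cast Nat.pos_of_ne_zero (NeZero.ne q)
  rcases (Fv_nonneg χ δ t).eq_or_lt with h0 | h0
  · rw [← h0]; positivity
  have hs : 1/2 < ((((1/2 + δ : ℝ)):ℂ) + t * I).re := by simp; linarith
  have hb := hB q χ h1 hp hRH 16 (by norm_num) _ hs
  set s : ℂ := (((1/2 + δ : ℝ)):ℂ) + t * I with hsd
  have hsm : (smooth (al χ) tri2 16 s).re ≤ Real.exp 16 + 1 := by
    refine (Complex.re_le_norm _).trans ?_
    unfold smooth
    refine (norm_sum_le _ _).trans ?_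
    have : ∀ n ∈ Finset.range (⌊Real.exp 16⌋₊ + 1), ‖LSeries.term (al χ) s n * ((tri2 (Real.log n / 16) : ℝ) : ℂ)‖ ≤ 1 := by
      intro n _
      rw [norm_mul, Complex.norm_real, Real.norm_eq_abs]
      have ht1 : |tri2 (Real.log n / 16)| ≤ 1 := by
        rw [tri2, abs_of_nonneg (sq_nonneg _)]
        exact pow_le_one₀ (tri_nonneg _) (tri_le_one _)
      have ht2 : ‖LSeries.term (al χ) s n‖ ≤ 1 := by
        rcases Nat.eq_zero_or_pos n with rfl | hn
        · simp
        rw [LSeries.norm_term_eq, if_neg hn.ne']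
        have hn1 : (1:ℝ) ≤ n := by exact_mod_cast hn
        rw [div_le_one (by positivity)]
        exact (al_norm_le χ n).trans (Real.one_le_rpow hn1 (by linarith))
      calc _ ≤ (1:ℝ) * 1 := mul_le_mul ht2 ht1 (abs_nonneg _) zero_le_one
        _ = 1 := by norm_num
    refine (Finset.sum_le_card_nsmul _ _ _ this).trans ?_
    simp only [Finset.card_range, nsmul_eq_mul, mul_one]
    push_cast
    linarith [Nat.floor_le (Real.exp_pos 16).le]
  have hl : Real.log (2 + ‖s‖) ≤ Real.log (3 * (1 + |t|)) :=
    Real.log_le_log (by positivity) (norm_line_le (by linarith) (by linarith))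
  have e1 : Fv χ δ t ≤ Real.exp (Real.exp 16 + 1 + (Real.log q + 2 * Real.log (3 * (1 + |t|)) + C0) / 16) := by
    rw [← Real.log_le_iff_le_exp h0]
    have : Real.log (Fv χ δ t) = Real.log ‖DirichletCharacter.LFunction χ s‖ := rfl
    rw [this]
    linarith
  refine e1.trans (le_of_eq ?_)
  have h3 : (0:ℝ) < 1 + |t| := by positivity
  rw [Real.rpow_def_of_pos hq, Real.rpow_def_of_pos h3, Real.rpow_def_of_pos (by norm_num : (0:ℝ) < 3), Real.log_mul (by norm_num) h3.ne', ← Real.exp_add, ← Real.exp_add, ← Real.exp_add]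
  congr 1; ring

/-- moving left across the critical line -/
lemma Lc_le (χ : DirichletCharacter ℂ q) (h1 : χ ≠ 1) (hp : χ.IsPrimitive) (hRH : dirichletRH χ)
    {δ : ℝ} (hd : 0 < δ) (hd2 : δ ≤ 1/8) (t : ℝ) :
    ‖DirichletCharacter.LFunction χ ((1/2 - δ : ℝ) + t * I)‖ ≤ 6 * (q:ℝ) ^ δ * (1 + |t|) ^ (2 * δ) * Fv χ δ t := by
  have hq : (0:ℝ) < q := by exact_mod_cast Nat.pos_of_ne_zero (NeZero.ne q)
  have h := L_mono χ h1 hp hRH (η := 2 * δ) (by linarith) (by linarith) (s := (((1/2 - δ : ℝ)):ℂ) + t * I) (by simp)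
  have e : (((1/2 - δ : ℝ)):ℂ) + t * I + ((2 * δ : ℝ):ℂ) = (((1/2 + δ : ℝ)):ℂ) + t * I := by push_cast; ring
  rw [e] at h
  refine h.trans (mul_le_mul_of_nonneg_right ?_ (norm_nonneg _))
  have h3 : (0:ℝ) < 1 + |t| := by positivity
  have hl : Real.log (2 + ‖(((1/2 - δ : ℝ)):ℂ) + t * I‖) ≤ Real.log (3 * (1 + |t|)) :=
    Real.log_le_log (by positivity) (norm_line_le (by linarith) (by linarith))
  rw [Real.log_mul (by norm_num) h3.ne'] at hl
  have hl3 : Real.log 3 ≤ 2 := by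
    have := Real.log_le_sub_one_of_pos (by norm_num : (0:ℝ) < 3); linarith
  have h6 : Real.exp (5/4) ≤ 6 := by
    have : Real.exp (5/4) ≤ Real.exp 1 * Real.exp 1 := by rw [← Real.exp_add]; exact Real.exp_le_exp.2 (by norm_num)
    have e1 := Real.exp_one_lt_d9
    have e2 : Real.exp (5/4) = Real.exp 1 * Real.exp (1/4) := by rw [← Real.exp_add]; norm_num
    have e3 : Real.exp (1/4) ≤ 2 := by
      have := Real.exp_bound_div_one_sub_of_interval (x := 1/4) (by norm_num) (by norm_num)
      norm_num at this ⊢; linarith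
    rw [e2]; nlinarith [Real.exp_pos 1]
  calc _ ≤ Real.exp (5/4 + δ * Real.log q + 2 * δ * Real.log (1 + |t|)) := by
        apply Real.exp_le_exp.2
        nlinarith
    _ = Real.exp (5/4) * (q:ℝ) ^ δ * (1 + |t|) ^ (2 * δ) := by
        rw [Real.exp_add, Real.exp_add, Real.rpow_def_of_pos hq, Real.rpow_def_of_pos h3]
        ring_nf
    _ ≤ _ := by gcongr

/-- weight -/
noncomputable def wT (T t : ℝ) : ℝ := (1 / T) * (1 + |t| / T) ^ (-(7/4) : ℝ)

lemma wT_nonneg {T : ℝ} (hT : 0 < T) (t : ℝ) : 0 ≤ wT T t := by unfold wT; positivity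

lemma wT_cont {T : ℝ} (hT : 0 < T) : Continuous (wT T) := by
  unfold wT
  refine continuous_const.mul (Continuous.rpow_const (by fun_prop) fun t => Or.inl ?_)
  positivity

lemma wT_le {T : ℝ} (hT : 1 ≤ T) (t : ℝ) : wT T t ≤ T * (1 + |t|) ^ (-(7/4) : ℝ) := by
  have hT0 : 0 < T := by linarith
  have h : (1 + |t| / T) ^ (-(7/4) : ℝ) ≤ ((1 + |t|) / T) ^ (-(7/4) : ℝ) := by
    refine Real.rpow_le_rpow_of_nonpos (by positivity) ?_ (by norm_num)
    rw [add_div]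
    have : 1 / T ≤ 1 := by rw [div_le_one hT0]; exact hT
    linarith
  unfold wT
  rw [Real.div_rpow (by positivity) hT0.le] at h
  have h2 : (T ^ (-(7/4) : ℝ))⁻¹ ≤ T ^ 2 := by
    rw [Real.rpow_neg hT0.le, inv_inv, ← rpow_natCast]
    exact rpow_le_rpow_of_exponent_le hT (by norm_num)
  calc _ ≤ (1 / T) * ((1 + |t|) ^ (-(7/4) : ℝ) * T ^ 2) := by
        refine mul_le_mul_of_nonneg_left (h.trans ?_) (by positivity)
        rw [div_eq_mul_inv]
        exact mul_le_mul_of_nonneg_left h2 (by positivity)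
    _ = _ := by field_simp

lemma jap_int {r : ℝ} (hr : 1 < r) : Integrable (fun t : ℝ => (1 + |t|) ^ (-r)) := by
  have := integrable_one_add_norm (E := ℝ) (μ := volume) (r := r) (by simpa using hr)
  simpa using this

lemma Fw_int (χ : DirichletCharacter ℂ q) (h1 : χ ≠ 1) (hp : χ.IsPrimitive) (hRH : dirichletRH χ)
    {δ : ℝ} (hd : 0 < δ) (hd2 : δ ≤ 1/2) {T : ℝ} (hT : 1 ≤ T) : Integrable (fun t => Fv χ δ t * wT T t) := by
  obtain ⟨C, hC, hg⟩ := growth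
  have hT0 : 0 < T := by linarith
  refine Integrable.mono' ((jap_int (r := 13/8) (by norm_num)).const_mul (C * (q:ℝ) ^ (1/16:ℝ) * T)) ((Fv_cont χ h1 δ).mul (wT_cont hT0)).aestronglyMeasurable (Eventually.of_forall fun t => ?_)
  have h3 : (0:ℝ) < 1 + |t| := by positivity
  rw [Real.norm_eq_abs, abs_of_nonneg (mul_nonneg (Fv_nonneg _ _ _) (wT_nonneg hT0 t))]
  calc _ ≤ (C * (q:ℝ) ^ (1/16:ℝ) * (1 + |t|) ^ (1/8:ℝ)) * (T * (1 + |t|) ^ (-(7/4) : ℝ)) :=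
        mul_le_mul (hg q χ h1 hp hRH δ hd hd2 t) (wT_le hT t) (wT_nonneg hT0 t) (by positivity)
    _ = C * (q:ℝ) ^ (1/16:ℝ) * T * ((1 + |t|) ^ (1/8:ℝ) * (1 + |t|) ^ (-(7/4) : ℝ)) := by ring
    _ = _ := by rw [← rpow_add h3]; norm_num
end

section
variable {q : ℕ} [NeZero q]

noncomputable def ker (s : ℂ) (h : ℝ) : ℂ := (((1 + h : ℝ) : ℂ) ^ (s + 1) - 1) / (h * (s * (s + 1)))

lemma ker_one {s : ℂ} (h0 : 0 < s.re) (h1 : s.re ≤ 1/2) {h : ℝ} (hh : 0 < h) : ‖ker s h - 1 / s‖ ≤ h := by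
  have hs0 : s ≠ 0 := fun h => by rw [h] at h0; simp at h0
  have hs1 : s + 1 ≠ 0 := fun h => by
    have := congrArg Complex.re h; simp at this; linarith
  have d1 : ∀ v : ℝ, 0 ≤ v → HasDerivAt (fun v : ℝ => ((1 + v : ℝ) : ℂ) ^ s) (s * ((1 + v : ℝ) : ℂ) ^ (s - 1)) v := by
    intro v hv
    have := (hasDerivAt_ofReal_cpow_const (x := 1 + v) (by linarith : 1 + v ≠ 0) hs0).scomp v ((hasDerivAt_id v).const_add 1)
    refine this.congr_deriv ?_
    simp
  have d2 : ∀ v : ℝ, 0 ≤ v → HasDerivAt (fun v : ℝ => ((1 + v : ℝ) : ℂ) ^ (s + 1) / (s + 1) - v) (((1 + v : ℝ) : ℂ) ^ s - 1) v := by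
    intro v hv
    have h2 := (hasDerivAt_ofReal_cpow_const (x := 1 + v) (r := s + 1) (by linarith : 1 + v ≠ 0) hs1).scomp v ((hasDerivAt_id v).const_add 1)
    refine ((h2.div_const (s + 1)).sub (hasDerivAt_id v).ofReal_comp).congr_deriv ?_
    simp; field_simp
  have b1 : ∀ v ∈ Set.Icc 0 h, ‖((1 + v : ℝ) : ℂ) ^ s - 1‖ ≤ ‖s‖ * h := by
    intro v hv
    have := (convex_Icc (0:ℝ) h).norm_image_sub_le_of_norm_hasDerivWithin_le (f := fun v : ℝ => ((1 + v : ℝ) : ℂ) ^ s) (C := ‖s‖)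
      (fun y hy => (d1 y hy.1).hasDerivWithinAt) (by
        intro y hy
        rw [norm_mul, Complex.norm_cpow_eq_rpow_re_of_pos (by linarith [hy.1])]
        refine mul_le_of_le_one_right (norm_nonneg _) ?_
        exact Real.rpow_le_one_of_one_le_of_nonpos (by linarith [hy.1]) (by simp; linarith)) (show (0:ℝ) ∈ _ from ⟨le_rfl, hh.le⟩) hv
    simp only [add_zero, Complex.ofReal_one, Complex.one_cpow, sub_zero] at this
    refine this.trans (mul_le_mul_of_nonneg_left ?_ (norm_nonneg _))
    rw [Real.norm_eq_abs, abs_of_nonneg hv.1]; exact hv.2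
  have b2 := (convex_Icc (0:ℝ) h).norm_image_sub_le_of_norm_hasDerivWithin_le (C := ‖s‖ * h)
      (fun y hy => (d2 y hy.1).hasDerivWithinAt) b1 (show (0:ℝ) ∈ _ from ⟨le_rfl, hh.le⟩) (show h ∈ _ from ⟨hh.le, le_rfl⟩)
  have hhc : (h:ℂ) ≠ 0 := by exact_mod_cast hh.ne'
  have e : ker s h - 1 / s = (((1 + h : ℝ) : ℂ) ^ (s + 1) / (s + 1) - h - (((1 + 0 : ℝ) : ℂ) ^ (s + 1) / (s + 1) - (0:ℝ))) / (h * s) := by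
    unfold ker
    simp only [add_zero, Complex.ofReal_one, Complex.one_cpow, Complex.ofReal_zero, sub_zero]
    field_simp; ring
  rw [e, norm_div, norm_mul, Complex.norm_real, Real.norm_eq_abs, abs_of_pos hh, div_le_iff₀ (by positivity)]
  rw [sub_zero, Real.norm_eq_abs, abs_of_pos hh] at b2
  linarith

lemma ker_two {s : ℂ} (h0 : 0 < s.re) (h1 : s.re ≤ 1/2) {h : ℝ} (hh : 0 < h) (hh1 : h ≤ 1) : ‖ker s h‖ ≤ 5 / (h * ‖s‖ ^ 2) := by
  have hs0 : s ≠ 0 := fun h => by rw [h] at h0; simp at h0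
  have hss : ‖s‖ ≤ ‖s + 1‖ := by
    rw [← sq_le_sq₀ (norm_nonneg _) (norm_nonneg _), Complex.sq_norm, Complex.sq_norm, Complex.normSq_apply, Complex.normSq_apply]
    simp; nlinarith
  have hn : ‖((1 + h : ℝ) : ℂ) ^ (s + 1) - 1‖ ≤ 5 := by
    refine (norm_sub_le _ _).trans ?_
    rw [Complex.norm_cpow_eq_rpow_re_of_pos (by linarith), norm_one]
    have : (1 + h) ^ (s + 1).re ≤ (2:ℝ) ^ (2:ℝ) := by
      calc _ ≤ (2:ℝ) ^ (s + 1).re := rpow_le_rpow (by linarith) (by linarith) (by simp; linarith)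
        _ ≤ _ := rpow_le_rpow_of_exponent_le (by norm_num) (by simp; linarith)
    norm_num at this ⊢; linarith
  unfold ker
  rw [norm_div, norm_mul, norm_mul, Complex.norm_real, Real.norm_eq_abs, abs_of_pos hh]
  have := norm_pos_iff.2 hs0
  refine div_le_div₀ (by norm_num) hn (by positivity) ?_
  rw [sq]; gcongr

lemma ker_diff {c t T : ℝ} (hc : 1/4 ≤ c) (hc2 : c ≤ 1/2) (hT : 1 ≤ T) :
    ‖ker (c + t * I) (1 / (2 * T)) - ker (c + t * I) (1 / T)‖ ≤ 1500 * ((1 / T) * ((1 + |t| / T) ^ 2)⁻¹) := by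
  have hT0 : 0 < T := by linarith
  set s : ℂ := c + t * I with hs
  have hre : s.re = c := by simp [hs]
  have hn : 1 + |t| ≤ 5 * ‖s‖ := norm_line_ge hc
  have hh : 1 / T ≤ 1 := by rw [div_le_one hT0]; exact hT
  have hh2 : 1 / (2 * T) ≤ 1 := by rw [div_le_one (by linarith)]; linarith
  have hta := abs_nonneg t
  rcases le_or_gt |t| T with htT | htT
  · have a1 := ker_one (s := s) (by linarith) (by linarith) (h := 1 / T) (by positivity)
    have a2 := ker_one (s := s) (by linarith) (by linarith) (h := 1 / (2 * T)) (by positivity)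
    have e : ker s (1 / (2 * T)) - ker s (1 / T) = (ker s (1 / (2 * T)) - 1 / s) - (ker s (1 / T) - 1 / s) := by ring
    rw [e]
    refine (norm_sub_le _ _).trans ((add_le_add a2 a1).trans ?_)
    have h3 : (1/4:ℝ) ≤ ((1 + |t| / T) ^ 2)⁻¹ := by
      rw [le_inv_comm₀ (by norm_num) (by positivity)]
      have : |t| / T ≤ 1 := by rw [div_le_one hT0]; exact htT
      have h0 : 0 ≤ |t| / T := by positivity
      norm_num; nlinarith
    have h4 : 1 / (2 * T) ≤ 1 / T := by apply one_div_le_one_div_of_le hT0; linarith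
    have h5 : 0 < 1 / T := by positivity
    nlinarith
  · have a1 := ker_two (s := s) (by linarith) (by linarith) (h := 1 / T) (by positivity) hh
    have a2 := ker_two (s := s) (by linarith) (by linarith) (h := 1 / (2 * T)) (by positivity) hh2
    refine (norm_sub_le _ _).trans ((add_le_add a2 a1).trans ?_)
    have hs0 : 0 < ‖s‖ := by linarith
    have h1 : 5 / (1 / (2 * T) * ‖s‖ ^ 2) + 5 / (1 / T * ‖s‖ ^ 2) = 15 * T / ‖s‖ ^ 2 := by field_simp; ring
    have h2 : 1500 * (1 / T * ((1 + |t| / T) ^ 2)⁻¹) = 1500 * T / (T + |t|) ^ 2 := by field_simp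
    rw [h1, h2, div_le_div_iff₀ (by positivity) (by positivity)]
    have : (T + |t|) ^ 2 ≤ (10 * ‖s‖) ^ 2 := by apply pow_le_pow_left₀ (by positivity); linarith
    nlinarith

lemma ker_base {c t : ℝ} (hc : 1/4 ≤ c) (hc2 : c ≤ 1/2) :
    ‖ker (c + t * I) 1‖ ≤ 1500 * ((1 / 1) * ((1 + |t| / 1) ^ 2)⁻¹) := by
  set s : ℂ := c + t * I with hs
  have hre : s.re = c := by simp [hs]
  have hn : 1 + |t| ≤ 5 * ‖s‖ := norm_line_ge hc
  have hta := abs_nonneg t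
  refine (ker_two (s := s) (by linarith) (by linarith) (h := 1) (by norm_num) le_rfl).trans ?_
  have hs0 : 0 < ‖s‖ := by linarith
  rw [div_one, div_one, one_mul, one_mul, ← div_eq_mul_inv, div_le_div_iff₀ (by positivity) (by positivity)]
  have : (1 + |t|) ^ 2 ≤ (5 * ‖s‖) ^ 2 := by apply pow_le_pow_left₀ (by positivity); linarith
  nlinarith

/-- integrability on the line left of 1/2 -/
lemma Lc_int (χ : DirichletCharacter ℂ q) (h1 : χ ≠ 1) (hp : χ.IsPrimitive) (hRH : dirichletRH χ)
    {δ : ℝ} (hd : 0 < δ) (hd2 : δ ≤ 1/8) :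
    Integrable (fun t : ℝ => ‖DirichletCharacter.LFunction χ ((1/2 - δ : ℝ) + t * I)‖ * ((1 + |t|) ^ 2)⁻¹) := by
  have h := (DirichletCharacter.differentiable_LFunction h1).continuous
  have hc : Continuous (fun t : ℝ => ‖DirichletCharacter.LFunction χ ((1/2 - δ : ℝ) + t * I)‖) :=
    (h.comp (by fun_prop : Continuous fun t : ℝ => (((1/2 - δ : ℝ) : ℂ) + t * I))).norm
  have hc2 : Continuous fun t : ℝ => ((1 + |t|) ^ 2)⁻¹ := Continuous.inv₀ (by fun_prop) (fun t => by positivity)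
  refine Integrable.mono' ((Fw_int χ h1 hp hRH hd (by linarith) (T := 1) le_rfl).const_mul (6 * (q:ℝ) ^ δ)) (hc.mul hc2).aestronglyMeasurable (Eventually.of_forall fun t => ?_)
  have h3 : (1:ℝ) ≤ 1 + |t| := by linarith [abs_nonneg t]
  rw [Real.norm_eq_abs, abs_of_nonneg (by positivity)]
  have h4 : (1 + |t|) ^ (2 * δ) * ((1 + |t|) ^ 2)⁻¹ ≤ wT 1 t := by
    unfold wT
    rw [div_one, div_one, one_mul, ← rpow_natCast, ← Real.rpow_neg (by linarith), ← rpow_add (by linarith)]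
    exact rpow_le_rpow_of_exponent_le h3 (by norm_num; linarith)
  calc _ ≤ (6 * (q:ℝ) ^ δ * (1 + |t|) ^ (2 * δ) * Fv χ δ t) * ((1 + |t|) ^ 2)⁻¹ :=
        mul_le_mul_of_nonneg_right (Lc_le χ h1 hp hRH hd hd2 t) (by positivity)
    _ = 6 * (q:ℝ) ^ δ * (Fv χ δ t * ((1 + |t|) ^ (2 * δ) * ((1 + |t|) ^ 2)⁻¹)) := by ring
    _ ≤ _ := by
        refine mul_le_mul_of_nonneg_left ?_ (by positivity)
        exact mul_le_mul_of_nonneg_left h4 (Fv_nonneg _ _ _)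
end

section
variable {q : ℕ} [NeZero q]

lemma norm_ss_ge {c t : ℝ} (hc : 1/4 ≤ c) : ‖(((c:ℂ) + t * I) * ((c:ℂ) + t * I + 1))‖⁻¹ ≤ 25 * ((1 + |t|) ^ 2)⁻¹ := by
  have hn : 1 + |t| ≤ 5 * ‖(c:ℂ) + t * I‖ := norm_line_ge hc
  have hn2 : 1 + |t| ≤ 5 * ‖((c + 1:ℝ):ℂ) + t * I‖ := norm_line_ge (by linarith)
  have e : (c:ℂ) + t * I + 1 = ((c + 1:ℝ):ℂ) + t * I := by push_cast; ring
  rw [norm_mul, e]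
  have hta := abs_nonneg t
  have h0 : 0 < ‖(c:ℂ) + t * I‖ := by linarith
  have h1 : 0 < ‖((c + 1:ℝ):ℂ) + t * I‖ := by linarith
  rw [inv_le_iff_one_le_mul₀ (by positivity), mul_assoc, inv_mul_eq_div, ← mul_div_assoc, le_div_iff₀ (by positivity)]
  nlinarith [mul_le_mul hn hn2 (by linarith) (by linarith)]

lemma Mfun_inv (χ : DirichletCharacter ℂ q) (h1 : χ ≠ 1) (hp : χ.IsPrimitive) (hRH : dirichletRH χ)
    {δ : ℝ} (hd : 0 < δ) (hd2 : δ ≤ 1/8) {x : ℝ} (hx : 0 < x) :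
    Integrable (fun t : ℝ => (x:ℂ) ^ (((1/2 - δ : ℝ) + t * I : ℂ) + 1) * (DirichletCharacter.LFunction χ ((1/2 - δ : ℝ) + t * I) / ((((1/2 - δ : ℝ):ℂ) + t * I) * (((1/2 - δ : ℝ):ℂ) + t * I + 1)))) ∧
    Mfun χ x = (1 / (2 * π) : ℂ) * ∫ t : ℝ, (x:ℂ) ^ (((1/2 - δ : ℝ) + t * I : ℂ) + 1) * (DirichletCharacter.LFunction χ ((1/2 - δ : ℝ) + t * I) / ((((1/2 - δ : ℝ):ℂ) + t * I) * (((1/2 - δ : ℝ):ℂ) + t * I + 1))) := by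
  set c : ℝ := 1/2 - δ with hc
  have hc4 : 1/4 ≤ c := by rw [hc]; linarith
  set G : ℝ → ℂ := fun t => DirichletCharacter.LFunction χ (c + t * I) / (((c:ℂ) + t * I) * ((c:ℂ) + t * I + 1)) with hG
  have hcontL := (DirichletCharacter.differentiable_LFunction h1).continuous
  have hne : ∀ t : ℝ, ((c:ℂ) + t * I) * ((c:ℂ) + t * I + 1) ≠ 0 := by
    intro t
    refine mul_ne_zero (fun h => ?_) (fun h => ?_)
    · have := congrArg Complex.re h; simp at this; linarith
    · have := congrArg Complex.re h; simp at this; linarith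
  have hGc : Continuous G := by
    refine Continuous.div (hcontL.comp (by fun_prop)) (by fun_prop) hne
  have hGi : Integrable G := by
    refine Integrable.mono' ((Lc_int χ h1 hp hRH hd hd2).const_mul 25) hGc.aestronglyMeasurable (Eventually.of_forall fun t => ?_)
    simp only [hG, norm_div]
    rw [div_eq_mul_inv]
    calc _ ≤ ‖DirichletCharacter.LFunction χ (c + t * I)‖ * (25 * ((1 + |t|) ^ 2)⁻¹) :=
          mul_le_mul_of_nonneg_left (norm_ss_ge hc4) (norm_nonneg _)
      _ = _ := by ring
  have hmel : ∀ y : ℝ, mellin (Mfun χ) (((-c - 1 : ℝ):ℂ) + y * I) = G (-y) := by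
    intro y
    have e : ((-c - 1 : ℝ):ℂ) + y * I = -((c:ℂ) + ((-y : ℝ):ℂ) * I) - 1 := by push_cast; ring
    rw [e, mellin_Mfun χ h1 (by simp; linarith)]
  have hVI : VerticalIntegrable (mellin (Mfun χ)) (-c - 1) := by
    unfold Complex.VerticalIntegrable
    simp_rw [hmel]
    exact hGi.comp_neg
  have hMC : MellinConvergent (Mfun χ) (((-c - 1 : ℝ)):ℂ) := by
    have := mellinConvergent_Mfun χ h1 (s := (c:ℂ)) (by simp; linarith)
    convert this using 1; push_cast; ring
  have hinv := mellinInv_mellin_eq (-c - 1) (Mfun χ) hx hMC hVI ((Mfun_continuousOn χ).continuousAt (Ioi_mem_nhds hx))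
  have hxi : Integrable (fun t : ℝ => (x:ℂ) ^ ((c + t * I : ℂ) + 1) * G t) := by
    refine (hGi.norm.const_mul (x ^ (c + 1))).mono' ?_ (Eventually.of_forall fun t => ?_)
    · refine (Continuous.mul ?_ hGc).aestronglyMeasurable
      exact Continuous.const_cpow (by fun_prop) (Or.inl (by exact_mod_cast hx.ne'))
    · rw [norm_mul, Complex.norm_cpow_eq_rpow_re_of_pos hx]
      simp
  refine ⟨hxi, ?_⟩
  rw [← hinv, mellinInv]
  rw [← integral_neg_eq_self]
  simp_rw [hmel, smul_eq_mul, neg_neg]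
  rw [Complex.real_smul]
  congr 1
  · push_cast; ring
  · congr 1
    ext t
    rw [hG]
    congr 2
    push_cast; ring

/-- smoothed character sum -/
noncomputable def AA (χ : DirichletCharacter ℂ q) (N T : ℝ) : ℂ := (Mfun χ (N + N / T) - Mfun χ N) / ((N / T : ℝ):ℂ)

lemma AA_inv (χ : DirichletCharacter ℂ q) (h1 : χ ≠ 1) (hp : χ.IsPrimitive) (hRH : dirichletRH χ)
    {δ : ℝ} (hd : 0 < δ) (hd2 : δ ≤ 1/8) {N T : ℝ} (hN : 0 < N) (hT : 0 < T) :
    Integrable (fun t : ℝ => (N:ℂ) ^ (((1/2 - δ : ℝ) + t * I : ℂ)) * DirichletCharacter.LFunction χ ((1/2 - δ : ℝ) + t * I) * ker ((1/2 - δ : ℝ) + t * I) (1 / T)) ∧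
    AA χ N T = (1 / (2 * π) : ℂ) * ∫ t : ℝ, (N:ℂ) ^ (((1/2 - δ : ℝ) + t * I : ℂ)) * DirichletCharacter.LFunction χ ((1/2 - δ : ℝ) + t * I) * ker ((1/2 - δ : ℝ) + t * I) (1 / T) := by
  obtain ⟨i1, e1⟩ := Mfun_inv χ h1 hp hRH hd hd2 (x := N) hN
  obtain ⟨i2, e2⟩ := Mfun_inv χ h1 hp hRH hd hd2 (x := N + N / T) (by positivity)
  have hNc : (N:ℂ) ≠ 0 := by exact_mod_cast hN.ne'
  have hTc : (T:ℂ) ≠ 0 := by exact_mod_cast hT.ne'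
  have hpt : ∀ t : ℝ, (N:ℂ) ^ (((1/2 - δ : ℝ) + t * I : ℂ)) * DirichletCharacter.LFunction χ ((1/2 - δ : ℝ) + t * I) * ker ((1/2 - δ : ℝ) + t * I) (1 / T)
    = (((N + N / T : ℝ):ℂ) ^ (((1/2 - δ : ℝ) + t * I : ℂ) + 1) * (DirichletCharacter.LFunction χ ((1/2 - δ : ℝ) + t * I) / ((((1/2 - δ : ℝ):ℂ) + t * I) * (((1/2 - δ : ℝ):ℂ) + t * I + 1)))
      - (N:ℂ) ^ (((1/2 - δ : ℝ) + t * I : ℂ) + 1) * (DirichletCharacter.LFunction χ ((1/2 - δ : ℝ) + t * I) / ((((1/2 - δ : ℝ):ℂ) + t * I) * (((1/2 - δ : ℝ):ℂ) + t * I + 1)))) / ((N / T : ℝ):ℂ) := by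
    intro t
    set s : ℂ := ((1/2 - δ : ℝ):ℂ) + t * I with hs
    have hs0 : s ≠ 0 := fun h => by have := congrArg Complex.re h; simp [hs] at this; linarith
    have hs1 : s + 1 ≠ 0 := fun h => by have := congrArg Complex.re h; simp [hs] at this; linarith
    have eN : N + N / T = N * (1 + 1 / T) := by ring
    rw [eN, Complex.ofReal_mul, Complex.mul_cpow_ofReal_nonneg hN.le (by positivity), Complex.cpow_add s 1 hNc, Complex.cpow_one]
    unfold ker
    generalize (((1 + 1 / T : ℝ)):ℂ) ^ (s + 1) = Y
    generalize DirichletCharacter.LFunction χ s = Z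
    generalize (N:ℂ) ^ s = Q
    push_cast
    field_simp
  have hd := (i2.sub i1).div_const ((N / T : ℝ):ℂ)
  refine ⟨hd.congr (Eventually.of_forall fun t => (hpt t).symm), ?_⟩
  simp_rw [hpt]
  rw [integral_div, integral_sub i2 i1, AA, e1, e2]
  ring
end

section
variable {q : ℕ} [NeZero q]

lemma pt_bound (χ : DirichletCharacter ℂ q) (h1 : χ ≠ 1) (hp : χ.IsPrimitive) (hRH : dirichletRH χ)
    {N T D : ℝ} (hN : 0 < N) (hNq : N ≤ q) (hT : 1 ≤ T) (hD8 : 8 ≤ D) (hD : 16 * (Real.log (2 * q / N) + Real.log T) ≤ D) (t : ℝ) :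
    N ^ (1/2 - 1/D) * ‖DirichletCharacter.LFunction χ ((1/2 - 1/D : ℝ) + t * I)‖ * ((1 / T) * ((1 + |t| / T) ^ 2)⁻¹)
      ≤ 12 * √N * (Fv χ (1/D) t * wT T t) := by
  have hT0 : 0 < T := by linarith
  have hD0 : 0 < D := by linarith
  have hq : (0:ℝ) < q := by linarith
  have hd : 0 < 1 / D := by positivity
  have hd8 : 1 / D ≤ 1 / 8 := one_div_le_one_div_of_le (by norm_num) hD8
  have hlT : 0 ≤ Real.log T := Real.log_nonneg hT
  have hqN : 1 ≤ q / N := by rw [le_div_iff₀ hN]; linarith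
  have hlq : Real.log (q / N) ≤ Real.log (2 * q / N) := Real.log_le_log (by positivity) (by rw [mul_div_assoc]; linarith)
  have hlq0 : 0 ≤ Real.log (q / N) := Real.log_nonneg hqN
  have hta := abs_nonneg t
  set δ := 1 / D with hδ
  have hδD : δ * D = 1 := by rw [hδ]; field_simp
  have hu : 1 ≤ 1 + |t| / T := by have : 0 ≤ |t| / T := by positivity
                                  linarith
  have A : (1 + |t|) ^ (2 * δ) ≤ T ^ (2 * δ) * (1 + |t| / T) ^ (1/4:ℝ) := by
    calc (1 + |t|) ^ (2 * δ) ≤ (T * (1 + |t| / T)) ^ (2 * δ) := by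
          refine rpow_le_rpow (by linarith) ?_ (by linarith)
          have : T * (1 + |t| / T) = T + |t| := by field_simp
          linarith
      _ = T ^ (2 * δ) * (1 + |t| / T) ^ (2 * δ) := mul_rpow hT0.le (by linarith)
      _ ≤ _ := by
          refine mul_le_mul_of_nonneg_left ?_ (by positivity)
          exact rpow_le_rpow_of_exponent_le hu (by linarith)
  have B : N ^ (1/2 - δ) * (q:ℝ) ^ δ * T ^ (2 * δ) ≤ 2 * √N := by
    have e : N ^ (1/2 - δ) * (q:ℝ) ^ δ * T ^ (2 * δ) = √N * Real.exp (δ * (Real.log (q / N) + 2 * Real.log T)) := by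
      rw [Real.sqrt_eq_rpow, Real.rpow_def_of_pos hN, Real.rpow_def_of_pos hN, Real.rpow_def_of_pos hq, Real.rpow_def_of_pos hT0, ← Real.exp_add, ← Real.exp_add, ← Real.exp_add, Real.log_div hq.ne' hN.ne']
      congr 1; ring
    rw [e]
    have : δ * (Real.log (q / N) + 2 * Real.log T) ≤ 1/8 := by
      have : δ * (Real.log (q / N) + 2 * Real.log T) ≤ δ * (D / 8) := by
        refine mul_le_mul_of_nonneg_left ?_ hd.le
        linarith
      linarith
    have h2 : Real.exp (δ * (Real.log (q / N) + 2 * Real.log T)) ≤ 2 := by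
      refine (Real.exp_le_exp.2 this).trans ?_
      have := Real.exp_bound_div_one_sub_of_interval (x := 1/8) (by norm_num) (by norm_num)
      norm_num at this ⊢; linarith
    have := Real.sqrt_nonneg N
    nlinarith
  have Cc : (1 / T) * ((1 + |t| / T) ^ (1/4:ℝ) * ((1 + |t| / T) ^ 2)⁻¹) = wT T t := by
    unfold wT
    rw [← rpow_natCast, ← Real.rpow_neg (by linarith), ← rpow_add (by linarith)]
    norm_num
  have L := Lc_le χ h1 hp hRH hd hd8 t
  have hF := Fv_nonneg χ δ t
  calc _ ≤ N ^ (1/2 - δ) * (6 * (q:ℝ) ^ δ * (T ^ (2 * δ) * (1 + |t| / T) ^ (1/4:ℝ)) * Fv χ δ t) * ((1 / T) * ((1 + |t| / T) ^ 2)⁻¹) := by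
        refine mul_le_mul_of_nonneg_right ?_ (by positivity)
        refine mul_le_mul_of_nonneg_left (L.trans ?_) (by positivity)
        refine mul_le_mul_of_nonneg_right ?_ hF
        exact mul_le_mul_of_nonneg_left A (by positivity)
    _ = 6 * (N ^ (1/2 - δ) * (q:ℝ) ^ δ * T ^ (2 * δ)) * (Fv χ δ t * ((1 / T) * ((1 + |t| / T) ^ (1/4:ℝ) * ((1 + |t| / T) ^ 2)⁻¹))) := by ring
    _ = 6 * (N ^ (1/2 - δ) * (q:ℝ) ^ δ * T ^ (2 * δ)) * (Fv χ δ t * wT T t) := by rw [Cc]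
    _ ≤ 6 * (2 * √N) * (Fv χ δ t * wT T t) := by
        refine mul_le_mul_of_nonneg_right ?_ (mul_nonneg hF (wT_nonneg hT0 t))
        linarith
    _ = _ := by ring

lemma int_kernel (χ : DirichletCharacter ℂ q) (h1 : χ ≠ 1) (hp : χ.IsPrimitive) (hRH : dirichletRH χ)
    {N T D : ℝ} (hN : 0 < N) (hNq : N ≤ q) (hT : 1 ≤ T) (hD8 : 8 ≤ D) (hD : 16 * (Real.log (2 * q / N) + Real.log T) ≤ D)
    (k : ℝ → ℂ) (hk : ∀ t, ‖k t‖ ≤ 1500 * ((1 / T) * ((1 + |t| / T) ^ 2)⁻¹)) :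
    ‖(1 / (2 * π) : ℂ) * ∫ t : ℝ, (N:ℂ) ^ (((1/2 - 1/D : ℝ) + t * I : ℂ)) * DirichletCharacter.LFunction χ ((1/2 - 1/D : ℝ) + t * I) * k t‖
      ≤ 18000 * √N * ∫ t, Fv χ (1/D) t * wT T t := by
  have hT0 : 0 < T := by linarith
  have hd : 0 < 1 / D := by have : 0 < D := by linarith
                            positivity
  have hd8 : 1 / D ≤ 1 / 8 := one_div_le_one_div_of_le (by norm_num) hD8
  have hI := Fw_int χ h1 hp hRH hd (by linarith) hT
  have h0 : ‖(1 / (2 * π) : ℂ)‖ ≤ 1 := by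
    have : (1 / (2 * π) : ℂ) = ((1 / (2 * π) : ℝ) : ℂ) := by push_cast; ring
    rw [this, Complex.norm_real, Real.norm_eq_abs, abs_of_pos (by positivity), div_le_one (by positivity)]
    linarith [Real.pi_gt_three]
  rw [norm_mul]
  refine (mul_le_of_le_one_left (norm_nonneg _) h0).trans ?_
  rw [← integral_const_mul]
  refine norm_integral_le_of_norm_le (hI.const_mul _) (Eventually.of_forall fun t => ?_)
  rw [norm_mul, norm_mul, Complex.norm_cpow_eq_rpow_re_of_pos hN]
  have hre : (((1/2 - 1/D : ℝ):ℂ) + t * I).re = 1/2 - 1/D := by simp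
  rw [hre]
  calc _ ≤ N ^ (1/2 - 1/D) * ‖DirichletCharacter.LFunction χ ((1/2 - 1/D : ℝ) + t * I)‖ * (1500 * ((1 / T) * ((1 + |t| / T) ^ 2)⁻¹)) :=
        mul_le_mul_of_nonneg_left (hk t) (by positivity)
    _ = 1500 * (N ^ (1/2 - 1/D) * ‖DirichletCharacter.LFunction χ ((1/2 - 1/D : ℝ) + t * I)‖ * ((1 / T) * ((1 + |t| / T) ^ 2)⁻¹)) := by ring
    _ ≤ 1500 * (12 * √N * (Fv χ (1/D) t * wT T t)) := mul_le_mul_of_nonneg_left (pt_bound χ h1 hp hRH hN hNq hT hD8 hD t) (by norm_num)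
    _ = _ := by ring

lemma AA_diff (χ : DirichletCharacter ℂ q) (h1 : χ ≠ 1) (hp : χ.IsPrimitive) (hRH : dirichletRH χ)
    {N T D : ℝ} (hN : 0 < N) (hNq : N ≤ q) (hT : 1 ≤ T) (hD8 : 8 ≤ D) (hD : 16 * (Real.log (2 * q / N) + Real.log T) ≤ D) :
    ‖AA χ N (2 * T) - AA χ N T‖ ≤ 18000 * √N * ∫ t, Fv χ (1/D) t * wT T t := by
  have hd : 0 < 1 / D := by have : 0 < D := by linarith
                            positivity
  have hd8 : 1 / D ≤ 1 / 8 := one_div_le_one_div_of_le (by norm_num) hD8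
  obtain ⟨i1, e1⟩ := AA_inv χ h1 hp hRH hd hd8 hN (T := T) (by linarith)
  obtain ⟨i2, e2⟩ := AA_inv χ h1 hp hRH hd hd8 hN (T := 2 * T) (by linarith)
  have := int_kernel χ h1 hp hRH hN hNq hT hD8 hD (fun t => ker ((1/2 - 1/D : ℝ) + t * I) (1 / (2 * T)) - ker ((1/2 - 1/D : ℝ) + t * I) (1 / T))
    (fun t => ker_diff (by linarith) (by linarith) hT)
  rw [e1, e2, ← mul_sub, ← integral_sub i2 i1]
  simp_rw [← mul_sub]
  exact this

lemma AA_base (χ : DirichletCharacter ℂ q) (h1 : χ ≠ 1) (hp : χ.IsPrimitive) (hRH : dirichletRH χ)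
    {N D : ℝ} (hN : 0 < N) (hNq : N ≤ q) (hD8 : 8 ≤ D) (hD : 16 * (Real.log (2 * q / N)) ≤ D) :
    ‖AA χ N 1‖ ≤ 18000 * √N * ∫ t, Fv χ (1/D) t * wT 1 t := by
  have hd : 0 < 1 / D := by have : 0 < D := by linarith
                            positivity
  have hd8 : 1 / D ≤ 1 / 8 := one_div_le_one_div_of_le (by norm_num) hD8
  obtain ⟨i1, e1⟩ := AA_inv χ h1 hp hRH hd hd8 hN (T := 1) (by norm_num)
  have := int_kernel χ h1 hp hRH hN hNq (T := 1) le_rfl hD8 (by simpa using hD) (fun t => ker ((1/2 - 1/D : ℝ) + t * I) (1 / 1))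
    (fun t => by
      have hb := ker_base (c := 1/2 - 1/D) (t := t) (by linarith) (by linarith)
      have e : (1:ℝ) / 1 = 1 := by norm_num
      rw [e] at hb ⊢
      exact hb)
  rw [e1]
  exact this
end

/-- six edges of the complete graph on four vertices are bounded by stars -/
lemma star_ineq {r c e A B : ℝ} (hr : 1 < r) (hA : A = (3 + r) / 4) (hB : B * (1 + r) = e * (3 + r)) (hcA : c ≤ A) (hcB : c ≤ B)
    {z01 z02 z12 z03 z13 z23 : ℝ} (h01 : 0 < z01) (h02 : 0 < z02) (h12 : 0 < z12) (h03 : 0 < z03) (h13 : 0 < z13) (h23 : 0 < z23)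
    (g01 : z01 ≤ 1) (g02 : z02 ≤ 1) (g12 : z12 ≤ 1) (g03 : z03 ≤ 1) (g13 : z13 ≤ 1) (g23 : z23 ≤ 1) :
    (z01 * z02 * z12) ^ (1/2:ℝ) * (z03 * z13 * z23) ^ e ≤
      z01 ^ c * z02 ^ c * z03 ^ c + z01 ^ c * z12 ^ c * z13 ^ c + z02 ^ c * z12 ^ c * z23 ^ c + z03 ^ c * z13 ^ c * z23 ^ c := by
  have hp : 0 < 3 + r := by linarith
  have hmono : ∀ {x y w a b d : ℝ}, 0 < x → 0 < y → 0 < w → x ≤ 1 → y ≤ 1 → w ≤ 1 → c ≤ a → c ≤ b → c ≤ d →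
      x ^ a * y ^ b * w ^ d ≤ x ^ c * y ^ c * w ^ c := by
    intro x y w a b d hx hy hw x1 y1 w1 ha hb hd
    exact mul_le_mul (mul_le_mul (Real.rpow_le_rpow_of_exponent_ge hx x1 ha) (Real.rpow_le_rpow_of_exponent_ge hy y1 hb) (by positivity) (by positivity))
      (Real.rpow_le_rpow_of_exponent_ge hw w1 hd) (by positivity) (by positivity)
  have m0 := hmono h01 h02 h03 g01 g02 g03 hcA hcA hcB
  have m1 := hmono h01 h12 h13 g01 g12 g13 hcA hcA hcB
  have m2 := hmono h02 h12 h23 g02 g12 g23 hcA hcA hcB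
  have m3 := hmono h03 h13 h23 g03 g13 g23 hcB hcB hcB
  have gm := Real.geom_mean_le_arith_mean4_weighted (w₁ := 1 / (3 + r)) (w₂ := 1 / (3 + r)) (w₃ := 1 / (3 + r)) (w₄ := r / (3 + r))
    (p₁ := z01 ^ A * z02 ^ A * z03 ^ B) (p₂ := z01 ^ A * z12 ^ A * z13 ^ B) (p₃ := z02 ^ A * z12 ^ A * z23 ^ B) (p₄ := z03 ^ B * z13 ^ B * z23 ^ B)
    (by positivity) (by positivity) (by positivity) (by positivity) (by positivity) (by positivity) (by positivity) (by positivity) (by field_simp; ring)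
  have e : (z01 * z02 * z12) ^ (1/2:ℝ) * (z03 * z13 * z23) ^ e = (z01 ^ A * z02 ^ A * z03 ^ B) ^ (1 / (3 + r)) * (z01 ^ A * z12 ^ A * z13 ^ B) ^ (1 / (3 + r)) *
      (z02 ^ A * z12 ^ A * z23 ^ B) ^ (1 / (3 + r)) * (z03 ^ B * z13 ^ B * z23 ^ B) ^ (r / (3 + r)) := by
    rw [← Real.exp_log h01, ← Real.exp_log h02, ← Real.exp_log h12, ← Real.exp_log h03, ← Real.exp_log h13, ← Real.exp_log h23]
    generalize Real.log z01 = l01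
    generalize Real.log z02 = l02
    generalize Real.log z12 = l12
    generalize Real.log z03 = l03
    generalize Real.log z13 = l13
    generalize Real.log z23 = l23
    simp only [← Real.exp_mul, ← Real.exp_add]
    congr 1
    have he : e = B * (1 + r) / (3 + r) := by rw [hB]; field_simp
    rw [he, hA]
    field_simp
    ring
  rw [e]
  refine gm.trans ?_
  have w1 : 1 / (3 + r) ≤ 1 := by rw [div_le_one hp]; linarith
  have w2 : r / (3 + r) ≤ 1 := by rw [div_le_one hp]; linarith
  have := mul_le_of_le_one_left (by positivity : 0 ≤ z01 ^ A * z02 ^ A * z03 ^ B) w1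
  have := mul_le_of_le_one_left (by positivity : 0 ≤ z01 ^ A * z12 ^ A * z13 ^ B) w1
  have := mul_le_of_le_one_left (by positivity : 0 ≤ z02 ^ A * z12 ^ A * z23 ^ B) w1
  have := mul_le_of_le_one_left (by positivity : 0 ≤ z03 ^ B * z13 ^ B * z23 ^ B) w2
  linarith

lemma star_sum {ι : Type} (J : Finset ι) (w : ι → ℝ) (hw : ∀ i ∈ J, 0 ≤ w i) (y : ι → ι → ℝ) (hy : ∀ i j, 0 ≤ y i j) {U W : ℝ}
    (hU : ∀ a ∈ J, ∑ b ∈ J, w b * y a b ≤ U) (hW : ∑ a ∈ J, w a ≤ W) (hU0 : 0 ≤ U) :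
    ∑ a ∈ J, ∑ b ∈ J, ∑ c ∈ J, ∑ d ∈ J, (w a * w b * w c * w d) * (y a b * y a c * y a d) ≤ W * U ^ 3 := by
  have e : ∀ a ∈ J, ∑ b ∈ J, ∑ c ∈ J, ∑ d ∈ J, (w a * w b * w c * w d) * (y a b * y a c * y a d) = w a * (∑ b ∈ J, w b * y a b) ^ 3 := by
    intro a _
    have : ∀ b c d, (w a * w b * w c * w d) * (y a b * y a c * y a d) = w a * ((w b * y a b) * ((w c * y a c) * (w d * y a d))) := by intros; ring
    simp_rw [this, ← mul_sum, ← sum_mul]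
    ring
  rw [sum_congr rfl e]
  calc _ ≤ ∑ a ∈ J, w a * U ^ 3 := by
        refine sum_le_sum fun a ha => mul_le_mul_of_nonneg_left ?_ (hw a ha)
        exact pow_le_pow_left₀ (sum_nonneg fun b hb => mul_nonneg (hw b hb) (hy a b)) (hU a ha) 3
    _ = (∑ a ∈ J, w a) * U ^ 3 := by rw [sum_mul]
    _ ≤ _ := mul_le_mul_of_nonneg_right hW (by positivity)

lemma tilt {ι : Type} (J : Finset ι) (ω Z z0 z1 z2 : ι → ℝ) {r γ V : ℝ} (hr : 1 < r) (hω : ∀ i ∈ J, 0 ≤ ω i) (hZ : ∀ i ∈ J, 0 ≤ Z i)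
    (h0 : ∀ i, 0 < z0 i) (h1 : ∀ i, 0 < z1 i) (h2 : ∀ i, 0 < z2 i) (hγ : 0 ≤ γ)
    (v0 : ∑ d ∈ J, ω d * z0 d ^ γ ≤ V) (v1 : ∑ d ∈ J, ω d * z1 d ^ γ ≤ V) (v2 : ∑ d ∈ J, ω d * z2 d ^ γ ≤ V) :
    (∑ d ∈ J, ω d * Z d) ^ r ≤ (3 * V) ^ (r - 1) * ∑ d ∈ J, ω d * Z d ^ r * (z0 d * z1 d * z2 d) ^ (-(γ * (r - 1) / 3)) := by
  set v : ι → ℝ := fun d => z0 d ^ γ + z1 d ^ γ + z2 d ^ γ with hv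
  have hv0 : ∀ d, 0 < v d := fun d => by have := h0 d; have := h1 d; have := h2 d; simp only [hv]; positivity
  have hvG : ∀ d, (z0 d * z1 d * z2 d) ^ (γ / 3) ≤ v d := by
    intro d
    have a0 := h0 d; have a1 := h1 d; have a2 := h2 d
    have gm := Real.geom_mean_le_arith_mean3_weighted (w₁ := 1/3) (w₂ := 1/3) (w₃ := 1/3) (p₁ := z0 d ^ γ) (p₂ := z1 d ^ γ) (p₃ := z2 d ^ γ)
      (by norm_num) (by norm_num) (by norm_num) (by positivity) (by positivity) (by positivity) (by norm_num)
    have e : (z0 d * z1 d * z2 d) ^ (γ / 3) = (z0 d ^ γ) ^ (1/3:ℝ) * (z1 d ^ γ) ^ (1/3:ℝ) * (z2 d ^ γ) ^ (1/3:ℝ) := by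
      rw [mul_rpow (by positivity) a2.le, mul_rpow a0.le a1.le, ← rpow_mul a0.le, ← rpow_mul a1.le, ← rpow_mul a2.le]
      ring_nf
    rw [e]; refine gm.trans ?_
    have : 0 ≤ z0 d ^ γ := by positivity
    have : 0 ≤ z1 d ^ γ := by positivity
    have : 0 ≤ z2 d ^ γ := by positivity
    simp only [hv]; linarith
  have hr0 : 0 < r := by linarith
  have hold := Real.inner_le_weight_mul_Lp_of_nonneg J (p := r) hr.le (fun d => max 0 (ω d * v d)) (fun d => max 0 (Z d / v d)) (fun d => le_max_left _ _) (fun d => le_max_left _ _)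
  have c1 : ∀ d ∈ J, max 0 (ω d * v d) = ω d * v d := fun d hd => max_eq_right (mul_nonneg (hω d hd) (hv0 d).le)
  have c2 : ∀ d ∈ J, max 0 (Z d / v d) = Z d / v d := fun d hd => max_eq_right (div_nonneg (hZ d hd) (hv0 d).le)
  have s1 : ∑ d ∈ J, max 0 (ω d * v d) * max 0 (Z d / v d) = ∑ d ∈ J, ω d * Z d := by
    refine sum_congr rfl fun d hd => ?_
    rw [c1 d hd, c2 d hd]; have := (hv0 d).ne'; field_simp
  have s2 : ∑ d ∈ J, max 0 (ω d * v d) = ∑ d ∈ J, ω d * v d := sum_congr rfl c1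
  have s3 : ∑ d ∈ J, max 0 (ω d * v d) * max 0 (Z d / v d) ^ r = ∑ d ∈ J, ω d * v d * (Z d / v d) ^ r :=
    sum_congr rfl fun d hd => by rw [c1 d hd, c2 d hd]
  rw [s1, s2, s3] at hold
  have n1 : 0 ≤ ∑ d ∈ J, ω d * v d := sum_nonneg fun d hd => mul_nonneg (hω d hd) (hv0 d).le
  have n2 : 0 ≤ ∑ d ∈ J, ω d * v d * (Z d / v d) ^ r := sum_nonneg fun d hd =>
    mul_nonneg (mul_nonneg (hω d hd) (hv0 d).le) (Real.rpow_nonneg (div_nonneg (hZ d hd) (hv0 d).le) _)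
  have n3 : 0 ≤ ∑ d ∈ J, ω d * Z d := sum_nonneg fun d hd => mul_nonneg (hω d hd) (hZ d hd)
  have h3 := rpow_le_rpow n3 hold hr0.le
  rw [mul_rpow (by positivity) (by positivity), ← rpow_mul n1, ← rpow_mul n2, inv_mul_cancel₀ hr0.ne', Real.rpow_one] at h3
  have e1 : (1 - r⁻¹) * r = r - 1 := by field_simp
  rw [e1] at h3
  have hV : ∑ d ∈ J, ω d * v d ≤ 3 * V := by
    have : ∑ d ∈ J, ω d * v d = ∑ d ∈ J, ω d * z0 d ^ γ + ∑ d ∈ J, ω d * z1 d ^ γ + ∑ d ∈ J, ω d * z2 d ^ γ := by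
      rw [← sum_add_distrib, ← sum_add_distrib]
      refine sum_congr rfl fun d _ => ?_
      simp only [hv]; ring
    rw [this]; linarith
  refine h3.trans (mul_le_mul (rpow_le_rpow n1 hV (by linarith)) ?_ n2 (Real.rpow_nonneg (n1.trans hV) _))
  refine sum_le_sum fun d hd => ?_
  have a0 := h0 d; have a1 := h1 d; have a2 := h2 d
  have e2 : v d * (Z d / v d) ^ r = Z d ^ r * v d ^ (-(r - 1)) := by
    rw [Real.div_rpow (hZ d hd) (hv0 d).le, neg_sub, Real.rpow_sub (hv0 d), Real.rpow_one]
    ring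
  rw [mul_assoc, e2, ← mul_assoc]
  refine mul_le_mul_of_nonneg_left ?_ (mul_nonneg (hω d hd) (Real.rpow_nonneg (hZ d hd) _))
  have e3 : (z0 d * z1 d * z2 d) ^ (-(γ * (r - 1) / 3)) = ((z0 d * z1 d * z2 d) ^ (γ / 3)) ^ (-(r - 1)) := by
    rw [← rpow_mul (by positivity)]; ring_nf
  rw [e3]
  exact Real.rpow_le_rpow_of_nonpos (by positivity) (hvG d) (by linarith)

lemma comb {ι κ : Type} (Q : Finset κ) (J : Finset ι) (ω s : ι → ℝ) (z : ι → ι → ℝ) (Z : κ → ι → ℝ)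
    {r c γ e A B K V U W : ℝ} (hr : 1 < r) (hA : A = (3 + r) / 4) (hB : B * (1 + r) = e * (3 + r)) (hcA : c ≤ A) (hcB : c ≤ B)
    (he : e = r / 2 - γ * (r - 1) / 3) (hγ : 0 ≤ γ)
    (hω : ∀ i ∈ J, 0 ≤ ω i) (hs : ∀ i ∈ J, 0 ≤ s i) (hZ : ∀ χ ∈ Q, ∀ i ∈ J, 0 ≤ Z χ i) (z0 : ∀ i j, 0 < z i j) (z1 : ∀ i j, z i j ≤ 1)
    (zs : ∀ i j, z i j = z j i) (hK : 0 ≤ K) (hU0 : 0 ≤ U)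
    (hM : ∀ a ∈ J, ∀ b ∈ J, ∀ c ∈ J, ∀ d ∈ J, ∑ χ ∈ Q, Z χ a * Z χ b * Z χ c * Z χ d ^ r ≤
      K * (s a * s b * s c * s d) * ((z a b * z a c * z b c) ^ (1/2:ℝ) * (z a d * z b d * z c d) ^ (r/2)))
    (hV : ∀ a ∈ J, ∑ d ∈ J, ω d * z a d ^ γ ≤ V)
    (hU : ∀ a ∈ J, ∑ b ∈ J, (ω b * s b) * z a b ^ c ≤ U) (hW : ∑ a ∈ J, ω a * s a ≤ W) (hV0 : 0 ≤ V) :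
    ∑ χ ∈ Q, (∑ a ∈ J, ω a * Z χ a) ^ (3 + r) ≤ (3 * V) ^ (r - 1) * (K * (4 * (W * U ^ 3))) := by
  have step : ∀ χ ∈ Q, (∑ a ∈ J, ω a * Z χ a) ^ (3 + r) ≤ ∑ a ∈ J, ∑ b ∈ J, ∑ c ∈ J, ∑ d ∈ J,
      (3 * V) ^ (r - 1) * ((ω a * ω b * ω c * ω d) * (z a d * z b d * z c d) ^ (-(γ * (r - 1) / 3)) * (Z χ a * Z χ b * Z χ c * Z χ d ^ r)) := by
    intro χ hχ
    have n : 0 ≤ ∑ a ∈ J, ω a * Z χ a := sum_nonneg fun a ha => mul_nonneg (hω a ha) (hZ χ hχ a ha)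
    rw [Real.rpow_add_of_nonneg n (by norm_num) (by linarith)]
    have e3 : (∑ a ∈ J, ω a * Z χ a) ^ (3:ℝ) * (∑ a ∈ J, ω a * Z χ a) ^ r
        = ∑ a ∈ J, ∑ b ∈ J, ∑ c ∈ J, (ω a * Z χ a) * ((ω b * Z χ b) * ((ω c * Z χ c) * (∑ a ∈ J, ω a * Z χ a) ^ r)) := by
      simp_rw [← mul_sum, ← sum_mul]
      rw [show (3:ℝ) = ((3:ℕ):ℝ) by norm_num, rpow_natCast]
      ring
    rw [e3]
    refine sum_le_sum fun a ha => sum_le_sum fun b hb => sum_le_sum fun c hc => ?_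
    have t := tilt J ω (Z χ) (z a) (z b) (z c) hr hω (hZ χ hχ) (z0 a) (z0 b) (z0 c) hγ (hV a ha) (hV b hb) (hV c hc)
    have na := mul_nonneg (hω a ha) (hZ χ hχ a ha)
    have nb := mul_nonneg (hω b hb) (hZ χ hχ b hb)
    have nc := mul_nonneg (hω c hc) (hZ χ hχ c hc)
    calc _ ≤ (ω a * Z χ a) * ((ω b * Z χ b) * ((ω c * Z χ c) * ((3 * V) ^ (r - 1) * ∑ d ∈ J, ω d * Z χ d ^ r * (z a d * z b d * z c d) ^ (-(γ * (r - 1) / 3))))) :=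
          mul_le_mul_of_nonneg_left (mul_le_mul_of_nonneg_left (mul_le_mul_of_nonneg_left t nc) nb) na
      _ = _ := by
          simp_rw [mul_sum]
          refine sum_congr rfl fun d _ => ?_
          ring
  have V1 : 0 ≤ (3 * V) ^ (r - 1) := Real.rpow_nonneg (by linarith) _
  have swap : ∀ f : κ → ι → ι → ι → ι → ℝ, ∑ χ ∈ Q, ∑ a ∈ J, ∑ b ∈ J, ∑ c ∈ J, ∑ d ∈ J, f χ a b c d = ∑ a ∈ J, ∑ b ∈ J, ∑ c ∈ J, ∑ d ∈ J, ∑ χ ∈ Q, f χ a b c d := by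
    intro f
    rw [sum_comm]
    refine sum_congr rfl fun a _ => ?_
    rw [sum_comm]
    refine sum_congr rfl fun b _ => ?_
    rw [sum_comm]
    refine sum_congr rfl fun c _ => ?_
    rw [sum_comm]
  refine (sum_le_sum step).trans ?_
  rw [swap]
  set w : ι → ℝ := fun i => ω i * s i with hw
  have hw0 : ∀ i ∈ J, 0 ≤ w i := fun i hi => mul_nonneg (hω i hi) (hs i hi)
  have quad : ∀ a ∈ J, ∀ b ∈ J, ∀ c' ∈ J, ∀ d ∈ J,
      ∑ χ ∈ Q, (3 * V) ^ (r - 1) * ((ω a * ω b * ω c' * ω d) * (z a d * z b d * z c' d) ^ (-(γ * (r - 1) / 3)) * (Z χ a * Z χ b * Z χ c' * Z χ d ^ r))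
      ≤ (3 * V) ^ (r - 1) * (K * ((w a * w b * w c' * w d) * (z a b ^ c * z a c' ^ c * z a d ^ c) + (w b * w a * w c' * w d) * (z b a ^ c * z b c' ^ c * z b d ^ c)
        + (w c' * w a * w b * w d) * (z c' a ^ c * z c' b ^ c * z c' d ^ c) + (w d * w a * w b * w c') * (z d a ^ c * z d b ^ c * z d c' ^ c))) := by
    intro a ha b hb c' hc' d hd
    rw [← mul_sum, ← mul_sum]
    refine mul_le_mul_of_nonneg_left ?_ V1
    have q1 := z0 a b; have q2 := z0 a c'; have q3 := z0 b c'; have q4 := z0 a d; have q5 := z0 b d; have q6 := z0 c' d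
    have o1 := hω a ha; have o2 := hω b hb; have o3 := hω c' hc'; have o4 := hω d hd
    have st := star_ineq hr hA hB hcA hcB q1 q2 q3 q4 q5 q6 (z1 _ _) (z1 _ _) (z1 _ _) (z1 _ _) (z1 _ _) (z1 _ _)
    have ee : (z a d * z b d * z c' d) ^ (r/2) * (z a d * z b d * z c' d) ^ (-(γ * (r - 1) / 3)) = (z a d * z b d * z c' d) ^ e := by
      rw [← rpow_add (by positivity), he]; ring_nf
    have p1 := hw0 a ha; have p2 := hw0 b hb; have p3 := hw0 c' hc'; have p4 := hw0 d hd
    calc _ ≤ (ω a * ω b * ω c' * ω d) * (z a d * z b d * z c' d) ^ (-(γ * (r - 1) / 3)) * (K * (s a * s b * s c' * s d) * ((z a b * z a c' * z b c') ^ (1/2:ℝ) * (z a d * z b d * z c' d) ^ (r/2))) :=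
          mul_le_mul_of_nonneg_left (hM a ha b hb c' hc' d hd) (by positivity)
      _ = K * (w a * w b * w c' * w d) * ((z a b * z a c' * z b c') ^ (1/2:ℝ) * ((z a d * z b d * z c' d) ^ (r/2) * (z a d * z b d * z c' d) ^ (-(γ * (r - 1) / 3)))) := by
          simp only [hw]; ring
      _ ≤ K * (w a * w b * w c' * w d) * (z a b ^ c * z a c' ^ c * z a d ^ c + z a b ^ c * z b c' ^ c * z b d ^ c + z a c' ^ c * z b c' ^ c * z c' d ^ c + z a d ^ c * z b d ^ c * z c' d ^ c) := by
          rw [ee]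
          exact mul_le_mul_of_nonneg_left st (by positivity)
      _ = _ := by
          rw [zs b a, zs c' a, zs c' b, zs d a, zs d b, zs d c']
          ring
  calc _ ≤ ∑ a ∈ J, ∑ b ∈ J, ∑ c' ∈ J, ∑ d ∈ J, (3 * V) ^ (r - 1) * (K * ((w a * w b * w c' * w d) * (z a b ^ c * z a c' ^ c * z a d ^ c) + (w b * w a * w c' * w d) * (z b a ^ c * z b c' ^ c * z b d ^ c)
        + (w c' * w a * w b * w d) * (z c' a ^ c * z c' b ^ c * z c' d ^ c) + (w d * w a * w b * w c') * (z d a ^ c * z d b ^ c * z d c' ^ c))) :=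
        sum_le_sum fun a ha => sum_le_sum fun b hb => sum_le_sum fun c' hc => sum_le_sum fun d hd => quad a ha b hb c' hc d hd
    _ ≤ _ := by
        simp_rw [← mul_sum]
        refine mul_le_mul_of_nonneg_left (mul_le_mul_of_nonneg_left ?_ hK) V1
        simp_rw [sum_add_distrib]
        have S := star_sum J w hw0 (fun i j => z i j ^ c) (fun i j => (Real.rpow_pos_of_pos (z0 i j) c).le) hU hW hU0
        have S1 : ∑ a ∈ J, ∑ b ∈ J, ∑ c' ∈ J, ∑ d ∈ J, (w b * w a * w c' * w d) * (z b a ^ c * z b c' ^ c * z b d ^ c) ≤ W * U ^ 3 := by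
          rw [sum_comm]; exact S
        have S2 : ∑ a ∈ J, ∑ b ∈ J, ∑ c' ∈ J, ∑ d ∈ J, (w c' * w a * w b * w d) * (z c' a ^ c * z c' b ^ c * z c' d ^ c) ≤ W * U ^ 3 := by
          refine le_trans (le_of_eq ?_) S
          rw [sum_congr rfl fun a _ => sum_comm]
          rw [sum_comm]
        have S3 : ∑ a ∈ J, ∑ b ∈ J, ∑ c' ∈ J, ∑ d ∈ J, (w d * w a * w b * w c') * (z d a ^ c * z d b ^ c * z d c' ^ c) ≤ W * U ^ 3 := by
          refine le_trans (le_of_eq ?_) S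
          rw [sum_congr rfl fun a _ => sum_congr rfl fun b _ => sum_comm]
          rw [sum_congr rfl fun a _ => sum_comm]
          rw [sum_comm]
        linarith

lemma two_sided (g : ℝ → ℝ) (hg : ∀ x, 0 ≤ x → 0 ≤ g x) {B : ℝ} (hB : ∀ m : ℕ, ∑ n ∈ Finset.range m, g n ≤ B) (L c : ℕ) :
    ∑ j ∈ Finset.range L, g |(j:ℝ) - c| ≤ 2 * B := by
  rw [← Finset.sum_filter_add_sum_filter_not (Finset.range L) (fun j => j < c)]
  have h1 : ∑ j ∈ (Finset.range L).filter (fun j => j < c), g |(j:ℝ) - c| ≤ B := by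
    have e : ∑ j ∈ (Finset.range L).filter (fun j => j < c), g |(j:ℝ) - c| = ∑ n ∈ ((Finset.range L).filter (fun j => j < c)).image (fun j => c - j), g n := by
      rw [Finset.sum_image]
      · refine sum_congr rfl fun j hj => ?_
        have hj2 := (Finset.mem_filter.1 hj).2
        rw [abs_sub_comm, Nat.cast_sub hj2.le, abs_of_nonneg]
        have : (j:ℝ) < c := by exact_mod_cast hj2
        linarith
      · intro a ha b hb hab
        have ha2 := (Finset.mem_filter.1 ha).2
        have hb2 := (Finset.mem_filter.1 hb).2
        simp only at hab; omega
    rw [e]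
    refine le_trans (Finset.sum_le_sum_of_subset_of_nonneg ?_ fun i _ _ => hg _ (Nat.cast_nonneg i)) (hB (c + 1))
    intro n hn
    obtain ⟨j, _, rfl⟩ := Finset.mem_image.1 hn
    simp
  have h2 : ∑ j ∈ (Finset.range L).filter (fun j => ¬ j < c), g |(j:ℝ) - c| ≤ B := by
    have e : ∑ j ∈ (Finset.range L).filter (fun j => ¬ j < c), g |(j:ℝ) - c| = ∑ n ∈ ((Finset.range L).filter (fun j => ¬ j < c)).image (fun j => j - c), g n := by
      rw [Finset.sum_image]
      · refine sum_congr rfl fun j hj => ?_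
        have hj2 := not_lt.1 (Finset.mem_filter.1 hj).2
        rw [Nat.cast_sub hj2, abs_of_nonneg]
        have : (c:ℝ) ≤ j := by exact_mod_cast hj2
        linarith
      · intro a ha b hb hab
        have ha2 := (Finset.mem_filter.1 ha).2
        have hb2 := (Finset.mem_filter.1 hb).2
        simp only at hab; omega
    rw [e]
    refine le_trans (Finset.sum_le_sum_of_subset_of_nonneg ?_ fun i _ _ => hg _ (Nat.cast_nonneg i)) (hB L)
    intro n hn
    obtain ⟨j, hj, rfl⟩ := Finset.mem_image.1 hn
    have := Finset.mem_range.1 (Finset.mem_filter.1 hj).1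
    simp; omega
  linarith

lemma half_sum {P : ℝ} (hP : 1 ≤ P) (m : ℕ) : ∑ n ∈ Finset.range m, (1 + (n:ℝ) / P) ^ (-(3/2):ℝ) ≤ 3 * P := by
  have hP0 : 0 < P := by linarith
  have key : ∀ m : ℕ, ∑ n ∈ Finset.range (m + 1), (1 + (n:ℝ) / P) ^ (-(3/2):ℝ) ≤ 1 + 2 * P * (1 - (√(1 + (m:ℝ) / P))⁻¹) := by
    intro m
    induction m with
    | zero => simp
    | succ m ih =>
      rw [sum_range_succ]
      set u := √(1 + (m:ℝ) / P) with hu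
      set v := √(1 + ((m + 1 : ℕ):ℝ) / P) with hv
      have u2 : u ^ 2 = 1 + (m:ℝ) / P := Real.sq_sqrt (by positivity)
      have v2 : v ^ 2 = 1 + ((m + 1 : ℕ):ℝ) / P := Real.sq_sqrt (by positivity)
      have u0 : 0 < u := Real.sqrt_pos.2 (by positivity)
      have v0 : 0 < v := Real.sqrt_pos.2 (by positivity)
      have huv : u ≤ v := Real.sqrt_le_sqrt (by push_cast; gcongr; linarith)
      have hd : P * (v ^ 2 - u ^ 2) = 1 := by rw [u2, v2]; push_cast; field_simp; ring
      have e : (1 + ((m + 1 : ℕ):ℝ) / P) ^ (-(3/2):ℝ) = (v ^ 3)⁻¹ := by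
        rw [← v2, Real.rpow_neg (by positivity), ← rpow_natCast v 2, ← rpow_mul v0.le, ← rpow_natCast v 3]
        norm_num
      rw [e]
      have : (v ^ 3)⁻¹ ≤ 2 * P * (u⁻¹ - v⁻¹) := by
        have e2 : 2 * P * (u⁻¹ - v⁻¹) = 2 * (P * (v ^ 2 - u ^ 2)) / (u * v * (u + v)) := by field_simp; ring
        rw [e2, hd, inv_eq_one_div, div_le_div_iff₀ (by positivity) (by positivity)]
        have : u * v * (u + v) ≤ v * v * (v + v) := by gcongr
        nlinarith
      linarith
  rcases m with _ | m
  · simp; linarith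
  · have h := key m
    have : 0 ≤ (√(1 + (m:ℝ) / P))⁻¹ := by positivity
    nlinarith

lemma max_sum {c : ℝ} (hc : 1 < c) : ∃ B : ℝ, 0 < B ∧ ∀ m : ℕ, ∑ n ∈ Finset.range m, (max 1 (n:ℝ)) ^ (-c) ≤ B := by
  have hs : Summable fun n : ℕ => (n:ℝ) ^ (-c) := Real.summable_nat_rpow.2 (by linarith)
  have h0 : 0 ≤ ∑' n : ℕ, (n:ℝ) ^ (-c) := tsum_nonneg fun n => by positivity
  refine ⟨1 + ∑' n : ℕ, (n:ℝ) ^ (-c), by linarith, ?_⟩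
  intro m
  rcases m with _ | m
  · simp; linarith
  rw [Finset.sum_range_succ']
  have e : ∀ n ∈ Finset.range m, (max 1 ((n + 1 : ℕ):ℝ)) ^ (-c) = ((n + 1 : ℕ):ℝ) ^ (-c) := by
    intro n _
    rw [max_eq_right]; push_cast; linarith [Nat.cast_nonneg (α := ℝ) n]
  rw [sum_congr rfl e]
  have h1 := hs.sum_le_tsum (Finset.range (m + 1)) (fun i _ => by positivity)
  rw [Finset.sum_range_succ'] at h1
  have : (0:ℝ) ≤ ((0:ℕ):ℝ) ^ (-c) := by positivity
  simp only [Nat.cast_zero, max_eq_left zero_le_one, Real.one_rpow]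
  simp only [Nat.cast_zero] at this h1
  linarith

noncomputable def xx (M j : ℕ) : ℝ := (j:ℝ) - M
noncomputable def zc (D : ℝ) (i j : ℕ) : ℝ := (1 / D + 1 / max 1 |(i:ℝ) - j|) / 2
noncomputable def om (T D : ℝ) (M j : ℕ) : ℝ := (1 / T) * (1 + |xx M j| / (D * T)) ^ (-(7/4):ℝ)
noncomputable def sS (ε T D : ℝ) (M j : ℕ) : ℝ := (T * (1 + |xx M j| / (D * T))) ^ ε

lemma zc_pos {D : ℝ} (hD : 0 < D) (i j : ℕ) : 0 < zc D i j := by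
  unfold zc
  have : 0 < max 1 |(i:ℝ) - j| := lt_of_lt_of_le one_pos (le_max_left _ _)
  positivity

lemma zc_le {D : ℝ} (hD : 1 ≤ D) (i j : ℕ) : zc D i j ≤ 1 := by
  unfold zc
  have h1 : 1 / max 1 |(i:ℝ) - j| ≤ 1 := by
    rw [div_le_one (lt_of_lt_of_le one_pos (le_max_left _ _))]; exact le_max_left _ _
  have h2 : 1 / D ≤ 1 := by rw [div_le_one (by linarith)]; exact hD
  linarith

lemma zc_symm (D : ℝ) (i j : ℕ) : zc D i j = zc D j i := by unfold zc; rw [abs_sub_comm]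

lemma zc_rpow {D c : ℝ} (hD : 0 < D) (hc : 0 ≤ c) (i j : ℕ) : zc D i j ^ c ≤ D ^ (-c) + (max 1 |(j:ℝ) - i|) ^ (-c) := by
  rw [abs_sub_comm]
  have hm : 0 < max 1 |(i:ℝ) - j| := lt_of_lt_of_le one_pos (le_max_left _ _)
  have e1 : D ^ (-c) = (1 / D) ^ c := by rw [one_div, Real.inv_rpow hD.le, Real.rpow_neg hD.le]
  have e2 : (max 1 |(i:ℝ) - j|) ^ (-c) = (1 / max 1 |(i:ℝ) - j|) ^ c := by rw [one_div, Real.inv_rpow hm.le, Real.rpow_neg hm.le]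
  rw [e1, e2]
  have hz := (zc_pos hD i j).le
  unfold zc at hz ⊢
  rcases le_total (1 / D) (1 / max 1 |(i:ℝ) - j|) with h | h
  · have : ((1 / D + 1 / max 1 |(i:ℝ) - j|) / 2) ^ c ≤ (1 / max 1 |(i:ℝ) - j|) ^ c := rpow_le_rpow hz (by linarith) hc
    have : 0 ≤ (1 / D) ^ c := by positivity
    linarith
  · have : ((1 / D + 1 / max 1 |(i:ℝ) - j|) / 2) ^ c ≤ (1 / D) ^ c := rpow_le_rpow hz (by linarith) hc
    have : 0 ≤ (1 / max 1 |(i:ℝ) - j|) ^ c := by positivity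
    linarith

lemma om_pos {T D : ℝ} (hT : 0 < T) (hD : 0 < D) (M j : ℕ) : 0 < om T D M j := by unfold om; positivity
lemma sS_pos (ε : ℝ) {T D : ℝ} (hT : 0 < T) (hD : 0 < D) (M j : ℕ) : 0 < sS ε T D M j := by unfold sS; positivity

lemma omS_le {ε T D : ℝ} (hT : 1 ≤ T) (hD : 1 ≤ D) (he0 : 0 ≤ ε) (he : ε ≤ 1/4) (M j : ℕ) :
    om T D M j * sS ε T D M j ≤ T ^ ε / T * (1 + |(j:ℝ) - M| / (D * T)) ^ (-(3/2):ℝ) := by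
  unfold om sS xx
  set u := 1 + |(j:ℝ) - M| / (D * T) with hu
  have hu1 : 1 ≤ u := by
    have : 0 ≤ |(j:ℝ) - M| / (D * T) := by positivity
    linarith
  rw [mul_rpow (by linarith) (by linarith)]
  have : u ^ (-(7/4):ℝ) * u ^ ε ≤ u ^ (-(3/2):ℝ) := by
    rw [← rpow_add (by linarith)]
    exact rpow_le_rpow_of_exponent_le hu1 (by linarith)
  calc _ = T ^ ε / T * (u ^ (-(7/4):ℝ) * u ^ ε) := by ring
    _ ≤ _ := mul_le_mul_of_nonneg_left this (by positivity)

lemma W_sum {ε T D : ℝ} (hT : 1 ≤ T) (hD : 1 ≤ D) (he0 : 0 ≤ ε) (he : ε ≤ 1/4) (M L : ℕ) :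
    ∑ j ∈ Finset.range L, om T D M j * sS ε T D M j ≤ 6 * T ^ ε * D := by
  have hDT : 1 ≤ D * T := by nlinarith
  have h := two_sided (fun x => (1 + x / (D * T)) ^ (-(3/2):ℝ)) (fun x hx => by positivity) (B := 3 * (D * T)) (fun m => half_sum hDT m) L M
  calc _ ≤ ∑ j ∈ Finset.range L, T ^ ε / T * (1 + |(j:ℝ) - M| / (D * T)) ^ (-(3/2):ℝ) := sum_le_sum fun j _ => omS_le hT hD he0 he M j
    _ ≤ T ^ ε / T * (2 * (3 * (D * T))) := by rw [← mul_sum]; exact mul_le_mul_of_nonneg_left h (by positivity)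
    _ = _ := by have : T ≠ 0 := by linarith
                field_simp; ring

lemma U_sum {c : ℝ} (hc : 1 < c) : ∃ B : ℝ, 1 ≤ B ∧ ∀ {ε T D : ℝ} (hT : 1 ≤ T) (hD : 1 ≤ D) (he0 : 0 ≤ ε) (he : ε ≤ 1/4) (M L a : ℕ),
    ∑ j ∈ Finset.range L, om T D M j * sS ε T D M j * zc D a j ^ c ≤ B * T ^ ε * (1 / T + D ^ (1 - c)) := by
  obtain ⟨B, hB, h⟩ := max_sum hc
  refine ⟨2 * B + 6, by linarith, ?_⟩
  intro ε T D hT hD he0 he M L a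
  have hT0 : 0 < T := by linarith
  have hD0 : 0 < D := by linarith
  have hw : ∀ j, om T D M j * sS ε T D M j ≤ T ^ ε / T := fun j => by
    refine (omS_le hT hD he0 he M j).trans (mul_le_of_le_one_right (by positivity) ?_)
    refine Real.rpow_le_one_of_one_le_of_nonpos ?_ (by norm_num)
    have : 0 ≤ |(j:ℝ) - M| / (D * T) := by positivity
    linarith
  have hw0 : ∀ j, 0 ≤ om T D M j * sS ε T D M j := fun j => mul_nonneg (om_pos hT0 hD0 _ _).le (sS_pos _ hT0 hD0 _ _).le
  have h2 := two_sided (fun x => (max 1 x) ^ (-c)) (fun x hx => by positivity) h L a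
  calc _ ≤ ∑ j ∈ Finset.range L, (om T D M j * sS ε T D M j * D ^ (-c) + T ^ ε / T * (max 1 |(j:ℝ) - a|) ^ (-c)) := by
        refine sum_le_sum fun j _ => ?_
        have h3 := mul_le_mul_of_nonneg_left (zc_rpow hD0 (by linarith : 0 ≤ c) a j) (hw0 j)
        have h4 := mul_le_mul_of_nonneg_right (hw j) (by positivity : 0 ≤ (max 1 |(j:ℝ) - a|) ^ (-c))
        linarith
    _ ≤ 6 * T ^ ε * D * D ^ (-c) + T ^ ε / T * (2 * B) := by
        rw [sum_add_distrib, ← sum_mul, ← mul_sum]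
        exact add_le_add (mul_le_mul_of_nonneg_right (W_sum hT hD he0 he M L) (by positivity)) (mul_le_mul_of_nonneg_left h2 (by positivity))
    _ = T ^ ε * (6 * D ^ (1 - c) + 2 * B * (1 / T)) := by
        rw [sub_eq_add_neg, rpow_add hD0, Real.rpow_one]; ring
    _ ≤ T ^ ε * ((2 * B + 6) * (1 / T + D ^ (1 - c))) := by
        refine mul_le_mul_of_nonneg_left ?_ (by positivity)
        have : 0 ≤ 1 / T := by positivity
        have : 0 ≤ D ^ (1 - c) := by positivity
        nlinarith
    _ = _ := by ring

lemma V_sum {c : ℝ} (hc : 1 < c) : ∃ B : ℝ, 1 ≤ B ∧ ∀ {T D : ℝ} (hT : 1 ≤ T) (hD : 1 ≤ D) (M L a : ℕ),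
    ∑ j ∈ Finset.range L, om T D M j * zc D a j ^ c ≤ B := by
  obtain ⟨B, hB, h⟩ := U_sum hc
  refine ⟨2 * B, by linarith, ?_⟩
  intro T D hT hD M L a
  have := h (ε := 0) hT hD le_rfl (by norm_num) M L a
  simp only [sS, Real.rpow_zero, mul_one] at this
  refine this.trans ?_
  have h1 : 1 / T ≤ 1 := by rw [div_le_one (by linarith)]; exact hT
  have h2 : D ^ (1 - c) ≤ 1 := Real.rpow_le_one_of_one_le_of_nonpos hD (by linarith)
  nlinarith

section
variable {q : ℕ} [NeZero q]

noncomputable def Zc (χ : DirichletCharacter ℂ q) (D : ℝ) (M j : ℕ) : ℝ :=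
  ∫ u : unitInterval, Fv χ (1/D) ((xx M j + (u:ℝ)) / D)

lemma Zc_nonneg (χ : DirichletCharacter ℂ q) (D : ℝ) (M j : ℕ) : 0 ≤ Zc χ D M j :=
  integral_nonneg fun _ => Fv_nonneg _ _ _

lemma Zc_rpow (χ : DirichletCharacter ℂ q) (h1 : χ ≠ 1) (D : ℝ) (M j : ℕ) {α : ℝ} (hα : 1 ≤ α) :
    Zc χ D M j ^ α ≤ ∫ u : unitInterval, Fv χ (1/D) ((xx M j + (u:ℝ)) / D) ^ α := by
  have hc : Continuous fun u : unitInterval => Fv χ (1/D) ((xx M j + (u:ℝ)) / D) := (Fv_cont χ h1 _).comp (by fun_prop)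
  have hc2 : Continuous fun u : unitInterval => Fv χ (1/D) ((xx M j + (u:ℝ)) / D) ^ α := hc.rpow_const fun u => Or.inr (by linarith)
  exact (convexOn_rpow hα).map_integral_le (continuousOn_id.rpow_const fun x _ => Or.inr (by linarith)) isClosed_Ici
    (Eventually.of_forall fun u => Fv_nonneg _ _ _) (hc.integrable_of_hasCompactSupport (HasCompactSupport.of_compactSpace _))
    (hc2.integrable_of_hasCompactSupport (HasCompactSupport.of_compactSpace _))

lemma zz_cell {ε : ℝ} (hε : 0 < ε) (hε1 : ε ≤ 1) {D T : ℝ} (hD : 8 ≤ D) (hT : 1 ≤ T) (M i j : ℕ) {u v : ℝ} (hu : u ∈ Set.Icc (0:ℝ) 1) (hv : v ∈ Set.Icc (0:ℝ) 1) :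
    ‖zz (1/D) ((xx M i + u) / D - (xx M j + v) / D)‖ ≤ (14 * (1 + 4 / ε)) * (D * (sS ε T D M i * sS ε T D M j) * zc D i j) := by
  have hD0 : 0 < D := by linarith
  have hT0 : 0 < T := by linarith
  have hd2 : 1 / D ≤ 1 / 2 := one_div_le_one_div_of_le (by norm_num) (by linarith)
  refine (zz_bound (by positivity) hd2 _).trans ?_
  set Δ := (xx M i + u) / D - (xx M j + v) / D with hΔ
  have hDΔ : D * |Δ| = |((i:ℝ) - j) + (u - v)| := by
    calc D * |Δ| = |D * Δ| := by rw [abs_mul, abs_of_pos hD0]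
      _ = _ := by rw [hΔ]; congr 1; unfold xx; field_simp; ring
  have huv : |u - v| ≤ 1 := by rw [abs_le]; constructor <;> linarith [hu.1, hu.2, hv.1, hv.2]
  have hm : max 1 |(i:ℝ) - j| ≤ 1 + D * |Δ| := by
    refine max_le (by have : 0 ≤ D * |Δ| := by positivity
                      linarith) ?_
    rw [hDΔ]
    have := abs_sub_abs_le_abs_sub ((i:ℝ) - j) (-(u - v))
    rw [sub_neg_eq_add, abs_neg] at this
    linarith
  have hm0 : 0 < max 1 |(i:ℝ) - j| := lt_of_lt_of_le one_pos (le_max_left _ _)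
  have b1 : 1 / (1 / D + |Δ|) ≤ D * (1 / max 1 |(i:ℝ) - j|) := by
    have : 1 / (1 / D + |Δ|) = D * (1 / (1 + D * |Δ|)) := by field_simp
    rw [this]
    exact mul_le_mul_of_nonneg_left (one_div_le_one_div_of_le hm0 hm) hD0.le
  have hy : ∀ k, T * (1 + |xx M k| / (D * T)) = T + |xx M k| / D := fun k => by field_simp
  have hs1 : ∀ k, 1 ≤ sS ε T D M k := fun k => by
    unfold sS; rw [hy]
    refine Real.one_le_rpow ?_ hε.le
    have : 0 ≤ |xx M k| / D := by positivity
    linarith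
  have b2 : Real.log (2 + |Δ|) ≤ 4 / ε * (sS ε T D M i * sS ε T D M j) := by
    refine (Real.log_le_rpow_div (by positivity) hε).trans ?_
    have hΔ2 : |Δ| ≤ |xx M i| / D + |xx M j| / D + 1 := by
      have : Δ = xx M i / D - xx M j / D + (u - v) / D := by rw [hΔ]; ring
      rw [this]
      refine (abs_add_le _ _).trans (add_le_add ((abs_sub _ _).trans ?_) ?_)
      · rw [abs_div, abs_div, abs_of_pos hD0]
      · rw [abs_div, abs_of_pos hD0, div_le_one hD0]; linarith
    have : (2 + |Δ|) ^ ε ≤ (4 * ((T * (1 + |xx M i| / (D * T))) * (T * (1 + |xx M j| / (D * T))))) ^ ε := by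
      refine rpow_le_rpow (by positivity) ?_ hε.le
      rw [hy, hy]
      have a0 : 0 ≤ |xx M i| / D := by positivity
      have c0 : 0 ≤ |xx M j| / D := by positivity
      nlinarith [mul_nonneg a0 c0]
    rw [mul_rpow (by norm_num) (by positivity), mul_rpow (by positivity) (by positivity)] at this
    have h4 : (4:ℝ) ^ ε ≤ 4 := by
      calc (4:ℝ) ^ ε ≤ 4 ^ (1:ℝ) := rpow_le_rpow_of_exponent_le (by norm_num) hε1
        _ = 4 := Real.rpow_one _
    have hp : 0 ≤ sS ε T D M i * sS ε T D M j := mul_nonneg (by linarith [hs1 i]) (by linarith [hs1 j])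
    rw [div_mul_eq_mul_div]
    refine div_le_div_of_nonneg_right (this.trans ?_) hε.le
    exact mul_le_mul_of_nonneg_right h4 hp
  have hss : 1 ≤ sS ε T D M i * sS ε T D M j := one_le_mul_of_one_le_of_one_le (hs1 i) (hs1 j)
  set S := sS ε T D M i * sS ε T D M j with hS
  have hmi : 0 < 1 / max 1 |(i:ℝ) - j| := by positivity
  have e : (14 * (1 + 4 / ε)) * (D * S * zc D i j) = 7 * (1 + 4 / ε) * S + 7 * (1 + 4 / ε) * S * (D * (1 / max 1 |(i:ℝ) - j|)) := by
    unfold zc; field_simp; ring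
  rw [e]
  have h4e : 0 ≤ 4 / ε := by positivity
  have c1 : D * (1 / max 1 |(i:ℝ) - j|) ≤ (1 + 4 / ε) * S * (D * (1 / max 1 |(i:ℝ) - j|)) := by
    refine le_mul_of_one_le_left (by positivity) ?_
    nlinarith
  have c2 : 4 / ε * S ≤ (1 + 4 / ε) * S := by nlinarith
  linarith

lemma momZ {ι : Type} [Fintype ι] (α : ι → ℝ) (hα : ∀ i, 1 ≤ α i) {ε : ℝ} (hε : 0 < ε) (hε1 : ε ≤ 1) :
    ∃ C : ℝ, 0 < C ∧ ∃ q0 : ℕ, 2 ≤ q0 ∧ ∀ (q : ℕ) [NeZero q], q0 ≤ q → (∀ χ : DirichletCharacter ℂ q, dirichletRH χ) →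
    ∀ D T : ℝ, 8 ≤ D → 1 ≤ T → ∀ M : ℕ, (M:ℝ) ≤ D * (q:ℝ) ^ 2 → ∀ j : ι → ℕ, (∀ i, j i < 2 * M) →
    ∑ χ ∈ prims q, ∏ i, Zc χ D M (j i) ^ α i ≤ C * (Nat.totient q) * ∏ i, ∏ k, (D * (sS ε T D M (j i) * sS ε T D M (j k)) * zc D (j i) (j k)) ^ (α i * α k / 4) := by
  have hα0 : ∀ i, 0 ≤ α i := fun i => by linarith [hα i]
  obtain ⟨C, hC, q0, hq0, hmom⟩ := momC (∑ i, α i) (sum_nonneg fun i _ => hα0 i)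
  set G : ℝ := 14 * (1 + 4 / ε) with hG
  have hG0 : 0 < G := by positivity
  refine ⟨C * ∏ i, ∏ k, G ^ (α i * α k / 4), mul_pos hC (Finset.prod_pos fun i _ => Finset.prod_pos fun k _ => by positivity), q0, hq0, ?_⟩
  intro q _ hq hRH D T hD hT M hM j hj
  have hD0 : 0 < D := by linarith
  have hT0 : 0 < T := by linarith
  have hd2 : 1 / D ≤ 1 / 2 := one_div_le_one_div_of_le (by norm_num) (by linarith)
  set R : ℝ := C * (∏ i, ∏ k, G ^ (α i * α k / 4)) * (Nat.totient q) * ∏ i, ∏ k, (D * (sS ε T D M (j i) * sS ε T D M (j k)) * zc D (j i) (j k)) ^ (α i * α k / 4) with hR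
  have hne : ∀ χ ∈ prims q, χ ≠ 1 := fun χ hχ => prims_ne (hq0.trans hq) (prims_mem hχ)
  have hcont : ∀ χ ∈ prims q, Continuous fun u : ι → unitInterval => ∏ i, Fv χ (1/D) ((xx M (j i) + (u i : ℝ)) / D) ^ α i := by
    intro χ hχ
    refine continuous_finset_prod _ fun i _ => ?_
    exact ((Fv_cont χ (hne χ hχ) _).comp (by fun_prop : Continuous fun u : ι → unitInterval => (xx M (j i) + (u i : ℝ)) / D)).rpow_const fun u => Or.inr (hα0 i)
  have hitg : ∀ χ ∈ prims q, Integrable fun u : ι → unitInterval => ∏ i, Fv χ (1/D) ((xx M (j i) + (u i : ℝ)) / D) ^ α i := fun χ hχ =>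
    (hcont χ hχ).integrable_of_hasCompactSupport (HasCompactSupport.of_compactSpace _)
  have step1 : ∀ χ ∈ prims q, ∏ i, Zc χ D M (j i) ^ α i ≤ ∫ u : ι → unitInterval, ∏ i, Fv χ (1/D) ((xx M (j i) + (u i : ℝ)) / D) ^ α i := by
    intro χ hχ
    rw [integral_fintype_prod_volume_eq_prod (fun i (u : unitInterval) => Fv χ (1/D) ((xx M (j i) + (u : ℝ)) / D) ^ α i)]
    exact Finset.prod_le_prod (fun i _ => Real.rpow_nonneg (Zc_nonneg _ _ _ _) _) fun i _ => Zc_rpow χ (hne χ hχ) D M (j i) (hα i)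
  refine (sum_le_sum step1).trans ?_
  rw [← integral_finset_sum _ hitg]
  have hpt : ∀ u : ι → unitInterval, ∑ χ ∈ prims q, ∏ i, Fv χ (1/D) ((xx M (j i) + (u i : ℝ)) / D) ^ α i ≤ R := by
    intro u
    have hb := hmom q hq hRH ι α (fun i => (xx M (j i) + (u i : ℝ)) / D) hα0 le_rfl (by
      intro i
      rw [abs_div, abs_of_pos hD0, div_le_iff₀ hD0]
      have h1 := (u i).2.1; have h2 := (u i).2.2
      have h3 : ((j i : ℕ):ℝ) + 1 ≤ 2 * M := by exact_mod_cast hj i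
      have h4 : (0:ℝ) ≤ j i := Nat.cast_nonneg _
      have : |xx M (j i) + (u i : ℝ)| ≤ M := by
        unfold xx; rw [abs_le]; constructor <;> linarith
      linarith) (1/D) (by positivity) hd2
    refine hb.trans ?_
    have hpr : ∏ i, ∏ k, ‖zz (1/D) ((xx M (j i) + (u i : ℝ)) / D - (xx M (j k) + (u k : ℝ)) / D)‖ ^ (α i * α k / 4)
        ≤ (∏ i, ∏ k, G ^ (α i * α k / 4)) * ∏ i, ∏ k, (D * (sS ε T D M (j i) * sS ε T D M (j k)) * zc D (j i) (j k)) ^ (α i * α k / 4) := by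
      rw [← Finset.prod_mul_distrib]
      refine Finset.prod_le_prod (fun i _ => Finset.prod_nonneg fun k _ => by positivity) fun i _ => ?_
      rw [← Finset.prod_mul_distrib]
      refine Finset.prod_le_prod (fun k _ => by positivity) fun k _ => ?_
      have p1 := sS_pos ε hT0 hD0 M (j i)
      have p2 := sS_pos ε hT0 hD0 M (j k)
      have p3 := zc_pos hD0 (j i) (j k)
      rw [← mul_rpow hG0.le (by positivity)]
      refine rpow_le_rpow (norm_nonneg _) (zz_cell hε hε1 hD hT M (j i) (j k) (u i).2 (u k).2) ?_
      have := mul_nonneg (hα0 i) (hα0 k); positivity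
    calc _ ≤ C * (Nat.totient q) * ((∏ i, ∏ k, G ^ (α i * α k / 4)) * ∏ i, ∏ k, (D * (sS ε T D M (j i) * sS ε T D M (j k)) * zc D (j i) (j k)) ^ (α i * α k / 4)) :=
          mul_le_mul_of_nonneg_left hpr (by positivity)
      _ = R := by rw [hR]; ring
  calc _ ≤ ∫ u : ι → unitInterval, R := integral_mono (integrable_finset_sum _ hitg) (integrable_const _) hpt
    _ = R := by simp
end

lemma sS_one_le {ε T D : ℝ} (he : 0 ≤ ε) (hT : 1 ≤ T) (hD : 0 < D) (M j : ℕ) : 1 ≤ sS ε T D M j := by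
  unfold sS
  refine Real.one_le_rpow ?_ he
  have : 0 ≤ |xx M j| / (D * T) := by positivity
  nlinarith

lemma sS_rpow {ε T D : ℝ} (x : ℝ) (hT : 0 < T) (hD : 0 < D) (M j : ℕ) : sS ε T D M j ^ x = sS (ε * x) T D M j := by
  unfold sS
  rw [← rpow_mul (by positivity)]

lemma prod_split {ι : Type} [Fintype ι] (α s : ι → ℝ) (z : ι → ι → ℝ) {D : ℝ} (hD : 0 < D) (hα : ∀ i, 0 ≤ α i) (hs : ∀ i, 1 ≤ s i)
    (hz : ∀ i j, 0 < z i j) :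
    ∏ i, ∏ k, (D * (s i * s k) * z i k) ^ (α i * α k / 4) ≤
      D ^ ((∑ i, α i) ^ 2 / 4) * (∏ i, s i ^ ((∑ i, α i) ^ 2 / 2)) * ∏ i, ∏ k, z i k ^ (α i * α k / 4) := by
  set p := ∑ i, α i with hp
  have s0 : ∀ i, 0 < s i := fun i => by linarith [hs i]
  have hαp : ∀ i, α i ≤ p := fun i => Finset.single_le_sum (fun i _ => hα i) (Finset.mem_univ i)
  have e1 : ∏ i, ∏ k, (D * (s i * s k) * z i k) ^ (α i * α k / 4)
      = (∏ i, ∏ k, D ^ (α i * α k / 4)) * ((∏ i, ∏ k, s i ^ (α i * α k / 4)) * (∏ i, ∏ k, s k ^ (α i * α k / 4))) * ∏ i, ∏ k, z i k ^ (α i * α k / 4) := by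
    simp_rw [← Finset.prod_mul_distrib]
    refine Finset.prod_congr rfl fun i _ => Finset.prod_congr rfl fun k _ => ?_
    rw [mul_rpow (by have := s0 i; have := s0 k; positivity) (hz i k).le, mul_rpow hD.le (mul_pos (s0 i) (s0 k)).le,
      mul_rpow (s0 i).le (s0 k).le]
  have e2 : ∏ i, ∏ k, D ^ (α i * α k / 4) = D ^ (p ^ 2 / 4) := by
    simp_rw [← Real.rpow_sum_of_pos hD]
    congr 1
    simp_rw [← Finset.sum_div, ← mul_sum, ← sum_mul]
    rw [← hp]; ring
  have e3 : ∏ i, ∏ k, s i ^ (α i * α k / 4) ≤ ∏ i, s i ^ (p ^ 2 / 4) := by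
    refine Finset.prod_le_prod (fun i _ => Finset.prod_nonneg fun k _ => Real.rpow_nonneg (s0 i).le _) fun i _ => ?_
    rw [← Real.rpow_sum_of_pos (s0 i)]
    refine rpow_le_rpow_of_exponent_le (hs i) ?_
    simp_rw [← Finset.sum_div, ← mul_sum]
    rw [← hp, sq]
    have : α i * p ≤ p * p := mul_le_mul_of_nonneg_right (hαp i) ((hα i).trans (hαp i))
    linarith
  have e4 : ∏ i, ∏ k, s k ^ (α i * α k / 4) = ∏ i, ∏ k, s i ^ (α i * α k / 4) := by
    rw [Finset.prod_comm]
    exact Finset.prod_congr rfl fun i _ => Finset.prod_congr rfl fun k _ => by rw [mul_comm (α k)]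
  rw [e1, e2, e4]
  refine mul_le_mul_of_nonneg_right (mul_le_mul_of_nonneg_left ?_ (by positivity)) (Finset.prod_nonneg fun i _ => Finset.prod_nonneg fun k _ => Real.rpow_nonneg (hz i k).le _)
  have n : 0 ≤ ∏ i, ∏ k, s i ^ (α i * α k / 4) := Finset.prod_nonneg fun i _ => Finset.prod_nonneg fun k _ => Real.rpow_nonneg (s0 i).le _
  refine (mul_le_mul e3 e3 n (n.trans e3)).trans (le_of_eq ?_)
  rw [← Finset.prod_mul_distrib]
  refine Finset.prod_congr rfl fun i _ => ?_
  rw [← rpow_add (s0 i)]; congr 1; ring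

lemma momZ2 {ι : Type} [Fintype ι] (α : ι → ℝ) (hα : ∀ i, 1 ≤ α i) (hp : 1 ≤ ∑ i, α i) {ε : ℝ} (hε : 0 < ε) (hε1 : ε ≤ 1/4) :
    ∃ C : ℝ, 0 < C ∧ ∃ q0 : ℕ, 2 ≤ q0 ∧ ∀ (q : ℕ) [NeZero q], q0 ≤ q → (∀ χ : DirichletCharacter ℂ q, dirichletRH χ) →
    ∀ D T : ℝ, 8 ≤ D → 1 ≤ T → ∀ M : ℕ, (M:ℝ) ≤ D * (q:ℝ) ^ 2 → ∀ j : ι → ℕ, (∀ i, j i < 2 * M) →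
    ∑ χ ∈ prims q, ∏ i, Zc χ D M (j i) ^ α i ≤ C * (Nat.totient q) * (D ^ ((∑ i, α i) ^ 2 / 4) * (∏ i, sS ε T D M (j i)) *
      ∏ i, ∏ k, zc D (j i) (j k) ^ (α i * α k / 4)) := by
  set p := ∑ i, α i with hpd
  have hp0 : 0 < p := by linarith
  have h2 : 2 * ε / p ^ 2 ≤ 1 := by
    rw [div_le_one (by positivity)]; nlinarith
  obtain ⟨C, hC, q0, hq0, h⟩ := momZ α hα (ε := 2 * ε / p ^ 2) (by positivity) h2
  refine ⟨C, hC, q0, hq0, ?_⟩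
  intro q _ hq hRH D T hD hT M hM j hj
  have hD0 : 0 < D := by linarith
  have hT0 : 0 < T := by linarith
  refine (h q hq hRH D T hD hT M hM j hj).trans (mul_le_mul_of_nonneg_left ?_ (by positivity))
  refine (prod_split α (fun i => sS (2 * ε / p ^ 2) T D M (j i)) (fun i k => zc D (j i) (j k)) hD0 (fun i => by linarith [hα i])
    (fun i => sS_one_le (by positivity) hT hD0 _ _) (fun i k => zc_pos hD0 _ _)).trans (le_of_eq ?_)
  rw [← hpd]
  congr 2
  refine Finset.prod_congr rfl fun i _ => ?_
  rw [sS_rpow _ hT0 hD0]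
  congr 1; field_simp

lemma momM1 {P ε : ℝ} (hP : 1 ≤ P) (hε : 0 < ε) (hε1 : ε ≤ 1/4) :
    ∃ C : ℝ, 0 < C ∧ ∃ q0 : ℕ, 2 ≤ q0 ∧ ∀ (q : ℕ) [NeZero q], q0 ≤ q → (∀ χ : DirichletCharacter ℂ q, dirichletRH χ) →
    ∀ D T : ℝ, 8 ≤ D → 1 ≤ T → ∀ M : ℕ, (M:ℝ) ≤ D * (q:ℝ) ^ 2 → ∀ j : ℕ, j < 2 * M →
    ∑ χ ∈ prims q, Zc χ D M j ^ P ≤ C * (Nat.totient q) * (D ^ (P ^ 2 / 4) * sS ε T D M j) := by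
  obtain ⟨C, hC, q0, hq0, h⟩ := momZ2 (ι := Unit) (fun _ => P) (fun _ => hP) (by simpa using hP) hε hε1
  refine ⟨C, hC, q0, hq0, ?_⟩
  intro q _ hq hRH D T hD hT M hM j hj
  have hD0 : 0 < D := by linarith
  have hT0 : 0 < T := by linarith
  have := h q hq hRH D T hD hT M hM (fun _ => j) (fun _ => hj)
  simp only [Finset.univ_unique, Finset.prod_singleton, Finset.sum_singleton] at this
  refine this.trans (mul_le_mul_of_nonneg_left ?_ (by positivity))
  have s0 := sS_pos ε hT0 hD0 M j
  refine mul_le_of_le_one_right (by positivity) (Real.rpow_le_one (zc_pos hD0 _ _).le (zc_le (by linarith) _ _) (by positivity))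

lemma momM4 {r ε : ℝ} (hr : 1 < r) (hε : 0 < ε) (hε1 : ε ≤ 1/4) :
    ∃ C : ℝ, 0 < C ∧ ∃ q0 : ℕ, 2 ≤ q0 ∧ ∀ (q : ℕ) [NeZero q], q0 ≤ q → (∀ χ : DirichletCharacter ℂ q, dirichletRH χ) →
    ∀ D T : ℝ, 8 ≤ D → 1 ≤ T → ∀ M : ℕ, (M:ℝ) ≤ D * (q:ℝ) ^ 2 → ∀ a < 2 * M, ∀ b < 2 * M, ∀ c < 2 * M, ∀ d < 2 * M,
    ∑ χ ∈ prims q, Zc χ D M a * Zc χ D M b * Zc χ D M c * Zc χ D M d ^ r ≤ (C * (Nat.totient q) * D ^ ((3 + r) ^ 2 / 4)) *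
      (sS ε T D M a * sS ε T D M b * sS ε T D M c * sS ε T D M d) *
      ((zc D a b * zc D a c * zc D b c) ^ (1/2:ℝ) * (zc D a d * zc D b d * zc D c d) ^ (r/2)) := by
  have hsum : ∑ i, (![1,1,1,r] : Fin 4 → ℝ) i = 3 + r := by simp [Fin.sum_univ_four]; ring
  obtain ⟨C, hC, q0, hq0, h⟩ := momZ2 (![1,1,1,r] : Fin 4 → ℝ) (by intro i; fin_cases i <;> simp <;> linarith) (by rw [hsum]; linarith) hε hε1
  rw [hsum] at h
  refine ⟨C, hC, q0, hq0, ?_⟩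
  intro q _ hq hRH D T hD hT M hM a ha b hb c hc d hd
  have hD0 : 0 < D := by linarith
  have hT0 : 0 < T := by linarith
  have h0 := h q hq hRH D T hD hT M hM ![a, b, c, d] (by intro i; fin_cases i <;> simp <;> assumption)
  simp only [Fin.prod_univ_four, Matrix.cons_val_zero, Matrix.cons_val_one, Matrix.cons_val, Real.rpow_one] at h0
  refine h0.trans ?_
  rw [mul_assoc (C * (Nat.totient q : ℝ)), mul_assoc (C * (Nat.totient q : ℝ))]
  refine mul_le_mul_of_nonneg_left ?_ (by positivity)
  have sa := sS_pos ε hT0 hD0 M a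
  have sb := sS_pos ε hT0 hD0 M b
  have sc := sS_pos ε hT0 hD0 M c
  have sd := sS_pos ε hT0 hD0 M d
  refine mul_le_mul_of_nonneg_left ?_ (by positivity)
  rw [zc_symm D b a, zc_symm D c a, zc_symm D c b, zc_symm D d a, zc_symm D d b, zc_symm D d c]
  have pab := zc_pos hD0 a b
  have pac := zc_pos hD0 a c
  have pbc := zc_pos hD0 b c
  have pad := zc_pos hD0 a d
  have pbd := zc_pos hD0 b d
  have pcd := zc_pos hD0 c d
  have one : ∀ (x : ℕ) (y : ℝ), 0 ≤ y → zc D x x ^ y ≤ 1 := fun x y hy => Real.rpow_le_one (zc_pos hD0 _ _).le (zc_le (by linarith) _ _) hy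
  have nn : ∀ (x : ℕ) (y : ℝ), 0 ≤ zc D x x ^ y := fun x y => Real.rpow_nonneg (zc_pos hD0 _ _).le _
  have sq1 : ∀ x : ℝ, 0 < x → x ^ (1/2:ℝ) = x ^ ((1:ℝ) * 1 / 4) * x ^ ((1:ℝ) * 1 / 4) := fun x hx => by rw [← rpow_add hx]; norm_num
  have sq2 : ∀ x : ℝ, 0 < x → x ^ (r/2:ℝ) = x ^ ((1:ℝ) * r / 4) * x ^ (r * 1 / 4) := fun x hx => by rw [← rpow_add hx]; congr 1; ring
  rw [mul_rpow (by positivity) pbc.le, mul_rpow pab.le pac.le, mul_rpow (by positivity) pcd.le, mul_rpow pad.le pbd.le,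
    sq1 _ pab, sq1 _ pac, sq1 _ pbc, sq2 _ pad, sq2 _ pbd, sq2 _ pcd]
  set R : ℝ := zc D a b ^ ((1:ℝ) * 1 / 4) * zc D a b ^ ((1:ℝ) * 1 / 4) * (zc D a c ^ ((1:ℝ) * 1 / 4) * zc D a c ^ ((1:ℝ) * 1 / 4)) *
    (zc D b c ^ ((1:ℝ) * 1 / 4) * zc D b c ^ ((1:ℝ) * 1 / 4)) * (zc D a d ^ ((1:ℝ) * r / 4) * zc D a d ^ (r * 1 / 4) * (zc D b d ^ ((1:ℝ) * r / 4) * zc D b d ^ (r * 1 / 4)) *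
    (zc D c d ^ ((1:ℝ) * r / 4) * zc D c d ^ (r * 1 / 4))) with hR
  have hR0 : 0 ≤ R := by positivity
  calc _ = R * (zc D a a ^ ((1:ℝ) * 1 / 4) * (zc D b b ^ ((1:ℝ) * 1 / 4) * (zc D c c ^ ((1:ℝ) * 1 / 4) * zc D d d ^ (r * r / 4)))) := by rw [hR]; ring
    _ ≤ R * 1 := by
      refine mul_le_mul_of_nonneg_left ?_ hR0
      refine mul_le_one₀ (one _ _ (by norm_num)) (mul_nonneg (nn _ _) (mul_nonneg (nn _ _) (nn _ _))) ?_
      refine mul_le_one₀ (one _ _ (by norm_num)) (mul_nonneg (nn _ _) (nn _ _)) ?_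
      exact mul_le_one₀ (one _ _ (by norm_num)) (nn _ _) (one _ _ (by positivity))
    _ = _ := by rw [mul_one]

section
variable {q : ℕ} [NeZero q]

lemma Zc_eq (χ : DirichletCharacter ℂ q) {D : ℝ} (hD : 0 < D) (M j : ℕ) :
    ∫ t in (xx M j / D)..(xx M (j+1) / D), Fv χ (1/D) t = (1/D) * Zc χ D M j := by
  have e : Zc χ D M j = ∫ u in (0:ℝ)..1, Fv χ (1/D) ((xx M j + u) / D) := by
    unfold Zc
    rw [intervalIntegral.integral_of_le zero_le_one, ← integral_Icc_eq_integral_Ioc]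
    exact integral_subtype measurableSet_Icc (fun u : ℝ => Fv χ (1/D) ((xx M j + u) / D))
  have e2 := intervalIntegral.integral_comp_mul_add (a := 0) (b := 1) (fun t => Fv χ (1/D) t) (one_div_ne_zero hD.ne') (xx M j / D)
  have e3 : ∀ u : ℝ, 1 / D * u + xx M j / D = (xx M j + u) / D := fun u => by ring
  simp only [e3] at e2
  rw [e, e2, smul_eq_mul, one_div, inv_inv, ← mul_assoc, inv_mul_cancel₀ hD.ne', one_mul]
  congr 1
  · ring
  · unfold xx; push_cast; ring

lemma cell_le (χ : DirichletCharacter ℂ q) (h1 : χ ≠ 1) {D T : ℝ} (hD : 8 ≤ D) (hT : 1 ≤ T) (M j : ℕ) :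
    ∫ t in (xx M j / D)..(xx M (j+1) / D), Fv χ (1/D) t * wT T t ≤ (4 / D) * (om T D M j * Zc χ D M j) := by
  have hD0 : 0 < D := by linarith
  have hT0 : 0 < T := by linarith
  have hc := Fv_cont χ h1 (1/D)
  have hw := wT_cont hT0
  have hle : xx M j / D ≤ xx M (j+1) / D := by
    refine div_le_div_of_nonneg_right ?_ hD0.le
    unfold xx; push_cast; linarith
  have : ∫ t in (xx M j / D)..(xx M (j+1) / D), Fv χ (1/D) t * wT T t ≤ ∫ t in (xx M j / D)..(xx M (j+1) / D), Fv χ (1/D) t * (4 * om T D M j) := by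
    refine intervalIntegral.integral_mono_on hle ((hc.mul hw).intervalIntegrable _ _) ((hc.mul continuous_const).intervalIntegrable _ _) ?_
    intro t ht
    refine mul_le_mul_of_nonneg_left ?_ (Fv_nonneg _ _ _)
    have hx : |xx M j| / D ≤ |t| + 1 / D := by
      rw [← abs_of_pos hD0, ← abs_div, abs_of_pos hD0]
      have h2 : |t - xx M j / D| ≤ 1 / D := by
        rw [abs_of_nonneg (by linarith [ht.1])]
        have := ht.2
        have e : xx M (j+1) / D = xx M j / D + 1 / D := by unfold xx; push_cast; ring
        linarith
      have := abs_sub_abs_le_abs_sub (xx M j / D) t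
      rw [abs_sub_comm] at this
      linarith
    have h2 : (1 + |xx M j| / (D * T)) / 2 ≤ 1 + |t| / T := by
      rw [← div_div]
      have a1 : |xx M j| / D / T ≤ (|t| + 1 / D) / T := div_le_div_of_nonneg_right hx hT0.le
      rw [add_div] at a1
      have a2 : 1 / D / T ≤ 1 := by rw [div_div, div_le_one (by positivity)]; nlinarith
      have a3 : 0 ≤ |t| / T := by positivity
      linarith
    unfold wT om
    have h3 : (1 + |t| / T) ^ (-(7/4) : ℝ) ≤ ((1 + |xx M j| / (D * T)) / 2) ^ (-(7/4) : ℝ) :=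
      Real.rpow_le_rpow_of_nonpos (by positivity) h2 (by norm_num)
    rw [Real.div_rpow (by positivity) (by norm_num), Real.rpow_neg (by norm_num : (0:ℝ) ≤ 2), div_inv_eq_mul] at h3
    have h4 : (2:ℝ) ^ (7/4:ℝ) ≤ 4 := by
      calc (2:ℝ) ^ (7/4:ℝ) ≤ 2 ^ (2:ℝ) := rpow_le_rpow_of_exponent_le (by norm_num) (by norm_num)
        _ = 4 := by norm_num
    have h5 : (0:ℝ) ≤ (1 + |xx M j| / (D * T)) ^ (-(7/4) : ℝ) := by positivity
    calc _ ≤ 1 / T * ((1 + |xx M j| / (D * T)) ^ (-(7/4) : ℝ) * 4) := mul_le_mul_of_nonneg_left (h3.trans (mul_le_mul_of_nonneg_left h4 h5)) (by positivity)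
      _ = _ := by ring
  refine this.trans (le_of_eq ?_)
  rw [intervalIntegral.integral_mul_const, Zc_eq χ hD0]
  ring

lemma tail_pt {C : ℝ} (hC : 0 < C) {D T t qq F : ℝ} (hq : 1 ≤ qq) (hT : 1 ≤ T) (hTq : T ≤ 2 * qq) (ht : qq ^ 2 ≤ 1 + |t|) (hF0 : 0 ≤ F)
    (hF : F ≤ C * qq ^ (1/16:ℝ) * (1 + |t|) ^ (1/8:ℝ)) : F * wT T t ≤ (4 * C * T ^ (-(1/16):ℝ)) * (1 + |t|) ^ (-(17/16):ℝ) := by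
  have hT0 : 0 < T := by linarith
  have hq0 : 0 < qq := by linarith
  have ht0 : 0 < 1 + |t| := by positivity
  have a : (1 + |t|) ^ (-(9/16):ℝ) ≤ qq ^ (-(9/8):ℝ) := by
    calc (1 + |t|) ^ (-(9/16):ℝ) ≤ (qq ^ 2) ^ (-(9/16):ℝ) := Real.rpow_le_rpow_of_nonpos (by positivity) ht (by norm_num)
      _ = qq ^ (-(9/8):ℝ) := by rw [← rpow_natCast, ← rpow_mul hq0.le]; norm_num
  have b : qq ^ (-(1/16):ℝ) ≤ 2 * T ^ (-(1/16):ℝ) := by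
    have h : qq ^ (-(1/16):ℝ) ≤ (T / 2) ^ (-(1/16):ℝ) := Real.rpow_le_rpow_of_nonpos (by positivity) (by linarith) (by norm_num)
    rw [Real.div_rpow hT0.le (by norm_num), Real.rpow_neg (by norm_num : (0:ℝ) ≤ 2), div_inv_eq_mul] at h
    have h4 : (2:ℝ) ^ (1/16:ℝ) ≤ 2 := by
      calc (2:ℝ) ^ (1/16:ℝ) ≤ 2 ^ (1:ℝ) := rpow_le_rpow_of_exponent_le (by norm_num) (by norm_num)
        _ = 2 := by norm_num
    have : T ^ (-(1/16):ℝ) * 2 ^ (1/16:ℝ) ≤ T ^ (-(1/16):ℝ) * 2 := mul_le_mul_of_nonneg_left h4 (by positivity)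
    linarith
  calc F * wT T t ≤ (C * qq ^ (1/16:ℝ) * (1 + |t|) ^ (1/8:ℝ)) * (T * (1 + |t|) ^ (-(7/4) : ℝ)) :=
        mul_le_mul hF (wT_le hT t) (wT_nonneg hT0 t) (by positivity)
    _ ≤ (C * qq ^ (1/16:ℝ) * (1 + |t|) ^ (1/8:ℝ)) * ((2 * qq) * (1 + |t|) ^ (-(7/4) : ℝ)) := by gcongr
    _ = 2 * C * (qq ^ (1/16:ℝ) * qq) * ((1 + |t|) ^ (1/8:ℝ) * (1 + |t|) ^ (-(7/4) : ℝ)) := by ring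
    _ = 2 * C * (qq ^ (17/16:ℝ)) * ((1 + |t|) ^ (-(9/16):ℝ) * (1 + |t|) ^ (-(17/16) : ℝ)) := by
        rw [← rpow_add ht0, ← rpow_add ht0, ← Real.rpow_add_one hq0.ne']; norm_num
    _ ≤ 2 * C * (qq ^ (17/16:ℝ)) * (qq ^ (-(9/8):ℝ) * (1 + |t|) ^ (-(17/16) : ℝ)) := by gcongr
    _ = 2 * C * (qq ^ (17/16:ℝ) * qq ^ (-(9/8):ℝ)) * (1 + |t|) ^ (-(17/16) : ℝ) := by ring
    _ = 2 * C * qq ^ (-(1/16):ℝ) * (1 + |t|) ^ (-(17/16) : ℝ) := by rw [← rpow_add hq0]; norm_num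
    _ ≤ 2 * C * (2 * T ^ (-(1/16):ℝ)) * (1 + |t|) ^ (-(17/16) : ℝ) := by gcongr
    _ = _ := by ring

lemma cells : ∃ C : ℝ, 0 < C ∧ ∀ (q : ℕ) [NeZero q] (χ : DirichletCharacter ℂ q), χ ≠ 1 → χ.IsPrimitive → dirichletRH χ →
    ∀ D T : ℝ, 8 ≤ D → 1 ≤ T → T ≤ 2 * q →
    ∫ t, Fv χ (1/D) t * wT T t ≤ (4 / D) * (∑ j ∈ Finset.range (2 * ⌊D * (q:ℝ) ^ 2⌋₊), om T D ⌊D * (q:ℝ) ^ 2⌋₊ j * Zc χ D ⌊D * (q:ℝ) ^ 2⌋₊ j) + C * T ^ (-(1/16):ℝ) := by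
  obtain ⟨C, hC, hg⟩ := growth
  set I0 : ℝ := ∫ t : ℝ, (1 + |t|) ^ (-(17/16):ℝ) with hI0
  have hI0n : 0 ≤ I0 := integral_nonneg fun t => by positivity
  refine ⟨4 * C * (I0 + 1), by positivity, ?_⟩
  intro q _ χ h1 hp hRH D T hD hT hTq
  have hD0 : 0 < D := by linarith
  have hT0 : 0 < T := by linarith
  have hd2 : 1 / D ≤ 1 / 2 := one_div_le_one_div_of_le (by norm_num) (by linarith)
  have hq : (1:ℝ) ≤ q := by exact_mod_cast Nat.pos_of_ne_zero (NeZero.ne q)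
  set M := ⌊D * (q:ℝ) ^ 2⌋₊ with hM
  set f : ℝ → ℝ := fun t => Fv χ (1/D) t * wT T t with hf
  have hitg : Integrable f := Fw_int χ h1 hp hRH (by positivity) hd2 hT
  have hfc : Continuous f := (Fv_cont χ h1 _).mul (wT_cont hT0)
  have hM1 : D * (q:ℝ) ^ 2 < M + 1 := Nat.lt_floor_add_one _
  have hM2 : (q:ℝ) ^ 2 ≤ 1 + M / D := by
    have : (q:ℝ) ^ 2 ≤ (M + 1) / D := by rw [le_div_iff₀ hD0]; linarith
    rw [add_div] at this
    have h8 : 1 / D ≤ 1 := by rw [div_le_one hD0]; linarith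
    linarith
  have hM0 : (0:ℝ) ≤ M / D := by positivity
  rw [← integral_add_compl (s := Set.Ioc (-((M:ℝ) / D)) (M / D)) measurableSet_Ioc hitg]
  refine add_le_add ?_ ?_
  · rw [← intervalIntegral.integral_of_le (by linarith)]
    have hs := intervalIntegral.sum_integral_adjacent_intervals (f := f) (μ := volume) (a := fun j => xx M j / D) (n := 2 * M) (fun k _ => hfc.intervalIntegrable _ _)
    have e0 : xx M 0 / D = -((M:ℝ) / D) := by unfold xx; push_cast; ring
    have e1 : xx M (2 * M) / D = (M:ℝ) / D := by unfold xx; push_cast; ring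
    simp only [e0, e1] at hs
    rw [← hs, mul_sum]
    exact sum_le_sum fun j _ => cell_le χ h1 hD hT M j
  · have hj : Integrable (fun t : ℝ => (4 * C * T ^ (-(1/16):ℝ)) * (1 + |t|) ^ (-(17/16):ℝ)) := (jap_int (by norm_num)).const_mul _
    calc ∫ t in (Set.Ioc (-((M:ℝ) / D)) (M / D))ᶜ, f t ≤ ∫ t in (Set.Ioc (-((M:ℝ) / D)) (M / D))ᶜ, (4 * C * T ^ (-(1/16):ℝ)) * (1 + |t|) ^ (-(17/16):ℝ) := by
          refine setIntegral_mono_on hitg.integrableOn hj.integrableOn measurableSet_Ioc.compl ?_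
          intro t ht
          refine tail_pt hC (D := D) hq hT hTq ?_ (Fv_nonneg _ _ _) (hg q χ h1 hp hRH (1/D) (by positivity) hd2 t)
          have : (M:ℝ) / D ≤ |t| := by
            by_contra hcon
            push Not at hcon
            rw [abs_lt] at hcon
            exact ht ⟨hcon.1, hcon.2.le⟩
          linarith
      _ ≤ ∫ t, (4 * C * T ^ (-(1/16):ℝ)) * (1 + |t|) ^ (-(17/16):ℝ) := setIntegral_le_integral hj (Eventually.of_forall fun t => by simp only [Pi.zero_apply]; positivity)
      _ = 4 * C * I0 * T ^ (-(1/16):ℝ) := by rw [integral_const_mul]; ring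
      _ ≤ _ := by
        refine mul_le_mul_of_nonneg_right ?_ (by positivity)
        nlinarith
end

lemma powmean {ι : Type} (J : Finset ι) (ω Z : ι → ℝ) {r V : ℝ} (hr : 1 < r) (hω : ∀ i ∈ J, 0 ≤ ω i) (hZ : ∀ i ∈ J, 0 ≤ Z i)
    (hV : ∑ d ∈ J, ω d ≤ V) : (∑ d ∈ J, ω d * Z d) ^ r ≤ (3 * V) ^ (r - 1) * ∑ d ∈ J, ω d * Z d ^ r := by
  have h := tilt J ω Z (fun _ => 1) (fun _ => 1) (fun _ => 1) (γ := 0) hr hω hZ (fun _ => one_pos) (fun _ => one_pos) (fun _ => one_pos) le_rfl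
    (by simpa using hV) (by simpa using hV) (by simpa using hV)
  simpa using h

lemma add_rpow_two {a b p : ℝ} (ha : 0 ≤ a) (hb : 0 ≤ b) (hp : 0 ≤ p) : (a + b) ^ p ≤ 2 ^ p * (a ^ p + b ^ p) := by
  have h1 : a + b ≤ 2 * max a b := by linarith [le_max_left a b, le_max_right a b]
  have h2 : (max a b) ^ p ≤ a ^ p + b ^ p := by
    have := Real.rpow_nonneg ha p
    have := Real.rpow_nonneg hb p
    rcases max_choice a b with h | h <;> rw [h] <;> linarith
  calc (a + b) ^ p ≤ (2 * max a b) ^ p := rpow_le_rpow (by positivity) h1 hp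
    _ = 2 ^ p * (max a b) ^ p := mul_rpow (by norm_num) (le_max_of_le_left ha)
    _ ≤ _ := mul_le_mul_of_nonneg_left h2 (by positivity)

lemma prims_card (q : ℕ) [NeZero q] : ((prims q).card : ℝ) ≤ Nat.totient q := by
  have h : (prims q).card ≤ Fintype.card (DirichletCharacter ℂ q) := Finset.card_le_univ _
  have h2 : Fintype.card (DirichletCharacter ℂ q) = Nat.totient q := by
    rw [← Nat.card_eq_fintype_card]
    exact DirichletCharacter.card_eq_totient_of_hasEnoughRootsOfUnity ℂ q
  rw [h2] at h
  exact_mod_cast h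

noncomputable def XX {q : ℕ} [NeZero q] (χ : DirichletCharacter ℂ q) (D T : ℝ) : ℝ := ∫ t, Fv χ (1/D) t * wT T t

lemma XX_nonneg {q : ℕ} [NeZero q] (χ : DirichletCharacter ℂ q) (D : ℝ) {T : ℝ} (hT : 0 < T) : 0 ≤ XX χ D T :=
  integral_nonneg fun t => mul_nonneg (Fv_nonneg _ _ _) (wT_nonneg hT t)

/-- passing from the discretised sum to the integral -/
lemma XX_of_Y {p : ℝ} (hp : 0 ≤ p) : ∃ C : ℝ, 0 < C ∧ ∀ (q : ℕ) [NeZero q], 2 ≤ q → (∀ χ : DirichletCharacter ℂ q, dirichletRH χ) →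
    ∀ D T : ℝ, 8 ≤ D → 1 ≤ T → T ≤ 2 * q →
    ∑ χ ∈ prims q, XX χ D T ^ p ≤ C * (D ^ (-p) * (∑ χ ∈ prims q, (∑ j ∈ Finset.range (2 * ⌊D * (q:ℝ) ^ 2⌋₊), om T D ⌊D * (q:ℝ) ^ 2⌋₊ j * Zc χ D ⌊D * (q:ℝ) ^ 2⌋₊ j) ^ p)
      + (Nat.totient q) * T ^ (-(p/16))) := by
  obtain ⟨C, hC, h⟩ := cells
  refine ⟨2 ^ p * (4 ^ p + C ^ p), by positivity, ?_⟩
  intro q _ hq hRH D T hD hT hTq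
  have hD0 : 0 < D := by linarith
  have hT0 : 0 < T := by linarith
  set Y : DirichletCharacter ℂ q → ℝ := fun χ => ∑ j ∈ Finset.range (2 * ⌊D * (q:ℝ) ^ 2⌋₊), om T D ⌊D * (q:ℝ) ^ 2⌋₊ j * Zc χ D ⌊D * (q:ℝ) ^ 2⌋₊ j with hY
  have hY0 : ∀ χ, 0 ≤ Y χ := fun χ => sum_nonneg fun j _ => mul_nonneg (om_pos hT0 hD0 _ _).le (Zc_nonneg _ _ _ _)
  have h1 : ∀ χ ∈ prims q, XX χ D T ^ p ≤ 2 ^ p * (4 ^ p * D ^ (-p) * Y χ ^ p + C ^ p * T ^ (-(p/16))) := by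
    intro χ hχ
    have hx := h q χ (prims_ne hq (prims_mem hχ)) (prims_mem hχ) (hRH χ) D T hD hT hTq
    calc XX χ D T ^ p ≤ ((4 / D) * Y χ + C * T ^ (-(1/16):ℝ)) ^ p := rpow_le_rpow (XX_nonneg χ D hT0) hx hp
      _ ≤ 2 ^ p * (((4 / D) * Y χ) ^ p + (C * T ^ (-(1/16):ℝ)) ^ p) := add_rpow_two (mul_nonneg (by positivity) (hY0 χ)) (by positivity) hp
      _ = _ := by
        rw [mul_rpow (by positivity) (hY0 χ), mul_rpow hC.le (by positivity), ← rpow_mul hT0.le, Real.div_rpow (by norm_num) hD0.le,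
          Real.rpow_neg hD0.le p, div_eq_mul_inv]
        ring_nf
  refine (sum_le_sum h1).trans ?_
  rw [← mul_sum, sum_add_distrib, ← mul_sum, Finset.sum_const, nsmul_eq_mul, mul_assoc ((2:ℝ) ^ p)]
  refine mul_le_mul_of_nonneg_left ?_ (by positivity)
  have hS : 0 ≤ ∑ χ ∈ prims q, Y χ ^ p := sum_nonneg fun χ _ => Real.rpow_nonneg (hY0 χ) _
  set S := ∑ χ ∈ prims q, Y χ ^ p
  have c1 : ((prims q).card : ℝ) * (C ^ p * T ^ (-(p/16))) ≤ (Nat.totient q) * (C ^ p * T ^ (-(p/16))) := mul_le_mul_of_nonneg_right (prims_card q) (by positivity)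
  have c2 : 0 ≤ C ^ p * (D ^ (-p) * S) := by positivity
  have c3 : 0 ≤ (4:ℝ) ^ p * ((Nat.totient q) * T ^ (-(p/16))) := by positivity
  nlinarith

lemma sharp {k : ℝ} (hk : 2 < k) : ∃ c : ℝ, 1 < c ∧ ∀ ε : ℝ, 0 < ε → ε ≤ 1/4 →
    ∃ C : ℝ, 0 < C ∧ ∃ q0 : ℕ, 2 ≤ q0 ∧ ∀ (q : ℕ) [NeZero q], q0 ≤ q → (∀ χ : DirichletCharacter ℂ q, dirichletRH χ) →
    ∀ D T : ℝ, 8 ≤ D → 1 ≤ T → T ≤ 2 * q →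
    ∑ χ ∈ prims q, XX χ D T ^ (2 * k) ≤ C * (Nat.totient q) * (D ^ ((k-1)^2) * (T ^ (4 * ε) * (1 / T + D ^ (1 - c)) ^ 3) + T ^ (-(k/8))) := by
  set r := 2 * k - 3 with hr
  have hr1 : 1 < r := by linarith
  set γ := 1 + r / (4 * (3 + r)) with hγ
  have hγ1 : 1 < γ := by have : 0 < r / (4 * (3 + r)) := by positivity
                         linarith
  set e := r / 2 - γ * (r - 1) / 3 with he
  set A := (3 + r) / 4 with hA
  set B := e * (3 + r) / (1 + r) with hB
  have hBe : B * (1 + r) = e * (3 + r) := by rw [hB]; field_simp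
  have heB : e * (3 + r) = (1 + r) + r * (r - 1) / 12 := by rw [he, hγ]; field_simp; ring
  have hB1 : 1 < B := by
    rw [hB, heB, lt_div_iff₀ (by linarith)]
    have : 0 < r * (r - 1) / 12 := by have : 0 < r - 1 := by linarith
                                      positivity
    linarith
  have hA1 : 1 < A := by rw [hA]; linarith
  refine ⟨min A B, lt_min hA1 hB1, ?_⟩
  intro ε hε hε1
  have hc1 : 1 < min A B := lt_min hA1 hB1
  set c := min A B with hc
  obtain ⟨C1, hC1, q0, hq0, hM⟩ := momM4 hr1 hε hε1
  obtain ⟨C2, hC2, hX⟩ := XX_of_Y (p := 2 * k) (by linarith)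
  obtain ⟨BU, hBU, hU⟩ := U_sum hc1
  obtain ⟨BV, hBV, hV⟩ := V_sum hγ1
  set G := (3 * BV) ^ (r - 1) * (C1 * (4 * (6 * BU ^ 3))) with hG
  have hG0 : 0 < G := by positivity
  refine ⟨C2 * (G + 1), by positivity, q0, hq0, ?_⟩
  intro q _ hq hRH D T hD hT hTq
  have hD0 : 0 < D := by linarith
  have hT0 : 0 < T := by linarith
  refine (hX q (hq0.trans hq) hRH D T hD hT hTq).trans ?_
  set M := ⌊D * (q:ℝ) ^ 2⌋₊ with hMd
  have hMle : (M:ℝ) ≤ D * (q:ℝ) ^ 2 := Nat.floor_le (by positivity)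
  have hcb := comb (prims q) (Finset.range (2 * M)) (om T D M) (sS ε T D M) (zc D) (fun χ j => Zc χ D M j) (K := C1 * (Nat.totient q) * D ^ ((3 + r) ^ 2 / 4))
    (V := BV) (U := BU * T ^ ε * (1 / T + D ^ (1 - c))) (W := 6 * T ^ ε * D) hr1 hA hBe (min_le_left A B) (min_le_right A B) he (by linarith)
    (fun i _ => (om_pos hT0 hD0 _ _).le) (fun i _ => (sS_pos ε hT0 hD0 _ _).le) (fun χ _ i _ => Zc_nonneg _ _ _ _) (zc_pos hD0) (zc_le (by linarith)) (zc_symm D)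
    (by positivity) (by positivity)
    (fun a ha b hb c hc d hd => hM q hq hRH D T hD hT M hMle a (Finset.mem_range.1 ha) b (Finset.mem_range.1 hb) c (Finset.mem_range.1 hc) d (Finset.mem_range.1 hd))
    (fun a _ => hV hT (by linarith) M _ a) (fun a _ => hU hT (by linarith) hε.le hε1 M _ a) (W_sum hT (by linarith) hε.le hε1 M _) (by linarith)
  have e3r : 3 + r = 2 * k := by rw [hr]; ring
  rw [e3r] at hcb
  have ek : (2 * k) ^ 2 / 4 = k ^ 2 := by ring
  rw [ek] at hcb
  set u := 1 / T + D ^ (1 - c) with hu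
  have hu0 : 0 < u := by positivity
  have eD : D ^ (-(2 * k)) * (D ^ (k ^ 2) * D) = D ^ ((k - 1) ^ 2) := by
    rw [← Real.rpow_add_one hD0.ne', ← rpow_add hD0]; congr 1; ring
  have eT : T ^ (4 * ε) = T ^ ε * (T ^ ε) ^ 3 := by
    rw [mul_comm, rpow_mul hT0.le, show (4:ℝ) = ((4:ℕ):ℝ) by norm_num, rpow_natCast]; ring
  have key : D ^ (-(2 * k)) * ∑ χ ∈ prims q, (∑ j ∈ Finset.range (2 * M), om T D M j * Zc χ D M j) ^ (2 * k) ≤ G * ((Nat.totient q) * (D ^ ((k-1)^2) * (T ^ (4 * ε) * u ^ 3))) := by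
    refine (mul_le_mul_of_nonneg_left hcb (by positivity)).trans (le_of_eq ?_)
    rw [hG, ← eD, eT]; ring
  have ek8 : -(2 * k / 16) = -(k / 8) := by ring
  rw [ek8]
  set P := (Nat.totient q : ℝ) * (D ^ ((k-1)^2) * (T ^ (4 * ε) * u ^ 3)) with hP
  have hP0 : 0 ≤ P := by positivity
  have hQ0 : 0 ≤ (Nat.totient q : ℝ) * T ^ (-(k/8)) := by positivity
  calc _ ≤ C2 * (G * P + (Nat.totient q) * T ^ (-(k/8))) := by
        refine mul_le_mul_of_nonneg_left ?_ hC2.le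
        linarith
    _ ≤ C2 * ((G + 1) * (P + (Nat.totient q) * T ^ (-(k/8)))) := by
        refine mul_le_mul_of_nonneg_left ?_ hC2.le
        nlinarith
    _ = _ := by rw [hP]; ring

lemma weak {k : ℝ} (hk : 2 < k) : ∃ C : ℝ, 0 < C ∧ ∃ q0 : ℕ, 2 ≤ q0 ∧ ∀ (q : ℕ) [NeZero q], q0 ≤ q → (∀ χ : DirichletCharacter ℂ q, dirichletRH χ) →
    ∀ D T : ℝ, 8 ≤ D → 1 ≤ T → T ≤ 2 * q →
    ∑ χ ∈ prims q, XX χ D T ^ (4 * k) ≤ C * (Nat.totient q) * (D ^ (4 * k ^ 2) * T ^ (1/4:ℝ)) := by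
  obtain ⟨C1, hC1, q0, hq0, hM⟩ := momM1 (P := 4 * k) (ε := 1/4) (by linarith) (by norm_num) le_rfl
  obtain ⟨C2, hC2, hX⟩ := XX_of_Y (p := 4 * k) (by linarith)
  set G := (3 * 6) ^ (4 * k - 1) * (C1 * 6) with hG
  have hG0 : 0 < G := by positivity
  refine ⟨C2 * (G + 1), by positivity, q0, hq0, ?_⟩
  intro q _ hq hRH D T hD hT hTq
  have hD0 : 0 < D := by linarith
  have hT0 : 0 < T := by linarith
  refine (hX q (hq0.trans hq) hRH D T hD hT hTq).trans ?_
  set M := ⌊D * (q:ℝ) ^ 2⌋₊ with hMd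
  have hMle : (M:ℝ) ≤ D * (q:ℝ) ^ 2 := Nat.floor_le (by positivity)
  have hV : ∑ j ∈ Finset.range (2 * M), om T D M j ≤ 6 * D := by
    have := W_sum (ε := 0) hT (by linarith : 1 ≤ D) le_rfl (by norm_num) M (2 * M)
    simpa [sS] using this
  have hW := W_sum (ε := 1/4) hT (by linarith : 1 ≤ D) (by norm_num) le_rfl M (2 * M)
  have hy : ∑ χ ∈ prims q, (∑ j ∈ Finset.range (2 * M), om T D M j * Zc χ D M j) ^ (4 * k) ≤ (3 * (6 * D)) ^ (4 * k - 1) *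
      (C1 * (Nat.totient q) * D ^ (4 * k ^ 2) * (6 * T ^ (1/4:ℝ) * D)) := by
    calc _ ≤ ∑ χ ∈ prims q, (3 * (6 * D)) ^ (4 * k - 1) * ∑ j ∈ Finset.range (2 * M), om T D M j * Zc χ D M j ^ (4 * k) :=
          sum_le_sum fun χ _ => powmean _ _ _ (by linarith) (fun j _ => (om_pos hT0 hD0 _ _).le) (fun j _ => Zc_nonneg _ _ _ _) hV
      _ = (3 * (6 * D)) ^ (4 * k - 1) * ∑ j ∈ Finset.range (2 * M), om T D M j * ∑ χ ∈ prims q, Zc χ D M j ^ (4 * k) := by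
          rw [← mul_sum, sum_comm]
          simp_rw [mul_sum]
      _ ≤ (3 * (6 * D)) ^ (4 * k - 1) * ∑ j ∈ Finset.range (2 * M), (C1 * (Nat.totient q) * D ^ (4 * k ^ 2)) * (om T D M j * sS (1/4) T D M j) := by
          refine mul_le_mul_of_nonneg_left (sum_le_sum fun j hj => ?_) (by positivity)
          have h := mul_le_mul_of_nonneg_left (hM q hq hRH D T hD hT M hMle j (Finset.mem_range.1 hj)) (om_pos hT0 hD0 M j).le
          have e : (4 * k) ^ 2 / 4 = 4 * k ^ 2 := by ring
          rw [e] at h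
          refine h.trans (le_of_eq ?_); ring
      _ ≤ _ := by
          rw [← mul_sum]
          gcongr
  have eD : D ^ (-(4 * k)) * (D ^ (4 * k - 1) * D) = 1 := by
    rw [← Real.rpow_add_one hD0.ne', ← rpow_add hD0]
    rw [show -(4 * k) + (4 * k - 1 + 1) = 0 by ring, Real.rpow_zero]
  have hDp : (3 * (6 * D)) ^ (4 * k - 1) = (3 * 6) ^ (4 * k - 1) * D ^ (4 * k - 1) := by
    rw [← mul_assoc, mul_rpow (by norm_num) hD0.le]
  rw [hDp] at hy
  set P := (Nat.totient q : ℝ) * (D ^ (4 * k ^ 2) * T ^ (1/4:ℝ)) with hP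
  have hP0 : 0 ≤ P := by positivity
  have key : D ^ (-(4 * k)) * ∑ χ ∈ prims q, (∑ j ∈ Finset.range (2 * M), om T D M j * Zc χ D M j) ^ (4 * k) ≤ G * P := by
    refine (mul_le_mul_of_nonneg_left hy (by positivity)).trans (le_of_eq ?_)
    calc _ = (D ^ (-(4 * k)) * (D ^ (4 * k - 1) * D)) * ((3 * 6) ^ (4 * k - 1) * (C1 * 6)) * ((Nat.totient q : ℝ) * (D ^ (4 * k ^ 2) * T ^ (1/4:ℝ))) := by ring
      _ = G * P := by rw [eD, one_mul]
  have hQ : (Nat.totient q : ℝ) * T ^ (-(4 * k / 16)) ≤ P := by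
    refine mul_le_mul_of_nonneg_left ?_ (by positivity)
    have a1 : T ^ (-(4 * k / 16)) ≤ 1 := Real.rpow_le_one_of_one_le_of_nonpos hT (by linarith)
    have a2 : 1 ≤ T ^ (1/4:ℝ) := Real.one_le_rpow hT (by norm_num)
    have a3 : 1 ≤ D ^ (4 * k ^ 2) := Real.one_le_rpow (by linarith) (by positivity)
    nlinarith
  calc _ ≤ C2 * ((G + 1) * P) := by
        refine mul_le_mul_of_nonneg_left ?_ hC2.le
        linarith
    _ = _ := by rw [hP]; ring

section
noncomputable def cf (N T : ℝ) (n : ℕ) : ℝ := (max (N + N / T - n) 0 - max (N - n) 0) / (N / T)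

lemma cf_mem {N T : ℝ} (hN : 0 < N) (hT : 0 < T) (n : ℕ) : 0 ≤ cf N T n ∧ cf N T n ≤ 1 := by
  have h : 0 < N / T := by positivity
  unfold cf
  constructor
  · refine div_nonneg ?_ h.le
    have : max (N - n) 0 ≤ max (N + N / T - n) 0 := max_le_max (by linarith) le_rfl
    linarith
  · rw [div_le_one h]
    have : max (N + N / T - n) 0 ≤ max (N - n) 0 + N / T := max_le (by linarith [le_max_left (N - n) 0]) (by linarith [le_max_right (N - n) 0])
    linarith

lemma cf_one {N T : ℝ} (hN : 0 < N) (hT : 0 < T) {n : ℕ} (h : (n:ℝ) ≤ N) : cf N T n = 1 := by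
  have h' : 0 < N / T := by positivity
  unfold cf
  rw [max_eq_left (by linarith), max_eq_left (by linarith), div_eq_one_iff_eq h'.ne']; ring

lemma cf_zero {N T : ℝ} (hN : 0 < N) (hT : 0 < T) {n : ℕ} (h : N + N / T ≤ n) : cf N T n = 0 := by
  have h' : 0 < N / T := by positivity
  unfold cf
  rw [max_eq_right (by linarith), max_eq_right (by linarith)]; simp

variable {q : ℕ} [NeZero q]

lemma AA_eq (χ : DirichletCharacter ℂ q) {N T : ℝ} (hN : 0 < N) (hT : 0 < T) (L : ℕ) (hL : N + N / T ≤ L) :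
    AA χ N T = ∑ n ∈ Finset.Icc 1 L, (cf N T n : ℂ) * χ (n : ZMod q) := by
  have h' : 0 < N / T := by positivity
  have f1 : ⌊N + N / T⌋₊ ≤ L := by exact_mod_cast (Nat.floor_le (by positivity)).trans hL
  have f2 : ⌊N⌋₊ ≤ L := (Nat.floor_mono (by linarith)).trans f1
  unfold AA
  rw [Mfun_eq_sum χ _ (by positivity) L f1, Mfun_eq_sum χ _ hN.le L f2, ← Finset.sum_sub_distrib, Finset.sum_div]
  refine sum_congr rfl fun n _ => ?_
  unfold cf; push_cast; ring

lemma AA_end (χ : DirichletCharacter ℂ q) {N : ℕ} (hN : 0 < N) {T : ℝ} (hT : (N:ℝ) ≤ T) :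
    AA χ N T = ∑ n ∈ Finset.Icc 1 N, χ (n : ZMod q) := by
  have hN0 : (0:ℝ) < N := by exact_mod_cast hN
  have hT0 : 0 < T := by linarith
  have h1 : (N:ℝ) / T ≤ 1 := by rw [div_le_one hT0]; exact hT
  rw [AA_eq χ hN0 hT0 (N + 1) (by push_cast; linarith), Finset.sum_Icc_succ_top (by omega), cf_zero hN0 hT0 (by push_cast; linarith)]
  simp only [ofReal_zero, zero_mul, add_zero]
  refine sum_congr rfl fun n hn => ?_
  rw [cf_one hN0 hT0 (by exact_mod_cast (Finset.mem_Icc.1 hn).2)]; simp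

lemma AA_L2 {N : ℕ} (hN : 0 < N) (hNq : N ≤ q) {T : ℝ} (hT : 1 ≤ T) :
    ∑ χ ∈ prims q, ‖AA χ N (2 * T) - AA χ N T‖ ^ 2 ≤ (Nat.totient q) * (N / T) := by
  have hN0 : (0:ℝ) < N := by exact_mod_cast hN
  have hT0 : 0 < T := by linarith
  have hT2 : 0 < 2 * T := by linarith
  set H := ⌊(N:ℝ) / T⌋₊ with hH
  have hHle : (H:ℝ) ≤ N / T := Nat.floor_le (by positivity)
  have hHlt : (N:ℝ) / T < H + 1 := Nat.lt_floor_add_one _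
  have hHN : (H:ℝ) ≤ N := hHle.trans (div_le_self hN0.le hT)
  have hHq : H ≤ q := by
    have : H ≤ N := by exact_mod_cast hHN
    omega
  have hhalf : (N:ℝ) / (2 * T) ≤ N / T := div_le_div_of_nonneg_left hN0.le hT0 (by linarith)
  have e : ∀ χ : DirichletCharacter ℂ q, AA χ N (2 * T) - AA χ N T = ∑ n ∈ Finset.Ioc N (N + H), ((cf N (2 * T) n - cf N T n : ℝ) : ℂ) * χ (n : ZMod q) := by
    intro χ
    rw [AA_eq χ hN0 hT2 (N + H + 1) (by push_cast; linarith), AA_eq χ hN0 hT0 (N + H + 1) (by push_cast; linarith), ← Finset.sum_sub_distrib]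
    symm
    have hsub : Finset.Ioc N (N + H) ⊆ Finset.Icc 1 (N + H + 1) := by
      intro n hn; rw [Finset.mem_Ioc] at hn; rw [Finset.mem_Icc]; omega
    rw [← Finset.sum_subset hsub]
    · refine sum_congr rfl fun n _ => ?_
      push_cast; ring
    · intro n hn hn2
      rw [Finset.mem_Icc] at hn
      rw [Finset.mem_Ioc] at hn2
      rcases le_or_gt n N with h | h
      · have h3 : (n:ℝ) ≤ N := by exact_mod_cast h
        rw [cf_one hN0 hT2 h3, cf_one hN0 hT0 h3, sub_self]
      · have h3 : N + H + 1 ≤ n := by omega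
        have h4 : (N:ℝ) + H + 1 ≤ n := by exact_mod_cast h3
        rw [cf_zero hN0 hT2 (by linarith), cf_zero hN0 hT0 (by linarith), sub_self]
  have hinj : Set.InjOn (fun n : ℕ => (n : ZMod q)) (Finset.Ioc N (N + H) : Finset ℕ) := by
    intro a ha b hb hab
    simp only [Finset.coe_Ioc, Set.mem_Ioc] at ha hb
    have hab2 : a ≡ b [MOD q] := (ZMod.natCast_eq_natCast_iff a b q).1 hab
    rcases le_total a b with h | h
    · have := (Nat.modEq_iff_dvd' h).1 hab2
      have h5 := Nat.eq_zero_of_dvd_of_lt this (by omega)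
      omega
    · have := (Nat.modEq_iff_dvd' h).1 hab2.symm
      have h5 := Nat.eq_zero_of_dvd_of_lt this (by omega)
      omega
  have ho := orth (q := q) (Finset.Ioc N (N + H)) (fun n => ((cf N (2 * T) n - cf N T n : ℝ) : ℂ)) (fun n : ℕ => (n : ZMod q)) hinj
  simp_rw [← e] at ho
  calc _ ≤ ∑ χ : DirichletCharacter ℂ q, ‖AA χ N (2 * T) - AA χ N T‖ ^ 2 := Finset.sum_le_sum_of_subset_of_nonneg (Finset.subset_univ _) fun _ _ _ => by positivity
    _ ≤ _ := ho
    _ ≤ (Nat.totient q : ℝ) * ∑ n ∈ Finset.Ioc N (N + H), (1:ℝ) := by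
      refine mul_le_mul_of_nonneg_left (sum_le_sum fun n _ => ?_) (by positivity)
      have h1 := cf_mem hN0 hT2 n
      have h2 := cf_mem hN0 hT0 n
      rw [Complex.norm_real, Real.norm_eq_abs, sq_abs, sq_le_one_iff_abs_le_one, abs_le]
      constructor <;> linarith
    _ ≤ _ := by
      refine mul_le_mul_of_nonneg_left ?_ (by positivity)
      simp; exact hHle

/-- interpolation of moments between 2 and 4k -/
lemma interp {κ : Type} (Q : Finset κ) (b : κ → ℝ) (hb : ∀ i ∈ Q, 0 ≤ b i) {k X Y : ℝ} (hk : 2 < k)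
    (h2 : ∑ i ∈ Q, b i ^ 2 ≤ X) (h4 : ∑ i ∈ Q, b i ^ (4 * k) ≤ Y) :
    ∑ i ∈ Q, b i ^ (2 * k) ≤ X ^ (k / (2 * k - 1)) * Y ^ ((k - 1) / (2 * k - 1)) := by
  have hd : 0 < 2 * k - 1 := by linarith
  set p := (2 * k - 1) / k with hp
  set p' := (2 * k - 1) / (k - 1) with hp'
  have hk1 : 0 < k - 1 := by linarith
  have hk0 : 0 < k := by linarith
  have hpq : p.HolderConjugate p' := by
    rw [Real.holderConjugate_iff]
    constructor
    · rw [hp, lt_div_iff₀ hk0]; linarith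
    · rw [hp, hp', inv_div, inv_div, ← add_div, div_eq_one_iff_eq hd.ne']; ring
  have h := Real.inner_le_Lp_mul_Lq_of_nonneg Q hpq (f := fun i => b i ^ (2 / p)) (g := fun i => b i ^ (4 * k / p'))
    (fun i hi => Real.rpow_nonneg (hb i hi) _) (fun i hi => Real.rpow_nonneg (hb i hi) _)
  have hp0 : 0 < p := by positivity
  have hp0' : 0 < p' := by positivity
  have e1 : ∑ i ∈ Q, b i ^ (2 / p) * b i ^ (4 * k / p') = ∑ i ∈ Q, b i ^ (2 * k) := by
    refine sum_congr rfl fun i hi => ?_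
    rw [← Real.rpow_add_of_nonneg (hb i hi) (by positivity) (by positivity)]
    congr 1
    rw [hp, hp']; field_simp; ring
  have e2 : ∑ i ∈ Q, (b i ^ (2 / p)) ^ p = ∑ i ∈ Q, b i ^ 2 := by
    refine sum_congr rfl fun i hi => ?_
    rw [← rpow_mul (hb i hi), div_mul_cancel₀ _ hp0.ne', ← rpow_natCast]; norm_num
  have e3 : ∑ i ∈ Q, (b i ^ (4 * k / p')) ^ p' = ∑ i ∈ Q, b i ^ (4 * k) := by
    refine sum_congr rfl fun i hi => ?_
    rw [← rpow_mul (hb i hi), div_mul_cancel₀ _ hp0'.ne']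
  rw [e1, e2, e3] at h
  have f1 : 1 / p = k / (2 * k - 1) := by rw [hp, one_div, inv_div]
  have f2 : 1 / p' = (k - 1) / (2 * k - 1) := by rw [hp', one_div, inv_div]
  rw [f1, f2] at h
  refine h.trans ?_
  have n2 : 0 ≤ ∑ i ∈ Q, b i ^ 2 := sum_nonneg fun i _ => by positivity
  have n4 : 0 ≤ ∑ i ∈ Q, b i ^ (4 * k) := sum_nonneg fun i hi => Real.rpow_nonneg (hb i hi) _
  exact mul_le_mul (rpow_le_rpow n2 h2 (by positivity)) (rpow_le_rpow n4 h4 (by positivity)) (by positivity) (Real.rpow_nonneg (n2.trans h2) _)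
end

lemma sharp2 {k : ℝ} (hk : 2 < k) : ∃ c : ℝ, 0 < c ∧ c ≤ 1/4 ∧
    ∃ C : ℝ, 0 < C ∧ ∃ q0 : ℕ, 2 ≤ q0 ∧ ∀ (q : ℕ) [NeZero q], q0 ≤ q → (∀ χ : DirichletCharacter ℂ q, dirichletRH χ) →
    ∀ D T : ℝ, 8 ≤ D → 1 ≤ T → T ≤ 2 * q → T ≤ D ^ (16 * k ^ 2) →
    ∑ χ ∈ prims q, XX χ D T ^ (2 * k) ≤ C * (Nat.totient q) * (D ^ ((k-1)^2) * T ^ (-c)) := by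
  obtain ⟨c0, hc0, hs⟩ := sharp hk
  have hA0 : 0 < 16 * k ^ 2 := by positivity
  set A := 16 * k ^ 2 with hA
  set η := min (1/4) ((c0 - 1) / A) with hη
  have hη0 : 0 < η := lt_min (by norm_num) (div_pos (by linarith) hA0)
  have hη1 : η ≤ 1/4 := min_le_left _ _
  have hη2 : η ≤ (c0 - 1) / A := min_le_right _ _
  obtain ⟨C, hC, q0, hq0, h⟩ := hs (η / 4) (by positivity) (by linarith)
  refine ⟨η, hη0, hη1, C * 9, by positivity, q0, hq0, ?_⟩
  intro q _ hq hRH D T hD hT hTq hTD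
  have hD0 : 0 < D := by linarith
  have hT0 : 0 < T := by linarith
  refine (h q hq hRH D T hD hT hTq).trans ?_
  have a1 : 1 / T ≤ T ^ (-η) := by
    rw [one_div, ← Real.rpow_neg_one]
    exact rpow_le_rpow_of_exponent_le hT (by linarith)
  have a2 : D ^ (1 - c0) ≤ T ^ (-η) := by
    have h1 : D ^ (1 - c0) = (D ^ A) ^ ((1 - c0) / A) := by rw [← rpow_mul hD0.le, mul_div_cancel₀ _ hA0.ne']
    rw [h1]
    calc (D ^ A) ^ ((1 - c0) / A) ≤ T ^ ((1 - c0) / A) := Real.rpow_le_rpow_of_nonpos hT0 hTD (div_nonpos_of_nonpos_of_nonneg (by linarith) hA0.le)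
      _ ≤ T ^ (-η) := by
        refine rpow_le_rpow_of_exponent_le hT ?_
        have : (1 - c0) / A = -((c0 - 1) / A) := by ring
        rw [this]; linarith
  have a3 : T ^ (4 * (η / 4)) * (1 / T + D ^ (1 - c0)) ^ 3 ≤ 8 * T ^ (-η) := by
    have b1 : (1 / T + D ^ (1 - c0)) ^ 3 ≤ (2 * T ^ (-η)) ^ 3 := by
      refine pow_le_pow_left₀ (by positivity) (by linarith) 3
    calc _ ≤ T ^ (4 * (η / 4)) * (2 * T ^ (-η)) ^ 3 := mul_le_mul_of_nonneg_left b1 (by positivity)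
      _ = 8 * (T ^ η * T ^ (-η)) * T ^ (-η) * T ^ (-η) := by rw [mul_div_cancel₀ _ (by norm_num : (4:ℝ) ≠ 0)]; ring
      _ = 8 * T ^ (-η) * T ^ (-η) := by rw [← rpow_add hT0, add_neg_cancel, Real.rpow_zero]; ring
      _ ≤ 8 * T ^ (-η) * 1 := mul_le_mul_of_nonneg_left (Real.rpow_le_one_of_one_le_of_nonpos hT (by linarith)) (by positivity)
      _ = _ := by ring
  have a4 : T ^ (-(k/8)) ≤ T ^ (-η) := rpow_le_rpow_of_exponent_le hT (by linarith)
  have a5 : 1 ≤ D ^ ((k-1)^2) := Real.one_le_rpow (by linarith) (by positivity)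
  have hTη : 0 < T ^ (-η) := by positivity
  calc _ ≤ C * (Nat.totient q) * (D ^ ((k-1)^2) * (8 * T ^ (-η)) + D ^ ((k-1)^2) * T ^ (-η)) := by
        refine mul_le_mul_of_nonneg_left (add_le_add (mul_le_mul_of_nonneg_left a3 (by positivity)) ?_) (by positivity)
        nlinarith
    _ = _ := by ring

lemma Wpos {q N : ℕ} (hN : 0 < N) (hNq : N ≤ q) : 11 ≤ 16 * Real.log (2 * q / N) := by
  have hN0 : (0:ℝ) < N := by exact_mod_cast hN
  have h : (2:ℝ) ≤ 2 * q / N := by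
    rw [le_div_iff₀ hN0]
    have : (N:ℝ) ≤ q := by exact_mod_cast hNq
    linarith
  have := Real.log_le_log (by norm_num) h
  have := Real.log_two_gt_d9
  linarith

lemma D_absorb {c m : ℝ} (hc : 0 < c) (hm : 0 < m) : ∃ C : ℝ, 0 < C ∧ ∀ W T : ℝ, 11 ≤ 16 * W → 1 ≤ T →
    (16 * (W + Real.log T)) ^ m * T ^ (-c) ≤ C * (W ^ m * T ^ (-(c/2))) := by
  set κ := c / (2 * m) with hκ
  have hκ0 : 0 < κ := by positivity
  refine ⟨(16 * (1 + 2 / κ)) ^ m, by positivity, ?_⟩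
  intro W T hW hT
  have hT0 : 0 < T := by linarith
  have hW0 : 0 < W := by linarith
  have hlog := Real.log_le_rpow_div hT0.le hκ0
  have hl0 := Real.log_nonneg hT
  have hTκ : 1 ≤ T ^ κ := Real.one_le_rpow hT hκ0.le
  have hD : 16 * (W + Real.log T) ≤ 16 * (1 + 2 / κ) * (W * T ^ κ) := by
    have b1 : W ≤ W * T ^ κ := le_mul_of_one_le_right hW0.le hTκ
    have b2 : T ^ κ / κ ≤ 2 / κ * (W * T ^ κ) := by
      have : T ^ κ ≤ 2 * (W * T ^ κ) := by nlinarith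
      calc T ^ κ / κ ≤ 2 * (W * T ^ κ) / κ := div_le_div_of_nonneg_right this hκ0.le
        _ = _ := by ring
    linarith
  calc _ ≤ (16 * (1 + 2 / κ) * (W * T ^ κ)) ^ m * T ^ (-c) :=
        mul_le_mul_of_nonneg_right (rpow_le_rpow (by positivity) hD hm.le) (by positivity)
    _ = (16 * (1 + 2 / κ)) ^ m * (W ^ m * ((T ^ κ) ^ m * T ^ (-c))) := by
        rw [mul_rpow (by positivity) (by positivity), mul_rpow hW0.le (by positivity)]; ring
    _ = _ := by
        rw [← rpow_mul hT0.le, ← rpow_add hT0]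
        congr 3
        rw [hκ]; field_simp; ring_nf

lemma norm_to_XX {N x X k G : ℝ} (hk : 0 < k) (hN : 0 < N) (hG : 0 ≤ G) (hX : 0 ≤ X) (hx : 0 ≤ x) (h : x ≤ G * √N * X) : x ^ (2 * k) ≤ G ^ (2 * k) * N ^ k * X ^ (2 * k) := by
  calc x ^ (2 * k) ≤ (G * √N * X) ^ (2 * k) := rpow_le_rpow hx h (by positivity)
    _ = G ^ (2 * k) * (√N) ^ (2 * k) * X ^ (2 * k) := by rw [mul_rpow (by positivity) hX, mul_rpow hG (by positivity)]
    _ = _ := by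
      rw [rpow_mul (Real.sqrt_nonneg N), Real.rpow_two, Real.sq_sqrt hN.le]

lemma block {k : ℝ} (hk : 2 < k) : ∃ c : ℝ, 0 < c ∧
    ∃ C : ℝ, 0 < C ∧ ∃ q0 : ℕ, 2 ≤ q0 ∧ ∀ (q : ℕ) [NeZero q], q0 ≤ q → (∀ χ : DirichletCharacter ℂ q, dirichletRH χ) →
    ∀ N : ℕ, 0 < N → N ≤ q →
    (∑ χ ∈ prims q, ‖AA χ N 1‖ ^ (2 * k) ≤ C * (Nat.totient q) * ((N:ℝ) ^ k * Real.log (2 * q / N) ^ ((k-1)^2))) ∧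
    ∀ T : ℝ, 1 ≤ T → T ≤ 2 * q →
    ∑ χ ∈ prims q, ‖AA χ N (2 * T) - AA χ N T‖ ^ (2 * k) ≤ C * (Nat.totient q) * ((N:ℝ) ^ k * Real.log (2 * q / N) ^ ((k-1)^2)) * T ^ (-c) := by
  obtain ⟨c, hc, hc4, C1, hC1, q1, hq1, hS⟩ := sharp2 hk
  obtain ⟨C2, hC2, q2, hq2, hW⟩ := weak hk
  obtain ⟨C3, hC3, hA⟩ := D_absorb (c := c) (m := (k-1)^2) hc (by have : 0 < k - 1 := by linarith
                                                                  positivity)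
  have hk0 : 0 < k := by linarith
  have hk1 : 0 < k - 1 := by linarith
  have hd : 0 < 2 * k - 1 := by linarith
  set θ := k / (2 * k - 1) with hθ
  set θ' := (k - 1) / (2 * k - 1) with hθ'
  have hθ0 : 0 < θ := by positivity
  have hθ0' : 0 < θ' := by positivity
  have hsum : θ + θ' = 1 := by rw [hθ, hθ', ← add_div, div_eq_one_iff_eq hd.ne']; ring
  have hsum2 : θ + 2 * k * θ' = k := by
    have e : θ + 2 * k * θ' = k * (2 * k - 1) / (2 * k - 1) := by rw [hθ, hθ']; ring
    rw [e, mul_div_cancel_right₀ _ hd.ne']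
  have hθh : 1 / 2 ≤ θ := by rw [hθ, le_div_iff₀ hd]; linarith
  set G : ℝ := 18000 with hG
  set C4 : ℝ := G ^ (2 * k) * C1 + (G ^ (4 * k) * C2) ^ θ' with hC4
  have hC40 : 0 < C4 := by positivity
  refine ⟨c / 2, by positivity, C4 * C3, by positivity, max q1 q2, le_max_of_le_left hq1, ?_⟩
  intro q _ hq hRH N hN hNq
  have hN0 : (0:ℝ) < N := by exact_mod_cast hN
  have hNq' : (N:ℝ) ≤ q := by exact_mod_cast hNq
  have hqq1 : q1 ≤ q := (le_max_left _ _).trans hq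
  have hqq2 : q2 ≤ q := (le_max_right _ _).trans hq
  have hq0 : (2:ℝ) ≤ q := by exact_mod_cast hq1.trans hqq1
  have hW11 := Wpos hN hNq
  set W := Real.log (2 * q / N) with hWd
  have hW0 : 0 < W := by linarith
  have hne : ∀ χ ∈ prims q, χ ≠ 1 := fun χ hχ => prims_ne (hq1.trans hqq1) (prims_mem hχ)
  -- the low range
  have low : ∀ (x : DirichletCharacter ℂ q → ℝ) (T : ℝ), 1 ≤ T → T ≤ 2 * q → T ≤ (16 * (W + Real.log T)) ^ (16 * k ^ 2) →
      (∀ χ ∈ prims q, 0 ≤ x χ ∧ x χ ≤ G * √N * XX χ (16 * (W + Real.log T)) T) →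
      ∑ χ ∈ prims q, x χ ^ (2 * k) ≤ C4 * (Nat.totient q) * ((N:ℝ) ^ k * ((16 * (W + Real.log T)) ^ ((k-1)^2) * T ^ (-c))) := by
    intro x T hT hTq hTD hx
    have hl := Real.log_nonneg hT
    have h := hS q hqq1 hRH (16 * (W + Real.log T)) T (by linarith) hT hTq hTD
    set D := 16 * (W + Real.log T) with hD
    have hD0 : 0 < D := by linarith
    have hT0 : 0 < T := by linarith
    calc _ ≤ ∑ χ ∈ prims q, G ^ (2 * k) * (N:ℝ) ^ k * XX χ D T ^ (2 * k) :=
          sum_le_sum fun χ hχ => norm_to_XX hk0 hN0 (by norm_num) (XX_nonneg χ D hT0) (hx χ hχ).1 (hx χ hχ).2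
      _ ≤ G ^ (2 * k) * (N:ℝ) ^ k * (C1 * (Nat.totient q) * (D ^ ((k-1)^2) * T ^ (-c))) := by
          rw [← mul_sum]
          exact mul_le_mul_of_nonneg_left h (by positivity)
      _ = (G ^ (2 * k) * C1) * ((Nat.totient q) * ((N:ℝ) ^ k * (D ^ ((k-1)^2) * T ^ (-c)))) := by ring
      _ ≤ C4 * ((Nat.totient q) * ((N:ℝ) ^ k * (D ^ ((k-1)^2) * T ^ (-c)))) := by
          refine mul_le_mul_of_nonneg_right ?_ (by positivity)
          rw [hC4]
          have : 0 < (G ^ (4 * k) * C2) ^ θ' := by positivity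
          linarith
      _ = _ := by ring
  have fin : ∀ (T : ℝ), 1 ≤ T → C4 * (Nat.totient q) * ((N:ℝ) ^ k * ((16 * (W + Real.log T)) ^ ((k-1)^2) * T ^ (-c))) ≤
      C4 * C3 * (Nat.totient q) * ((N:ℝ) ^ k * W ^ ((k-1)^2)) * T ^ (-(c/2)) := by
    intro T hT
    have h := hA W T hW11 hT
    calc _ ≤ C4 * (Nat.totient q) * ((N:ℝ) ^ k * (C3 * (W ^ ((k-1)^2) * T ^ (-(c/2))))) := by gcongr
      _ = _ := by ring
  constructor
  · have h1 := low (fun χ => ‖AA χ N 1‖) 1 le_rfl (by linarith)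
      (Real.one_le_rpow (by rw [Real.log_one]; linarith) (by positivity))
      (fun χ hχ => ⟨norm_nonneg _, AA_base χ (hne χ hχ) (prims_mem hχ) (hRH χ) hN0 hNq' (by rw [Real.log_one]; linarith) (by rw [Real.log_one]; linarith)⟩)
    have h2 := h1.trans (fin 1 le_rfl)
    rwa [Real.one_rpow, mul_one] at h2
  · intro T hT hTq
    have hT0 : 0 < T := by linarith
    have hl := Real.log_nonneg hT
    refine le_trans ?_ (fin T hT)
    have hdiff : ∀ χ ∈ prims q, 0 ≤ ‖AA χ N (2 * T) - AA χ N T‖ ∧ ‖AA χ N (2 * T) - AA χ N T‖ ≤ G * √N * XX χ (16 * (W + Real.log T)) T :=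
      fun χ hχ => ⟨norm_nonneg _, AA_diff χ (hne χ hχ) (prims_mem hχ) (hRH χ) hN0 hNq' hT (by linarith) le_rfl⟩
    rcases le_or_gt T ((16 * (W + Real.log T)) ^ (16 * k ^ 2)) with hTD | hTD
    · exact low _ T hT hTq hTD hdiff
    · have h := hW q hqq2 hRH (16 * (W + Real.log T)) T (by linarith) hT hTq
      set D := 16 * (W + Real.log T) with hD
      have hD8 : 8 ≤ D := by linarith
      have hD0 : 0 < D := by linarith
      have h4 : ∑ χ ∈ prims q, ‖AA χ N (2 * T) - AA χ N T‖ ^ (4 * k) ≤ (Nat.totient q) * ((G ^ (4 * k) * C2) * ((N:ℝ) ^ (2 * k) * T ^ (1/2:ℝ))) := by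
        calc _ ≤ ∑ χ ∈ prims q, G ^ (4 * k) * (N:ℝ) ^ (2 * k) * XX χ D T ^ (4 * k) := by
              refine sum_le_sum fun χ hχ => ?_
              have := norm_to_XX (k := 2 * k) (by positivity) hN0 (by norm_num) (XX_nonneg χ D hT0) (hdiff χ hχ).1 (hdiff χ hχ).2
              rwa [show 2 * (2 * k) = 4 * k by ring] at this
          _ ≤ G ^ (4 * k) * (N:ℝ) ^ (2 * k) * (C2 * (Nat.totient q) * (D ^ (4 * k ^ 2) * T ^ (1/4:ℝ))) := by
              rw [← mul_sum]
              exact mul_le_mul_of_nonneg_left h (by positivity)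
          _ ≤ G ^ (4 * k) * (N:ℝ) ^ (2 * k) * (C2 * (Nat.totient q) * (T ^ (1/4:ℝ) * T ^ (1/4:ℝ))) := by
              have : D ^ (4 * k ^ 2) ≤ T ^ (1/4:ℝ) := by
                calc D ^ (4 * k ^ 2) = (D ^ (16 * k ^ 2)) ^ (1/4:ℝ) := by rw [← rpow_mul hD0.le]; congr 1; ring
                  _ ≤ _ := rpow_le_rpow (by positivity) hTD.le (by norm_num)
              gcongr
          _ = _ := by rw [← rpow_add hT0]; norm_num; ring
      have hi := interp (prims q) (fun χ => ‖AA χ N (2 * T) - AA χ N T‖) (fun _ _ => norm_nonneg _) hk (AA_L2 hN hNq hT) h4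
      rw [← hθ, ← hθ'] at hi
      refine hi.trans ?_
      have hφ : (0:ℝ) < Nat.totient q := by exact_mod_cast Nat.totient_pos.2 (Nat.pos_of_ne_zero (NeZero.ne q))
      have e1 : ((Nat.totient q : ℝ) * (N / T)) ^ θ * ((Nat.totient q) * ((G ^ (4 * k) * C2) * ((N:ℝ) ^ (2 * k) * T ^ (1/2:ℝ)))) ^ θ'
          = (G ^ (4 * k) * C2) ^ θ' * (Nat.totient q) * ((N:ℝ) ^ k * T ^ (-θ + θ' / 2)) := by
        have hφs : (Nat.totient q : ℝ) = (Nat.totient q : ℝ) ^ θ * (Nat.totient q : ℝ) ^ θ' := by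
          rw [← rpow_add hφ, hsum, Real.rpow_one]
        have hNs : (N:ℝ) ^ k = (N:ℝ) ^ θ * (N:ℝ) ^ (2 * k * θ') := by rw [← rpow_add hN0, hsum2]
        have hTs : T ^ (-θ + θ' / 2) = (T ^ θ)⁻¹ * T ^ (θ' / 2) := by rw [rpow_add hT0, Real.rpow_neg hT0.le]
        rw [mul_rpow hφ.le (by positivity), Real.div_rpow hN0.le hT0.le, mul_rpow hφ.le (by positivity), mul_rpow (by positivity) (by positivity),
          mul_rpow (x := (N:ℝ) ^ (2 * k)) (by positivity) (by positivity), ← rpow_mul hN0.le, ← rpow_mul hT0.le, hNs, hTs]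
        rw [show 1 / 2 * θ' = θ' / 2 by ring]
        set g := (G ^ (4 * k) * C2) ^ θ'
        conv_rhs => rw [hφs]
        ring
      rw [e1]
      have e2 : T ^ (-θ + θ' / 2) ≤ T ^ (-c) := rpow_le_rpow_of_exponent_le hT (by linarith)
      have e3 : 1 ≤ D ^ ((k-1)^2) := Real.one_le_rpow (by linarith) (by positivity)
      have e4 : (G ^ (4 * k) * C2) ^ θ' ≤ C4 := by
        rw [hC4]
        have : 0 < G ^ (2 * k) * C1 := by positivity
        linarith
      have e5 : T ^ (-θ + θ' / 2) ≤ D ^ ((k-1)^2) * T ^ (-c) := e2.trans (le_mul_of_one_le_left (by positivity) e3)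
      gcongr

lemma geo {a : ℝ} (ha : 0 < a) : ∃ C : ℝ, 0 < C ∧ ∀ J : ℕ, ∑ j ∈ Finset.range J, ((2:ℝ) ^ j) ^ (-a) ≤ C := by
  have h0 : (0:ℝ) < 2 ^ (-a) := by positivity
  have h1 : (2:ℝ) ^ (-a) < 1 := Real.rpow_lt_one_of_one_lt_of_neg (by norm_num) (by linarith)
  refine ⟨(1 - 2 ^ (-a))⁻¹, inv_pos.2 (by linarith), fun J => ?_⟩
  have e : ∀ j : ℕ, ((2:ℝ) ^ j) ^ (-a) = (2 ^ (-a)) ^ j := fun j => by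
    rw [← rpow_natCast, ← rpow_natCast, ← rpow_mul (by norm_num), ← rpow_mul (by norm_num), mul_comm]
  simp_rw [e]
  rw [← tsum_geometric_of_lt_one h0.le h1]
  exact (summable_geometric_of_lt_one h0.le h1).sum_le_tsum _ (fun _ _ => by positivity)

lemma mainN {k : ℝ} (hk : 2 < k) : ∃ C : ℝ, 0 < C ∧ ∃ q0 : ℕ, 2 ≤ q0 ∧ ∀ (q : ℕ) [NeZero q], q0 ≤ q → (∀ χ : DirichletCharacter ℂ q, dirichletRH χ) →
    ∀ N : ℕ, 0 < N → N ≤ q →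
    ∑ χ ∈ prims q, ‖∑ n ∈ Finset.Icc 1 N, χ (n : ZMod q)‖ ^ (2 * k) ≤ C * ((Nat.totient q) * ((N:ℝ) ^ k * Real.log (2 * q / N) ^ ((k-1)^2))) := by
  obtain ⟨c, hc, C, hC, q0, hq0, hb⟩ := block hk
  have hp1 : 1 < 2 * k := by linarith
  have hp1' : 0 < 2 * k - 1 := by linarith
  set κ := c / (2 * (2 * k - 1)) with hκ
  have hκ0 : 0 < κ := by positivity
  obtain ⟨V, hV, hVs⟩ := geo hκ0
  obtain ⟨U, hU, hUs⟩ := geo (half_pos hc)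
  refine ⟨2 ^ (2 * k) * (C + (3 * V) ^ (2 * k - 1) * (C * U)), by positivity, q0, hq0, ?_⟩
  intro q _ hq hRH N hN hNq
  obtain ⟨hbase, hblk⟩ := hb q hq hRH N hN hNq
  have hN0 : (0:ℝ) < N := by exact_mod_cast hN
  have hNq' : (N:ℝ) ≤ q := by exact_mod_cast hNq
  have hW0 : 0 < Real.log (2 * q / N) := by have := Wpos hN hNq; linarith
  set R : ℝ := (Nat.totient q) * ((N:ℝ) ^ k * Real.log (2 * q / N) ^ ((k-1)^2)) with hR
  have hR0 : 0 ≤ R := by positivity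
  have hex : ∃ J : ℕ, N ≤ 2 ^ J := ⟨N, Nat.lt_two_pow_self.le⟩
  classical
  set J := Nat.find hex with hJ
  have hJ1 : N ≤ 2 ^ J := Nat.find_spec hex
  have hJ2 : ∀ j < J, 2 ^ j < N := fun j hj => not_le.1 (Nat.find_min hex hj)
  set b : DirichletCharacter ℂ q → ℕ → ℝ := fun χ j => ‖AA χ N (2 * 2 ^ j) - AA χ N (2 ^ j)‖ with hbd
  have hw : ∀ j : ℕ, (0:ℝ) < ((2:ℝ) ^ j) ^ (-κ) := fun j => by positivity
  have hS : ∀ χ : DirichletCharacter ℂ q, ‖∑ n ∈ Finset.Icc 1 N, χ (n : ZMod q)‖ ^ (2 * k) ≤ 2 ^ (2 * k) * (‖AA χ N 1‖ ^ (2 * k) +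
      (3 * V) ^ (2 * k - 1) * ∑ j ∈ Finset.range J, ((2:ℝ) ^ j) ^ (c / 2) * b χ j ^ (2 * k)) := by
    intro χ
    have e : ∑ n ∈ Finset.Icc 1 N, χ (n : ZMod q) = AA χ N 1 + ∑ j ∈ Finset.range J, (AA χ N (2 * 2 ^ j) - AA χ N (2 ^ j)) := by
      rw [← AA_end χ hN (T := (2:ℝ) ^ J) (by exact_mod_cast hJ1)]
      have := Finset.sum_range_sub (fun j => AA χ N ((2:ℝ) ^ j)) J
      simp only [pow_succ, pow_zero, mul_comm _ (2:ℝ)] at this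
      rw [this]; ring
    have h1 : ‖∑ n ∈ Finset.Icc 1 N, χ (n : ZMod q)‖ ≤ ‖AA χ N 1‖ + ∑ j ∈ Finset.range J, b χ j := by
      rw [e]
      exact (norm_add_le _ _).trans (add_le_add_right (norm_sum_le _ _) _)
    have hb0 : 0 ≤ ∑ j ∈ Finset.range J, b χ j := sum_nonneg fun j _ => norm_nonneg _
    have h2 : (∑ j ∈ Finset.range J, b χ j) ^ (2 * k) ≤ (3 * V) ^ (2 * k - 1) * ∑ j ∈ Finset.range J, ((2:ℝ) ^ j) ^ (c / 2) * b χ j ^ (2 * k) := by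
      have h := powmean (Finset.range J) (fun j => ((2:ℝ) ^ j) ^ (-κ)) (fun j => b χ j / ((2:ℝ) ^ j) ^ (-κ)) hp1 (fun j _ => (hw j).le)
        (fun j _ => div_nonneg (norm_nonneg _) (hw j).le) (hVs J)
      have e1 : ∑ j ∈ Finset.range J, ((2:ℝ) ^ j) ^ (-κ) * (b χ j / ((2:ℝ) ^ j) ^ (-κ)) = ∑ j ∈ Finset.range J, b χ j :=
        sum_congr rfl fun j _ => mul_div_cancel₀ _ (hw j).ne'
      have e2 : ∑ j ∈ Finset.range J, ((2:ℝ) ^ j) ^ (-κ) * (b χ j / ((2:ℝ) ^ j) ^ (-κ)) ^ (2 * k) = ∑ j ∈ Finset.range J, ((2:ℝ) ^ j) ^ (c / 2) * b χ j ^ (2 * k) := by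
        refine sum_congr rfl fun j _ => ?_
        have h2j : (0:ℝ) < 2 ^ j := by positivity
        rw [Real.div_rpow (norm_nonneg _) (hw j).le, ← rpow_mul h2j.le, div_eq_mul_inv, ← Real.rpow_neg h2j.le, mul_comm (b χ j ^ (2 * k)), ← mul_assoc,
          ← rpow_add h2j]
        congr 2
        rw [hκ]
        have : -(c / (2 * (2 * k - 1))) + -(-(c / (2 * (2 * k - 1))) * (2 * k)) = c * (2 * k - 1) / (2 * (2 * k - 1)) := by ring
        rw [this, mul_div_mul_right _ _ hp1'.ne']
      rw [e1, e2] at h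
      exact h
    calc _ ≤ (‖AA χ N 1‖ + ∑ j ∈ Finset.range J, b χ j) ^ (2 * k) := rpow_le_rpow (norm_nonneg _) h1 (by linarith)
      _ ≤ 2 ^ (2 * k) * (‖AA χ N 1‖ ^ (2 * k) + (∑ j ∈ Finset.range J, b χ j) ^ (2 * k)) := add_rpow_two (norm_nonneg _) hb0 (by linarith)
      _ ≤ _ := mul_le_mul_of_nonneg_left (by linarith) (by positivity)
  refine (sum_le_sum fun χ _ => hS χ).trans ?_
  rw [← mul_sum, sum_add_distrib, ← mul_sum, sum_comm, mul_assoc]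
  refine mul_le_mul_of_nonneg_left ?_ (by positivity)
  have hsum : ∑ j ∈ Finset.range J, ∑ χ ∈ prims q, ((2:ℝ) ^ j) ^ (c / 2) * b χ j ^ (2 * k) ≤ C * R * U := by
    calc _ ≤ ∑ j ∈ Finset.range J, C * R * ((2:ℝ) ^ j) ^ (-(c / 2)) := by
          refine sum_le_sum fun j hj => ?_
          have h2j : (0:ℝ) < 2 ^ j := by positivity
          have hjN : ((2:ℝ) ^ j) ≤ N := by exact_mod_cast (hJ2 j (Finset.mem_range.1 hj)).le
          have h := hblk ((2:ℝ) ^ j) (one_le_pow₀ (by norm_num)) (by linarith)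
          rw [← mul_sum]
          calc _ ≤ ((2:ℝ) ^ j) ^ (c / 2) * (C * (Nat.totient q) * ((N:ℝ) ^ k * Real.log (2 * q / N) ^ ((k-1)^2)) * ((2:ℝ) ^ j) ^ (-c)) :=
                mul_le_mul_of_nonneg_left h (by positivity)
            _ = C * R * (((2:ℝ) ^ j) ^ (c / 2) * ((2:ℝ) ^ j) ^ (-c)) := by rw [hR]; ring
            _ = _ := by rw [← rpow_add h2j]; congr 2; ring
      _ = C * R * ∑ j ∈ Finset.range J, ((2:ℝ) ^ j) ^ (-(c / 2)) := by rw [mul_sum]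
      _ ≤ _ := mul_le_mul_of_nonneg_left (hUs J) (by positivity)
  have hV' : 0 ≤ (3 * V) ^ (2 * k - 1) := by positivity
  calc _ ≤ C * R + (3 * V) ^ (2 * k - 1) * (C * R * U) := by
        refine add_le_add (hbase.trans (le_of_eq ?_)) (mul_le_mul_of_nonneg_left hsum hV')
        rw [hR]; ring
    _ = _ := by ring

lemma mainY {k : ℝ} (hk : 2 < k) : ∃ C : ℝ, 0 < C ∧ ∃ q0 : ℕ, ∀ (q : ℕ) [NeZero q], q0 ≤ q → (∀ χ : DirichletCharacter ℂ q, dirichletRH χ) →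
    ∀ y : ℝ, (q : ℝ) ^ ((1 : ℝ) / 2) < y → y ≤ (q : ℝ) →
    ∑ χ ∈ prims q, ‖∑ n ∈ Finset.Icc 1 ⌊y⌋₊, χ (n : ZMod q)‖ ^ (2 * k) ≤ C * (Nat.totient q) * y ^ k * Real.log (2 * q / y) ^ ((k - 1) ^ 2) := by
  obtain ⟨C, hC, q0, hq0, h⟩ := mainN hk
  refine ⟨C * 2 ^ ((k-1)^2), by positivity, q0, ?_⟩
  intro q _ hq hRH y hy1 hy2
  have hq1 : (1:ℝ) ≤ q := by exact_mod_cast Nat.pos_of_ne_zero (NeZero.ne q)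
  have hy : 1 < y := lt_of_le_of_lt (Real.one_le_rpow hq1 (by norm_num)) hy1
  have hN : 0 < ⌊y⌋₊ := Nat.floor_pos.2 hy.le
  have hNy : (⌊y⌋₊:ℝ) ≤ y := Nat.floor_le (by linarith)
  have hNq : ⌊y⌋₊ ≤ q := by exact_mod_cast hNy.trans hy2
  have hlt := Nat.lt_floor_add_one y
  have hb := h q hq hRH ⌊y⌋₊ hN hNq
  have hW := Wpos hN hNq
  set N := ⌊y⌋₊ with hNd
  have hN1 : (1:ℝ) ≤ N := by exact_mod_cast hN
  have hlog : Real.log (2 * q / N) ≤ 2 * Real.log (2 * q / y) := by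
    have h2 : (2:ℝ) ≤ 2 * q / y := by rw [le_div_iff₀ (by linarith)]; linarith
    have h3 : 2 * (q:ℝ) / N ≤ 2 * (2 * q / y) := by
      have : 2 * (2 * (q:ℝ) / y) = 2 * q / (y / 2) := by field_simp
      rw [this]
      exact div_le_div_of_nonneg_left (by positivity) (by linarith) (by linarith)
    have h4 := Real.log_le_log (by positivity) h3
    rw [Real.log_mul (by norm_num) (by linarith)] at h4
    have h5 := Real.log_le_log (by norm_num) h2
    linarith
  have hl0 : 0 ≤ Real.log (2 * q / y) := by linarith
  have a1 : Real.log (2 * q / N) ^ ((k-1)^2) ≤ 2 ^ ((k-1)^2) * Real.log (2 * q / y) ^ ((k-1)^2) := by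
    rw [← mul_rpow (by norm_num) hl0]
    exact rpow_le_rpow (by linarith) hlog (by positivity)
  have a2 : (N:ℝ) ^ k ≤ y ^ k := rpow_le_rpow (by linarith) hNy (by linarith)
  refine hb.trans ?_
  have hlN : 0 ≤ Real.log (2 * q / N) ^ ((k-1)^2) := Real.rpow_nonneg (by linarith) _
  have hy0 : 0 ≤ y ^ k := Real.rpow_nonneg (by linarith) _
  calc _ ≤ C * ((Nat.totient q) * (y ^ k * (2 ^ ((k-1)^2) * Real.log (2 * q / y) ^ ((k-1)^2)))) := by
        refine mul_le_mul_of_nonneg_left (mul_le_mul_of_nonneg_left (mul_le_mul a2 a1 hlN hy0) (by positivity)) hC.le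
    _ = _ := by ring

end Szabo

open Classical in
theorem stmt4 (k : ℝ) (hk : 2 < k) :
    ∃ C : ℝ, 0 < C ∧ ∃ q0 : ℕ, ∀ (q : ℕ) [NeZero q], q0 ≤ q →
      (∀ χ : DirichletCharacter ℂ q, dirichletRH χ) →
      ∀ y : ℝ, (q : ℝ) ^ ((1 : ℝ) / 2) < y → y ≤ (q : ℝ) →
      ∑ χ ∈ Finset.univ.filter (fun χ : DirichletCharacter ℂ q => χ.IsPrimitive),
        ‖(∑ n ∈ Finset.Icc 1 ⌊y⌋₊, χ n : ℂ)‖ ^ (2 * k)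
      ≤ C * (Nat.totient q) * y ^ k * Real.log (2 * q / y) ^ ((k - 1) ^ 2) := by
  obtain ⟨C, hC, q0, h⟩ := Szabo.mainY hk
  refine ⟨C, hC, q0, ?_⟩
  intro q _ hq hRH y hy1 hy2
  have h1 := h q hq hRH y hy1 hy2
  have e : (Finset.univ.filter (fun χ : DirichletCharacter ℂ q => χ.IsPrimitive)) = Szabo.prims q := by
    ext χ; simp [Szabo.prims]
  rw [e]
  exact h1
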